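/- Parabolic existence and uniqueness. Let Ω ⊂ ℝ^N be of class W^{2,∞}, u₀ ∈ C_b(cl(Ω)), assume (M), (J0), (J1), and let H be either of Bellman type satisfying (C'), (L'), (B') or coercive satisfying (H0') and (He') or (He''); assume (H') and (E'). Then there exists a unique bounded viscosity solution of ∂_t u − I[u(·,t)](x) + H(x,t,u,Du) = 0 in Ω×(0,∞), ∂u/∂n = 0 on ∂Ω×(0,∞), u(·,0) = u₀, belonging to C(cl(Ω)×[0,∞)) ∩ L^∞(cl(Ω)×[0,T]) for every T > 0. If in addition (H'') holds (there is γ₀ > 0 with γ_R ≥ γ₀ for all R), then this solution is uniformly bounded on cl(Ω)×[0,∞). -/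

import Mathlib

set_option autoImplicit false

/- Common framework for censored nonlocal Hamilton–Jacobi equations with
Neumann boundary conditions (Barles-type viscosity solutions). -/

open Set Metric MeasureTheory Filter Topology Function
open scoped RealInnerProductSpace NNReal ENNReal

noncomputable section

namespace Censored

abbrev Euc (N : ℕ) : Type := EuclideanSpace ℝ (Fin N)

variable {N : ℕ}

/-- Signed distance to the boundary of `Ω`, positive inside `Ω`. -/
def sdist (Ω : Set (Euc N)) (x : Euc N) : ℝ := infDist x Ωᶜ - infDist x Ω

/-- A modulus of continuity. -/
def IsModulus (ω : ℝ → ℝ) : Prop :=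
  (∀ s, 0 ≤ ω s) ∧ Monotone ω ∧ Tendsto ω (nhdsWithin 0 (Ioi 0)) (nhds 0)

/-- A `W^{2,∞}` boundary chart for `Ω` at `s`, with radius `r`: a diffeomorphism of
class `W^{2,∞}` (i.e. `C^1` with Lipschitz differential, with inverse of the same
regularity) whose `N`-th component coincides with the signed distance. -/
def IsW2Chart (hN : 0 < N) (Ω : Set (Euc N)) (s : Euc N) (r : ℝ)
    (ψ ψinv : Euc N → Euc N) : Prop :=
  0 < r ∧
  ContDiffOn ℝ 1 ψ (ball s r) ∧
  (∃ L : ℝ≥0, LipschitzOnWith L (fun x => fderiv ℝ ψ x) (ball s r)) ∧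
  ContDiffOn ℝ 1 ψinv (ψ '' ball s r) ∧
  (∃ L : ℝ≥0, LipschitzOnWith L (fun x => fderiv ℝ ψinv x) (ψ '' ball s r)) ∧
  (∀ x ∈ ball s r, ψinv (ψ x) = x) ∧
  (∀ x ∈ ball s r, ψ x ⟨N - 1, Nat.sub_lt hN Nat.one_pos⟩ = sdist Ω x)

/-- Assumption (O): `Ω` is open of class `W^{2,∞}`. -/
def IsW2Domain (hN : 0 < N) (Ω : Set (Euc N)) : Prop :=
  IsOpen Ω ∧ ∀ s ∈ frontier Ω, ∃ r ψ ψinv, IsW2Chart hN Ω s r ψ ψinv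

/-- `n` is the exterior unit normal vector field to `∂Ω`:  `n = -D d` where `d` is the
signed distance (positive inside). -/
def IsExteriorNormal (Ω : Set (Euc N)) (n : Euc N → Euc N) : Prop :=
  ∀ x ∈ frontier Ω, ‖n x‖ = 1 ∧ HasGradientAt (sdist Ω) (-(n x)) x

/-- First part of assumption (M): the measures `μ_x` have a (measurable, nonnegative)
density `g x` with respect to Lebesgue measure, bounded by `Cμ |z|^{-(N+σ)}`. -/
def AssumptionM1 (Ω : Set (Euc N)) (g : Euc N → Euc N → ℝ) (Cμ σ : ℝ) : Prop :=
  0 < Cμ ∧ σ ∈ Ioo (0:ℝ) 1 ∧ (∀ x, Measurable (g x)) ∧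
  (∀ x ∈ closure Ω, ∀ z : Euc N, 0 ≤ g x z) ∧
  (∀ x ∈ closure Ω, ∀ z : Euc N, g x z ≤ Cμ * ‖z‖ ^ (-((N : ℝ) + σ)))

/-- Assumption (M). -/
def AssumptionM (Ω : Set (Euc N)) (g : Euc N → Euc N → ℝ) (Cμ Dμ σ : ℝ) : Prop :=
  AssumptionM1 Ω g Cμ σ ∧ 0 < Dμ ∧
  (∀ x ∈ closure Ω, ∀ y ∈ closure Ω, ∀ z : Euc N,
    |g x z - g y z| ≤ Dμ * ‖x - y‖ * ‖z‖ ^ (-((N : ℝ) + σ)))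

/-- Assumption (J0). -/
def AssumptionJ0 (Ω : Set (Euc N)) (j : Euc N → Euc N → Euc N) (Aj : ℝ) : Prop :=
  ∀ x ∈ closure Ω,
    ContDiff ℝ 1 (j x) ∧ Function.Bijective (j x) ∧
    ContDiff ℝ 1 (Function.invFun (j x)) ∧
    ∀ z : Euc N, ‖fderiv ℝ (Function.invFun (j x)) z‖ ≤ Aj

/-- Assumption (J1). -/
def AssumptionJ1 (Ω : Set (Euc N)) (j : Euc N → Euc N → Euc N) (Cj' Cj Dj : ℝ) : Prop :=
  0 < Cj' ∧ 0 < Cj ∧ 0 < Dj ∧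
  (∀ x ∈ closure Ω, ∀ z : Euc N, Cj' * ‖z‖ ≤ ‖j x z‖ ∧ ‖j x z‖ ≤ Cj * ‖z‖) ∧
  (∀ x ∈ closure Ω, ∀ y ∈ closure Ω, ∀ z : Euc N, ‖j x z - j y z‖ ≤ Dj * ‖z‖ * ‖x - y‖)

/-- The truncated censored nonlocal term over `{|z| ≥ ξ}` (`I^ξ`). -/
def Iout (Ω : Set (Euc N)) (j : Euc N → Euc N → Euc N) (g : Euc N → Euc N → ℝ)
    (ξ : ℝ) (u : Euc N → ℝ) (x : Euc N) : ℝ :=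
  ∫ z in {z : Euc N | ξ ≤ ‖z‖ ∧ x + j x z ∈ closure Ω}, (u (x + j x z) - u x) * g x z

/-- The truncated censored nonlocal term over `{|z| < ξ}` (`I_ξ`). -/
def Iin (Ω : Set (Euc N)) (j : Euc N → Euc N → Euc N) (g : Euc N → Euc N → ℝ)
    (ξ : ℝ) (φ : Euc N → ℝ) (x : Euc N) : ℝ :=
  ∫ z in {z : Euc N | ‖z‖ < ξ ∧ x + j x z ∈ closure Ω}, (φ (x + j x z) - φ x) * g x z

/-- The censored nonlocal operator of order `σ < 1`, as a principal value. -/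
def Ipv (Ω : Set (Euc N)) (j : Euc N → Euc N → Euc N) (g : Euc N → Euc N → ℝ)
    (u : Euc N → ℝ) (x : Euc N) : ℝ :=
  limUnder (nhdsWithin (0:ℝ) (Ioi 0)) (fun δ =>
    ∫ z in {z : Euc N | δ < ‖z‖ ∧ x + j x z ∈ closure Ω}, (u (x + j x z) - u x) * g x z)

/-- `u` is bounded on `S`. -/
def BddOn (u : Euc N → ℝ) (S : Set (Euc N)) : Prop := ∃ M, ∀ x ∈ S, |u x| ≤ M

/-- `u = u(x,t)` is bounded on `S × I`. -/
def BddOnT (u : Euc N → ℝ → ℝ) (S : Set (Euc N)) (I : Set ℝ) : Prop :=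
  ∃ M, ∀ x ∈ S, ∀ t ∈ I, |u x t| ≤ M

/-- Viscosity subsolution, with generalized Neumann boundary conditions, of the
stationary equation `F(x, u, Du, I[u]) = 0` in `Ω`, `∂u/∂n = 0` on `∂Ω`,
for the censored operator determined by `j, g` (with constant `Cj` from (J1)). -/
def IsSubSol (Ω : Set (Euc N)) (j : Euc N → Euc N → Euc N) (g : Euc N → Euc N → ℝ)
    (n : Euc N → Euc N) (Cj : ℝ) (F : Euc N → ℝ → Euc N → ℝ → ℝ) (u : Euc N → ℝ) : Prop :=
  ∀ ξ > (0:ℝ), ∀ φ : Euc N → ℝ, ContDiff ℝ 1 φ →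
    ∀ x ∈ closure Ω,
      (∀ y ∈ closedBall x (Cj * ξ) ∩ closure Ω, u y - φ y ≤ u x - φ x) →
      (x ∈ Ω → F x (u x) (gradient φ x) (Iin Ω j g ξ φ x + Iout Ω j g ξ u x) ≤ 0) ∧
      (x ∈ frontier Ω →
        min (F x (u x) (gradient φ x) (Iin Ω j g ξ φ x + Iout Ω j g ξ u x))
          ⟪gradient φ x, n x⟫ ≤ 0)

/-- Viscosity supersolution, with generalized Neumann boundary conditions. -/
def IsSuperSol (Ω : Set (Euc N)) (j : Euc N → Euc N → Euc N) (g : Euc N → Euc N → ℝ)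
    (n : Euc N → Euc N) (Cj : ℝ) (F : Euc N → ℝ → Euc N → ℝ → ℝ) (v : Euc N → ℝ) : Prop :=
  ∀ ξ > (0:ℝ), ∀ φ : Euc N → ℝ, ContDiff ℝ 1 φ →
    ∀ x ∈ closure Ω,
      (∀ y ∈ closedBall x (Cj * ξ) ∩ closure Ω, v x - φ x ≤ v y - φ y) →
      (x ∈ Ω → 0 ≤ F x (v x) (gradient φ x) (Iin Ω j g ξ φ x + Iout Ω j g ξ v x)) ∧
      (x ∈ frontier Ω →
        0 ≤ max (F x (v x) (gradient φ x) (Iin Ω j g ξ φ x + Iout Ω j g ξ v x))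
          ⟪gradient φ x, n x⟫)

/-- `F` corresponding to the stationary equation `u - I[u] + H(x,Du) = 0`. -/
def statF (H : Euc N → Euc N → ℝ) : Euc N → ℝ → Euc N → ℝ → ℝ :=
  fun x r p I => r - I + H x p

/-- `F` corresponding to the ergodic equation `λ - I[w] - H(x,Dw) = 0`. -/
def ergF (H : Euc N → Euc N → ℝ) (lam : ℝ) : Euc N → ℝ → Euc N → ℝ → ℝ :=
  fun x _ p I => lam - I - H x p

/-- Parabolic viscosity subsolution with generalized Neumann boundary conditions,
for `F(x, t, ∂_t u, u, Du, I[u(·,t)]) = 0` in `Ω × (0,∞)`. -/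
def IsParSubSol (Ω : Set (Euc N)) (j : Euc N → Euc N → Euc N) (g : Euc N → Euc N → ℝ)
    (n : Euc N → Euc N) (Cj : ℝ) (F : Euc N → ℝ → ℝ → ℝ → Euc N → ℝ → ℝ)
    (u : Euc N → ℝ → ℝ) : Prop :=
  ∀ ξ > (0:ℝ), ∀ φ : Euc N → ℝ → ℝ,
    ContDiff ℝ 1 (fun q : Euc N × ℝ => φ q.1 q.2) →
    ∀ x ∈ closure Ω, ∀ t ∈ Ioi (0:ℝ),
      (∀ y ∈ closedBall x (Cj * ξ) ∩ closure Ω, ∀ s ∈ Ioi (0:ℝ), |s - t| ≤ ξ →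
        u y s - φ y s ≤ u x t - φ x t) →
      (x ∈ Ω →
        F x t (deriv (φ x) t) (u x t) (gradient (fun y => φ y t) x)
          (Iin Ω j g ξ (fun y => φ y t) x + Iout Ω j g ξ (fun y => u y t) x) ≤ 0) ∧
      (x ∈ frontier Ω →
        min (F x t (deriv (φ x) t) (u x t) (gradient (fun y => φ y t) x)
              (Iin Ω j g ξ (fun y => φ y t) x + Iout Ω j g ξ (fun y => u y t) x))
          ⟪gradient (fun y => φ y t) x, n x⟫ ≤ 0)

/-- Parabolic viscosity supersolution with generalized Neumann boundary conditions. -/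
def IsParSuperSol (Ω : Set (Euc N)) (j : Euc N → Euc N → Euc N) (g : Euc N → Euc N → ℝ)
    (n : Euc N → Euc N) (Cj : ℝ) (F : Euc N → ℝ → ℝ → ℝ → Euc N → ℝ → ℝ)
    (v : Euc N → ℝ → ℝ) : Prop :=
  ∀ ξ > (0:ℝ), ∀ φ : Euc N → ℝ → ℝ,
    ContDiff ℝ 1 (fun q : Euc N × ℝ => φ q.1 q.2) →
    ∀ x ∈ closure Ω, ∀ t ∈ Ioi (0:ℝ),
      (∀ y ∈ closedBall x (Cj * ξ) ∩ closure Ω, ∀ s ∈ Ioi (0:ℝ), |s - t| ≤ ξ →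
        v x t - φ x t ≤ v y s - φ y s) →
      (x ∈ Ω →
        0 ≤ F x t (deriv (φ x) t) (v x t) (gradient (fun y => φ y t) x)
          (Iin Ω j g ξ (fun y => φ y t) x + Iout Ω j g ξ (fun y => v y t) x)) ∧
      (x ∈ frontier Ω →
        0 ≤ max (F x t (deriv (φ x) t) (v x t) (gradient (fun y => φ y t) x)
              (Iin Ω j g ξ (fun y => φ y t) x + Iout Ω j g ξ (fun y => v y t) x))
          ⟪gradient (fun y => φ y t) x, n x⟫)

/-- `F` for the parabolic equation `∂_t u - I[u] + H(x,t,u,Du) = 0`. -/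
def parF (H : Euc N → ℝ → ℝ → Euc N → ℝ) : Euc N → ℝ → ℝ → ℝ → Euc N → ℝ → ℝ :=
  fun x t pt r p I => pt - I + H x t r p

/-! ### Hamiltonians: Bellman form and coercive form (stationary) -/




/-- `H` is of Bellman type with drift `b` and cost `l` over the control set `A`. -/
def IsBellman {A : Type} (b : Euc N → A → Euc N) (l : Euc N → A → ℝ)
    (H : Euc N → Euc N → ℝ) : Prop :=
  ∀ x p, H x p = ⨆ α : A, (-⟪b x α, p⟫ - l x α)

/-- Continuity and boundedness of the Bellman data `b, l`. -/
def BellmanData {A : Type} [TopologicalSpace A]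
    (b : Euc N → A → Euc N) (l : Euc N → A → ℝ) : Prop :=
  Continuous (fun q : Euc N × A => b q.1 q.2) ∧ (∃ M, ∀ x α, ‖b x α‖ ≤ M) ∧
  Continuous (fun q : Euc N × A => l q.1 q.2) ∧ (∃ M, ∀ x α, |l x α| ≤ M)

/-- Assumption (C): uniform continuity of the cost `l`. -/
def AssumptionC (Ω : Set (Euc N)) {A : Type} (l : Euc N → A → ℝ) : Prop :=
  ∃ ω, IsModulus ω ∧ ∀ (α : A), ∀ x ∈ closure Ω, ∀ y ∈ closure Ω,
    |l x α - l y α| ≤ ω ‖x - y‖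

/-- Assumption (L): uniform Lipschitz continuity of the drift `b`. -/
def AssumptionL (Ω : Set (Euc N)) {A : Type} (b : Euc N → A → Euc N) : Prop :=
  ∃ C > (0:ℝ), ∀ (α : A), ∀ x ∈ closure Ω, ∀ y ∈ closure Ω,
    ‖b x α - b y α‖ ≤ C * ‖x - y‖

/-- The part of the boundary where the drift points inwards for every control. -/
def GammaIn (Ω : Set (Euc N)) (n : Euc N → Euc N) {A : Type}
    (b : Euc N → A → Euc N) : Set (Euc N) :=
  {x | x ∈ frontier Ω ∧ ∀ α : A, ⟪b x α, n x⟫ < 0}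

/-- The part of the boundary where the drift points outwards for every control. -/
def GammaOut (Ω : Set (Euc N)) (n : Euc N → Euc N) {A : Type}
    (b : Euc N → A → Euc N) : Set (Euc N) :=
  {x | x ∈ frontier Ω ∧ ∀ α : A, 0 < ⟪b x α, n x⟫}

/-- The part of the boundary where the drift points both inwards and outwards. -/
def GammaMix (Ω : Set (Euc N)) (n : Euc N → Euc N) {A : Type}
    (b : Euc N → A → Euc N) : Set (Euc N) :=
  {x | x ∈ frontier Ω ∧ ∃ α₁ α₂ : A, ⟪b x α₁, n x⟫ < 0 ∧ 0 < ⟪b x α₂, n x⟫}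

/-- `S` is a union of connected components of `T`. -/
def IsUnionOfComponents (S T : Set (Euc N)) : Prop :=
  S ⊆ T ∧ ∀ x ∈ S, connectedComponentIn T x ⊆ S

/-- Assumption (B). -/
def AssumptionB (Ω : Set (Euc N)) (n : Euc N → Euc N) {A : Type}
    (b : Euc N → A → Euc N) : Prop :=
  GammaIn Ω n b ∪ GammaOut Ω n b ∪ GammaMix Ω n b = frontier Ω ∧
  IsUnionOfComponents (GammaIn Ω n b) (frontier Ω) ∧
  IsUnionOfComponents (GammaOut Ω n b) (frontier Ω) ∧
  IsUnionOfComponents (GammaMix Ω n b) (frontier Ω)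

/-- All the structural assumptions on a Bellman Hamiltonian: (C), (L), (B) together
with continuity and boundedness of the data. -/
def StatBellmanOK (Ω : Set (Euc N)) (n : Euc N → Euc N) {A : Type} [TopologicalSpace A]
    (b : Euc N → A → Euc N) (l : Euc N → A → ℝ) (H : Euc N → Euc N → ℝ) : Prop :=
  BellmanData b l ∧ IsBellman b l H ∧ AssumptionC Ω l ∧ AssumptionL Ω b ∧ AssumptionB Ω n b

/-- Assumption (H1): superfractional coercivity of order `m > σ`. -/
def AssumptionH1 (Ω : Set (Euc N)) (H : Euc N → Euc N → ℝ) (σ m c₀ D : ℝ) : Prop :=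
  σ < m ∧ 0 < c₀ ∧ 0 < D ∧ ∀ x ∈ closure Ω, ∀ p : Euc N, c₀ * ‖p‖ ^ m - D ≤ H x p

/-- Assumption (Ha) (sublinear case) with constant `C` and modulus `ω₁`. -/
def AssumptionHa (H : Euc N → Euc N → ℝ) (C : ℝ) (ω₁ : ℝ → ℝ) : Prop :=
  0 < C ∧ IsModulus ω₁ ∧
  ∀ x y p q : Euc N, H y p - H x q ≤ ω₁ ‖x - y‖ * (1 + ‖p‖) + C * ‖p - q‖

/-- Assumption (Hb) (superlinear case) with constants `m, A, Cb`. -/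
def AssumptionHb (H : Euc N → Euc N → ℝ) (m A Cb : ℝ) : Prop :=
  1 < m ∧ 0 < A ∧ 0 < Cb ∧
  ∀ μ ∈ Ioo (0:ℝ) 1, ∀ x p : Euc N,
    H x p - μ * H x (μ⁻¹ • p) ≤ (1 - μ) * (Cb * (1 - m) * ‖p‖ ^ m + A)

/-- Assumption (Hc) with constant `C` and modulus `ω₁`. -/
def AssumptionHc (H : Euc N → Euc N → ℝ) (m C : ℝ) (ω₁ : ℝ → ℝ) : Prop :=
  0 < C ∧ IsModulus ω₁ ∧
  ∀ x y p q : Euc N,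
    H y p - H x q ≤ ω₁ ‖x - y‖ * (1 + (max ‖p‖ ‖q‖) ^ m)
      + C * ‖p - q‖ * (max ‖p‖ ‖q‖) ^ (m - 1)

/-- The structural assumptions on a coercive Hamiltonian:
(H1), (Ha) (sublinear) or (H1), (Hb), (Hc) (superlinear). -/
def StatCoerciveOK (Ω : Set (Euc N)) (H : Euc N → Euc N → ℝ) (σ : ℝ) : Prop :=
  ∃ m c₀ D, AssumptionH1 Ω H σ m c₀ D ∧
    ((m ≤ 1 ∧ ∃ C ω₁, AssumptionHa H C ω₁) ∨
     (∃ A Cb, AssumptionHb H m A Cb ∧ ∃ C ω₁, AssumptionHc H m C ω₁))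

/-- Assumption (E). -/
def AssumptionE (Ω : Set (Euc N)) (H : Euc N → Euc N → ℝ) : Prop :=
  ∀ R > (0:ℝ), ∃ HR : ℝ, ∀ x ∈ closure Ω, ∀ p : Euc N, ‖p‖ ≤ R → |H x p| ≤ HR

/-! ### Parabolic Hamiltonians and assumptions -/

/-- `H(x,t,r,p)` is of (time-dependent) Bellman type. -/
def IsParBellman {A : Type} (lam : Euc N → ℝ → A → ℝ) (b : Euc N → ℝ → A → Euc N)
    (l : Euc N → ℝ → A → ℝ) (H : Euc N → ℝ → ℝ → Euc N → ℝ) : Prop :=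
  ∀ x t r p, H x t r p = ⨆ α : A, (lam x t α * r - ⟪b x t α, p⟫ - l x t α)

/-- Continuity and boundedness of the parabolic Bellman data. -/
def ParBellmanData {A : Type} [TopologicalSpace A] (lam : Euc N → ℝ → A → ℝ)
    (b : Euc N → ℝ → A → Euc N) (l : Euc N → ℝ → A → ℝ) : Prop :=
  Continuous (fun q : Euc N × ℝ × A => lam q.1 q.2.1 q.2.2) ∧
  (∃ M, ∀ x t α, |lam x t α| ≤ M) ∧
  Continuous (fun q : Euc N × ℝ × A => b q.1 q.2.1 q.2.2) ∧
  (∃ M, ∀ x t α, ‖b x t α‖ ≤ M) ∧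
  Continuous (fun q : Euc N × ℝ × A => l q.1 q.2.1 q.2.2) ∧
  (∃ M, ∀ x t α, |l x t α| ≤ M)

/-- Assumption (C'): uniform continuity of `l` and `λ` in `(x,t)`, uniformly in `α`. -/
def AssumptionC' (Ω : Set (Euc N)) {A : Type} (lam l : Euc N → ℝ → A → ℝ) : Prop :=
  (∃ ω, IsModulus ω ∧ ∀ (α : A), ∀ x ∈ closure Ω, ∀ y ∈ closure Ω,
      ∀ t ∈ Ici (0:ℝ), ∀ s ∈ Ici (0:ℝ), |l x t α - l y s α| ≤ ω (‖x - y‖ + |t - s|)) ∧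
  (∃ ω, IsModulus ω ∧ ∀ (α : A), ∀ x ∈ closure Ω, ∀ y ∈ closure Ω,
      ∀ t ∈ Ici (0:ℝ), ∀ s ∈ Ici (0:ℝ), |lam x t α - lam y s α| ≤ ω (‖x - y‖ + |t - s|))

/-- Assumption (L'): uniform Lipschitz continuity of the drift `b` in `(x,t)`. -/
def AssumptionL' (Ω : Set (Euc N)) {A : Type} (b : Euc N → ℝ → A → Euc N) : Prop :=
  ∃ C > (0:ℝ), ∀ (α : A), ∀ x ∈ closure Ω, ∀ y ∈ closure Ω, ∀ s ∈ Ici (0:ℝ), ∀ t ∈ Ici (0:ℝ),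
    ‖b x s α - b y t α‖ ≤ C * (‖x - y‖ + |s - t|)

/-- Inward part of the boundary for time-dependent drift. -/
def GammaInT (Ω : Set (Euc N)) (n : Euc N → Euc N) {A : Type}
    (b : Euc N → ℝ → A → Euc N) : Set (Euc N) :=
  {x | x ∈ frontier Ω ∧ ∀ t ∈ Ici (0:ℝ), ∀ α : A, ⟪b x t α, n x⟫ < 0}

/-- Outward part of the boundary for time-dependent drift. -/
def GammaOutT (Ω : Set (Euc N)) (n : Euc N → Euc N) {A : Type}
    (b : Euc N → ℝ → A → Euc N) : Set (Euc N) :=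
  {x | x ∈ frontier Ω ∧ ∀ t ∈ Ici (0:ℝ), ∀ α : A, 0 < ⟪b x t α, n x⟫}

/-- Mixed part of the boundary for time-dependent drift. -/
def GammaMixT (Ω : Set (Euc N)) (n : Euc N → Euc N) {A : Type}
    (b : Euc N → ℝ → A → Euc N) : Set (Euc N) :=
  {x | x ∈ frontier Ω ∧ ∀ t ∈ Ici (0:ℝ),
    ∃ α₁ α₂ : A, ⟪b x t α₁, n x⟫ < 0 ∧ 0 < ⟪b x t α₂, n x⟫}

/-- Assumption (B'). -/
def AssumptionB' (Ω : Set (Euc N)) (n : Euc N → Euc N) {A : Type}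
    (b : Euc N → ℝ → A → Euc N) : Prop :=
  GammaInT Ω n b ∪ GammaOutT Ω n b ∪ GammaMixT Ω n b = frontier Ω ∧
  IsUnionOfComponents (GammaInT Ω n b) (frontier Ω) ∧
  IsUnionOfComponents (GammaOutT Ω n b) (frontier Ω) ∧
  IsUnionOfComponents (GammaMixT Ω n b) (frontier Ω)

/-- All the structural assumptions on a parabolic Bellman Hamiltonian: (C'), (L'), (B'). -/
def ParBellmanOK (Ω : Set (Euc N)) (n : Euc N → Euc N) {A : Type} [TopologicalSpace A]
    (lam : Euc N → ℝ → A → ℝ) (b : Euc N → ℝ → A → Euc N) (l : Euc N → ℝ → A → ℝ)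
    (H : Euc N → ℝ → ℝ → Euc N → ℝ) : Prop :=
  ParBellmanData lam b l ∧ IsParBellman lam b l H ∧
  AssumptionC' Ω lam l ∧ AssumptionL' Ω b ∧ AssumptionB' Ω n b

/-- Assumption (H'): monotonicity of `H` in the `u` variable. -/
def AssumptionH' (Ω : Set (Euc N)) (H : Euc N → ℝ → ℝ → Euc N → ℝ) : Prop :=
  ∃ K : ℝ, ∀ R > (0:ℝ), ∃ γ, -K ≤ γ ∧
    ∀ x ∈ closure Ω, ∀ t ∈ Icc (0:ℝ) R, ∀ r s : ℝ, |r| ≤ R → |s| ≤ R → s ≤ r →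
      ∀ p : Euc N, γ * (r - s) ≤ H x t r p - H x t s p

/-- Assumption (H''): the monotonicity constants `γ_R` are bounded below by some `γ₀ > 0`. -/
def AssumptionH'' (Ω : Set (Euc N)) (H : Euc N → ℝ → ℝ → Euc N → ℝ) : Prop :=
  ∃ γ₀ > (0:ℝ), ∀ R > (0:ℝ), ∃ γ, γ₀ ≤ γ ∧
    ∀ x ∈ closure Ω, ∀ t ∈ Icc (0:ℝ) R, ∀ r s : ℝ, |r| ≤ R → |s| ≤ R → s ≤ r →
      ∀ p : Euc N, γ * (r - s) ≤ H x t r p - H x t s p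

/-- Assumption (E'). -/
def AssumptionE' (Ω : Set (Euc N)) (H : Euc N → ℝ → ℝ → Euc N → ℝ) : Prop :=
  ∀ T > (0:ℝ), ∀ R > (0:ℝ), ∃ HR : ℝ, ∀ x ∈ Ω, ∀ t ∈ Icc (0:ℝ) T, ∀ r : ℝ, ∀ p : Euc N,
    |r| ≤ R → ‖p‖ ≤ R → |H x t r p| ≤ HR

/-- Assumption (H0'): separated structure `H(x,t,r,p) = H₀(x,r,p) - f(x,t)`. -/
def AssumptionH0' (H : Euc N → ℝ → ℝ → Euc N → ℝ) : Prop :=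
  ∃ (H₀ : Euc N → ℝ → Euc N → ℝ) (f : Euc N → ℝ → ℝ),
    Continuous (fun q : Euc N × ℝ × Euc N => H₀ q.1 q.2.1 q.2.2) ∧
    UniformContinuous (fun q : Euc N × ℝ => f q.1 q.2) ∧
    (∃ M, ∀ x t, |f x t| ≤ M) ∧
    ∀ x t r p, H x t r p = H₀ x r p - f x t

/-- Assumption (He'): `H` satisfies (H1), (Ha) in `x`, uniformly in `t`
and uniformly on compact sets in `r` (sublinearly coercive case). -/
def AssumptionHe' (Ω : Set (Euc N)) (H : Euc N → ℝ → ℝ → Euc N → ℝ) (σ : ℝ) : Prop :=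
  ∃ m : ℝ, σ < m ∧ m ≤ 1 ∧
    ∀ R > (0:ℝ),
      (∃ c₀ > (0:ℝ), ∃ D > (0:ℝ), ∀ x ∈ closure Ω, ∀ t ∈ Ici (0:ℝ), ∀ r : ℝ, |r| ≤ R →
        ∀ p : Euc N, c₀ * ‖p‖ ^ m - D ≤ H x t r p) ∧
      (∃ C > (0:ℝ), ∃ ω₁, IsModulus ω₁ ∧ ∀ x y : Euc N, ∀ t ∈ Ici (0:ℝ), ∀ r : ℝ, |r| ≤ R →
        ∀ p q : Euc N, H y t r p - H x t r q ≤ ω₁ ‖x - y‖ * (1 + ‖p‖) + C * ‖p - q‖)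

/-- Assumption (He''): `H` satisfies (H1), (Hb), (Hc) in `x`, uniformly in `t`
and uniformly on compact sets in `r` (superlinearly coercive case, exponent `m`). -/
def AssumptionHe'' (Ω : Set (Euc N)) (H : Euc N → ℝ → ℝ → Euc N → ℝ) (σ m : ℝ) : Prop :=
  1 < m ∧ σ < m ∧
  ∀ R > (0:ℝ),
    (∃ c₀ > (0:ℝ), ∃ D > (0:ℝ), ∀ x ∈ closure Ω, ∀ t ∈ Ici (0:ℝ), ∀ r : ℝ, |r| ≤ R →
      ∀ p : Euc N, c₀ * ‖p‖ ^ m - D ≤ H x t r p) ∧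
    (∃ A > (0:ℝ), ∃ Cb > (0:ℝ), ∀ μ ∈ Ioo (0:ℝ) 1, ∀ x ∈ closure Ω, ∀ t ∈ Ici (0:ℝ),
      ∀ r : ℝ, |r| ≤ R → ∀ p : Euc N,
        H x t r p - μ * H x t r (μ⁻¹ • p) ≤ (1 - μ) * (Cb * (1 - m) * ‖p‖ ^ m + A)) ∧
    (∃ C > (0:ℝ), ∃ ω₁, IsModulus ω₁ ∧ ∀ x y : Euc N, ∀ t ∈ Ici (0:ℝ), ∀ r : ℝ, |r| ≤ R →
      ∀ p q : Euc N, H y t r p - H x t r q ≤ ω₁ ‖x - y‖ * (1 + (max ‖p‖ ‖q‖) ^ m)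
        + C * ‖p - q‖ * (max ‖p‖ ‖q‖) ^ (m - 1))

/-- Structural parabolic coercive assumptions: (H0') and (He') or (He''). -/
def ParCoerciveOK (Ω : Set (Euc N)) (H : Euc N → ℝ → ℝ → Euc N → ℝ) (σ : ℝ) : Prop :=
  AssumptionH0' H ∧ (AssumptionHe' Ω H σ ∨ ∃ m, AssumptionHe'' Ω H σ m)

/-! ### Iterative covering property -/

/-- The iterated reachable sets `X_r(x)` of the censored jump process. -/
def Xiter (Ω : Set (Euc N)) (j : Euc N → Euc N → Euc N) (g : Euc N → Euc N → ℝ)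
    (x : Euc N) : ℕ → Set (Euc N)
  | 0 => {x}
  | r + 1 => (⋃ ξ ∈ Xiter Ω j g x r,
      (fun z => ξ + j ξ z) '' closure (Function.support (g ξ))) ∩ closure Ω

/-- Iterative covering property: `𝒳(x) = Ω` (i.e. the closure of the reachable set
is all of `closure Ω`) for every `x ∈ Ω`. -/
def CoveringProperty (Ω : Set (Euc N)) (j : Euc N → Euc N → Euc N)
    (g : Euc N → Euc N → ℝ) : Prop :=
  ∀ x ∈ Ω, closure (⋃ r : ℕ, Xiter Ω j g x r) = closure Ω

set_option linter.all false

/-- Bundle of the geometric data. -/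
structure Dat (N : ℕ) where
  hN : 0 < N
  Ω : Set (Euc N)
  hΩ : IsW2Domain hN Ω
  n : Euc N → Euc N
  hn : IsExteriorNormal Ω n
  g : Euc N → Euc N → ℝ
  Cμ : ℝ
  Dμ : ℝ
  σ : ℝ
  hM : AssumptionM Ω g Cμ Dμ σ
  j : Euc N → Euc N → Euc N
  Aj : ℝ
  hJ0 : AssumptionJ0 Ω j Aj
  Cl : ℝ
  Cj : ℝ
  Dj : ℝ
  hJ1 : AssumptionJ1 Ω j Cl Cj Dj

namespace Dat
variable (D : Dat N)

lemma open_Ω : IsOpen D.Ω := D.hΩ.1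
lemma σ_pos : 0 < D.σ := D.hM.1.2.1.1
lemma σ_lt : D.σ < 1 := D.hM.1.2.1.2
lemma Cμ_pos : 0 < D.Cμ := D.hM.1.1
lemma Dμ_pos : 0 < D.Dμ := D.hM.2.1
lemma Cl_pos : 0 < D.Cl := D.hJ1.1
lemma Cj_pos : 0 < D.Cj := D.hJ1.2.1
lemma Dj_pos : 0 < D.Dj := D.hJ1.2.2.1
lemma g_meas (x : Euc N) : Measurable (D.g x) := D.hM.1.2.2.1 x
lemma g_nonneg {x : Euc N} (hx : x ∈ closure D.Ω) (z : Euc N) : 0 ≤ D.g x z := D.hM.1.2.2.2.1 x hx z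
lemma g_le {x : Euc N} (hx : x ∈ closure D.Ω) (z : Euc N) :
    D.g x z ≤ D.Cμ * ‖z‖ ^ (-((N : ℝ) + D.σ)) := D.hM.1.2.2.2.2 x hx z
lemma g_diff {x y : Euc N} (hx : x ∈ closure D.Ω) (hy : y ∈ closure D.Ω) (z : Euc N) :
    |D.g x z - D.g y z| ≤ D.Dμ * ‖x - y‖ * ‖z‖ ^ (-((N : ℝ) + D.σ)) := D.hM.2.2 x hx y hy z
lemma j_cd {x : Euc N} (hx : x ∈ closure D.Ω) : ContDiff ℝ 1 (D.j x) := (D.hJ0 x hx).1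
lemma j_cont {x : Euc N} (hx : x ∈ closure D.Ω) : Continuous (D.j x) := (D.j_cd hx).continuous
lemma j_ge {x : Euc N} (hx : x ∈ closure D.Ω) (z : Euc N) : D.Cl * ‖z‖ ≤ ‖D.j x z‖ :=
  (D.hJ1.2.2.2.1 x hx z).1
lemma j_le {x : Euc N} (hx : x ∈ closure D.Ω) (z : Euc N) : ‖D.j x z‖ ≤ D.Cj * ‖z‖ :=
  (D.hJ1.2.2.2.1 x hx z).2
lemma j_diff {x y : Euc N} (hx : x ∈ closure D.Ω) (hy : y ∈ closure D.Ω) (z : Euc N) :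
    ‖D.j x z - D.j y z‖ ≤ D.Dj * ‖z‖ * ‖x - y‖ := D.hJ1.2.2.2.2 x hx y hy z

/-- Signed distance. -/
def d (x : Euc N) : ℝ := sdist D.Ω x

end Dat

/-- Volume of Lipschitz images. -/
lemma volume_lipschitz_image {f : Euc N → Euc N} {K : ℝ≥0} (hf : LipschitzWith K f) (s : Set (Euc N)) :
    volume (f '' s) ≤ (K : ℝ≥0∞) ^ N * volume s := by
  have h1 := hf.hausdorffMeasure_image_le (d := (N : ℝ)) (by positivity) s
  have hfr : (Module.finrank ℝ (Euc N) : ℝ) = N := by simp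
  haveI : (μH[(N : ℝ)] : Measure (Euc N)).IsAddHaarMeasure := by
    rw [← hfr]; infer_instance
  have h2 := MeasureTheory.Measure.isAddLeftInvariant_eq_smul (volume : Measure (Euc N)) (μH[(N : ℝ)])
  rw [h2]
  simp only [Measure.smul_apply, ENNReal.smul_def, smul_eq_mul] at *
  rw [ENNReal.rpow_natCast] at h1
  calc _ ≤ _ * (_ * _) := mul_le_mul_right h1 _
    _ = _ := by ring

/-- kernel weight. -/
def ker (N : ℕ) (σ : ℝ) (z : Euc N) : ℝ := ‖z‖ ^ (-((N : ℝ) + σ))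

lemma ker_nonneg (σ : ℝ) (z : Euc N) : 0 ≤ ker N σ z := by unfold ker; positivity

lemma ker_meas (σ : ℝ) : Measurable (ker N σ) := by unfold ker; fun_prop

/-- Integrability of the truncated kernel. -/
lemma ker_integrable (hN : 0 < N) {σ : ℝ} (h0 : 0 < σ) (h1 : σ < 1) (B M : ℝ) (hB : 0 ≤ B) (hM : 0 ≤ M) :
    Integrable (fun z : Euc N => min (B * ‖z‖) M * ker N σ z) := by
  haveI : Nonempty (Fin N) := ⟨⟨0, hN⟩⟩
  haveI : Nontrivial (Euc N) := inferInstance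
  have := (integrable_fun_norm_addHaar (volume : Measure (Euc N))
    (f := fun r => min (B * r) M * r ^ (-((N : ℝ) + σ)))).2 ?_
  · exact this
  have hd : Module.finrank ℝ (Euc N) = N := by simp
  rw [hd]
  have hNN : ((N - 1 : ℕ) : ℝ) = N - 1 := by rw [Nat.cast_sub hN]; simp
  have key : ∀ r ∈ Ioi (0:ℝ), r ^ (N - 1) • (min (B * r) M * r ^ (-((N : ℝ) + σ)))
      = min (B * r) M * r ^ (-(1 + σ)) := by
    intro r hr
    have hr : 0 < r := hr
    rw [smul_eq_mul, ← Real.rpow_natCast, hNN, mul_left_comm, ← Real.rpow_add hr]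
    congr 2; ring
  rw [integrableOn_congr_fun key measurableSet_Ioi, ← Ioc_union_Ioi_eq_Ioi (zero_le_one' ℝ)]
  have hmeas : Measurable (fun r : ℝ => min (B * r) M * r ^ (-(1 + σ))) := by fun_prop
  apply IntegrableOn.union
  · have hi : IntegrableOn (fun r : ℝ => B * r ^ (-σ)) (Ioc 0 1) := by
      have := (intervalIntegral.intervalIntegrable_rpow' (a := 0) (b := 1) (r := -σ) (by linarith)).1
      exact this.const_mul B
    refine Integrable.mono' hi hmeas.aestronglyMeasurable ?_
    refine (ae_restrict_iff' measurableSet_Ioc).2 (Eventually.of_forall fun r hr => ?_)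
    have hr0 : 0 < r := hr.1
    have e : r ^ (-σ) = r * r ^ (-(1+σ)) := by
      nth_rw 2 [← Real.rpow_one r]; rw [← Real.rpow_add hr0]; congr 1; ring
    have hp : 0 ≤ r ^ (-(1+σ)) := by positivity
    rw [Real.norm_of_nonneg (by have : 0 ≤ min (B*r) M := by positivity
                                positivity), e, ← mul_assoc]
    exact mul_le_mul_of_nonneg_right (min_le_left _ _) hp
  · have hi : IntegrableOn (fun r : ℝ => M * r ^ (-(1+σ))) (Ioi 1) :=
      (integrableOn_Ioi_rpow_of_lt (by linarith) one_pos).const_mul M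
    refine Integrable.mono' hi hmeas.aestronglyMeasurable ?_
    refine (ae_restrict_iff' measurableSet_Ioi).2 (Eventually.of_forall fun r hr => ?_)
    have hr0 : 0 < r := lt_trans one_pos hr
    have hp : 0 ≤ r ^ (-(1+σ)) := by positivity
    rw [Real.norm_of_nonneg (by have : 0 ≤ min (B*r) M := by positivity
                                positivity)]
    exact mul_le_mul_of_nonneg_right (min_le_right _ _) hp

/-- Scaling of the truncated kernel integral. -/
lemma ker_scaling (hN : 0 < N) {σ : ℝ} (B M : ℝ) (hB : 0 < B) :
    ∫ z : Euc N, min (B * ‖z‖) M * ker N σ z = B ^ σ * ∫ z : Euc N, min ‖z‖ M * ker N σ z := by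
  have h := Measure.integral_comp_smul (volume : Measure (Euc N)) (fun z => min ‖z‖ M * ker N σ z) B
  have e : ∀ z : Euc N, min ‖B • z‖ M * ker N σ (B • z) = B ^ (-((N:ℝ)+σ)) * (min (B * ‖z‖) M * ker N σ z) := by
    intro z
    unfold ker
    rw [norm_smul, Real.norm_of_nonneg hB.le, Real.mul_rpow hB.le (norm_nonneg _)]; ring
  simp_rw [e] at h
  rw [integral_const_mul] at h
  have hd : Module.finrank ℝ (Euc N) = N := by simp
  rw [hd, smul_eq_mul, abs_of_pos (by positivity)] at h
  have hb : 0 < B ^ (-((N:ℝ)+σ)) := by positivity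
  have e2 : (B ^ N)⁻¹ = B ^ (-((N:ℝ)+σ)) * B ^ σ := by
    rw [← Real.rpow_add hB, ← Real.rpow_natCast, ← Real.rpow_neg hB.le]; congr 1; ring
  rw [e2, mul_assoc] at h
  exact mul_left_cancel₀ hb.ne' h

namespace Dat
variable (D : Dat N)

lemma d_lip (x y : Euc N) : |D.d x - D.d y| ≤ 2 * ‖x - y‖ := by
  have h1 := (Metric.lipschitz_infDist_pt (D.Ωᶜ)).dist_le_mul x y
  have h2 := (Metric.lipschitz_infDist_pt (D.Ω)).dist_le_mul x y
  simp only [NNReal.coe_one, one_mul, Real.dist_eq, dist_eq_norm] at h1 h2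
  rw [Real.norm_eq_abs] at h1 h2
  unfold d sdist
  rw [abs_le] at *
  constructor <;> linarith

lemma d_cont : Continuous D.d := by
  unfold d sdist; exact (continuous_infDist_pt _).sub (continuous_infDist_pt _)

lemma frontier_nonempty' {s : Euc N} (hs : s ∈ frontier D.Ω) : D.Ω.Nonempty ∧ D.Ωᶜ.Nonempty := by
  constructor
  · exact closure_nonempty_iff.1 ⟨s, frontier_subset_closure hs⟩
  · refine ⟨s, ?_⟩
    rw [D.open_Ω.frontier_eq] at hs; exact hs.2

lemma not_mem_of_frontier {s : Euc N} (hs : s ∈ frontier D.Ω) : s ∉ D.Ω := by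
  rw [D.open_Ω.frontier_eq] at hs; exact hs.2

lemma mem_or {x : Euc N} (hx : x ∈ closure D.Ω) : x ∈ D.Ω ∨ x ∈ frontier D.Ω := by
  by_cases h : x ∈ D.Ω
  · exact Or.inl h
  · right; rw [D.open_Ω.frontier_eq]; exact ⟨hx, h⟩

lemma d_pos {s : Euc N} (hs : s ∈ frontier D.Ω) {x : Euc N} (hx : x ∈ D.Ω) : 0 < D.d x := by
  have h := D.frontier_nonempty' hs
  have h1 : 0 < infDist x D.Ωᶜ :=
    (D.open_Ω.isClosed_compl.notMem_iff_infDist_pos h.2).1 (by simpa using hx)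
  have h2 : infDist x D.Ω = 0 := infDist_zero_of_mem hx
  unfold d sdist; linarith

lemma d_neg {s : Euc N} (hs : s ∈ frontier D.Ω) {x : Euc N} (hx : x ∉ closure D.Ω) : D.d x < 0 := by
  have h := D.frontier_nonempty' hs
  have h1 : infDist x D.Ωᶜ = 0 := infDist_zero_of_mem (fun hh => hx (subset_closure hh))
  have h2 : 0 < infDist x (closure D.Ω) :=
    (isClosed_closure.notMem_iff_infDist_pos h.1.closure).1 hx
  rw [infDist_closure] at h2
  unfold d sdist; linarith

lemma d_zero {x : Euc N} (hx : x ∈ frontier D.Ω) : D.d x = 0 := by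
  have h1 : infDist x D.Ωᶜ = 0 := infDist_zero_of_mem (D.not_mem_of_frontier hx)
  have h2 : infDist x D.Ω = 0 := by
    rw [← infDist_closure]; exact infDist_zero_of_mem (frontier_subset_closure hx)
  unfold d sdist; linarith

lemma d_nonneg {s : Euc N} (hs : s ∈ frontier D.Ω) {x : Euc N} (hx : x ∈ closure D.Ω) : 0 ≤ D.d x := by
  rcases D.mem_or hx with h | h
  · exact (D.d_pos hs h).le
  · exact (D.d_zero h).ge

lemma mem_Ω_of_d_pos {s : Euc N} (hs : s ∈ frontier D.Ω) {x : Euc N} (hx : 0 < D.d x) : x ∈ D.Ω := by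
  have h1 : x ∈ closure D.Ω := by
    by_contra h; linarith [D.d_neg hs h]
  rcases D.mem_or h1 with h | h
  · exact h
  · linarith [D.d_zero h]

/-- gradient of the signed distance -/
def gd (x : Euc N) : Euc N := gradient D.d x

/-- regular neighbourhood of a boundary point. -/
structure Near (s : Euc N) (r L : ℝ) : Prop where
  hs : s ∈ frontier D.Ω
  r_pos : 0 < r
  L_nonneg : 0 ≤ L
  cd : ContDiffOn ℝ 1 D.d (ball s r)
  lip : ∀ x ∈ ball s r, ∀ y ∈ ball s r, ‖D.gd x - D.gd y‖ ≤ L * ‖x - y‖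

lemma exists_near {s : Euc N} (hs : s ∈ frontier D.Ω) : ∃ r L, D.Near s r L := by
  obtain ⟨r, ψ, ψi, hr, hψ, ⟨L, hL⟩, -, -, -, he⟩ := D.hΩ.2 s hs
  set i : Fin N := ⟨N - 1, Nat.sub_lt D.hN Nat.one_pos⟩
  let π : Euc N →L[ℝ] ℝ := EuclideanSpace.proj i
  have heq : ∀ x ∈ ball s r, π (ψ x) = D.d x := fun x hx => he x hx
  have hfd : ∀ x ∈ ball s r, HasFDerivAt D.d (π.comp (fderiv ℝ ψ x)) x := by
    intro x hx
    have hd : DifferentiableAt ℝ ψ x :=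
      ((hψ.contDiffAt (isOpen_ball.mem_nhds hx)).differentiableAt one_ne_zero)
    have := π.hasFDerivAt.comp x hd.hasFDerivAt
    refine this.congr_of_eventuallyEq ?_
    filter_upwards [isOpen_ball.mem_nhds hx] with y hy
    exact (heq y hy).symm
  refine ⟨r, ‖π‖ * L, hs, hr, by positivity, ?_, ?_⟩
  · refine (π.contDiff.comp_contDiffOn hψ).congr fun x hx => (heq x hx).symm
  · intro x hx y hy
    unfold gd gradient
    rw [← map_sub, LinearIsometryEquiv.norm_map, (hfd x hx).fderiv, (hfd y hy).fderiv,
      ← ContinuousLinearMap.comp_sub]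
    refine (ContinuousLinearMap.opNorm_comp_le _ _).trans ?_
    rw [mul_assoc]
    have := hL.dist_le_mul x hx y hy
    rw [dist_eq_norm, dist_eq_norm] at this
    exact mul_le_mul_of_nonneg_left this (norm_nonneg _)

variable {D}
namespace Near
variable {s : Euc N} {r L : ℝ}

lemma hasGrad (h : D.Near s r L) {x : Euc N} (hx : x ∈ ball s r) : HasGradientAt D.d (D.gd x) x :=
  ((h.cd.contDiffAt (isOpen_ball.mem_nhds hx)).differentiableAt one_ne_zero).hasGradientAt

lemma hasFD (h : D.Near s r L) {x : Euc N} (hx : x ∈ ball s r) :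
    HasFDerivAt D.d (innerSL ℝ (D.gd x)) x := (h.hasGrad hx).hasFDerivAt

lemma gd_le (h : D.Near s r L) {x : Euc N} (hx : x ∈ ball s r) : ‖D.gd x‖ ≤ 2 := by
  have h1 := (h.hasFD hx).le_of_lip' (C := 2) (by norm_num) (Eventually.of_forall fun y => by
    rw [Real.norm_eq_abs]; exact D.d_lip y x)
  rwa [innerSL_apply_norm] at h1

lemma gd_frontier {x : Euc N} (hx : x ∈ frontier D.Ω) : D.gd x = -D.n x :=
  ((D.hn x hx).2).gradient

lemma mono (h : D.Near s r L) {r' : ℝ} (h0 : 0 < r') (h1 : r' ≤ r) : D.Near s r' L :=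
  ⟨h.hs, h0, h.L_nonneg, h.cd.mono (ball_subset_ball h1),
    fun x hx y hy => h.lip x (ball_subset_ball h1 hx) y (ball_subset_ball h1 hy)⟩

lemma taylor (h : D.Near s r L) {x y : Euc N} (hx : x ∈ ball s r) (hy : y ∈ ball s r) :
    |D.d y - D.d x - ⟪D.gd x, y - x⟫| ≤ L * ‖y - x‖ * ‖y - x‖ := by
  have hc : Convex ℝ (ball s r ∩ closedBall x ‖y - x‖) := (convex_ball _ _).inter (convex_closedBall _ _)
  have := hc.norm_image_sub_le_of_norm_hasFDerivWithin_le' (f := D.d) (f' := fun z => innerSL ℝ (D.gd z))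
    (φ := innerSL ℝ (D.gd x)) (C := L * ‖y - x‖) (x := x) (y := y)
    (fun z hz => (h.hasFD hz.1).hasFDerivWithinAt) (fun z hz => ?_) ⟨hx, by simp⟩
    ⟨hy, by simp [mem_closedBall, dist_eq_norm]⟩
  · simpa [Real.norm_eq_abs] using this
  · rw [← map_sub, innerSL_apply_norm]
    refine (h.lip z hz.1 x hx).trans (mul_le_mul_of_nonneg_left ?_ h.L_nonneg)
    simpa [mem_closedBall, dist_eq_norm] using hz.2

lemma second (h : D.Near s r L) {x y w : Euc N} (hx : x ∈ ball s (r/2)) (hy : y ∈ ball s (r/2))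
    (hw : ‖w‖ < r/2) : |(D.d (x + w) - D.d x) - (D.d (y + w) - D.d y)| ≤ L * ‖w‖ * ‖x - y‖ := by
  have hin : ∀ z ∈ ball s (r/2), z ∈ ball s r ∧ z + w ∈ ball s r := by
    intro z hz
    rw [mem_ball, dist_eq_norm] at hz
    constructor
    · rw [mem_ball, dist_eq_norm]; have := h.r_pos; linarith
    · rw [mem_ball, dist_eq_norm]
      calc ‖z + w - s‖ = ‖(z - s) + w‖ := by congr 1; abel
        _ ≤ ‖z - s‖ + ‖w‖ := norm_add_le _ _
        _ < r := by linarith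
  have := (convex_ball s (r/2)).norm_image_sub_le_of_norm_hasFDerivWithin_le
    (f := fun z => D.d (z + w) - D.d z) (f' := fun z => innerSL ℝ (D.gd (z + w)) - innerSL ℝ (D.gd z))
    (C := L * ‖w‖) (x := y) (y := x) (fun z hz => ?_) (fun z hz => ?_) hy hx
  · simpa [Real.norm_eq_abs] using this
  · refine (HasFDerivAt.sub ?_ (h.hasFD (hin z hz).1)).hasFDerivWithinAt
    exact (hasFDerivAt_comp_add_right w).2 (h.hasFD (hin z hz).2)
  · rw [← map_sub, innerSL_apply_norm]
    simpa using h.lip (z + w) (hin z hz).2 z (hin z hz).1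

/-- quasi-linear behaviour of `d` near `s`. -/
lemma quasi (h : D.Near s r L) (hr : L * r ≤ 1/2) {x y : Euc N} (hx : x ∈ ball s r) (hy : y ∈ ball s r) :
    |D.d y - D.d x - ⟪D.gd s, y - x⟫| ≤ 1/2 * ‖y - x‖ := by
  have := (convex_ball s r).norm_image_sub_le_of_norm_hasFDerivWithin_le' (f := D.d)
    (f' := fun z => innerSL ℝ (D.gd z))
    (φ := innerSL ℝ (D.gd s)) (C := 1/2) (x := x) (y := y)
    (fun z hz => (h.hasFD hz).hasFDerivWithinAt) (fun z hz => ?_) hx hy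
  · simpa [Real.norm_eq_abs] using this
  · rw [← map_sub, innerSL_apply_norm]
    refine (h.lip z hz s (mem_ball_self h.r_pos)).trans (le_trans ?_ hr)
    refine mul_le_mul_of_nonneg_left ?_ h.L_nonneg
    rw [← dist_eq_norm]; exact (mem_ball.1 hz).le

lemma exists_small (h : D.Near s r L) : ∃ r' > 0, D.Near s r' L ∧ L * r' ≤ 1/2 := by
  refine ⟨min r (1 / (2 * (L + 1))), ?_, ?_, ?_⟩
  · have := h.r_pos; have := h.L_nonneg; positivity
  · refine h.mono ?_ (min_le_left _ _)
    have := h.r_pos; have := h.L_nonneg; positivity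
  · have := h.L_nonneg
    calc L * min r (1 / (2 * (L + 1))) ≤ L * (1 / (2 * (L+1))) := mul_le_mul_of_nonneg_left (min_le_right _ _) this
      _ ≤ 1/2 := by rw [mul_one_div, div_le_div_iff₀ (by positivity) (by norm_num)]; linarith

end Near

variable (D)

lemma n_norm {x : Euc N} (hx : x ∈ frontier D.Ω) : ‖D.n x‖ = 1 := (D.hn x hx).1

lemma n_cont : ContinuousOn D.n (frontier D.Ω) := by
  intro s hs
  obtain ⟨r, L, h⟩ := D.exists_near hs
  have hle : ∀ᶠ x in 𝓝[frontier D.Ω] s, dist (D.n x) (D.n s) ≤ L * ‖x - s‖ := by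
    filter_upwards [self_mem_nhdsWithin, mem_nhdsWithin_of_mem_nhds (ball_mem_nhds s h.r_pos)] with x hx hxb
    have := h.lip x hxb s (mem_ball_self h.r_pos)
    rw [Near.gd_frontier hx, Near.gd_frontier hs] at this
    rw [dist_eq_norm, ← norm_neg, show -(D.n x - D.n s) = -D.n x - -D.n s by abel]; exact this
  refine tendsto_iff_dist_tendsto_zero.2 (squeeze_zero' (Eventually.of_forall fun _ => dist_nonneg) hle ?_)
  have : Continuous fun x : Euc N => L * ‖x - s‖ := by fun_prop
  have h2 := this.tendsto s
  simp only [sub_self, norm_zero, mul_zero] at h2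
  exact h2.mono_left nhdsWithin_le_nhds

lemma inward {s : Euc N} (hs : s ∈ frontier D.Ω) : ∀ᶠ h in 𝓝[>] (0:ℝ), s - h • D.n s ∈ D.Ω := by
  obtain ⟨r, L, hr⟩ := D.exists_near hs
  obtain ⟨r', hr', h1, h2⟩ := hr.exists_small
  filter_upwards [Ioo_mem_nhdsGT hr'] with h hh
  apply D.mem_Ω_of_d_pos hs
  have hin : s - h • D.n s ∈ ball s r' := by
    rw [mem_ball, dist_eq_norm]
    simp only [sub_sub_cancel_left, norm_neg, norm_smul, D.n_norm hs, mul_one, Real.norm_eq_abs, abs_of_pos hh.1]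
    exact hh.2
  have := h1.quasi h2 (mem_ball_self hr') hin
  rw [Near.gd_frontier hs, D.d_zero hs] at this
  simp only [sub_sub_cancel_left, sub_zero, norm_neg, norm_smul, D.n_norm hs, mul_one,
    inner_neg_neg, inner_smul_right, real_inner_self_eq_norm_sq, Real.norm_eq_abs, abs_of_pos hh.1] at this
  rw [abs_le] at this
  have h3 := hh.1
  linarith [this.1]

end Dat

namespace Dat
variable (D : Dat N)

lemma vol_closedBall (ρ : ℝ) (hρ : 0 ≤ ρ) : volume (closedBall (0 : Euc N) ρ)
    = ENNReal.ofReal (ρ ^ N * (volume (ball (0 : Euc N) 1)).toReal) := by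
  rw [Measure.addHaar_closedBall _ _ hρ, ENNReal.ofReal_mul (by positivity),
    ENNReal.ofReal_toReal measure_ball_lt_top.ne]
  simp

variable {D} in
/-- slab estimate by packing. -/
lemma Near.slab {s : Euc N} {r L : ℝ} (h : D.Near s r L) (hr : L * r ≤ 1/2) {x : Euc N}
    (hx : x ∈ ball s (r/4)) {a η : ℝ} (ha : 0 < a) (har : a ≤ r/4) (hη : 0 < η) :
    volume {w : Euc N | ‖w‖ ≤ a ∧ |D.d (x + w)| ≤ η} ≤
      ENNReal.ofReal (10 * 2 ^ N * (volume (ball (0 : Euc N) 1)).toReal * (min 1 (η / a) * a ^ N)) := by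
  set S := {w : Euc N | ‖w‖ ≤ a ∧ |D.d (x + w)| ≤ η} with hS
  set v1 := (volume (ball (0 : Euc N) 1)).toReal with hv1
  have hv1n : 0 ≤ v1 := ENNReal.toReal_nonneg
  have hScl : IsClosed S := by
    have hdc := D.d_cont
    have h1 : IsClosed {w : Euc N | ‖w‖ ≤ a} := isClosed_le continuous_norm continuous_const
    have h2 : IsClosed {w : Euc N | |D.d (x + w)| ≤ η} :=
      isClosed_le (by fun_prop) continuous_const
    exact h1.inter h2
  have htriv : volume S ≤ ENNReal.ofReal (a ^ N * v1) := by
    rw [← vol_closedBall a ha.le]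
    exact measure_mono fun w hw => by simpa using hw.1
  have h2N : (1:ℝ) ≤ 2 ^ N := one_le_pow₀ (by norm_num)
  by_cases hc : a < 5 * η
  · refine htriv.trans (ENNReal.ofReal_le_ofReal ?_)
    have h5 : 1 / 5 ≤ min 1 (η / a) := by
      refine le_min (by norm_num) ?_
      rw [div_le_div_iff₀ (by norm_num) ha]; linarith
    have hP : 0 ≤ a ^ N * v1 := by positivity
    have : 1 ≤ 10 * 2 ^ N * min 1 (η / a) := by nlinarith
    nlinarith
  · push Not at hc
    set e := D.gd s with he
    have hen : ‖e‖ = 1 := by rw [he, Near.gd_frontier h.hs, norm_neg, D.n_norm h.hs]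
    set m := ⌊a / (5 * η)⌋₊ with hm
    have hm1 : (m : ℝ) ≤ a / (5 * η) := Nat.floor_le (by positivity)
    have hm2 : a / (5 * η) < m + 1 := Nat.lt_floor_add_one _
    have hm0 : (1:ℝ) ≤ m := by
      have : 1 ≤ m := Nat.le_floor (by rw [Nat.cast_one, one_le_div (by positivity)]; linarith)
      exact_mod_cast this
    have hmη : 5 * η * m ≤ a := by rwa [le_div_iff₀ (by positivity), mul_comm] at hm1
    let T : ℕ → Set (Euc N) := fun k => (fun w => w + (-(5 * η * k)) • e) ⁻¹' S
    have hTm : ∀ k, MeasurableSet (T k) := fun k =>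
      (hScl.preimage (by fun_prop)).measurableSet
    have hTv : ∀ k, volume (T k) = volume S := fun k => measure_preimage_add_right _ _ _
    have hin : ∀ w, ‖w‖ ≤ 2 * a → x + w ∈ ball s r := by
      intro w hw
      rw [mem_ball, dist_eq_norm] at *
      calc ‖x + w - s‖ = ‖(x - s) + w‖ := by congr 1; abel
        _ ≤ ‖x - s‖ + ‖w‖ := norm_add_le _ _
        _ < r := by linarith
    have hsub : ∀ k < m, T k ⊆ closedBall 0 (2 * a) := by
      intro k hk w hw
      have hk' : (k:ℝ) ≤ m := by exact_mod_cast hk.le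
      have h1 : ‖w + (-(5 * η * k)) • e‖ ≤ a := hw.1
      have h2 : ‖w‖ ≤ ‖w + (-(5 * η * k)) • e‖ + ‖(-(5 * η * k)) • e‖ := by
        have := norm_sub_le (w + (-(5 * η * k)) • e) ((-(5 * η * k)) • e)
        simpa using this
      rw [norm_smul, hen, mul_one, Real.norm_eq_abs, abs_neg, abs_of_nonneg (by positivity)] at h2
      simp only [mem_closedBall, dist_zero_right]
      have : 5 * η * k ≤ 5 * η * m := mul_le_mul_of_nonneg_left hk' (by positivity)
      linarith
    have hdis : ∀ k l : ℕ, k < l → Disjoint (T k) (T l) := by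
      intro k l hkl
      rw [Set.disjoint_left]
      rintro w ⟨h1, h2⟩ ⟨h3, h4⟩
      have hkl' : (k:ℝ) + 1 ≤ l := by exact_mod_cast hkl
      have hq := h.quasi hr (hin (w + (-(5 * η * l)) • e) (by linarith))
        (hin (w + (-(5 * η * k)) • e) (by linarith))
      have e1 : x + (w + (-(5 * η * k)) • e) - (x + (w + (-(5 * η * l)) • e)) = (5 * η * (l - k)) • e := by
        module
      have hlk : (0:ℝ) ≤ 5 * η * (l - k) := mul_nonneg (by positivity) (by linarith)
      rw [e1, inner_smul_right, ← he, real_inner_self_eq_norm_sq, norm_smul, hen, Real.norm_eq_abs,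
        abs_of_nonneg hlk] at hq
      rw [abs_le] at hq h2 h4
      simp only at h2 h4
      nlinarith [hq.1, h2.2, h4.1]
    have hsum : ∑ k ∈ Finset.range m, volume (T k) ≤ volume (closedBall (0 : Euc N) (2 * a)) := by
      rw [← measure_biUnion_finset]
      · refine measure_mono (iUnion₂_subset fun k hk => hsub k (Finset.mem_range.1 hk))
      · intro k _ l _ hkl
        rcases lt_or_gt_of_ne hkl with hh | hh
        · exact hdis k l hh
        · exact (hdis l k hh).symm
      · exact fun k _ => hTm k
    simp only [hTv, Finset.sum_const, Finset.card_range, nsmul_eq_mul] at hsum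
    rw [vol_closedBall _ (by positivity)] at hsum
    have hmn : (m : ℝ≥0∞) ≠ 0 := by
      intro h0; have : m = 0 := by exact_mod_cast h0
      rw [this] at hm0; norm_num at hm0
    have hfin : volume S ≤ ENNReal.ofReal ((2 * a) ^ N * v1 / m) := by
      rw [ENNReal.ofReal_div_of_pos (by linarith), ENNReal.ofReal_natCast]
      rw [ENNReal.le_div_iff_mul_le (Or.inl hmn) (Or.inl (ENNReal.natCast_ne_top m)), mul_comm]
      exact hsum
    refine hfin.trans (ENNReal.ofReal_le_ofReal ?_)
    have hmin : min 1 (η / a) = η / a := min_eq_right (by rw [div_le_one ha]; linarith)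
    rw [hmin, div_le_iff₀ (by linarith), mul_pow]
    have h10 : 1 ≤ 10 * (η / a) * m := by
      rw [div_lt_iff₀ (by positivity)] at hm2
      have : a ≤ 10 * η * m := by nlinarith
      rw [mul_div_assoc', div_mul_eq_mul_div, le_div_iff₀ ha]; linarith
    have hP : 0 ≤ 2 ^ N * a ^ N * v1 := by positivity
    nlinarith

lemma invFun_lip {x : Euc N} (hx : x ∈ closure D.Ω) :
    LipschitzWith (Real.toNNReal D.Aj) (Function.invFun (D.j x)) := by
  obtain ⟨-, -, h3, h4⟩ := D.hJ0 x hx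
  refine lipschitzWith_of_nnnorm_fderiv_le (𝕜 := ℝ) (h3.differentiable one_ne_zero) fun z => ?_
  rw [← NNReal.coe_le_coe, Real.coe_toNNReal', coe_nnnorm]
  exact (h4 z).trans (le_max_left _ _)

lemma vol_preimage {x : Euc N} (hx : x ∈ closure D.Ω) (S : Set (Euc N)) :
    volume {z | D.j x z ∈ S} ≤ (Real.toNNReal D.Aj : ℝ≥0∞) ^ N * volume S := by
  refine le_trans (measure_mono ?_) (volume_lipschitz_image (D.invFun_lip hx) S)
  intro z hz
  exact ⟨D.j x z, hz, Function.leftInverse_invFun (D.hJ0 x hx).2.1.1 z⟩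

lemma frontier_null : volume (frontier D.Ω) = 0 := by
  refine measure_null_of_locally_null _ fun s hs => ?_
  obtain ⟨r, L, h0⟩ := D.exists_near hs
  obtain ⟨r', hr', h, hL⟩ := h0.exists_small
  refine ⟨frontier D.Ω ∩ ball s (r'/4), inter_mem_nhdsWithin _ (ball_mem_nhds s (by positivity)), ?_⟩
  have hsl := fun η hη => h.slab hL (mem_ball_self (by positivity) : s ∈ ball s (r'/4)) (a := r'/4)
    (by positivity) le_rfl (η := η) hη
  set C := 10 * 2 ^ N * (volume (ball (0 : Euc N) 1)).toReal
  have hC : 0 ≤ C := by positivity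
  have hle : ∀ η > 0, volume (frontier D.Ω ∩ ball s (r'/4)) ≤
      ENNReal.ofReal (C * (η / (r'/4) * (r'/4) ^ N)) := by
    intro η hη
    have : volume (frontier D.Ω ∩ ball s (r'/4)) = volume ((fun w => s + w) ⁻¹' (frontier D.Ω ∩ ball s (r'/4))) :=
      (measure_preimage_add _ _ _).symm
    rw [this]
    refine (measure_mono ?_).trans ((hsl η hη).trans (ENNReal.ofReal_le_ofReal ?_))
    · rintro w ⟨hw1, hw2⟩
      refine ⟨?_, ?_⟩
      · simp only [mem_ball, dist_eq_norm, add_sub_cancel_left] at hw2; exact hw2.le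
      · rw [D.d_zero hw1]; simpa using hη.le
    · exact mul_le_mul_of_nonneg_left (mul_le_mul_of_nonneg_right (min_le_right _ _) (by positivity)) hC
  refine le_antisymm (ge_of_tendsto (x := 𝓝[>] (0:ℝ)) ?_ (by
    filter_upwards [self_mem_nhdsWithin] with η hη using hle η hη)) zero_le
  have hcon : Continuous fun η : ℝ => ENNReal.ofReal (C * (η / (r'/4) * (r'/4) ^ N)) :=
    ENNReal.continuous_ofReal.comp (by fun_prop)
  have := hcon.tendsto 0
  simp only [zero_div, zero_mul, mul_zero, ENNReal.ofReal_zero] at this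
  exact this.mono_left nhdsWithin_le_nhds

lemma ae_not_frontier {x : Euc N} (hx : x ∈ closure D.Ω) :
    ∀ᵐ z : Euc N, x + D.j x z ∉ frontier D.Ω := by
  rw [ae_iff]
  have h := D.vol_preimage hx ((fun w => x + w) ⁻¹' frontier D.Ω)
  rw [measure_preimage_add, D.frontier_null, mul_zero] at h
  simpa using h

/-- mismatch set. -/
def mism (x y : Euc N) : Set (Euc N) :=
  {z | ¬ (x + D.j x z ∈ closure D.Ω ↔ y + D.j y z ∈ closure D.Ω)}

/-- The exponent used for slab estimates. -/
def θ : ℝ := (1 - D.σ) / 2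

lemma θ_pos : 0 < D.θ := by unfold θ; linarith [D.σ_lt]
lemma θ_lt : D.θ < 1 := by unfold θ; linarith [D.σ_pos]

end Dat

namespace Dat
variable (D : Dat N)

lemma ring_sum (C ξ : ℝ) (hC : 0 ≤ C) (hξ : 0 < ξ) : ∃ C' ≥ 0, ∀ (A : Set (Euc N)) (q h : ℝ), 0 ≤ q → 0 ≤ h →
    (∀ a, 0 < a → a ≤ ξ → volume {z | z ∈ A ∧ ‖z‖ ≤ a} ≤ ENNReal.ofReal (C * (a ^ N * (q + (h / a) ^ D.θ)))) →
    ∫⁻ z in {z | ‖z‖ < ξ ∧ z ∈ A}, ENNReal.ofReal (‖z‖ * ker N D.σ z) ≤ ENNReal.ofReal (C' * (q + h ^ D.θ)) := by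
  set β : ℝ := (1/2 : ℝ) ^ D.θ with hβ
  have hβ0 : 0 ≤ β := by positivity
  have hβ1 : β < 1 := Real.rpow_lt_one (by norm_num) (by norm_num) D.θ_pos
  set K : ℝ := (2:ℝ) ^ ((N:ℝ) + D.σ - 1) * C * (ξ ^ D.θ * (1 + ξ ^ D.θ)) with hK
  have hK0 : 0 ≤ K := by positivity
  refine ⟨K * (1 - β)⁻¹, mul_nonneg hK0 (inv_nonneg.2 (by linarith)), ?_⟩
  intro A q h hq hh hA
  have hθ := D.θ_pos
  have hNr : (1:ℝ) ≤ N := by exact_mod_cast D.hN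
  let a : ℕ → ℝ := fun i => ξ * (1/2) ^ i
  have ha0 : ∀ i, 0 < a i := fun i => by positivity
  have haξ : ∀ i, a i ≤ ξ := fun i => by
    have : ((1:ℝ)/2) ^ i ≤ 1 := pow_le_one₀ (by norm_num) (by norm_num)
    exact mul_le_of_le_one_right hξ.le this
  let R : ℕ → Set (Euc N) := fun i => {z | (z ∈ A ∧ ‖z‖ ≤ a i) ∧ a i / 2 < ‖z‖}
  have hcov : {z | ‖z‖ < ξ ∧ z ∈ A} ⊆ {z | z = 0} ∪ ⋃ i, R i := by
    rintro z ⟨hz, hzA⟩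
    by_cases h0 : z = 0
    · exact Or.inl h0
    right
    have hzp : 0 < ‖z‖ := norm_pos_iff.2 h0
    obtain ⟨i, hi1, hi2⟩ := exists_nat_pow_near_of_lt_one (x := ‖z‖ / ξ) (y := (1/2 : ℝ)) (by positivity)
      (by rw [div_le_one hξ]; exact hz.le) (by norm_num) (by norm_num)
    rw [lt_div_iff₀ hξ] at hi1
    rw [div_le_iff₀ hξ] at hi2
    refine mem_iUnion.2 ⟨i, ⟨hzA, ?_⟩, ?_⟩
    · show ‖z‖ ≤ ξ * (1/2)^i
      linarith
    · show ξ * (1/2)^i / 2 < ‖z‖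
      rw [pow_succ] at hi1; linarith
  have hring : ∀ i, ∫⁻ z in R i, ENNReal.ofReal (‖z‖ * ker N D.σ z)
      ≤ ENNReal.ofReal (K * (q + h ^ D.θ) * β ^ i) := by
    intro i
    have hai := ha0 i
    have hw : ∀ z ∈ R i, ENNReal.ofReal (‖z‖ * ker N D.σ z) ≤ ENNReal.ofReal ((a i / 2) ^ (1 - N - D.σ)) := by
      rintro z ⟨-, hz⟩
      apply ENNReal.ofReal_le_ofReal
      have hzp : 0 < ‖z‖ := lt_trans (by positivity) hz
      have e : ‖z‖ * ker N D.σ z = ‖z‖ ^ (1 - N - D.σ) := by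
        unfold ker; nth_rw 1 [← Real.rpow_one ‖z‖]; rw [← Real.rpow_add hzp]; congr 1; ring
      rw [e]
      exact Real.rpow_le_rpow_of_nonpos (by positivity) hz.le (by linarith [D.σ_pos])
    calc ∫⁻ z in R i, ENNReal.ofReal (‖z‖ * ker N D.σ z)
        ≤ ∫⁻ z in R i, ENNReal.ofReal ((a i / 2) ^ (1 - N - D.σ)) := by
          exact setLIntegral_mono measurable_const hw
      _ = ENNReal.ofReal ((a i / 2) ^ (1 - N - D.σ)) * volume (R i) := by rw [setLIntegral_const]
      _ ≤ ENNReal.ofReal ((a i / 2) ^ (1 - N - D.σ)) *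
            ENNReal.ofReal (C * (a i ^ N * (q + (h / a i) ^ D.θ))) := by
          gcongr
          exact (measure_mono fun z hz => hz.1).trans (hA (a i) (ha0 i) (haξ i))
      _ = ENNReal.ofReal ((a i / 2) ^ (1 - N - D.σ) * (C * (a i ^ N * (q + (h / a i) ^ D.θ)))) := by
          rw [ENNReal.ofReal_mul (p := (a i / 2) ^ (1 - N - D.σ)) (by positivity)]
      _ ≤ ENNReal.ofReal (K * (q + h ^ D.θ) * β ^ i) := by
          apply ENNReal.ofReal_le_ofReal
          have e1 : (a i / 2) ^ (1 - N - D.σ) * a i ^ N = 2 ^ ((N:ℝ) + D.σ - 1) * a i ^ (1 - D.σ) := by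
            rw [Real.div_rpow hai.le (by norm_num), ← Real.rpow_natCast (a i) N, div_mul_eq_mul_div,
              ← Real.rpow_add hai, div_eq_iff (by positivity), mul_right_comm, ← Real.rpow_add (by norm_num)]
            ring_nf; simp
          have e2 : a i ^ D.θ = ξ ^ D.θ * β ^ i := by
            show (ξ * (1/2)^i) ^ D.θ = _
            rw [Real.mul_rpow hξ.le (by positivity), hβ, ← Real.rpow_natCast, ← Real.rpow_mul (by norm_num),
              mul_comm (i:ℝ), Real.rpow_mul (by norm_num), Real.rpow_natCast]
          have e3 : a i ^ (1 - D.σ) = a i ^ D.θ * a i ^ D.θ := by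
            rw [← Real.rpow_add hai]; congr 1; unfold θ; ring
          have e4 : a i ^ D.θ * (h / a i) ^ D.θ = h ^ D.θ := by
            rw [← Real.mul_rpow hai.le (by positivity), mul_div_cancel₀ _ hai.ne']
          have e5 : a i ^ D.θ ≤ ξ ^ D.θ := Real.rpow_le_rpow hai.le (haξ i) hθ.le
          calc (a i / 2) ^ (1 - N - D.σ) * (C * (a i ^ N * (q + (h / a i) ^ D.θ)))
              = ((a i / 2) ^ (1 - N - D.σ) * a i ^ N) * (C * (q + (h / a i) ^ D.θ)) := by ring
            _ = 2 ^ ((N:ℝ) + D.σ - 1) * C * (a i ^ D.θ * (a i ^ D.θ * q + a i ^ D.θ * (h / a i) ^ D.θ)) := by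
                rw [e1, e3]; ring
            _ = 2 ^ ((N:ℝ) + D.σ - 1) * C * (a i ^ D.θ * (a i ^ D.θ * q + h ^ D.θ)) := by rw [e4]
            _ ≤ 2 ^ ((N:ℝ) + D.σ - 1) * C * (a i ^ D.θ * ((1 + ξ ^ D.θ) * (q + h ^ D.θ))) := by
                gcongr
                have : 0 ≤ h ^ D.θ := by positivity
                have : 0 ≤ ξ ^ D.θ := by positivity
                nlinarith
            _ = K * (q + h ^ D.θ) * β ^ i := by rw [e2, hK]; ring
  have hgs : Summable fun i : ℕ => K * (q + h ^ D.θ) * β ^ i :=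
    (summable_geometric_of_lt_one hβ0 hβ1).mul_left _
  calc ∫⁻ z in {z | ‖z‖ < ξ ∧ z ∈ A}, ENNReal.ofReal (‖z‖ * ker N D.σ z)
      ≤ ∫⁻ z in {z | z = 0} ∪ ⋃ i, R i, ENNReal.ofReal (‖z‖ * ker N D.σ z) := lintegral_mono_set hcov
    _ ≤ (∫⁻ z in {z : Euc N | z = 0}, ENNReal.ofReal (‖z‖ * ker N D.σ z)) +
          ∫⁻ z in ⋃ i, R i, ENNReal.ofReal (‖z‖ * ker N D.σ z) := lintegral_union_le _ _ _
    _ ≤ 0 + ∑' i, ENNReal.ofReal (K * (q + h ^ D.θ) * β ^ i) := by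
        gcongr
        · refine (setLIntegral_mono (g := fun _ => 0) measurable_const ?_).trans (by simp)
          rintro z rfl; simp
        · exact (lintegral_iUnion_le _ _).trans (ENNReal.tsum_le_tsum hring)
    _ = ENNReal.ofReal (K * (1 - β)⁻¹ * (q + h ^ D.θ)) := by
        rw [zero_add, ← ENNReal.ofReal_tsum_of_nonneg _ hgs, tsum_mul_left, tsum_geometric_of_lt_one hβ0 hβ1]
        · congr 1; ring
        · intro i; positivity

/-- mismatch estimate near any point of the closure. -/
lemma mism_est {s : Euc N} (hs : s ∈ closure D.Ω) : ∃ ξ > 0, ∃ r > 0, ∃ C ≥ 0, ∀ x ∈ closure D.Ω, ∀ y ∈ closure D.Ω,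
    x ∈ ball s r → y ∈ ball s r → ∀ h > 0, (s ∈ frontier D.Ω → |D.d x - D.d y| ≤ h) →
    ∫⁻ z in {z | ‖z‖ < ξ ∧ z ∈ D.mism x y}, ENNReal.ofReal (‖z‖ * ker N D.σ z) ≤
      ENNReal.ofReal (C * (‖x - y‖ + h ^ D.θ)) := by
  rcases D.mem_or hs with hs | hs
  · obtain ⟨ε, hε, hb⟩ := Metric.isOpen_iff.1 D.open_Ω s hs
    have hCj := D.Cj_pos
    refine ⟨ε / (2 * D.Cj), by positivity, ε / 2, by positivity, 0, le_rfl, ?_⟩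
    intro x hx y hy hxb hyb h _ _
    have hin : ∀ x ∈ closure D.Ω, x ∈ ball s (ε/2) → ∀ z : Euc N, ‖z‖ < ε / (2 * D.Cj) →
        x + D.j x z ∈ closure D.Ω := by
      intro x hx hxb z hz
      apply subset_closure; apply hb
      rw [mem_ball, dist_eq_norm] at *
      rw [lt_div_iff₀ (by positivity)] at hz
      calc ‖x + D.j x z - s‖ = ‖(x - s) + D.j x z‖ := by congr 1; abel
        _ ≤ ‖x - s‖ + ‖D.j x z‖ := norm_add_le _ _
        _ < ε := by linarith [D.j_le hx z]
    have : {z | ‖z‖ < ε / (2 * D.Cj) ∧ z ∈ D.mism x y} = ∅ := by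
      ext z
      simp only [mem_setOf_eq, mem_empty_iff_false, iff_false, not_and, mism, not_not]
      intro hz
      exact ⟨fun _ => hin y hy hyb z hz, fun _ => hin x hx hxb z hz⟩
    rw [this]; simp
  · obtain ⟨r0, L, h0⟩ := D.exists_near hs
    obtain ⟨r, hr, hn, hLr⟩ := h0.exists_small
    have hCj := D.Cj_pos
    have hDj := D.Dj_pos
    have hL := hn.L_nonneg
    have hξ : 0 < r / (4 * D.Cj) := by positivity
    set v1 := (volume (ball (0 : Euc N) 1)).toReal
    set Aj : ℝ := (Real.toNNReal D.Aj : ℝ)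
    have hAj : 0 ≤ Aj := NNReal.coe_nonneg _
    set C1 := L * D.Cj + 2 * D.Dj with hC1
    set C2 := Aj ^ N * (10 * 2 ^ N * v1) * (D.Cj ^ N * (1 + 1 / D.Cj) ) with hC2
    have hv1 : 0 ≤ v1 := ENNReal.toReal_nonneg
    obtain ⟨C', hC', hring⟩ := D.ring_sum C2 (r / (4 * D.Cj)) (by positivity) hξ
    refine ⟨r / (4 * D.Cj), hξ, r / 4, by positivity, C' * (C1 + 1), by positivity, ?_⟩
    intro x hx y hy hxb hyb h hh hdh
    have hdh := hdh hs
    refine (hring (D.mism x y ∩ {z | ‖z‖ ≤ r / (4 * D.Cj)}) (C1 * ‖x - y‖) h (by positivity) hh.le ?_ |>.trans' ?_).trans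
      (ENNReal.ofReal_le_ofReal ?_)
    · intro a ha har
      have har' : D.Cj * a ≤ r / 4 := by
        rw [le_div_iff₀ (by positivity)] at har; linarith
      set η := h + C1 * ‖x - y‖ * a with hη
      have hη0 : 0 < η := by positivity
      have hsub : {z | z ∈ D.mism x y ∩ {z | ‖z‖ ≤ r / (4 * D.Cj)} ∧ ‖z‖ ≤ a} ⊆
          {z | D.j x z ∈ {w : Euc N | ‖w‖ ≤ D.Cj * a ∧ |D.d (x + w)| ≤ η}} := by
        rintro z ⟨⟨hz, -⟩, hza⟩
        have hjx : ‖D.j x z‖ ≤ D.Cj * a := (D.j_le hx z).trans (by gcongr)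
        refine ⟨hjx, ?_⟩
        have h1 := hn.second (x := x) (y := y) (w := D.j x z) (ball_subset_ball (by linarith) hxb)
          (ball_subset_ball (by linarith) hyb) (by linarith)
        have h2 := D.d_lip (y + D.j x z) (y + D.j y z)
        rw [add_sub_add_left_eq_sub] at h2
        have h3 := D.j_diff hx hy z
        have h4 : |D.d (x + D.j x z) - D.d (y + D.j y z)| ≤ η := by
          have h5 : L * ‖D.j x z‖ * ‖x - y‖ ≤ L * (D.Cj * a) * ‖x - y‖ := by gcongr
          have h6 : D.Dj * ‖z‖ * ‖x - y‖ ≤ D.Dj * a * ‖x - y‖ := by gcongr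
          have h7 : η = h + L * (D.Cj * a) * ‖x - y‖ + 2 * (D.Dj * a * ‖x - y‖) := by rw [hη, hC1]; ring
          rw [abs_le] at *
          constructor <;> linarith [h1.1, h1.2, h2.1, h2.2, hdh.1, hdh.2]
        have hsign : ∀ w, w ∈ closure D.Ω → 0 ≤ D.d w := fun w hw => D.d_nonneg hs hw
        have hsign' : ∀ w, w ∉ closure D.Ω → D.d w < 0 := fun w hw => D.d_neg hs hw
        have hz' : ¬ (x + D.j x z ∈ closure D.Ω ↔ y + D.j y z ∈ closure D.Ω) := hz
        by_cases hxc : x + D.j x z ∈ closure D.Ω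
        · have hyc : y + D.j y z ∉ closure D.Ω := fun hc => hz' ⟨fun _ => hc, fun _ => hxc⟩
          have := hsign _ hxc; have := hsign' _ hyc
          rw [abs_le] at *; constructor <;> linarith [h4.1, h4.2]
        · have hyc : y + D.j y z ∈ closure D.Ω := by
            by_contra hc; exact hz' ⟨fun hh => absurd hh hxc, fun hh => absurd hh hc⟩
          have := hsign' _ hxc; have := hsign _ hyc
          rw [abs_le] at *; constructor <;> linarith [h4.1, h4.2]
      refine (measure_mono hsub).trans ((D.vol_preimage hx _).trans ?_)
      have hsl := hn.slab hLr hxb (a := D.Cj * a) (η := η) (by positivity) har' hη0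
      refine (mul_le_mul_right hsl _).trans ?_
      rw [show ((Real.toNNReal D.Aj : ℝ≥0∞)) ^ N = ENNReal.ofReal (Aj ^ N) by
        rw [ENNReal.ofReal_pow hAj]; rw [ENNReal.ofReal_coe_nnreal], ← ENNReal.ofReal_mul (by positivity)]
      apply ENNReal.ofReal_le_ofReal
      have hmin : min 1 (η / (D.Cj * a)) ≤ (1 + 1 / D.Cj) * (C1 * ‖x - y‖ + (h / a) ^ D.θ) := by
        have hCn : 0 ≤ 1 / D.Cj := by positivity
        have hqn : 0 ≤ C1 * ‖x - y‖ := by positivity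
        by_cases hc : h ≤ a
        · refine (min_le_right _ _).trans ?_
          have e : η / (D.Cj * a) = 1 / D.Cj * (C1 * ‖x - y‖ + h / a) := by rw [hη]; field_simp; ring
          have h9 : h / a ≤ (h / a) ^ D.θ := by
            conv_lhs => rw [← Real.rpow_one (h / a)]
            exact Real.rpow_le_rpow_of_exponent_ge (by positivity) (by rw [div_le_one ha]; exact hc) D.θ_lt.le
          have h10 : 0 ≤ h / a := by positivity
          rw [e]; nlinarith
        · push Not at hc
          refine (min_le_left _ _).trans ?_
          have h9 : 1 ≤ (h / a) ^ D.θ := Real.one_le_rpow (by rw [one_le_div ha]; exact hc.le) D.θ_pos.le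
          nlinarith
      calc _ ≤ Aj ^ N * (10 * 2 ^ N * v1 * (((1 + 1 / D.Cj) * (C1 * ‖x - y‖ + (h / a) ^ D.θ)) * (D.Cj * a) ^ N)) := by
            gcongr
        _ = _ := by rw [hC2, mul_pow]; ring
    · refine lintegral_mono_set ?_
      rintro z ⟨h1, h2⟩
      exact ⟨h1, h2, h1.le⟩
    · have hhθ : 0 ≤ h ^ D.θ := by positivity
      have hC1' : 0 ≤ C1 := by positivity
      have hq := norm_nonneg (x - y)
      rw [mul_assoc]
      apply mul_le_mul_of_nonneg_left _ hC'
      nlinarith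

end Dat

/-- Fatou engine, all-k version. -/
lemma fatou_aux {f E : ℕ → Euc N → ℝ} {F G : Euc N → ℝ} {c : ℕ → ℝ} {c0 : ℝ}
    (hf : ∀ k, Integrable (f k)) (hE : ∀ k, Integrable (E k)) (hE0 : ∀ k z, 0 ≤ E k z)
    (hG : Integrable G) (hfG : ∀ k, ∀ᵐ z, f k z ≤ G z + E k z) (hc : ∀ k, c k ≤ ∫ z, f k z)
    (hct : Tendsto c atTop (𝓝 c0)) (hEt : Tendsto (fun k => ∫ z, E k z) atTop (𝓝 0))
    (hF : AEStronglyMeasurable F) (hFG : ∀ᵐ z, F z ≤ G z)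
    (hlim : ∀ᵐ z, ∀ ε > 0, ∀ᶠ k in atTop, f k z ≤ F z + ε) :
    Integrable F ∧ c0 ≤ ∫ z, F z := by
  have hh : ∀ k, Integrable (fun z => G z + E k z - f k z) := fun k => (hG.add (hE k)).sub (hf k)
  have hh0 : ∀ k, 0 ≤ᵐ[volume] fun z => G z + E k z - f k z := fun k => by
    filter_upwards [hfG k] with z hz; simpa using hz
  have hintg : ∀ k, ∫ z, (G z + E k z - f k z) = (∫ z, G z) + (∫ z, E k z) - ∫ z, f k z := fun k => by
    have h2 : Integrable (fun z => G z + E k z) := hG.add (hE k)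
    rw [integral_sub h2 (hf k), integral_add hG (hE k)]
  have hup : ∀ k, ∫⁻ z, ENNReal.ofReal (G z + E k z - f k z) ≤
      ENNReal.ofReal ((∫ z, G z) + (∫ z, E k z) - c k) := fun k => by
    rw [← ofReal_integral_eq_lintegral_ofReal (hh k) (hh0 k), hintg]
    apply ENNReal.ofReal_le_ofReal; linarith [hc k]
  have hlimr : Tendsto (fun k => (∫ z, G z) + (∫ z, E k z) - c k) atTop (𝓝 ((∫ z, G z) + 0 - c0)) :=
    (tendsto_const_nhds.add hEt).sub hct
  have hpos : 0 ≤ (∫ z, G z) + 0 - c0 := ge_of_tendsto' hlimr fun k => by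
    have := integral_nonneg_of_ae (hh0 k)
    rw [hintg] at this; linarith [hc k]
  have hle : ∫⁻ z, ENNReal.ofReal (G z - F z) ≤ ENNReal.ofReal ((∫ z, G z) + 0 - c0) := by
    calc ∫⁻ z, ENNReal.ofReal (G z - F z)
        ≤ ∫⁻ z, liminf (fun k => ENNReal.ofReal (G z + E k z - f k z)) atTop := by
          apply lintegral_mono_ae
          filter_upwards [hlim] with z hz
          refine le_of_forall_lt fun b hb => ?_
          have hbt : b ≠ ⊤ := (hb.trans_le le_top).ne
          rw [← ENNReal.ofReal_toReal hbt] at hb ⊢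
          have hGF : b.toReal < G z - F z := (ENNReal.ofReal_lt_ofReal_iff_of_nonneg ENNReal.toReal_nonneg).1 hb
          set m := (b.toReal + (G z - F z)) / 2 with hm
          have h1 : b.toReal < m := by rw [hm]; linarith
          refine lt_of_lt_of_le ((ENNReal.ofReal_lt_ofReal_iff_of_nonneg ENNReal.toReal_nonneg).2 h1) ?_
          refine le_liminf_of_le (by isBoundedDefault) ?_
          filter_upwards [hz (G z - F z - m) (by rw [hm]; linarith)] with k hk
          apply ENNReal.ofReal_le_ofReal
          linarith [hE0 k z]
      _ ≤ liminf (fun k => ∫⁻ z, ENNReal.ofReal (G z + E k z - f k z)) atTop :=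
          lintegral_liminf_le' fun k => (hh k).aestronglyMeasurable.aemeasurable.ennreal_ofReal
      _ ≤ liminf (fun k => ENNReal.ofReal ((∫ z, G z) + (∫ z, E k z) - c k)) atTop :=
          liminf_le_liminf (Eventually.of_forall hup)
      _ = ENNReal.ofReal ((∫ z, G z) + 0 - c0) :=
          ((ENNReal.continuous_ofReal.tendsto _).comp hlimr).liminf_eq
  have hGF0 : 0 ≤ᵐ[volume] fun z => G z - F z := by
    filter_upwards [hFG] with z hz; simpa using hz
  have hGFm : AEStronglyMeasurable (fun z => G z - F z) := hG.aestronglyMeasurable.sub hF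
  have hGFi : Integrable (fun z => G z - F z) := by
    refine ⟨hGFm, ?_⟩
    rw [hasFiniteIntegral_iff_ofReal hGF0]
    exact hle.trans_lt ENNReal.ofReal_lt_top
  have hFi : Integrable F := by
    have := hG.sub hGFi
    refine this.congr (Eventually.of_forall fun z => ?_)
    simp
  refine ⟨hFi, ?_⟩
  rw [← ofReal_integral_eq_lintegral_ofReal hGFi hGF0, ENNReal.ofReal_le_ofReal_iff hpos,
    integral_sub hG hFi] at hle
  linarith

lemma fatou {f E : ℕ → Euc N → ℝ} {F G : Euc N → ℝ} {c : ℕ → ℝ} {c0 : ℝ}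
    (hG : Integrable G)
    (h : ∀ᶠ k in atTop, Integrable (f k) ∧ Integrable (E k) ∧ (∀ z, 0 ≤ E k z) ∧
      (∀ᵐ z, f k z ≤ G z + E k z) ∧ c k ≤ ∫ z, f k z)
    (hct : Tendsto c atTop (𝓝 c0)) (hEt : Tendsto (fun k => ∫ z, E k z) atTop (𝓝 0))
    (hF : AEStronglyMeasurable F) (hFG : ∀ᵐ z, F z ≤ G z)
    (hlim : ∀ᵐ z, ∀ ε > 0, ∀ᶠ k in atTop, f k z ≤ F z + ε) :
    Integrable F ∧ c0 ≤ ∫ z, F z := by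
  obtain ⟨K, hK⟩ := eventually_atTop.1 h
  refine fatou_aux (f := fun k => f (k + K)) (E := fun k => E (k + K)) (c := fun k => c (k + K))
    (fun k => (hK _ (by omega)).1) (fun k => (hK _ (by omega)).2.1) (fun k => (hK _ (by omega)).2.2.1) hG
    (fun k => (hK _ (by omega)).2.2.2.1) (fun k => (hK _ (by omega)).2.2.2.2)
    (hct.comp (tendsto_add_atTop_nat K)) (hEt.comp (tendsto_add_atTop_nat K)) hF hFG ?_
  filter_upwards [hlim] with z hz ε hε
  exact (tendsto_add_atTop_nat K).eventually (hz ε hε)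

/-- Measurability of semicontinuous functions on closed sets. -/
lemma meas_indicator_of_usc {w : Euc N → ℝ} {C : Set (Euc N)} (hC : IsClosed C) (hw : UpperSemicontinuousOn w C) :
    Measurable (C.indicator w) := by
  refine measurable_of_restrict_of_restrict_compl hC.measurableSet ?_ ?_
  · have : C.domRestrict (C.indicator w) = C.domRestrict w := by
      ext ⟨x, hx⟩; exact indicator_of_mem hx _
    rw [this]
    exact (upperSemicontinuousOn_iff_restrict.2 hw).measurable
  · have : Cᶜ.domRestrict (C.indicator w) = fun _ => 0 := by
      ext ⟨x, hx⟩; exact indicator_of_notMem hx _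
    rw [this]; exact measurable_const

namespace Dat
variable (D : Dat N)

/-- The set of admissible jumps. -/
def J (x : Euc N) : Set (Euc N) := {z | x + D.j x z ∈ closure D.Ω}

lemma J_meas {x : Euc N} (hx : x ∈ closure D.Ω) : MeasurableSet (D.J x) :=
  (isClosed_closure.preimage (continuous_const.add (D.j_cont hx))).measurableSet

/-- Censored increments. -/
def inc (w : Euc N → ℝ) (x z : Euc N) : ℝ :=
  (D.J x).indicator (fun z => (w (x + D.j x z) - w x) * D.g x z) z

lemma inc_of_mem {w : Euc N → ℝ} {x z : Euc N} (h : x + D.j x z ∈ closure D.Ω) :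
    D.inc w x z = (w (x + D.j x z) - w x) * D.g x z := indicator_of_mem (s := D.J x) h _

lemma inc_of_notMem {w : Euc N → ℝ} {x z : Euc N} (h : x + D.j x z ∉ closure D.Ω) :
    D.inc w x z = 0 := indicator_of_notMem (s := D.J x) h _

lemma inc_neg (w : Euc N → ℝ) (x z : Euc N) : D.inc (fun y => -w y) x z = -D.inc w x z := by
  by_cases h : x + D.j x z ∈ closure D.Ω
  · rw [D.inc_of_mem h, D.inc_of_mem h]; ring
  · rw [D.inc_of_notMem h, D.inc_of_notMem h]; ring

lemma inc_add (w v : Euc N → ℝ) (x z : Euc N) :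
    D.inc (fun y => w y + v y) x z = D.inc w x z + D.inc v x z := by
  by_cases h : x + D.j x z ∈ closure D.Ω
  · rw [D.inc_of_mem h, D.inc_of_mem h, D.inc_of_mem h]; ring
  · rw [D.inc_of_notMem h, D.inc_of_notMem h, D.inc_of_notMem h]; ring

lemma inc_smul (c : ℝ) (w : Euc N → ℝ) (x z : Euc N) :
    D.inc (fun y => c * w y) x z = c * D.inc w x z := by
  by_cases h : x + D.j x z ∈ closure D.Ω
  · rw [D.inc_of_mem h, D.inc_of_mem h]; ring
  · rw [D.inc_of_notMem h, D.inc_of_notMem h]; ring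

lemma inc_meas {w : Euc N → ℝ} {x : Euc N} (hx : x ∈ closure D.Ω)
    (hw : Measurable ((closure D.Ω).indicator w)) : Measurable (D.inc w x) := by
  have hj : Measurable (D.j x) := (D.j_cont hx).measurable
  have e : D.inc w x = (D.J x).indicator
      (fun z => ((closure D.Ω).indicator w (x + D.j x z) - w x) * D.g x z) := by
    ext z
    by_cases h : x + D.j x z ∈ closure D.Ω
    · rw [D.inc_of_mem h, indicator_of_mem (s := D.J x) h, indicator_of_mem h]
    · rw [D.inc_of_notMem h, indicator_of_notMem (s := D.J x) h]
  rw [e]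
  refine Measurable.indicator ?_ (D.J_meas hx)
  exact ((hw.comp (measurable_const.add hj)).sub measurable_const).mul (D.g_meas x)

lemma inc_mono {w v : Euc N → ℝ} {x z : Euc N} (hx : x ∈ closure D.Ω)
    (h : x + D.j x z ∈ closure D.Ω → w (x + D.j x z) - w x ≤ v (x + D.j x z) - v x) :
    D.inc w x z ≤ D.inc v x z := by
  by_cases hz : x + D.j x z ∈ closure D.Ω
  · rw [D.inc_of_mem hz, D.inc_of_mem hz]
    exact mul_le_mul_of_nonneg_right (h hz) (D.g_nonneg hx z)
  · rw [D.inc_of_notMem hz, D.inc_of_notMem hz]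

/-- truncated dominating kernel -/
def dom (B M : ℝ) (z : Euc N) : ℝ := D.Cμ * (min (B * D.Cj * ‖z‖) M * ker N D.σ z)

lemma dom_nonneg {B M : ℝ} (hB : 0 ≤ B) (hM : 0 ≤ M) (z : Euc N) : 0 ≤ D.dom B M z := by
  have := D.Cμ_pos; have := D.Cj_pos; have := ker_nonneg D.σ z
  unfold dom; positivity

lemma dom_integrable {B M : ℝ} (hB : 0 ≤ B) (hM : 0 ≤ M) : Integrable (D.dom B M) := by
  have h := ker_integrable D.hN D.σ_pos D.σ_lt (B * D.Cj) M (mul_nonneg hB D.Cj_pos.le) hM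
  exact h.const_mul D.Cμ

/-- constant for crude bounds. -/
def KM (M : ℝ) : ℝ := D.Cμ * (D.Cj ^ D.σ * ∫ z : Euc N, min ‖z‖ M * ker N D.σ z)

lemma KM_nonneg {M : ℝ} (hM : 0 ≤ M) : 0 ≤ D.KM M := by
  have := D.Cμ_pos; have := D.Cj_pos
  have : 0 ≤ ∫ z : Euc N, min ‖z‖ M * ker N D.σ z :=
    integral_nonneg fun z => by have := ker_nonneg D.σ z; positivity
  unfold KM; positivity

lemma dom_integral {B M : ℝ} (hB : 0 < B) : ∫ z, D.dom B M z = D.KM M * B ^ D.σ := by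
  have hC := D.Cj_pos
  unfold dom KM
  rw [integral_const_mul, ker_scaling D.hN _ _ (by positivity), Real.mul_rpow hB.le hC.le]; ring

lemma inc_le {w : Euc N → ℝ} {x : Euc N} {B M : ℝ} (hx : x ∈ closure D.Ω) (hB : 0 ≤ B) (hM : 0 ≤ M)
    (h : ∀ y ∈ closure D.Ω, w y - w x ≤ min (B * ‖y - x‖) M) (z : Euc N) : D.inc w x z ≤ D.dom B M z := by
  by_cases hz : x + D.j x z ∈ closure D.Ω
  · rw [D.inc_of_mem hz]
    have h1 := h _ hz
    rw [add_sub_cancel_left] at h1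
    have h2 : min (B * ‖D.j x z‖) M ≤ min (B * D.Cj * ‖z‖) M := by
      refine min_le_min_right _ ?_
      rw [mul_assoc]; exact mul_le_mul_of_nonneg_left (D.j_le hx z) hB
    have h3 := D.g_nonneg hx z
    have h4 : 0 ≤ min (B * D.Cj * ‖z‖) M := by have := D.Cj_pos; positivity
    calc (w (x + D.j x z) - w x) * D.g x z ≤ min (B * D.Cj * ‖z‖) M * D.g x z :=
          mul_le_mul_of_nonneg_right (h1.trans h2) h3
      _ ≤ min (B * D.Cj * ‖z‖) M * (D.Cμ * ker N D.σ z) := mul_le_mul_of_nonneg_left (D.g_le hx z) h4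
      _ = D.dom B M z := by unfold dom; ring
  · rw [D.inc_of_notMem hz]; exact D.dom_nonneg hB hM z

lemma inc_abs_le {w : Euc N → ℝ} {x : Euc N} {B M : ℝ} (hx : x ∈ closure D.Ω) (hB : 0 ≤ B) (hM : 0 ≤ M)
    (h : ∀ y ∈ closure D.Ω, |w y - w x| ≤ min (B * ‖y - x‖) M) (z : Euc N) : |D.inc w x z| ≤ D.dom B M z := by
  rw [abs_le']
  refine ⟨D.inc_le hx hB hM (fun y hy => (le_abs_self _).trans (h y hy)) z, ?_⟩
  rw [← D.inc_neg]
  refine D.inc_le hx hB hM (fun y hy => le_trans ?_ (h y hy)) z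
  rw [neg_sub_neg, abs_sub_comm]; exact le_abs_self _

lemma inc_integrable {w : Euc N → ℝ} {x : Euc N} {B M : ℝ} (hx : x ∈ closure D.Ω) (hB : 0 ≤ B) (hM : 0 ≤ M)
    (hw : Measurable ((closure D.Ω).indicator w))
    (h : ∀ y ∈ closure D.Ω, |w y - w x| ≤ min (B * ‖y - x‖) M) : Integrable (D.inc w x) :=
  (D.dom_integrable hB hM).mono' (D.inc_meas hx hw).aestronglyMeasurable
    (Eventually.of_forall fun z => D.inc_abs_le hx hB hM h z)

lemma inc_integral_le {w : Euc N → ℝ} {x : Euc N} {B M : ℝ} (hx : x ∈ closure D.Ω) (hB : 0 < B) (hM : 0 ≤ M)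
    (hi : Integrable (D.inc w x))
    (h : ∀ y ∈ closure D.Ω, w y - w x ≤ min (B * ‖y - x‖) M) : ∫ z, D.inc w x z ≤ D.KM M * B ^ D.σ := by
  rw [← D.dom_integral hB]
  exact integral_mono hi (D.dom_integrable hB.le hM) (D.inc_le hx hB.le hM h)

/-- pointwise upper limit of increments. -/
lemma inc_limsup {w : ℕ → Euc N → ℝ} {w0 : Euc N → ℝ} {x : ℕ → Euc N} {x0 z : Euc N}
    (hx : ∀ᶠ k in atTop, x k ∈ closure D.Ω) (hx0 : x0 ∈ closure D.Ω) (hxt : Tendsto x atTop (𝓝 x0))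
    (hz : x0 + D.j x0 z ∉ frontier D.Ω)
    (hbd : ∃ M, ∀ᶠ k in atTop, ∀ y ∈ closure D.Ω, |w k y| ≤ M)
    (hup : ∀ y ∈ D.Ω, ∀ y' : ℕ → Euc N, (∀ᶠ k in atTop, y' k ∈ closure D.Ω) → Tendsto y' atTop (𝓝 y) →
      ∀ ε > 0, ∀ᶠ k in atTop, w k (y' k) ≤ w0 y + ε)
    (hlow : Tendsto (fun k => w k (x k)) atTop (𝓝 (w0 x0))) :
    ∀ ε > 0, ∀ᶠ k in atTop, D.inc (w k) (x k) z ≤ D.inc w0 x0 z + ε := by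
  intro ε hε
  have hyt : Tendsto (fun k => x k + D.j (x k) z) atTop (𝓝 (x0 + D.j x0 z)) := by
    refine hxt.add ?_
    rw [tendsto_iff_norm_sub_tendsto_zero]
    refine squeeze_zero' (Eventually.of_forall fun _ => norm_nonneg _)
      (hx.mono fun k hk => D.j_diff hk hx0 z) ?_
    have h0 := (tendsto_iff_norm_sub_tendsto_zero.1 hxt).const_mul (D.Dj * ‖z‖)
    simpa using h0
  by_cases hzc : x0 + D.j x0 z ∈ closure D.Ω
  · have hzΩ : x0 + D.j x0 z ∈ D.Ω := (D.mem_or hzc).resolve_right hz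
    have hyΩ : ∀ᶠ k in atTop, x k + D.j (x k) z ∈ D.Ω := hyt.eventually (D.open_Ω.mem_nhds hzΩ)
    have hgt : Tendsto (fun k => D.g (x k) z) atTop (𝓝 (D.g x0 z)) := by
      rw [tendsto_iff_norm_sub_tendsto_zero]
      refine squeeze_zero' (Eventually.of_forall fun _ => norm_nonneg _)
        (hx.mono fun k hk => D.g_diff hk hx0 z) ?_
      have h0 := ((tendsto_iff_norm_sub_tendsto_zero.1 hxt).const_mul D.Dμ).mul_const
        (‖z‖ ^ (-((N : ℝ) + D.σ)))
      simpa using h0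
    have hu := hup _ hzΩ _ (hyΩ.mono fun k hk => subset_closure hk) hyt
    have hg0 := D.g_nonneg hx0 z
    obtain ⟨δ, hδ, hδε⟩ : ∃ δ > 0, (w0 (x0 + D.j x0 z) - w0 x0 + δ) * D.g x0 z
        < (w0 (x0 + D.j x0 z) - w0 x0) * D.g x0 z + ε := by
      refine ⟨ε / (2 * (D.g x0 z + 1)), by positivity, ?_⟩
      have : ε / (2 * (D.g x0 z + 1)) * D.g x0 z < ε := by
        rw [div_mul_eq_mul_div, div_lt_iff₀ (by positivity)]; nlinarith
      linarith
    have hlim2 : Tendsto (fun k => (w0 (x0 + D.j x0 z) + δ - w k (x k)) * D.g (x k) z) atTop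
        (𝓝 ((w0 (x0 + D.j x0 z) + δ - w0 x0) * D.g x0 z)) := (tendsto_const_nhds.sub hlow).mul hgt
    have hlt : (w0 (x0 + D.j x0 z) + δ - w0 x0) * D.g x0 z < (w0 (x0 + D.j x0 z) - w0 x0) * D.g x0 z + ε := by
      have : (w0 (x0 + D.j x0 z) + δ - w0 x0) = (w0 (x0 + D.j x0 z) - w0 x0 + δ) := by ring
      rw [this]; exact hδε
    filter_upwards [hu δ hδ, hyΩ, hx, hlim2.eventually (Iio_mem_nhds hlt)] with k h1 h2 h3 h4
    rw [D.inc_of_mem (subset_closure h2), D.inc_of_mem hzc]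
    refine le_trans (mul_le_mul_of_nonneg_right ?_ (D.g_nonneg h3 z)) (le_of_lt h4)
    linarith
  · have : ∀ᶠ k in atTop, x k + D.j (x k) z ∉ closure D.Ω :=
      hyt.eventually (isClosed_closure.isOpen_compl.mem_nhds hzc)
    filter_upwards [this] with k hk
    rw [D.inc_of_notMem hk, D.inc_of_notMem hzc]; linarith

/-- Stability of nonlocal inequality. -/
lemma stab {w : ℕ → Euc N → ℝ} {w0 : Euc N → ℝ} {x : ℕ → Euc N} {x0 : Euc N} {c : ℕ → ℝ} {c0 B M : ℝ}
    (hB : 0 ≤ B) (hM : 0 ≤ M)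
    (hx : ∀ᶠ k in atTop, x k ∈ closure D.Ω) (hx0 : x0 ∈ closure D.Ω) (hxt : Tendsto x atTop (𝓝 x0))
    (hbd : ∃ M, ∀ᶠ k in atTop, ∀ y ∈ closure D.Ω, |w k y| ≤ M)
    (hup : ∀ y ∈ D.Ω, ∀ y' : ℕ → Euc N, (∀ᶠ k in atTop, y' k ∈ closure D.Ω) → Tendsto y' atTop (𝓝 y) →
      ∀ ε > 0, ∀ᶠ k in atTop, w k (y' k) ≤ w0 y + ε)
    (hlow : Tendsto (fun k => w k (x k)) atTop (𝓝 (w0 x0)))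
    (hdom : ∀ᶠ k in atTop, ∀ z, D.inc (w k) (x k) z ≤ D.dom B M z)
    (hdom0 : ∀ z, D.inc w0 x0 z ≤ D.dom B M z)
    (hw0 : Measurable ((closure D.Ω).indicator w0))
    (hi : ∀ᶠ k in atTop, Integrable (D.inc (w k) (x k)) ∧ c k ≤ ∫ z, D.inc (w k) (x k) z)
    (hc : Tendsto c atTop (𝓝 c0)) :
    Integrable (D.inc w0 x0) ∧ c0 ≤ ∫ z, D.inc w0 x0 z := by
  refine fatou (f := fun k => D.inc (w k) (x k)) (E := fun _ _ => 0) (D.dom_integrable hB hM) ?_ hc (by simp)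
    (D.inc_meas hx0 hw0).aestronglyMeasurable (Eventually.of_forall hdom0) ?_
  · filter_upwards [hdom, hi] with k h1 h2
    exact ⟨h2.1, integrable_zero _ _ _, fun _ => le_rfl, Eventually.of_forall fun z => by simpa using h1 z, h2.2⟩
  · filter_upwards [D.ae_not_frontier hx0] with z hz
    exact D.inc_limsup hx hx0 hxt hz hbd hup hlow

end Dat

/-- Linear form on space-time. -/
def clm (p : Euc N) (a : ℝ) : (Euc N × ℝ) →L[ℝ] ℝ :=
  (innerSL ℝ p).comp (ContinuousLinearMap.fst ℝ (Euc N) ℝ) + a • ContinuousLinearMap.snd ℝ (Euc N) ℝ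

lemma clm_apply (p : Euc N) (a : ℝ) (q : Euc N × ℝ) : clm p a q = ⟪p, q.1⟫ + a * q.2 := by
  simp [clm]

lemma clm_add (p p' : Euc N) (a a' : ℝ) : clm p a + clm p' a' = clm (p + p') (a + a') := by
  ext q <;> simp [clm, inner_add_left]

lemma clm_neg (p : Euc N) (a : ℝ) : -clm p a = clm (-p) (-a) := by
  ext q <;> simp [clm]

lemma clm_smul (c : ℝ) (p : Euc N) (a : ℝ) : c • clm p a = clm (c • p) (c * a) := by
  ext q <;> simp [clm, inner_smul_left]

lemma exists_clm (L : (Euc N × ℝ) →L[ℝ] ℝ) : ∃ p a, L = clm p a := by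
  refine ⟨(InnerProductSpace.toDual ℝ (Euc N)).symm (L.comp (ContinuousLinearMap.inl ℝ _ _)), L (0, 1), ?_⟩
  ext q <;> simp [clm]

lemma hasGrad_slice {φ : Euc N × ℝ → ℝ} {p : Euc N} {a : ℝ} {x : Euc N} {t : ℝ}
    (h : HasFDerivAt φ (clm p a) (x, t)) : HasGradientAt (fun y => φ (y, t)) p x := by
  rw [hasGradientAt_iff_hasFDerivAt]
  have h1 : HasFDerivAt (fun y : Euc N => (y, t)) (ContinuousLinearMap.inl ℝ (Euc N) ℝ) x :=
    hasFDerivAt_prodMk_left x t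
  have h2 := HasFDerivAt.comp x (f := fun y : Euc N => (y, t)) h h1
  have e : (clm p a).comp (ContinuousLinearMap.inl ℝ (Euc N) ℝ) = InnerProductSpace.toDual ℝ (Euc N) p := by
    ext v; simp [clm]
  rw [e] at h2
  exact h2

lemma hasDeriv_slice {φ : Euc N × ℝ → ℝ} {p : Euc N} {a : ℝ} {x : Euc N} {t : ℝ}
    (h : HasFDerivAt φ (clm p a) (x, t)) : HasDerivAt (fun s => φ (x, s)) a t := by
  have h1 : HasFDerivAt (fun s : ℝ => (x, s)) (ContinuousLinearMap.inr ℝ (Euc N) ℝ) t :=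
    hasFDerivAt_prodMk_right x t
  have h2 := (HasFDerivAt.comp t (f := fun s : ℝ => (x, s)) h h1).hasDerivAt
  have e : ((clm p a).comp (ContinuousLinearMap.inr ℝ (Euc N) ℝ)) 1 = a := by simp [clm]
  rw [e] at h2
  exact h2

/-- Hamiltonian of the reflected equation. -/
def Hneg (H : Euc N → ℝ → ℝ → Euc N → ℝ) : Euc N → ℝ → ℝ → Euc N → ℝ :=
  fun x t r p => -H x t (-r) (-p)

lemma Hneg_Hneg (H : Euc N → ℝ → ℝ → Euc N → ℝ) : Hneg (Hneg H) = H := by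
  funext x t r p; simp [Hneg]

namespace Dat
variable (D : Dat N)

/-- space-time cylinder -/
def Cyl : Set (Euc N × ℝ) := closure D.Ω ×ˢ Ici 0

lemma mem_Cyl {x : Euc N} {t : ℝ} : (x, t) ∈ D.Cyl ↔ x ∈ closure D.Ω ∧ 0 ≤ t := by simp [Cyl]

lemma Cyl_closed : IsClosed D.Cyl := isClosed_closure.prod isClosed_Ici

/-- bounded on finite time slabs -/
def LocBdd (u : Euc N × ℝ → ℝ) : Prop :=
  ∀ T, ∃ M, 0 ≤ M ∧ ∀ x ∈ closure D.Ω, ∀ t, 0 ≤ t → t ≤ T → |u (x, t)| ≤ M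

/-- admissible: usc and bounded on slabs -/
structure Adm (u : Euc N × ℝ → ℝ) : Prop where
  usc : UpperSemicontinuousOn u D.Cyl
  bdd : D.LocBdd u

variable {D} in
lemma LocBdd.neg {u : Euc N × ℝ → ℝ} (h : D.LocBdd u) : D.LocBdd (fun q => -u q) := fun T => by
  obtain ⟨M, h0, hM⟩ := h T
  exact ⟨M, h0, fun x hx t h1 h2 => by simpa using hM x hx t h1 h2⟩

/-- φ touches u from above at (x,t), with gradient (p,a). -/
structure Touch (u φ : Euc N × ℝ → ℝ) (x : Euc N) (t : ℝ) (p : Euc N) (a : ℝ) : Prop where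
  cd : ContDiffAt ℝ 1 φ (x, t)
  fd : HasFDerivAt φ (clm p a) (x, t)
  le : ∀ᶠ q in 𝓝[D.Cyl] (x, t), u q - φ q ≤ u (x, t) - φ (x, t)

/-- Local formulation of subsolutions. -/
def LSub (H : Euc N → ℝ → ℝ → Euc N → ℝ) (u : Euc N × ℝ → ℝ) : Prop :=
  ∀ x ∈ closure D.Ω, ∀ t > (0:ℝ), ∀ p a φ, D.Touch u φ x t p a → (x ∈ D.Ω ∨ 0 < ⟪p, D.n x⟫) →
    Integrable (D.inc (fun y => u (y, t)) x) ∧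
      a + H x t (u (x, t)) p ≤ ∫ z, D.inc (fun y => u (y, t)) x z

variable {D} in
lemma Adm.meas_slice {u : Euc N × ℝ → ℝ} (hu : UpperSemicontinuousOn u D.Cyl) {t : ℝ} (ht : 0 ≤ t) :
    Measurable ((closure D.Ω).indicator fun y => u (y, t)) := by
  refine meas_indicator_of_usc isClosed_closure ?_
  have hc : ContinuousOn (fun y : Euc N => (y, t)) (closure D.Ω) := by fun_prop
  exact hu.comp hc fun y hy => D.mem_Cyl.2 ⟨hy, ht⟩

/-- one-sided increments from a local Lipschitz bound. -/
lemma lip_glob {w : Euc N → ℝ} {x : Euc N} {B M r : ℝ} (hB : 0 ≤ B) (hM : 0 ≤ M) (hr : 0 < r)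
    (h1 : ∀ y ∈ closure D.Ω, ‖y - x‖ < r → w y - w x ≤ B * ‖y - x‖)
    (h2 : ∀ y ∈ closure D.Ω, w y - w x ≤ M) :
    ∀ y ∈ closure D.Ω, w y - w x ≤ min ((B + M / r) * ‖y - x‖) M := by
  intro y hy
  refine le_min ?_ (h2 y hy)
  have h3 : 0 ≤ M / r * ‖y - x‖ := by positivity
  have h4 : 0 ≤ B * ‖y - x‖ := by positivity
  by_cases h : ‖y - x‖ < r
  · linarith [h1 y hy h]
  · have : M ≤ M / r * ‖y - x‖ := by
      rw [div_mul_eq_mul_div, le_div_iff₀ hr]; exact mul_le_mul_of_nonneg_left (not_lt.1 h) hM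
    linarith [h2 y hy]

variable {D} in
lemma Touch.bound {u φ : Euc N × ℝ → ℝ} {x : Euc N} {t : ℝ} {p : Euc N} {a M : ℝ}
    (h : D.Touch u φ x t p a) (ht : 0 < t) (hM0 : 0 ≤ M)
    (hM : ∀ y ∈ closure D.Ω, u (y, t) - u (x, t) ≤ M) :
    ∃ B, 0 ≤ B ∧ ∀ y ∈ closure D.Ω, u (y, t) - u (x, t) ≤ min (B * ‖y - x‖) M := by
  obtain ⟨K, s, hs, hK⟩ := h.cd.exists_lipschitzOnWith
  have hev : ∀ᶠ y in 𝓝 x, (y, t) ∈ s ∧ (y ∈ closure D.Ω → u (y, t) - φ (y, t) ≤ u (x, t) - φ (x, t)) := by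
    have hc : Tendsto (fun y : Euc N => (y, t)) (𝓝 x) (𝓝 (x, t)) := (by fun_prop : Continuous fun y : Euc N => (y, t)).tendsto x
    have h1 := hc.eventually hs
    have h2 := hc.eventually (eventually_nhdsWithin_iff.1 h.le)
    filter_upwards [h1, h2] with y hy1 hy2
    exact ⟨hy1, fun hy => hy2 (D.mem_Cyl.2 ⟨hy, ht.le⟩)⟩
  obtain ⟨r, hr, hball⟩ := Metric.eventually_nhds_iff.1 hev
  refine ⟨K + M / r, by positivity, D.lip_glob (w := fun y => u (y, t)) K.2 hM0 hr ?_ hM⟩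
  intro y hy hyr
  have h1 := hball (y := y) (by rwa [dist_eq_norm])
  have h0 := hball (y := x) (by simpa using hr)
  have h2 := hK.dist_le_mul _ h1.1 _ h0.1
  have h3 := h1.2 hy
  rw [Real.dist_eq] at h2
  have h4 : dist (y, t) (x, t) = ‖y - x‖ := by simp [Prod.dist_eq, dist_eq_norm]
  rw [h4] at h2
  have := le_abs_self (φ (y, t) - φ (x, t))
  show u (y, t) - u (x, t) ≤ K * ‖y - x‖
  linarith

lemma Iin_eq {ξ : ℝ} {w : Euc N → ℝ} {x : Euc N} (hx : x ∈ closure D.Ω) :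
    Iin D.Ω D.j D.g ξ w x = ∫ z, {z : Euc N | ‖z‖ < ξ}.indicator (D.inc w x) z := by
  unfold Iin
  have hm : MeasurableSet {z : Euc N | ‖z‖ < ξ} := (isOpen_lt continuous_norm continuous_const).measurableSet
  have hm2 : MeasurableSet {z : Euc N | ‖z‖ < ξ ∧ x + D.j x z ∈ closure D.Ω} := hm.inter (D.J_meas hx)
  rw [← integral_indicator hm2]
  congr 1; ext z
  unfold inc J; simp only [indicator, mem_setOf_eq]
  by_cases h1 : ‖z‖ < ξ <;> by_cases h2 : x + D.j x z ∈ closure D.Ω <;> simp [h1, h2]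

lemma Iout_eq {ξ : ℝ} {w : Euc N → ℝ} {x : Euc N} (hx : x ∈ closure D.Ω) :
    Iout D.Ω D.j D.g ξ w x = ∫ z, {z : Euc N | ξ ≤ ‖z‖}.indicator (D.inc w x) z := by
  unfold Iout
  have hm : MeasurableSet {z : Euc N | ξ ≤ ‖z‖} := (isClosed_le continuous_const continuous_norm).measurableSet
  have hm2 : MeasurableSet {z : Euc N | ξ ≤ ‖z‖ ∧ x + D.j x z ∈ closure D.Ω} := hm.inter (D.J_meas hx)
  rw [← integral_indicator hm2]
  congr 1; ext z
  unfold inc J; simp only [indicator, mem_setOf_eq]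
  by_cases h1 : ξ ≤ ‖z‖ <;> by_cases h2 : x + D.j x z ∈ closure D.Ω <;> simp [h1, h2]

/-- away from the origin bounded increments are integrable. -/
lemma out_integrable {ξ M : ℝ} {w : Euc N → ℝ} {x : Euc N} (hx : x ∈ closure D.Ω) (hξ : 0 < ξ) (hM0 : 0 ≤ M)
    (hw : Measurable ((closure D.Ω).indicator w)) (hM : ∀ y ∈ closure D.Ω, |w y - w x| ≤ M) :
    Integrable ({z : Euc N | ξ ≤ ‖z‖}.indicator (D.inc w x)) := by
  have hm : MeasurableSet {z : Euc N | ξ ≤ ‖z‖} := (isClosed_le continuous_const continuous_norm).measurableSet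
  have hC := D.Cl_pos; have hCj := D.Cj_pos
  have hB : 0 ≤ M / (D.Cj * ξ) := by positivity
  refine (D.dom_integrable hB hM0).mono' ((D.inc_meas hx hw).indicator hm).aestronglyMeasurable
    (Eventually.of_forall fun z => ?_)
  by_cases hz : ξ ≤ ‖z‖
  · rw [indicator_of_mem (s := {z : Euc N | ξ ≤ ‖z‖}) hz]
    by_cases h : x + D.j x z ∈ closure D.Ω
    · rw [D.inc_of_mem h, Real.norm_eq_abs, abs_mul, abs_of_nonneg (D.g_nonneg hx z)]
      have h1 : M / (D.Cj * ξ) * D.Cj * ‖z‖ ≥ M := by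
        have : M / (D.Cj * ξ) * D.Cj * ‖z‖ = M * (‖z‖ / ξ) := by field_simp
        rw [this]
        exact le_mul_of_one_le_right hM0 ((one_le_div hξ).2 hz)
      unfold dom
      rw [min_eq_right h1]
      calc |w (x + D.j x z) - w x| * D.g x z ≤ M * (D.Cμ * ker N D.σ z) :=
            mul_le_mul (hM _ h) (D.g_le hx z) (D.g_nonneg hx z) hM0
        _ = _ := by ring
    · rw [D.inc_of_notMem h, norm_zero]; exact D.dom_nonneg hB hM0 z
  · rw [indicator_of_notMem (s := {z : Euc N | ξ ≤ ‖z‖}) hz, norm_zero]; exact D.dom_nonneg hB hM0 z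

lemma in_integrable {ξ B : ℝ} {w : Euc N → ℝ} {x : Euc N} (hx : x ∈ closure D.Ω) (hξ : 0 < ξ) (hB : 0 ≤ B)
    (hw : Continuous w) (hL : ∀ y ∈ closedBall x (D.Cj * ξ), |w y - w x| ≤ B * ‖y - x‖) :
    Integrable ({z : Euc N | ‖z‖ < ξ}.indicator (D.inc w x)) := by
  have hm : MeasurableSet {z : Euc N | ‖z‖ < ξ} := (isOpen_lt continuous_norm continuous_const).measurableSet
  have hCj := D.Cj_pos
  have hM0 : 0 ≤ B * D.Cj * ξ := by positivity
  have hwm : Measurable ((closure D.Ω).indicator w) := hw.measurable.indicator isClosed_closure.measurableSet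
  refine (D.dom_integrable hB hM0).mono' ((D.inc_meas hx hwm).indicator hm).aestronglyMeasurable
    (Eventually.of_forall fun z => ?_)
  by_cases hz : ‖z‖ < ξ
  · rw [indicator_of_mem (s := {z : Euc N | ‖z‖ < ξ}) hz]
    by_cases h : x + D.j x z ∈ closure D.Ω
    · rw [D.inc_of_mem h, Real.norm_eq_abs, abs_mul, abs_of_nonneg (D.g_nonneg hx z)]
      have h1 : B * D.Cj * ‖z‖ ≤ B * D.Cj * ξ := by gcongr
      unfold dom
      rw [min_eq_left h1]
      have h2 := D.j_le hx z
      have h3 := hL (x + D.j x z) (by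
        rw [mem_closedBall, dist_eq_norm, add_sub_cancel_left]
        exact h2.trans (by gcongr))
      rw [add_sub_cancel_left] at h3
      calc |w (x + D.j x z) - w x| * D.g x z ≤ (B * (D.Cj * ‖z‖)) * (D.Cμ * ker N D.σ z) :=
            mul_le_mul (h3.trans (by gcongr)) (D.g_le hx z) (D.g_nonneg hx z) (by positivity)
        _ = _ := by ring
    · rw [D.inc_of_notMem h, norm_zero]; exact D.dom_nonneg hB hM0 z
  · rw [indicator_of_notMem (s := {z : Euc N | ‖z‖ < ξ}) hz, norm_zero]; exact D.dom_nonneg hB hM0 z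

lemma inc_split {ξ : ℝ} {w : Euc N → ℝ} {x : Euc N} (z : Euc N) :
    D.inc w x z = {z : Euc N | ‖z‖ < ξ}.indicator (D.inc w x) z + {z : Euc N | ξ ≤ ‖z‖}.indicator (D.inc w x) z := by
  by_cases hz : ‖z‖ < ξ
  · rw [indicator_of_mem (s := {z : Euc N | ‖z‖ < ξ}) hz,
      indicator_of_notMem (s := {z : Euc N | ξ ≤ ‖z‖}) (by simpa using hz), add_zero]
  · rw [indicator_of_notMem (s := {z : Euc N | ‖z‖ < ξ}) hz,
      indicator_of_mem (s := {z : Euc N | ξ ≤ ‖z‖}) (by simpa using hz), zero_add]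

lemma slice_cd {φ : Euc N → ℝ → ℝ} (h : ContDiff ℝ 1 (fun q : Euc N × ℝ => φ q.1 q.2)) (t : ℝ) :
    ContDiff ℝ 1 (fun y => φ y t) := h.comp (f := fun y : Euc N => (y, t)) (by fun_prop)

/-- LSub implies IsParSubSol -/
lemma par_of_lsub {H : Euc N → ℝ → ℝ → Euc N → ℝ} {u : Euc N → ℝ → ℝ}
    (hb : D.LocBdd (fun q => u q.1 q.2)) (hc : UpperSemicontinuousOn (fun q : Euc N × ℝ => u q.1 q.2) D.Cyl)
    (h : D.LSub H (fun q => u q.1 q.2)) : IsParSubSol D.Ω D.j D.g D.n D.Cj (parF H) u := by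
  intro ξ hξ φ hφ x hx t ht htouch
  rw [mem_Ioi] at ht
  have hCj := D.Cj_pos
  obtain ⟨p, a, hpa⟩ := exists_clm (fderiv ℝ (fun q : Euc N × ℝ => φ q.1 q.2) (x, t))
  have hfd : HasFDerivAt (fun q : Euc N × ℝ => φ q.1 q.2) (clm p a) (x, t) :=
    hpa ▸ (hφ.differentiable (by norm_num)).differentiableAt.hasFDerivAt
  have hp : gradient (fun y => φ y t) x = p := (hasGrad_slice hfd).gradient
  have ha : deriv (φ x) t = a := (hasDeriv_slice hfd).deriv
  rw [hp, ha]
  have hT : D.Touch (fun q => u q.1 q.2) (fun q => φ q.1 q.2) x t p a := by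
    refine ⟨hφ.contDiffAt, hfd, ?_⟩
    rw [eventually_nhdsWithin_iff]
    have e1 : ∀ᶠ q : Euc N × ℝ in 𝓝 (x, t), q.1 ∈ closedBall x (D.Cj * ξ) :=
      continuous_fst.continuousAt (closedBall_mem_nhds _ (by positivity))
    have e2 : ∀ᶠ q : Euc N × ℝ in 𝓝 (x, t), q.2 ∈ closedBall t ξ :=
      continuous_snd.continuousAt (closedBall_mem_nhds _ hξ)
    have e3 : ∀ᶠ q : Euc N × ℝ in 𝓝 (x, t), q.2 ∈ Ioi (0:ℝ) :=
      continuous_snd.continuousAt (Ioi_mem_nhds ht)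
    filter_upwards [e1, e2, e3] with q h1 h2 h3 h4
    exact htouch q.1 ⟨h1, h4.1⟩ q.2 h3 (by rwa [mem_closedBall, Real.dist_eq] at h2)
  have key : (x ∈ D.Ω ∨ 0 < ⟪p, D.n x⟫) → parF H x t a (u x t) p
      (Iin D.Ω D.j D.g ξ (fun y => φ y t) x + Iout D.Ω D.j D.g ξ (fun y => u y t) x) ≤ 0 := by
    intro hor
    obtain ⟨hi, hle⟩ := h x hx t ht p a _ hT hor
    obtain ⟨M, hM0, hM⟩ := hb t
    have hφc : ContDiff ℝ 1 (fun y => φ y t) := slice_cd hφ t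
    obtain ⟨B, hB0, hB⟩ : ∃ B, 0 ≤ B ∧ ∀ y ∈ closedBall x (D.Cj * ξ), |φ y t - φ x t| ≤ B * ‖y - x‖ := by
      obtain ⟨K, hK⟩ := hφc.contDiffOn.exists_lipschitzOnWith (s := closedBall x (D.Cj * ξ)) (by norm_num)
        (convex_closedBall _ _) (isCompact_closedBall _ _)
      refine ⟨K, K.2, fun y hy => ?_⟩
      have := hK.dist_le_mul y hy x (mem_closedBall_self (by positivity))
      rwa [Real.dist_eq, dist_eq_norm] at this
    have i1 := D.in_integrable hx hξ hB0 hφc.continuous hB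
    have i2 := D.out_integrable (w := fun y => u y t) (M := 2 * M) hx hξ (by positivity) (Adm.meas_slice hc ht.le) (fun y hy => by
      have h1 := hM y hy t ht.le le_rfl
      have h2 := hM x hx t ht.le le_rfl
      rw [abs_le] at *; constructor <;> linarith)
    rw [D.Iin_eq hx, D.Iout_eq hx, ← integral_add i1 i2]
    have hmono : ∫ z, D.inc (fun y => u y t) x z ≤ ∫ z, ({z : Euc N | ‖z‖ < ξ}.indicator (D.inc (fun y => φ y t) x) z +
        {z : Euc N | ξ ≤ ‖z‖}.indicator (D.inc (fun y => u y t) x) z) := by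
      refine integral_mono hi (i1.add i2) fun z => ?_
      show D.inc (fun y => u y t) x z ≤ _
      rw [D.inc_split (ξ := ξ)]
      refine add_le_add_left ?_ _
      refine indicator_le_indicator' fun hz => ?_
      refine D.inc_mono hx fun hz2 => ?_
      have h2 := D.j_le hx z
      have := htouch (x + D.j x z) ⟨by
        rw [mem_closedBall, dist_eq_norm, add_sub_cancel_left]
        exact h2.trans (mul_le_mul_of_nonneg_left (le_of_lt hz) hCj.le), hz2⟩ t ht (by simpa using hξ.le)
      linarith
    unfold parF
    linarith
  refine ⟨fun hxΩ => key (Or.inl hxΩ), fun _ => ?_⟩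
  by_cases hn : 0 < ⟪p, D.n x⟫
  · exact (min_le_left _ _).trans (key (Or.inr hn))
  · exact (min_le_right _ _).trans (not_lt.1 hn)

/-- IsParSubSol implies LSub -/
lemma lsub_of_par {H : Euc N → ℝ → ℝ → Euc N → ℝ} {u : Euc N → ℝ → ℝ}
    (hb : D.LocBdd (fun q => u q.1 q.2)) (hc : UpperSemicontinuousOn (fun q : Euc N × ℝ => u q.1 q.2) D.Cyl)
    (h : IsParSubSol D.Ω D.j D.g D.n D.Cj (parF H) u) : D.LSub H (fun q => u q.1 q.2) := by
  intro x hx t ht p a φ hT hor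
  have hCj := D.Cj_pos
  obtain ⟨M, hM0, hM⟩ := hb t
  -- global extension
  obtain ⟨ψ, hψc, hψs, hψe⟩ : ∃ ψ : Euc N × ℝ → ℝ, ContDiff ℝ 1 ψ ∧ HasCompactSupport ψ ∧ ∀ᶠ q in 𝓝 (x, t), ψ q = φ q := by
    obtain ⟨s, hs, hsφ⟩ := hT.cd.contDiffOn (m := 1) le_rfl (by simp)
    obtain ⟨e, he, hball⟩ := Metric.mem_nhds_iff.1 (interior_mem_nhds.2 hs)
    let f : ContDiffBump (x, t) := ⟨e / 4, e / 2, by positivity, by linarith⟩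
    have hf1 : tsupport f ⊆ interior s := by
      rw [f.tsupport_eq]
      exact (closedBall_subset_ball (by show e / 2 < e; linarith)).trans hball
    have hd : ∀ q, ContDiffAt ℝ 1 (fun q => f q * φ q) q := by
      intro q
      by_cases hq : q ∈ tsupport f
      · exact f.contDiffAt.mul ((hsφ.mono interior_subset).contDiffAt (isOpen_interior.mem_nhds (hf1 hq)))
      · have : (fun q => f q * φ q) =ᶠ[𝓝 q] fun _ => 0 := by
          filter_upwards [(isClosed_tsupport f).isOpen_compl.mem_nhds hq] with y hy
          rw [image_eq_zero_of_notMem_tsupport hy, zero_mul]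
        exact contDiffAt_const.congr_of_eventuallyEq this
    refine ⟨fun q => f q * φ q, contDiff_iff_contDiffAt.2 hd, f.hasCompactSupport.mul_right, ?_⟩
    filter_upwards [f.eventuallyEq_one] with q hq
    rw [hq]; simp
  have hψt : ψ (x, t) = φ (x, t) := hψe.self_of_nhds
  have hψfd : HasFDerivAt ψ (clm p a) (x, t) := hT.fd.congr_of_eventuallyEq hψe
  have hp : gradient (fun y => ψ (y, t)) x = p := (hasGrad_slice hψfd).gradient
  have ha : deriv (fun s => ψ (x, s)) t = a := (hasDeriv_slice hψfd).deriv
  obtain ⟨K, hK⟩ := ContDiff.lipschitzWith_of_hasCompactSupport hψs hψc (by norm_num)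
  obtain ⟨Mψ, hMψ⟩ := hψs.exists_bound_of_continuous hψc.continuous
  have hMψ0 : 0 ≤ Mψ := (norm_nonneg _).trans (hMψ (x, t))
  obtain ⟨B, hB0, hB⟩ := hT.bound ht (M := 2 * M) (by positivity) (fun y hy => by
      have h1 := hM y hy t ht.le le_rfl
      have h2 := hM x hx t ht.le le_rfl
      simp only [abs_le] at *; linarith)
  have ev : ∀ᶠ ξ in 𝓝[>] (0:ℝ), ∀ y ∈ closedBall x (D.Cj * ξ) ∩ closure D.Ω, ∀ s ∈ Ioi (0:ℝ), |s - t| ≤ ξ →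
        u y s - ψ (y, s) ≤ u x t - ψ (x, t) := by
    have e := (eventually_nhdsWithin_iff.1 hT.le).and hψe
    obtain ⟨r, hr, hball⟩ := Metric.eventually_nhds_iff.1 e
    have e1 : ∀ᶠ ξ in 𝓝[>] (0:ℝ), D.Cj * ξ < r := by
      have : Tendsto (fun ξ => D.Cj * ξ) (𝓝[>] (0:ℝ)) (𝓝 (D.Cj * 0)) := (tendsto_id.mono_left nhdsWithin_le_nhds).const_mul _
      rw [mul_zero] at this; exact this.eventually (Iio_mem_nhds hr)
    have e2 : ∀ᶠ ξ in 𝓝[>] (0:ℝ), ξ < r := nhdsWithin_le_nhds (Iio_mem_nhds hr)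
    filter_upwards [e1, e2] with ξ h1 h2 y hy s hs hst
    obtain ⟨h3, h4⟩ := hball (y := (y, s)) (by
      rw [Prod.dist_eq]; exact max_lt (lt_of_le_of_lt hy.1 h1) (by rw [Real.dist_eq]; exact hst.trans_lt h2))
    rw [h4, hψt]
    exact h3 (D.mem_Cyl.2 ⟨hy.2, le_of_lt hs⟩)
  obtain ⟨ξ0, hξ0, hξ⟩ := mem_nhdsGT_iff_exists_Ioo_subset.1 ev
  rw [mem_Ioi] at hξ0
  set ξ : ℕ → ℝ := fun k => ξ0 / (k + 2) with hξdef
  have hξp : ∀ k, 0 < ξ k := fun k => by simp only [hξdef]; positivity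
  have hξl : ∀ k, ξ k < ξ0 := fun k => by
    simp only [hξdef]; rw [div_lt_iff₀ (by positivity)]; nlinarith [(Nat.cast_nonneg k : (0:ℝ) ≤ k)]
  have hξt : Tendsto ξ atTop (𝓝 0) := by
    refine Tendsto.div_atTop tendsto_const_nhds ?_
    exact tendsto_atTop_add_const_right _ _ tendsto_natCast_atTop_atTop
  have hcontψ : Continuous fun y => ψ (y, t) := (slice_cd (φ := fun y s => ψ (y, s)) hψc t).continuous
  have hLip : ∀ y, |ψ (y, t) - ψ (x, t)| ≤ K * ‖y - x‖ := fun y => by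
    have := hK.dist_le_mul (y, t) (x, t)
    rwa [Real.dist_eq, Prod.dist_eq, dist_self, max_eq_left dist_nonneg, dist_eq_norm] at this
  have i1 : ∀ k, Integrable ({z : Euc N | ‖z‖ < ξ k}.indicator (D.inc (fun y => ψ (y, t)) x)) := fun k =>
    D.in_integrable hx (hξp k) K.2 hcontψ fun y _ => hLip y
  have i2 : ∀ k, Integrable ({z : Euc N | ξ k ≤ ‖z‖}.indicator (D.inc (fun y => u y t) x)) := fun k =>
    D.out_integrable (w := fun y => u y t) (M := 2 * M) hx (hξp k) (by positivity) (Adm.meas_slice hc ht.le) (fun y hy => by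
      have h1 := hM y hy t ht.le le_rfl
      have h2 := hM x hx t ht.le le_rfl
      rw [abs_le] at *; constructor <;> linarith)
  have hBmax : 0 ≤ max B K := le_max_of_le_left hB0
  have hMmax : 0 ≤ max (2 * M) (2 * Mψ) := le_max_of_le_left (by positivity)
  have hdu : ∀ z, D.inc (fun y => u y t) x z ≤ D.dom (max B K) (max (2 * M) (2 * Mψ)) z := by
    refine D.inc_le hx hBmax hMmax fun y hy => (hB y hy).trans ?_
    exact min_le_min (mul_le_mul_of_nonneg_right (le_max_left _ _) (norm_nonneg _)) (le_max_left _ _)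
  have hdψ : ∀ z, D.inc (fun y => ψ (y, t)) x z ≤ D.dom (max B K) (max (2 * M) (2 * Mψ)) z := by
    refine D.inc_le hx hBmax hMmax fun y hy => le_min ?_ ?_
    · exact (le_abs_self _).trans ((hLip y).trans (mul_le_mul_of_nonneg_right (le_max_right _ _) (norm_nonneg _)))
    · refine le_trans ?_ (le_max_right _ _)
      have h1 := hMψ (y, t); have h2 := hMψ (x, t)
      rw [Real.norm_eq_abs, abs_le] at *; linarith
  refine fatou (c := fun _ => a + H x t (u x t) p) (E := fun _ _ => 0)
    (f := fun k z => {z : Euc N | ‖z‖ < ξ k}.indicator (D.inc (fun y => ψ (y, t)) x) z +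
      {z : Euc N | ξ k ≤ ‖z‖}.indicator (D.inc (fun y => u y t) x) z)
    (D.dom_integrable hBmax hMmax) (Eventually.of_forall fun k => ⟨(i1 k).add (i2 k), integrable_zero _ _ _, fun _ => le_rfl, ?_, ?_⟩)
    tendsto_const_nhds (by simp) (D.inc_meas hx (Adm.meas_slice hc ht.le)).aestronglyMeasurable
    (Eventually.of_forall hdu) (Eventually.of_forall fun z ε hε => ?_)
  · refine Eventually.of_forall fun z => ?_
    rw [add_zero]
    by_cases hz : ‖z‖ < ξ k
    · rw [indicator_of_mem (s := {z : Euc N | ‖z‖ < ξ k}) hz,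
        indicator_of_notMem (s := {z : Euc N | ξ k ≤ ‖z‖}) (by simpa using hz), add_zero]
      exact hdψ z
    · rw [indicator_of_notMem (s := {z : Euc N | ‖z‖ < ξ k}) hz,
        indicator_of_mem (s := {z : Euc N | ξ k ≤ ‖z‖}) (by simpa using hz), zero_add]
      exact hdu z
  · rw [integral_add (i1 k) (i2 k), ← D.Iin_eq hx, ← D.Iout_eq hx]
    have hs := h (ξ k) (hξp k) (fun y s => ψ (y, s)) hψc x hx t ht (hξ ⟨hξp k, hξl k⟩)
    rw [hp, ha] at hs
    have hF : parF H x t a (u x t) p (Iin D.Ω D.j D.g (ξ k) (fun y => ψ (y, t)) x + Iout D.Ω D.j D.g (ξ k) (fun y => u y t) x) ≤ 0 := by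
      rcases hor with hor | hor
      · exact hs.1 hor
      · rcases D.mem_or hx with hx1 | hx1
        · exact hs.1 hx1
        · rcases min_le_iff.1 (hs.2 hx1) with h3 | h3
          · exact h3
          · linarith
    unfold parF at hF
    linarith
  · by_cases hz0 : z = 0
    · have hj0 : D.j x z = 0 := by
        have := D.j_le hx z; rw [hz0, norm_zero, mul_zero] at this
        rw [hz0]; exact norm_le_zero_iff.1 this
      have h0 : ∀ w : Euc N → ℝ, D.inc w x z = 0 := fun w => by
        rw [D.inc_of_mem (by rw [hj0, add_zero]; exact hx), hj0]; simp
      refine Eventually.of_forall fun k => ?_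
      simp only [indicator, h0]; simp [hε.le]
    · filter_upwards [hξt.eventually (Iio_mem_nhds (norm_pos_iff.2 hz0))] with k hk
      have hk : ξ k < ‖z‖ := hk
      rw [indicator_of_notMem (s := {z : Euc N | ‖z‖ < ξ k}) (by simpa using hk.le),
        indicator_of_mem (s := {z : Euc N | ξ k ≤ ‖z‖}) hk.le, zero_add]
      linarith

lemma super_iff {H : Euc N → ℝ → ℝ → Euc N → ℝ} {u : Euc N → ℝ → ℝ} :
    IsParSuperSol D.Ω D.j D.g D.n D.Cj (parF H) u ↔
      IsParSubSol D.Ω D.j D.g D.n D.Cj (parF (Hneg H)) (fun x t => -u x t) := by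
  have hin : ∀ ξ w x, Iin D.Ω D.j D.g ξ (fun y => -w y) x = -Iin D.Ω D.j D.g ξ w x := fun ξ w x => by
    unfold Iin; rw [← integral_neg]; congr 1; ext z; ring
  have hout : ∀ ξ w x, Iout D.Ω D.j D.g ξ (fun y => -w y) x = -Iout D.Ω D.j D.g ξ w x := fun ξ w x => by
    unfold Iout; rw [← integral_neg]; congr 1; ext z; ring
  have hgr : ∀ (w : Euc N → ℝ) x, gradient (fun y => -w y) x = -gradient w x := fun w x => by
    unfold gradient; rw [fderiv_fun_neg, map_neg]
  have hde : ∀ (w : ℝ → ℝ) t, deriv (fun y => -w y) t = -deriv w t := fun w t => deriv.fun_neg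
  constructor
  · intro h ξ hξ φ hφ x hx t ht hto
    have := h ξ hξ (fun y s => -φ y s) hφ.neg x hx t ht (fun y hy s hs hst => by have := hto y hy s hs hst; linarith)
    simp only [hin, hout, hgr, hde] at this ⊢
    refine ⟨fun h1 => ?_, fun h1 => ?_⟩
    · have := this.1 h1
      simp only [parF, Hneg, neg_neg] at this ⊢; linarith
    · have := this.2 h1
      simp only [parF, Hneg, neg_neg, inner_neg_left] at this ⊢
      rcases le_max_iff.1 this with h2 | h2
      · exact (min_le_left _ _).trans (by linarith)
      · exact (min_le_right _ _).trans (by linarith)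
  · intro h ξ hξ φ hφ x hx t ht hto
    have := h ξ hξ (fun y s => -φ y s) hφ.neg x hx t ht (fun y hy s hs hst => by have := hto y hy s hs hst; linarith)
    simp only [hin, hout, hgr, hde] at this ⊢
    refine ⟨fun h1 => ?_, fun h1 => ?_⟩
    · have := this.1 h1
      simp only [parF, Hneg, neg_neg] at this ⊢; linarith
    · have := this.2 h1
      simp only [parF, Hneg, neg_neg, inner_neg_left] at this ⊢
      rcases min_le_iff.1 this with h2 | h2
      · exact le_max_of_le_left (by linarith)
      · exact le_max_of_le_right (by linarith)

end Dat

/-- profile function -/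
lemma exists_profile : ∃ (H1 : ℝ → ℝ) (L1 : ℝ), 0 ≤ L1 ∧ ContDiff ℝ 1 H1 ∧ H1 0 = 0 ∧ HasDerivAt H1 1 0 ∧
    (∀ s, |H1 s| ≤ 2) ∧ (∀ s, 2 ≤ |s| → H1 s = 0) ∧ ∀ s t, |H1 s - H1 t| ≤ L1 * |s - t| := by
  let β : ContDiffBump (0:ℝ) := ⟨1, 2, by norm_num, by norm_num⟩
  have hc : ContDiff ℝ 1 (fun s => s * β s) := contDiff_id.mul β.contDiff
  have hs : HasCompactSupport (fun s => s * β s) := β.hasCompactSupport.mul_left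
  have h0 : ∀ s, 2 ≤ |s| → s * β s = 0 := fun s hs => by
    rw [β.zero_of_le_dist (by rw [Real.dist_eq, sub_zero]; exact hs), mul_zero]
  obtain ⟨K, hK⟩ := ContDiff.lipschitzWith_of_hasCompactSupport hs hc (by norm_num)
  refine ⟨fun s => s * β s, K, K.2, hc, by simp, ?_, ?_, h0, ?_⟩
  · have : (fun s => s * β s) =ᶠ[𝓝 0] fun s => s := by
      filter_upwards [β.eventuallyEq_one] with s hs
      rw [hs]; simp
    exact (hasDerivAt_id 0).congr_of_eventuallyEq this
  · intro s
    show |s * β s| ≤ 2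
    by_cases h : 2 ≤ |s|
    · rw [h0 s h]; simp
    · rw [abs_mul, abs_of_nonneg β.nonneg]
      have h1 := β.nonneg (x := s); have h2 := β.le_one (x := s); have := abs_nonneg s
      push Not at h
      nlinarith
  · intro s t
    have := hK.dist_le_mul s t
    rwa [Real.dist_eq, Real.dist_eq] at this

namespace Dat
variable (D : Dat N)

lemma cd_d {s : Euc N} (hs : s ∈ frontier D.Ω) : ContDiffAt ℝ 1 D.d s := by
  obtain ⟨r, L, h⟩ := D.exists_near hs
  exact h.cd.contDiffAt (ball_mem_nhds _ h.r_pos)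

lemma d_const_of_empty (h : frontier D.Ω = ∅) (hne : D.Ω.Nonempty) : D.d = fun _ => 0 := by
  have hcl : IsClopen D.Ω := isClopen_iff_frontier_eq_empty.2 h
  have : D.Ω = univ := hcl.eq_univ hne
  funext x
  simp [d, sdist, this, infDist_zero_of_mem]

/-- compactness: a quantitative neighborhood where `d` is `C¹`. -/
lemma exists_delta (x0 : Euc N) (R : ℝ) : ∃ m > 0, ∀ x ∈ closedBall x0 R ∩ closure D.Ω,
    ¬ ContDiffAt ℝ 1 D.d x → m ≤ D.d x := by
  set K := (closedBall x0 R ∩ closure D.Ω) ∩ {x | ContDiffAt ℝ 1 D.d x}ᶜ with hK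
  have hop : IsOpen {x | ContDiffAt ℝ 1 D.d x} := isOpen_iff_mem_nhds.2 fun x hx =>
    ContDiffAt.eventually hx (by simp)
  have hKc : IsCompact K := ((isCompact_closedBall x0 R).inter_right isClosed_closure).inter_right hop.isClosed_compl
  rcases K.eq_empty_or_nonempty with he | hne
  · refine ⟨1, one_pos, fun x hx h => ?_⟩
    have : x ∈ K := ⟨hx, h⟩
    rw [he] at this; exact this.elim
  · obtain ⟨y, hy, hmin⟩ := hKc.exists_isMinOn hne D.d_cont.continuousOn
    have hyΩ : y ∈ D.Ω := by
      rcases D.mem_or hy.1.2 with h | h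
      · exact h
      · exact (hy.2 (D.cd_d h)).elim
    have hpos : 0 < D.d y := by
      rcases (frontier D.Ω).eq_empty_or_nonempty with he | ⟨s, hs⟩
      · exfalso; apply hy.2
        rw [mem_setOf_eq, D.d_const_of_empty he ⟨y, hyΩ⟩]; exact contDiffAt_const
      · exact D.d_pos hs hyΩ
    exact ⟨D.d y, hpos, fun x hx h => hmin ⟨hx, h⟩⟩

/-- The building block `θ`. -/
structure Theta (x0 : Euc N) (r τ C : ℝ) (θ : Euc N → ℝ) : Prop where
  lip : ∀ x y, |θ x - θ y| ≤ C * ‖x - y‖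
  cd : ∀ x ∈ closure D.Ω, ContDiffAt ℝ 1 θ x
  lower : ∀ x, -τ ≤ θ x
  upper : ∀ x, θ x ≤ 1 + τ
  off : ∀ x, r ≤ ‖x - x0‖ → 1 - τ ≤ θ x
  ctr : θ x0 ≤ τ
  neu : ∀ s ∈ frontier D.Ω, 0 ≤ ⟪gradient θ s, D.n s⟫
  neus : ∀ s ∈ frontier D.Ω, ‖s - x0‖ ≤ 2 * r → 0 < ⟪gradient θ s, D.n s⟫

lemma exists_theta {r : ℝ} (hr : 0 < r) : ∃ C, 0 ≤ C ∧ ∀ x0 : Euc N, ∀ τ > (0:ℝ), ∃ θ, D.Theta x0 r τ C θ := by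
  obtain ⟨H1, L1, hL1, hHc, hH0, hHd, hHb, hHs, hHl⟩ := exists_profile
  let f : ContDiffBump (0 : Euc N) := ⟨r / 2, r, by positivity, by linarith⟩
  let χ : ContDiffBump (0 : Euc N) := ⟨2 * r, 3 * r, by positivity, by linarith⟩
  obtain ⟨Kf, hKf⟩ := ContDiff.lipschitzWith_of_hasCompactSupport f.hasCompactSupport (f.contDiff (n := 1)) (by norm_num)
  obtain ⟨Kχ, hKχ⟩ := ContDiff.lipschitzWith_of_hasCompactSupport χ.hasCompactSupport (χ.contDiff (n := 1)) (by norm_num)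
  have lf : ∀ x y, |f x - f y| ≤ Kf * ‖x - y‖ := fun x y => by
    have := hKf.dist_le_mul x y; rwa [Real.dist_eq, dist_eq_norm] at this
  have lχ : ∀ x y, |χ x - χ y| ≤ Kχ * ‖x - y‖ := fun x y => by
    have := hKχ.dist_le_mul x y; rwa [Real.dist_eq, dist_eq_norm] at this
  set A : ℝ := Kf + 1 with hA
  have hA0 : 0 < A := by rw [hA]; have := Kf.2; positivity
  refine ⟨Kf + A * (2 * L1 + 2 * Kχ), by positivity, fun x0 τ hτ => ?_⟩
  obtain ⟨m, hm, hmd⟩ := D.exists_delta x0 (3 * r)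
  obtain ⟨δ, hδ, hδ1, hδm, hδτ⟩ : ∃ δ > 0, δ ≤ 1 ∧ 2 * δ < m ∧ A * (2 * δ) ≤ τ := by
    refine ⟨min 1 (min (m / 4) (τ / (2 * A))), by positivity, min_le_left _ _, ?_, ?_⟩
    · have := (min_le_right 1 (min (m / 4) (τ / (2 * A)))).trans (min_le_left _ _); linarith
    · have := (min_le_right 1 (min (m / 4) (τ / (2 * A)))).trans (min_le_right _ _)
      rw [le_div_iff₀ (by positivity)] at this; linarith
  set h : ℝ → ℝ := fun s => δ * H1 (s / δ) with hh
  have hb : ∀ s, |h s| ≤ 2 * δ := fun s => by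
    rw [hh]; simp only [abs_mul, abs_of_pos hδ]; nlinarith [hHb (s / δ)]
  have hl : ∀ s t, |h s - h t| ≤ L1 * |s - t| := fun s t => by
    have := hHl (s / δ) (t / δ)
    rw [← sub_div, abs_div, abs_of_pos hδ] at this
    have e : h s - h t = δ * (H1 (s / δ) - H1 (t / δ)) := by rw [hh]; ring
    rw [e, abs_mul, abs_of_pos hδ]
    calc δ * |H1 (s / δ) - H1 (t / δ)| ≤ δ * (L1 * (|s - t| / δ)) := by gcongr
      _ = L1 * |s - t| := by field_simp
  have hcd : ContDiff ℝ 1 h := contDiff_const.mul (hHc.comp (contDiff_id.div_const δ))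
  have hz : ∀ s, 2 * δ ≤ |s| → h s = 0 := fun s hs => by
    rw [hh]; simp only; rw [hHs, mul_zero]; rw [abs_div, abs_of_pos hδ, le_div_iff₀ hδ]; exact hs
  have hh0 : h 0 = 0 := by simp [hh, hH0]
  have hhd : HasDerivAt h 1 0 := by
    have h1 : HasDerivAt (fun s : ℝ => s / δ) (1 / δ) 0 := (hasDerivAt_id 0).div_const δ
    have h2 : HasDerivAt H1 1 ((fun s : ℝ => s / δ) 0) := by simpa using hHd
    have h3 := (HasDerivAt.comp (0:ℝ) h2 h1).const_mul δ
    have e : δ * (1 * (1 / δ)) = 1 := by field_simp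
    rw [e] at h3; exact h3
  set η : Euc N → ℝ := fun x => h (D.d x) * χ (x - x0) with hη
  have ηb : ∀ x, |A * η x| ≤ τ := fun x => by
    rw [abs_mul, abs_of_pos hA0, hη]
    simp only [abs_mul, abs_of_nonneg χ.nonneg]
    have h1 := hb (D.d x); have h2 := χ.le_one (x := x - x0); have h3 := χ.nonneg (x := x - x0)
    have : |h (D.d x)| * χ (x - x0) ≤ 2 * δ * 1 := mul_le_mul h1 h2 h3 (by positivity)
    calc A * (|h (D.d x)| * χ (x - x0)) ≤ A * (2 * δ * 1) := by gcongr
      _ ≤ τ := by linarith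
  have cf : ∀ x, ContDiffAt ℝ 1 (fun x : Euc N => 1 - f (x - x0)) x := fun x =>
    (contDiff_const.sub (f.contDiff.comp (contDiff_id.sub contDiff_const))).contDiffAt
  have cχ : ContDiff ℝ 1 (fun x : Euc N => χ (x - x0)) := χ.contDiff.comp (contDiff_id.sub contDiff_const)
  have cη : ∀ x ∈ closure D.Ω, ContDiffAt ℝ 1 η x := fun x hx => by
    by_cases hx3 : ‖x - x0‖ ≤ 3 * r
    · by_cases hd : ContDiffAt ℝ 1 D.d x
      · exact (hcd.contDiffAt.comp x hd).mul cχ.contDiffAt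
      · have h1 := hmd x ⟨by rwa [mem_closedBall, dist_eq_norm], hx⟩ hd
        have h2 : η =ᶠ[𝓝 x] fun _ => 0 := by
          filter_upwards [D.d_cont.continuousAt (Ioi_mem_nhds (hδm.trans_le h1))] with y hy
          have hy : 2 * δ < D.d y := hy
          rw [hη]; simp only; rw [hz _ (hy.le.trans (le_abs_self _)), zero_mul]
        exact contDiffAt_const.congr_of_eventuallyEq h2
    · have h2 : η =ᶠ[𝓝 x] fun _ => 0 := by
        have hc : Continuous fun y : Euc N => ‖y - x0‖ := by fun_prop
        filter_upwards [hc.continuousAt (Ioi_mem_nhds (not_le.1 hx3))] with y hy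
        have hy : 3 * r < ‖y - x0‖ := hy
        rw [hη]; simp only
        rw [χ.zero_of_le_dist (by rw [dist_zero_right]; exact hy.le), mul_zero]
      exact contDiffAt_const.congr_of_eventuallyEq h2
  have gθ : ∀ s ∈ frontier D.Ω, ⟪gradient (fun x => (1 - f (x - x0)) - A * η x) s, D.n s⟫ =
      ⟪gradient (fun x => 1 - f (x - x0)) s, D.n s⟫ + A * χ (s - x0) := fun s hs => by
    have d1 : HasFDerivAt (fun x => 1 - f (x - x0)) (fderiv ℝ (fun x => 1 - f (x - x0)) s) s :=
      ((cf s).differentiableAt (by norm_num)).hasFDerivAt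
    have d2 : HasFDerivAt D.d (fderiv ℝ D.d s) s := ((D.cd_d hs).differentiableAt (by norm_num)).hasFDerivAt
    have d3 : HasFDerivAt (fun x => h (D.d x)) ((1:ℝ) • fderiv ℝ D.d s) s := by
      have hd' : HasDerivAt h 1 (D.d s) := by rw [D.d_zero hs]; exact hhd
      exact HasDerivAt.comp_hasFDerivAt (h₂ := h) (f := D.d) s hd' d2
    have d4 : HasFDerivAt (fun x => χ (x - x0)) (fderiv ℝ (fun x => χ (x - x0)) s) s :=
      (cχ.differentiable (by norm_num) s).hasFDerivAt
    have d5 := (d1.sub ((d3.mul d4).const_mul A)).hasGradientAt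
    have e5 := d5.gradient
    have e : gradient (fun x => (1 - f (x - x0)) - A * η x) s = gradient ((fun x => 1 - f (x - x0)) - fun x => A * (h (D.d x) * χ (x - x0))) s := rfl
    rw [e]
    have e6 : ⟪gradient D.d s, D.n s⟫ = -1 := by
      show ⟪gradient (sdist D.Ω) s, D.n s⟫ = -1
      rw [(D.hn s hs).2.gradient, inner_neg_left, real_inner_self_eq_norm_sq, D.n_norm hs]; norm_num
    have e7 : fderiv ℝ D.d s (D.n s) = -1 := by
      rw [← e6]; unfold gradient; rw [InnerProductSpace.toDual_symm_apply]
    change gradient ((fun x => 1 - f (x - x0)) - fun x => A * (h (D.d x) * χ (x - x0))) s = _ at e5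
    rw [e5]
    unfold gradient
    rw [InnerProductSpace.toDual_symm_apply, InnerProductSpace.toDual_symm_apply]
    simp [D.d_zero hs, hh0, e7]
  have gζ : ∀ s ∈ frontier D.Ω, -Kf ≤ ⟪gradient (fun x => 1 - f (x - x0)) s, D.n s⟫ ∧
      (r < ‖s - x0‖ → ⟪gradient (fun x => 1 - f (x - x0)) s, D.n s⟫ = 0) := fun s hs => by
    constructor
    · have hlip : LipschitzWith Kf (fun x => 1 - f (x - x0)) := LipschitzWith.of_dist_le_mul fun x y => by
        rw [Real.dist_eq, dist_eq_norm]
        have := lf (y - x0) (x - x0)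
        have e1 : (1 - f (x - x0)) - (1 - f (y - x0)) = f (y - x0) - f (x - x0) := by ring
        have e2 : ‖x - y‖ = ‖y - x0 - (x - x0)‖ := by rw [norm_sub_rev]; congr 1; abel
        rw [e1, e2]; exact this
      have h1 := norm_fderiv_le_of_lipschitz ℝ hlip (x₀ := s)
      have h2 : ‖gradient (fun x => 1 - f (x - x0)) s‖ ≤ Kf := by
        unfold gradient; rw [LinearIsometryEquiv.norm_map]; exact h1
      have h3 := abs_real_inner_le_norm (gradient (fun x => 1 - f (x - x0)) s) (D.n s)
      rw [D.n_norm hs, mul_one] at h3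
      linarith [(abs_le.1 (h3.trans h2)).1]
    · intro hsr
      have h2 : (fun x => 1 - f (x - x0)) =ᶠ[𝓝 s] fun _ => 1 := by
        have hc : Continuous fun y : Euc N => ‖y - x0‖ := by fun_prop
        filter_upwards [hc.continuousAt (Ioi_mem_nhds hsr)] with y hy
        have hy : r < ‖y - x0‖ := hy
        rw [f.zero_of_le_dist (by rw [dist_zero_right]; exact hy.le), sub_zero]
      have h3 : gradient (fun x => 1 - f (x - x0)) s = 0 := by
        unfold gradient; rw [h2.fderiv_eq]; simp
      rw [h3, inner_zero_left]
  have hχ1 : ∀ s, ‖s - x0‖ ≤ 2 * r → χ (s - x0) = 1 := fun s hs =>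
    χ.one_of_mem_closedBall (by rw [mem_closedBall, dist_zero_right]; exact hs)
  refine ⟨fun x => (1 - f (x - x0)) - A * η x, ?_, ?_, ?_, ?_, ?_, ?_, ?_, ?_⟩
  · intro x y
    have h1 := lf (x - x0) (y - x0)
    have h2 := lχ (x - x0) (y - x0)
    rw [sub_sub_sub_cancel_right] at h1 h2
    have h3 := (hl (D.d x) (D.d y)).trans (mul_le_mul_of_nonneg_left (D.d_lip x y) hL1)
    have h4 := hb (D.d y)
    have e : ((1 - f (x - x0)) - A * η x) - ((1 - f (y - x0)) - A * η y)
        = -(f (x - x0) - f (y - x0)) - A * ((h (D.d x) - h (D.d y)) * χ (x - x0) + h (D.d y) * (χ (x - x0) - χ (y - x0))) := by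
      simp only [hη]; ring
    rw [e]
    have b1 : |(h (D.d x) - h (D.d y)) * χ (x - x0)| ≤ L1 * (2 * ‖x - y‖) := by
      rw [abs_mul, abs_of_nonneg χ.nonneg]
      exact (mul_le_of_le_one_right (abs_nonneg _) χ.le_one).trans h3
    have b2 : |h (D.d y) * (χ (x - x0) - χ (y - x0))| ≤ 2 * (Kχ * ‖x - y‖) := by
      rw [abs_mul]; exact mul_le_mul (h4.trans (by linarith)) h2 (abs_nonneg _) (by norm_num)
    calc _ ≤ |f (x - x0) - f (y - x0)| + A * |((h (D.d x) - h (D.d y)) * χ (x - x0) + h (D.d y) * (χ (x - x0) - χ (y - x0)))| := by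
            refine (abs_sub _ _).trans ?_
            rw [abs_neg, abs_mul, abs_of_pos hA0]
      _ ≤ Kf * ‖x - y‖ + A * (L1 * (2 * ‖x - y‖) + 2 * (Kχ * ‖x - y‖)) := by
            gcongr
            exact (abs_add_le _ _).trans (add_le_add b1 b2)
      _ = _ := by ring
  · intro x hx; exact (cf x).sub (contDiffAt_const.mul (cη x hx))
  · intro x
    have := f.le_one (x := x - x0); have := (abs_le.1 (ηb x)).2; linarith
  · intro x
    have := f.nonneg (x := x - x0); have := (abs_le.1 (ηb x)).1; linarith
  · intro x hx
    rw [f.zero_of_le_dist (by rw [dist_zero_right]; exact hx)]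
    have := (abs_le.1 (ηb x)).2; linarith
  · have : f (x0 - x0) = 1 := f.one_of_mem_closedBall (by rw [sub_self]; exact mem_closedBall_self (by show 0 ≤ r / 2; positivity))
    rw [this]
    have := (abs_le.1 (ηb x0)).1; linarith
  · intro s hs
    rw [gθ s hs]
    by_cases h2 : ‖s - x0‖ ≤ 2 * r
    · rw [hχ1 s h2]; have := (gζ s hs).1; linarith
    · rw [(gζ s hs).2 (by linarith)]; have := χ.nonneg (x := s - x0); positivity
  · intro s hs h2
    rw [gθ s hs, hχ1 s h2]; have := (gζ s hs).1; linarith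

variable {D} in
lemma Touch.grad {u φ f : Euc N × ℝ → ℝ} {x : Euc N} {t : ℝ} {p p0 : Euc N} {a a0 : ℝ}
    (hT : D.Touch u φ x t p a) (ht : 0 < t) (hf : HasFDerivAt f (clm p0 a0) (x, t))
    (hle : ∀ᶠ q in 𝓝[D.Cyl] (x, t), f q - f (x, t) ≤ u q - u (x, t)) :
    (x ∈ D.Ω → p = p0 ∧ a = a0) ∧ (x ∈ frontier D.Ω → ⟪p, D.n x⟫ ≤ ⟪p0, D.n x⟫) := by
  have hg : HasFDerivAt (fun q => φ q - f q) (clm (p - p0) (a - a0)) (x, t) := by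
    have := hT.fd.sub hf
    have e : clm p a - clm p0 a0 = clm (p - p0) (a - a0) := by
      rw [sub_eq_add_neg, clm_neg, clm_add, ← sub_eq_add_neg, ← sub_eq_add_neg]
    rw [e] at this; exact this
  have hmin : ∀ᶠ q in 𝓝[D.Cyl] (x, t), φ (x, t) - f (x, t) ≤ φ q - f q := by
    filter_upwards [hle, hT.le] with q h1 h2; linarith
  constructor
  · intro hx
    have hmem : D.Cyl ∈ 𝓝 (x, t) := by
      refine mem_of_superset (prod_mem_nhds (D.open_Ω.mem_nhds hx) (Ioi_mem_nhds ht)) ?_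
      exact prod_mono subset_closure Ioi_subset_Ici_self
    rw [nhdsWithin_eq_nhds.2 hmem] at hmin
    have hmin' : IsLocalMin (fun q => φ q - f q) (x, t) := hmin
    have h0 : clm (p - p0) (a - a0) = 0 := hmin'.hasFDerivAt_eq_zero hg
    have h1 := congrArg (fun L => L (p - p0, (0:ℝ))) h0
    have h2 := congrArg (fun L => L ((0 : Euc N), (1:ℝ))) h0
    simp only [clm_apply] at h1 h2
    simp at h1 h2
    exact ⟨sub_eq_zero.1 h1, sub_eq_zero.1 h2⟩
  · intro hx
    have hcv : HasDerivAt (fun h : ℝ => ((x - h • D.n x, t) : Euc N × ℝ)) (-D.n x, 0) 0 := by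
      have h1 : HasDerivAt (fun h : ℝ => x - h • D.n x) (-D.n x) 0 := by
        simpa using ((hasDerivAt_id (0:ℝ)).smul_const (D.n x)).const_sub x
      exact h1.prodMk (hasDerivAt_const _ _)
    have hg' : HasFDerivAt (fun q => φ q - f q) (clm (p - p0) (a - a0)) ((fun h : ℝ => ((x - h • D.n x, t) : Euc N × ℝ)) 0) := by
      simpa using hg
    have hd := hg'.comp_hasDerivAt (0:ℝ) hcv
    have hv : clm (p - p0) (a - a0) (-D.n x, 0) = ⟪p0, D.n x⟫ - ⟪p, D.n x⟫ := by
      rw [clm_apply]; simp [inner_sub_left]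
    rw [hv] at hd
    have hev : ∀ᶠ h in 𝓝[>] (0:ℝ), φ (x, t) - f (x, t) ≤ φ (x - h • D.n x, t) - f (x - h • D.n x, t) := by
      have htd : Tendsto (fun h : ℝ => ((x - h • D.n x, t) : Euc N × ℝ)) (𝓝[>] 0) (𝓝[D.Cyl] (x, t)) := by
        refine tendsto_nhdsWithin_iff.2 ⟨?_, ?_⟩
        · have := hcv.continuousAt.tendsto
          simp only [zero_smul, sub_zero] at this
          exact this.mono_left nhdsWithin_le_nhds
        · filter_upwards [D.inward hx] with h hh
          exact D.mem_Cyl.2 ⟨subset_closure hh, ht.le⟩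
      exact htd.eventually hmin
    have hsl := (hasDerivAt_iff_tendsto_slope.1 hd).mono_left (nhdsWithin_mono (0:ℝ) (s := Ioi (0:ℝ)) (t := {(0:ℝ)}ᶜ) (fun y (hy : y ∈ Ioi (0:ℝ)) => (ne_of_gt hy : y ≠ 0)))
    have : 0 ≤ ⟪p0, D.n x⟫ - ⟪p, D.n x⟫ := by
      refine ge_of_tendsto hsl ?_
      filter_upwards [hev, self_mem_nhdsWithin] with h h1 h2
      rw [slope_def_field]
      have h2 : 0 < h := h2
      refine div_nonneg ?_ (by linarith)
      simp only [comp_apply, zero_smul, sub_zero]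
      linarith
    linarith

/-- classical subsolutions -/
lemma classical_sub {H : Euc N → ℝ → ℝ → Euc N → ℝ} {f : Euc N × ℝ → ℝ}
    (h : ∀ x ∈ closure D.Ω, ∀ t > (0:ℝ), ∃ p0 a0, HasFDerivAt f (clm p0 a0) (x, t) ∧
      (x ∈ frontier D.Ω → ⟪p0, D.n x⟫ ≤ 0) ∧
      (x ∈ D.Ω → Integrable (D.inc (fun y => f (y, t)) x) ∧
        a0 + H x t (f (x, t)) p0 ≤ ∫ z, D.inc (fun y => f (y, t)) x z)) : D.LSub H f := by
  intro x hx t ht p a φ hT hor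
  obtain ⟨p0, a0, hf, hfr, hin⟩ := h x hx t ht
  have hg := hT.grad ht hf (Eventually.of_forall fun q => le_rfl)
  rcases D.mem_or hx with hxΩ | hxf
  · obtain ⟨rfl, rfl⟩ := hg.1 hxΩ
    exact hin hxΩ
  · exfalso
    have h1 := hg.2 hxf
    have h2 := hfr hxf
    rcases hor with h3 | h3
    · exact D.not_mem_of_frontier hxf h3
    · linarith

end Dat

lemma pen_seq {E : Type} [MetricSpace E] {K : Set E} (hK : IsCompact K) {X0 : E} (hX0 : X0 ∈ K)
    {u1 u2 ψ : E → ℝ} (h1 : UpperSemicontinuousOn u1 K) (h2 : UpperSemicontinuousOn u2 K)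
    (hψ : ContinuousOn ψ K)
    (hstr : ∀ X ∈ K, u1 X0 + u2 X0 - ψ X0 ≤ u1 X + u2 X - ψ X → X = X0)
    {pen : ℕ → E → E → ℝ} (hpc : ∀ k, ContinuousOn (fun q : E × E => pen k q.1 q.2) (K ×ˢ K))
    (hp0 : ∀ k X Y, 0 ≤ pen k X Y) (hpt : Tendsto (fun k => pen k X0 X0) atTop (𝓝 0))
    {c : ℕ → ℝ} (hc0 : ∀ k, 0 ≤ c k) (hc : Tendsto c atTop (𝓝 0)) (hcd : ∀ k X Y, dist X Y ≤ c k * pen k X Y) :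
    ∃ X Y : ℕ → E, (∀ k, X k ∈ K ∧ Y k ∈ K) ∧
      (∀ k, ∀ X' ∈ K, ∀ Y' ∈ K, u1 X' + u2 Y' - (ψ X' + ψ Y') / 2 - pen k X' Y' ≤
        u1 (X k) + u2 (Y k) - (ψ (X k) + ψ (Y k)) / 2 - pen k (X k) (Y k)) ∧
      Tendsto X atTop (𝓝 X0) ∧ Tendsto Y atTop (𝓝 X0) ∧
      Tendsto (fun k => u1 (X k)) atTop (𝓝 (u1 X0)) ∧ Tendsto (fun k => u2 (Y k)) atTop (𝓝 (u2 X0)) ∧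
      Tendsto (fun k => pen k (X k) (Y k)) atTop (𝓝 0) := by
  have hmax : ∀ k, ∃ q : E × E, q ∈ K ×ˢ K ∧ ∀ q' ∈ K ×ˢ K,
      u1 q'.1 + u2 q'.2 + (-((ψ q'.1 + ψ q'.2) / 2) - pen k q'.1 q'.2) ≤
      u1 q.1 + u2 q.2 + (-((ψ q.1 + ψ q.2) / 2) - pen k q.1 q.2) := fun k => by
    have c1 : ContinuousOn (fun q : E × E => q.1) (K ×ˢ K) := continuousOn_fst
    have c2 : ContinuousOn (fun q : E × E => q.2) (K ×ˢ K) := continuousOn_snd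
    have m1 : MapsTo (fun q : E × E => q.1) (K ×ˢ K) K := fun q hq => hq.1
    have m2 : MapsTo (fun q : E × E => q.2) (K ×ˢ K) K := fun q hq => hq.2
    have hu : UpperSemicontinuousOn (fun q : E × E => u1 q.1 + u2 q.2 + (-((ψ q.1 + ψ q.2) / 2) - pen k q.1 q.2)) (K ×ˢ K) := by
      refine ((h1.comp c1 m1).add (h2.comp c2 m2)).add (ContinuousOn.upperSemicontinuousOn ?_)
      exact (((hψ.comp c1 m1).add (hψ.comp c2 m2)).div_const 2).neg.sub (hpc k)
    obtain ⟨q, hq, hm⟩ := hu.exists_isMaxOn (⟨(X0, X0), ⟨hX0, hX0⟩⟩ : (K ×ˢ K).Nonempty) (hK.prod hK)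
    exact ⟨q, hq, fun q' hq' => hm hq'⟩
  choose q hqK hqm using hmax
  set X := fun k => (q k).1
  set Y := fun k => (q k).2
  have hXK : ∀ k, X k ∈ K := fun k => (hqK k).1
  have hYK : ∀ k, Y k ∈ K := fun k => (hqK k).2
  have hm : ∀ k, ∀ X' ∈ K, ∀ Y' ∈ K, u1 X' + u2 Y' - (ψ X' + ψ Y') / 2 - pen k X' Y' ≤
        u1 (X k) + u2 (Y k) - (ψ (X k) + ψ (Y k)) / 2 - pen k (X k) (Y k) := fun k X' hX' Y' hY' => by
    have := hqm k (X', Y') ⟨hX', hY'⟩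
    simp only at this
    show _ ≤ u1 (q k).1 + u2 (q k).2 - (ψ (q k).1 + ψ (q k).2) / 2 - pen k (q k).1 (q k).2
    linarith
  have key : ∀ k, pen k (X k) (Y k) ≤ u1 (X k) + u2 (Y k) - (ψ (X k) + ψ (Y k)) / 2 - (u1 X0 + u2 X0 - ψ X0) + pen k X0 X0 := fun k => by
    have := hm k X0 hX0 X0 hX0; linarith
  obtain ⟨Z1, hZ1, hb1⟩ := h1.exists_isMaxOn ⟨X0, hX0⟩ hK
  obtain ⟨Z2, hZ2, hb2⟩ := h2.exists_isMaxOn ⟨X0, hX0⟩ hK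
  obtain ⟨Z3, hZ3, hb3⟩ := hK.exists_isMinOn ⟨X0, hX0⟩ hψ
  have hd : Tendsto (fun k => dist (X k) (Y k)) atTop (𝓝 0) := by
    have h3 : ∀ k, dist (X k) (Y k) ≤ c k * ((u1 Z1 + u2 Z2 - ψ Z3 - (u1 X0 + u2 X0 - ψ X0)) + pen k X0 X0) := fun k => by
      refine (hcd k _ _).trans (mul_le_mul_of_nonneg_left ?_ (hc0 k))
      have a1 : u1 (X k) ≤ u1 Z1 := hb1 (hXK k)
      have a2 : u2 (Y k) ≤ u2 Z2 := hb2 (hYK k)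
      have a3 : ψ Z3 ≤ ψ (X k) := hb3 (hXK k)
      have a4 : ψ Z3 ≤ ψ (Y k) := hb3 (hYK k)
      linarith [key k]
    refine squeeze_zero (fun _ => dist_nonneg) h3 ?_
    simpa using hc.mul (hpt.const_add (u1 Z1 + u2 Z2 - ψ Z3 - (u1 X0 + u2 X0 - ψ X0)))
  -- usc along sequences
  have usc : ∀ {u : E → ℝ}, UpperSemicontinuousOn u K → ∀ {Z : ℕ → E} {Z0 : E}, Z0 ∈ K → (∀ k, Z k ∈ K) →
      Tendsto Z atTop (𝓝 Z0) → ∀ ε > 0, ∀ᶠ k in atTop, u (Z k) < u Z0 + ε := fun hu Z Z0 hZ0 hZ hZt ε hε => by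
    have := hu Z0 hZ0 (_ + ε) (lt_add_of_pos_right _ hε)
    exact (tendsto_nhdsWithin_iff.2 ⟨hZt, Eventually.of_forall hZ⟩).eventually this
  have hX : Tendsto X atTop (𝓝 X0) := by
    refine hK.tendsto_nhds_of_unique_mapClusterPt (Eventually.of_forall hXK) fun Z hZ hcl => ?_
    obtain ⟨φ, hφ, hφt⟩ := hcl.tendsto_subseq
    have hYt : Tendsto (fun k => Y (φ k)) atTop (𝓝 Z) :=
      (tendsto_iff_of_dist (hd.comp hφ.tendsto_atTop)).1 hφt
    refine hstr Z hZ (le_of_forall_pos_le_add fun ε hε => ?_)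
    have e1 := usc h1 hZ (fun k => hXK (φ k)) hφt (ε / 8) (by positivity)
    have e2 := usc h2 hZ (fun k => hYK (φ k)) hYt (ε / 8) (by positivity)
    have e3 := usc hψ.neg.upperSemicontinuousOn hZ (fun k => hXK (φ k)) hφt (ε / 8) (by positivity)
    have e4 := usc hψ.neg.upperSemicontinuousOn hZ (fun k => hYK (φ k)) hYt (ε / 8) (by positivity)
    have e5 := (hpt.comp hφ.tendsto_atTop) (Iio_mem_nhds (show (0:ℝ) < ε / 8 by positivity))
    obtain ⟨k, f1, f2, f3, f4, f5⟩ := (e1.and (e2.and (e3.and (e4.and e5)))).exists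
    have f5 : pen (φ k) X0 X0 < ε / 8 := f5
    simp only [Pi.neg_apply] at f3 f4
    have := key (φ k); have := hp0 (φ k) (X (φ k)) (Y (φ k))
    linarith
  have hY : Tendsto Y atTop (𝓝 X0) := (tendsto_iff_of_dist hd).1 hX
  have tψX : Tendsto (fun k => ψ (X k)) atTop (𝓝 (ψ X0)) :=
    (hψ X0 hX0).tendsto.comp (tendsto_nhdsWithin_iff.2 ⟨hX, Eventually.of_forall hXK⟩)
  have tψY : Tendsto (fun k => ψ (Y k)) atTop (𝓝 (ψ X0)) :=
    (hψ X0 hX0).tendsto.comp (tendsto_nhdsWithin_iff.2 ⟨hY, Eventually.of_forall hYK⟩)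
  have hlow : ∀ ε > 0, ∀ᶠ k in atTop, u1 X0 + u2 X0 - ε < u1 (X k) + u2 (Y k) - pen k (X k) (Y k) := fun ε hε => by
    filter_upwards [tψX (Ioi_mem_nhds (show ψ X0 - ε / 4 < ψ X0 by linarith)), tψY (Ioi_mem_nhds (show ψ X0 - ε / 4 < ψ X0 by linarith)),
      hpt (Iio_mem_nhds (show (0:ℝ) < ε / 4 by positivity))] with k f1 f2 f3
    have f1 : ψ X0 - ε / 4 < ψ (X k) := f1
    have f2 : ψ X0 - ε / 4 < ψ (Y k) := f2
    have f3 : pen k X0 X0 < ε / 4 := f3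
    linarith [key k]
  refine ⟨X, Y, fun k => ⟨hXK k, hYK k⟩, hm, hX, hY, ?_, ?_, ?_⟩
  · rw [Metric.tendsto_nhds]
    intro ε hε
    filter_upwards [usc h1 hX0 hXK hX (ε / 2) (by positivity), usc h2 hX0 hYK hY (ε / 4) (by positivity), hlow (ε / 4) (by positivity)] with k f1 f2 f3
    rw [Real.dist_eq, abs_lt]; have := hp0 k (X k) (Y k)
    constructor <;> linarith
  · rw [Metric.tendsto_nhds]
    intro ε hε
    filter_upwards [usc h1 hX0 hXK hX (ε / 4) (by positivity), usc h2 hX0 hYK hY (ε / 2) (by positivity), hlow (ε / 4) (by positivity)] with k f1 f2 f3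
    rw [Real.dist_eq, abs_lt]; have := hp0 k (X k) (Y k)
    constructor <;> linarith
  · rw [Metric.tendsto_nhds]
    intro ε hε
    filter_upwards [usc h1 hX0 hXK hX (ε / 4) (by positivity), usc h2 hX0 hYK hY (ε / 4) (by positivity), hlow (ε / 4) (by positivity)] with k f1 f2 f3
    rw [Real.dist_eq, sub_zero, abs_of_nonneg (hp0 _ _ _)]
    linarith

/-- regularized absolute value -/
def br (ρ s : ℝ) : ℝ := √(s ^ 2 + ρ ^ 2)

lemma br_pos {ρ : ℝ} (hρ : 0 < ρ) (s : ℝ) : 0 < br ρ s := Real.sqrt_pos.2 (by positivity)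
lemma br_ge (ρ s : ℝ) : |s| ≤ br ρ s := by
  rw [← Real.sqrt_sq_eq_abs]; exact Real.sqrt_le_sqrt (by nlinarith [sq_nonneg ρ])
lemma br_zero {ρ : ℝ} (hρ : 0 < ρ) : br ρ 0 = ρ := by
  unfold br; rw [zero_pow two_ne_zero, zero_add, Real.sqrt_sq hρ.le]
lemma br_sub {ρ : ℝ} (hρ : 0 < ρ) (s t : ℝ) : br ρ s - br ρ t ≤ |s - t| := by
  have h1 := br_pos hρ s; have h2 := br_pos hρ t
  have e1 : br ρ s ^ 2 = s ^ 2 + ρ ^ 2 := Real.sq_sqrt (by positivity)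
  have e2 : br ρ t ^ 2 = t ^ 2 + ρ ^ 2 := Real.sq_sqrt (by positivity)
  have g1 := br_ge ρ s; have g2 := br_ge ρ t
  have h3 : (br ρ s - br ρ t) * (br ρ s + br ρ t) ≤ |s - t| * (br ρ s + br ρ t) := by
    have : (br ρ s - br ρ t) * (br ρ s + br ρ t) = (s - t) * (s + t) := by nlinarith
    rw [this]
    calc (s - t) * (s + t) ≤ |s - t| * |s + t| := by rw [← abs_mul]; exact le_abs_self _
      _ ≤ _ := by gcongr; exact (abs_add_le s t).trans (add_le_add g1 g2)
  exact le_of_mul_le_mul_right h3 (by linarith)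

/-- derivative coefficient -/
lemma br_coef {ρ : ℝ} (hρ : 0 < ρ) (s : ℝ) : |s / br ρ s| ≤ 1 := by
  rw [abs_div, abs_of_pos (br_pos hρ s)]; exact (div_le_one (br_pos hρ s)).2 (br_ge ρ s)

lemma br_coef_ge {ρ s : ℝ} (hρ : 0 < ρ) (hs : ρ ≤ |s|) : 1 / 2 ≤ |s| / br ρ s := by
  rw [le_div_iff₀ (br_pos hρ s)]
  have : br ρ s ≤ √((2 * |s|) ^ 2) := by
    apply Real.sqrt_le_sqrt
    have : ρ ^ 2 ≤ |s| ^ 2 := by gcongr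
    nlinarith [sq_abs s, sq_nonneg s]
  rw [Real.sqrt_sq (by positivity)] at this
  linarith

lemma br_cont (ρ : ℝ) : Continuous (br ρ) := by unfold br; fun_prop

lemma br_cd {ρ : ℝ} (hρ : 0 < ρ) : ContDiff ℝ 1 (br ρ) := by
  unfold br
  exact ((contDiff_id.pow 2).add contDiff_const).sqrt (fun s => by positivity)

lemma br_deriv {ρ : ℝ} (hρ : 0 < ρ) (s : ℝ) : HasDerivAt (br ρ) (s / br ρ s) s := by
  have h := ((hasDerivAt_pow 2 s).add_const (ρ ^ 2)).sqrt (by positivity)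
  have h1 := br_pos hρ s
  have e : s / br ρ s = ((2:ℕ) : ℝ) * s ^ (2 - 1) / (2 * br ρ s) := by
    rw [Nat.cast_ofNat, pow_one, mul_div_mul_left _ _ two_ne_zero]
  rw [e]; exact h

/-- norm version -/
lemma brn_cd {ρ : ℝ} (hρ : 0 < ρ) (y : Euc N) : ContDiff ℝ 1 (fun x : Euc N => br ρ ‖x - y‖) := by
  unfold br
  exact (((contDiff_id.sub contDiff_const).norm_sq ℝ).add contDiff_const).sqrt (fun s => by positivity)

lemma brn_deriv {ρ : ℝ} (hρ : 0 < ρ) (x y : Euc N) :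
    HasFDerivAt (fun x : Euc N => br ρ ‖x - y‖) (innerSL ℝ ((br ρ ‖x - y‖)⁻¹ • (x - y))) x := by
  have h1 : HasFDerivAt (fun x : Euc N => ‖x - y‖ ^ 2) (2 • innerSL ℝ (x - y)) x := by
    have := (hasStrictFDerivAt_norm_sq (x - y)).hasFDerivAt.comp x ((hasFDerivAt_id x).sub_const y)
    simpa [comp_def] using this
  have h2 : 0 < ‖x - y‖ ^ 2 + ρ ^ 2 := by positivity
  have h := (h1.add_const (ρ ^ 2)).sqrt h2.ne'
  have e : (innerSL ℝ ((br ρ ‖x - y‖)⁻¹ • (x - y))) = (1 / (2 * √(‖x - y‖ ^ 2 + ρ ^ 2))) • (2 • innerSL ℝ (x - y)) := by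
    have h3 := br_pos hρ ‖x - y‖
    ext v
    show ⟪(br ρ ‖x - y‖)⁻¹ • (x - y), v⟫ = (1 / (2 * br ρ ‖x - y‖)) * (2 • ⟪x - y, v⟫)
    rw [real_inner_smul_left]
    simp; field_simp
  rw [e]; exact h

/-- components of a continuous linear form -/
def cpp (L : (Euc N × ℝ) →L[ℝ] ℝ) : Euc N :=
  (InnerProductSpace.toDual ℝ (Euc N)).symm (L.comp (ContinuousLinearMap.inl ℝ (Euc N) ℝ))
def cpa (L : (Euc N × ℝ) →L[ℝ] ℝ) : ℝ := L (0, 1)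

lemma clm_cp (L : (Euc N × ℝ) →L[ℝ] ℝ) : clm (cpp L) (cpa L) = L := by
  ext q <;> simp [clm, cpp, cpa]
lemma cpp_clm (p : Euc N) (a : ℝ) : cpp (clm p a) = p := by
  apply ext_inner_right ℝ; intro v
  simp [clm, cpp]
lemma cpa_clm (p : Euc N) (a : ℝ) : cpa (clm p a) = a := by simp [clm, cpa]
lemma cpp_cont : Continuous (cpp : ((Euc N × ℝ) →L[ℝ] ℝ) → Euc N) := by
  unfold cpp
  refine (InnerProductSpace.toDual ℝ (Euc N)).symm.continuous.comp ?_
  fun_prop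
lemma cpa_cont : Continuous (cpa : ((Euc N × ℝ) →L[ℝ] ℝ) → ℝ) := by
  unfold cpa; fun_prop

namespace Dat
variable (D : Dat N)

/-- localized distance-like function -/
structure Loc (s : Euc N) (r L : ℝ) (e : Euc N → ℝ) (ge : Euc N → Euc N) : Prop where
  r_pos : 0 < r
  L_nonneg : 0 ≤ L
  cd : ∀ x ∈ ball s r, ContDiffAt ℝ 1 e x
  grad : ∀ x ∈ ball s r, HasFDerivAt e (innerSL ℝ (ge x)) x
  gle : ∀ x ∈ ball s r, ‖ge x‖ ≤ 2
  glip : ∀ x ∈ ball s r, ∀ y ∈ ball s r, ‖ge x - ge y‖ ≤ L * ‖x - y‖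
  lipe : ∀ x y, |e x - e y| ≤ 2 * ‖x - y‖
  second : ∀ x ∈ ball s r, ∀ y ∈ ball s r, ∀ w : Euc N, ‖w‖ < r → |(e (x + w) - e x) - (e (y + w) - e y)| ≤ L * ‖w‖ * ‖x - y‖
  tay : ∀ x ∈ ball s r, ∀ y ∈ ball s r, x ∈ frontier D.Ω → y ∈ closure D.Ω → -(L * ‖x - y‖ * ‖x - y‖) ≤ ⟪x - y, D.n x⟫
  nrm : ∀ x ∈ ball s r, ∀ y ∈ closure D.Ω, x ∈ frontier D.Ω → e x - e y ≤ 0 ∧ ⟪ge x, D.n x⟫ ≤ 0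

lemma exists_loc {s : Euc N} (hs : s ∈ closure D.Ω) : ∃ r L e ge, D.Loc s r L e ge ∧
    (s ∈ frontier D.Ω → e = D.d ∧ ge = D.gd) := by
  rcases D.mem_or hs with hs | hs
  · obtain ⟨r, hr, hb⟩ := Metric.isOpen_iff.1 D.open_Ω s hs
    refine ⟨r, 0, fun _ => 0, fun _ => 0, ⟨hr, le_rfl, fun _ _ => contDiffAt_const, fun x _ => by
      simpa using hasFDerivAt_const (0:ℝ) x, by simp, by simp, ?_, by simp, ?_, ?_⟩, fun h => (D.not_mem_of_frontier h hs).elim⟩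
    · intro x y; simp
    · intro x hx y _ hxf; exact (D.not_mem_of_frontier hxf (hb hx)).elim
    · intro x hx y _ hxf; exact (D.not_mem_of_frontier hxf (hb hx)).elim
  · obtain ⟨r, L, h⟩ := D.exists_near hs
    have hr := h.r_pos
    have hsub : ball s (r / 2) ⊆ ball s r := ball_subset_ball (by linarith)
    refine ⟨r / 2, L, D.d, D.gd, ⟨by linarith, h.L_nonneg, fun x hx => h.cd.contDiffAt (isOpen_ball.mem_nhds (hsub hx)),
      fun x hx => h.hasFD (hsub hx), fun x hx => h.gd_le (hsub hx),
      fun x hx y hy => h.lip x (hsub hx) y (hsub hy), D.d_lip, fun x hx y hy w hw => h.second hx hy hw, ?_, ?_⟩, fun _ => ⟨rfl, rfl⟩⟩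
    · intro x hx y hy hxf hyc
      have h1 := h.taylor (hsub hx) (hsub hy)
      rw [D.d_zero hxf, Near.gd_frontier hxf, norm_sub_rev y x] at h1
      have h2 := D.d_nonneg hs hyc
      have h3 := (abs_le.1 h1).2
      have h4 : ⟪-D.n x, y - x⟫ = ⟪x - y, D.n x⟫ := by
        rw [real_inner_comm, inner_neg_right, ← inner_neg_left]; congr 1; abel
      rw [h4] at h3
      linarith
    · intro x hx y hy hxf
      rw [D.d_zero hxf, Near.gd_frontier hxf, inner_neg_left, real_inner_self_eq_norm_sq]
      have := D.d_nonneg hs hy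
      constructor <;> nlinarith [sq_nonneg ‖D.n x‖]

end Dat

/-- penalization gradient -/
def gr (e : Euc N → ℝ) (ge : Euc N → Euc N) (P Q ρ : ℝ) (x y : Euc N) : Euc N :=
  (P * (br ρ ‖x - y‖)⁻¹) • (x - y) + (Q * ((e x - e y) / br ρ (e x - e y))) • ge x
/-- penalization time derivative -/
def ta (R ρ t s : ℝ) : ℝ := R * ((t - s) / br ρ (t - s))

lemma br_neg (ρ s : ℝ) : br ρ (-s) = br ρ s := by unfold br; rw [neg_sq]

lemma ta_swap (R ρ t s : ℝ) : ta R ρ s t = -ta R ρ t s := by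
  unfold ta; rw [← neg_sub t s, br_neg]; ring

lemma ta_abs {R ρ : ℝ} (hR : 0 ≤ R) (hρ : 0 < ρ) (t s : ℝ) : |ta R ρ t s| ≤ R := by
  unfold ta; rw [abs_mul, abs_of_nonneg hR]; exact mul_le_of_le_one_right hR (br_coef hρ _)

lemma gr_add (e : Euc N → ℝ) (ge : Euc N → Euc N) (P Q ρ : ℝ) (x y : Euc N) :
    gr e ge P Q ρ x y + gr e ge P Q ρ y x = (Q * ((e x - e y) / br ρ (e x - e y))) • (ge x - ge y) := by
  unfold gr
  rw [norm_sub_rev y x, ← neg_sub x y, ← neg_sub (e x) (e y), br_neg, smul_neg, smul_sub (Q * ((e x - e y) / br ρ (e x - e y))) (ge x) (ge y), neg_div, mul_neg, neg_smul]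
  abel

lemma brn_coef {ρ : ℝ} (hρ : 0 < ρ) {P : ℝ} (hP : 0 ≤ P) (v : Euc N) : ‖(P * (br ρ ‖v‖)⁻¹) • v‖ ≤ P := by
  have h := br_pos hρ ‖v‖
  rw [norm_smul, Real.norm_eq_abs, abs_of_nonneg (by positivity), mul_assoc]
  refine mul_le_of_le_one_right hP ?_
  rw [inv_mul_le_iff₀ h, mul_one]
  have := br_ge ρ ‖v‖; rwa [abs_of_nonneg (norm_nonneg _)] at this

lemma gr_norm {e : Euc N → ℝ} {ge : Euc N → Euc N} {P Q ρ : ℝ} (hP : 0 ≤ P) (hQ : 0 ≤ Q) (hρ : 0 < ρ) {x y : Euc N}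
    (hg : ‖ge x‖ ≤ 2) : ‖gr e ge P Q ρ x y‖ ≤ P + 2 * Q := by
  unfold gr
  refine (norm_add_le _ _).trans (add_le_add (brn_coef hρ hP _) ?_)
  rw [norm_smul, Real.norm_eq_abs, abs_mul, abs_of_nonneg hQ]
  have := br_coef hρ (e x - e y)
  calc Q * |(e x - e y) / br ρ (e x - e y)| * ‖ge x‖ ≤ Q * 1 * 2 := by gcongr
    _ = _ := by ring

lemma gr_add_norm {e : Euc N → ℝ} {ge : Euc N → Euc N} {P Q ρ L : ℝ} (hQ : 0 ≤ Q) (hρ : 0 < ρ) {x y : Euc N}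
    (hg : ‖ge x - ge y‖ ≤ L * ‖x - y‖) : ‖gr e ge P Q ρ x y + gr e ge P Q ρ y x‖ ≤ L * (Q * ‖x - y‖) := by
  rw [gr_add, norm_smul, Real.norm_eq_abs, abs_mul, abs_of_nonneg hQ]
  have := br_coef hρ (e x - e y)
  calc Q * |(e x - e y) / br ρ (e x - e y)| * ‖ge x - ge y‖ ≤ Q * 1 * (L * ‖x - y‖) := by gcongr
    _ = _ := by ring

namespace Dat
variable (D : Dat N)

/-- The outcome of the doubling of variables. -/
structure Dbl (u1 u2 : Euc N × ℝ → ℝ) (xh : Euc N) (th : ℝ) (p : Euc N) (a : ℝ) (e : Euc N → ℝ) (ge : Euc N → Euc N)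
    (r C0 : ℝ) (P Q R ρ : ℕ → ℝ) (x y : ℕ → Euc N) (t s : ℕ → ℝ) (p1 p2 : ℕ → Euc N) (a1 a2 : ℕ → ℝ) : Prop where
  r_pos : 0 < r
  C0_nonneg : 0 ≤ C0
  hx : ∀ k, x k ∈ closure D.Ω
  hy : ∀ k, y k ∈ closure D.Ω
  ht : ∀ k, 0 < t k
  hs : ∀ k, 0 < s k
  tx : Tendsto x atTop (𝓝 xh)
  ty : Tendsto y atTop (𝓝 xh)
  tt : Tendsto t atTop (𝓝 th)
  ts : Tendsto s atTop (𝓝 th)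
  tu1 : Tendsto (fun k => u1 (x k, t k)) atTop (𝓝 (u1 (xh, th)))
  tu2 : Tendsto (fun k => u2 (y k, s k)) atTop (𝓝 (u2 (xh, th)))
  Pq : Tendsto (fun k => P k * ‖x k - y k‖) atTop (𝓝 0)
  Rq : Tendsto (fun k => R k * |t k - s k|) atTop (𝓝 0)
  tp1 : Tendsto p1 atTop (𝓝 ((1/2:ℝ) • p))
  tp2 : Tendsto p2 atTop (𝓝 ((1/2:ℝ) • p))
  ta1 : Tendsto a1 atTop (𝓝 (1/2 * a))
  ta2 : Tendsto a2 atTop (𝓝 (1/2 * a))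
  touch1 : ∀ᶠ k in atTop, ∃ φ, D.Touch u1 φ (x k) (t k) (p1 k + gr e ge (P k) (Q k) (ρ k) (x k) (y k)) (a1 k + ta (R k) (ρ k) (t k) (s k))
  touch2 : ∀ᶠ k in atTop, ∃ φ, D.Touch u2 φ (y k) (s k) (p2 k + gr e ge (P k) (Q k) (ρ k) (y k) (x k)) (a2 k + ta (R k) (ρ k) (s k) (t k))
  var : ∀ k, ∀ x' ∈ closure D.Ω, x' ∈ ball xh r → ∀ y' ∈ closure D.Ω, y' ∈ ball xh r →
    u1 (x', t k) - u1 (x k, t k) + (u2 (y', s k) - u2 (y k, s k)) ≤ C0 * (‖x' - x k‖ + ‖y' - y k‖)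
      + P k * |‖x' - y'‖ - ‖x k - y k‖| + Q k * |(e x' - e y') - (e (x k) - e (y k))|
  varw : ∀ y' ∈ closure D.Ω, y' ∈ ball xh r → u1 (y', th) + u2 (y', th) - (u1 (xh, th) + u2 (xh, th)) ≤ C0 * ‖y' - xh‖

variable {D} in
lemma Dbl.swap {u1 u2 : Euc N × ℝ → ℝ} {xh : Euc N} {th : ℝ} {p : Euc N} {a : ℝ} {e : Euc N → ℝ} {ge : Euc N → Euc N}
    {r C0 : ℝ} {P Q R ρ : ℕ → ℝ} {x y : ℕ → Euc N} {t s : ℕ → ℝ} {p1 p2 : ℕ → Euc N} {a1 a2 : ℕ → ℝ}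
    (h : D.Dbl u1 u2 xh th p a e ge r C0 P Q R ρ x y t s p1 p2 a1 a2) :
    D.Dbl u2 u1 xh th p a e ge r C0 P Q R ρ y x s t p2 p1 a2 a1 where
  r_pos := h.r_pos
  C0_nonneg := h.C0_nonneg
  hx := h.hy
  hy := h.hx
  ht := h.hs
  hs := h.ht
  tx := h.ty
  ty := h.tx
  tt := h.ts
  ts := h.tt
  tu1 := h.tu2
  tu2 := h.tu1
  Pq := by simpa only [norm_sub_rev] using h.Pq
  Rq := by simpa only [abs_sub_comm] using h.Rq
  tp1 := h.tp2
  tp2 := h.tp1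
  ta1 := h.ta2
  ta2 := h.ta1
  touch1 := h.touch2
  touch2 := h.touch1
  var := fun k x' hx' hxb y' hy' hyb => by
    have := h.var k y' hy' hyb x' hx' hxb
    rw [norm_sub_rev y' x', norm_sub_rev (x k) (y k)] at this
    have e1 : |(e y' - e x') - (e (x k) - e (y k))| = |(e x' - e y') - (e (y k) - e (x k))| := by
      rw [← abs_neg]; congr 1; ring
    rw [e1] at this
    linarith
  varw := fun y' hy' hyb => by have := h.varw y' hy' hyb; linarith

lemma pen_fd {e : Euc N → ℝ} {ge : Euc N → Euc N} {P Q R ρ : ℝ} (hρ : 0 < ρ) {x y : Euc N} {t s : ℝ}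
    (hcd : ContDiffAt ℝ 1 e x) (hg : HasFDerivAt e (innerSL ℝ (ge x)) x) :
    ContDiffAt ℝ 1 (fun q : Euc N × ℝ => P * br ρ ‖q.1 - y‖ + Q * br ρ (e q.1 - e y) + R * br ρ (q.2 - s)) (x, t) ∧
    HasFDerivAt (fun q : Euc N × ℝ => P * br ρ ‖q.1 - y‖ + Q * br ρ (e q.1 - e y) + R * br ρ (q.2 - s))
      (clm (gr e ge P Q ρ x y) (ta R ρ t s)) (x, t) := by
  have hf : HasFDerivAt (fun q : Euc N × ℝ => q.1) (ContinuousLinearMap.fst ℝ (Euc N) ℝ) (x, t) := hasFDerivAt_fst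
  have hsn : HasFDerivAt (fun q : Euc N × ℝ => q.2) (ContinuousLinearMap.snd ℝ (Euc N) ℝ) (x, t) := hasFDerivAt_snd
  constructor
  · refine ContDiffAt.add (ContDiffAt.add (contDiffAt_const.mul ?_) (contDiffAt_const.mul ?_)) (contDiffAt_const.mul ?_)
    · exact ((brn_cd hρ y).comp contDiff_fst).contDiffAt
    · refine (br_cd hρ).contDiffAt.comp (x, t) (ContDiffAt.sub ?_ contDiffAt_const)
      exact ContDiffAt.comp (g := e) (f := Prod.fst) (x, t) hcd contDiffAt_fst
    · exact ((br_cd hρ).comp (contDiff_snd.sub contDiff_const)).contDiffAt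
  · have h1 := (HasFDerivAt.comp (g := fun x : Euc N => br ρ ‖x - y‖) (f := Prod.fst) (x, t) (brn_deriv hρ x y) hf).const_mul P
    have h2' : HasFDerivAt (fun q : Euc N × ℝ => e q.1 - e y) ((innerSL ℝ (ge x)).comp (ContinuousLinearMap.fst ℝ (Euc N) ℝ)) (x, t) :=
      (HasFDerivAt.comp (g := e) (f := Prod.fst) (x, t) hg hf).sub_const _
    have h2 := (HasDerivAt.comp_hasFDerivAt (h₂ := br ρ) (f := fun q : Euc N × ℝ => e q.1 - e y) (x, t) (br_deriv hρ (e x - e y)) h2').const_mul Q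
    have h3' : HasFDerivAt (fun q : Euc N × ℝ => q.2 - s) (ContinuousLinearMap.snd ℝ (Euc N) ℝ) (x, t) := hsn.sub_const _
    have h3 := (HasDerivAt.comp_hasFDerivAt (h₂ := br ρ) (f := fun q : Euc N × ℝ => q.2 - s) (x, t) (br_deriv hρ (t - s)) h3').const_mul R
    have h := (h1.add h2).add h3
    have e : clm (gr e ge P Q ρ x y) (ta R ρ t s) = P • ((innerSL ℝ ((br ρ ‖x - y‖)⁻¹ • (x - y))).comp (ContinuousLinearMap.fst ℝ (Euc N) ℝ))
        + Q • (((e x - e y) / br ρ (e x - e y)) • (innerSL ℝ (ge x)).comp (ContinuousLinearMap.fst ℝ (Euc N) ℝ))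
        + R • (((t - s) / br ρ (t - s)) • ContinuousLinearMap.snd ℝ (Euc N) ℝ) := by
      ext q <;> simp [clm, gr, ta, inner_add_left, real_inner_smul_left] <;> ring
    rw [e]; exact h

lemma exists_dbl {u1 u2 ψ : Euc N × ℝ → ℝ} {xh : Euc N} {th : ℝ} {p : Euc N} {a : ℝ} {e : Euc N → ℝ} {ge : Euc N → Euc N}
    {r0 L : ℝ} {P Q R ρ : ℕ → ℝ} (h1 : UpperSemicontinuousOn u1 D.Cyl) (h2 : UpperSemicontinuousOn u2 D.Cyl)
    (hxh : xh ∈ closure D.Ω) (hth : 0 < th) (hT : D.Touch (fun q => u1 q + u2 q) ψ xh th p a)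
    (hl : D.Loc xh r0 L e ge) (hP : ∀ k, 0 < P k) (hQ : ∀ k, 0 ≤ Q k) (hR : ∀ k, 0 < R k) (hρ : ∀ k, 0 < ρ k)
    (hPt : Tendsto P atTop atTop) (hRt : Tendsto R atTop atTop)
    (hρt : Tendsto (fun k => (P k + Q k + R k) * ρ k) atTop (𝓝 0)) :
    ∃ r C0 x y t s p1 p2 a1 a2, r ≤ r0 ∧ D.Dbl u1 u2 xh th p a e ge r C0 P Q R ρ x y t s p1 p2 a1 a2 := by
  set ψ' : Euc N × ℝ → ℝ := fun q => ψ q + (‖q.1 - xh‖ ^ 2 + (q.2 - th) ^ 2) with hψ'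
  have hsqc : ContDiff ℝ 1 (fun q : Euc N × ℝ => ‖q.1 - xh‖ ^ 2 + (q.2 - th) ^ 2) :=
    ((contDiff_fst.sub contDiff_const).norm_sq ℝ).add ((contDiff_snd.sub contDiff_const).pow 2)
  have hcd : ContDiffAt ℝ 1 ψ' (xh, th) := hT.cd.add hsqc.contDiffAt
  have hsq0 : HasFDerivAt (fun q : Euc N × ℝ => ‖q.1 - xh‖ ^ 2 + (q.2 - th) ^ 2) (0 : (Euc N × ℝ) →L[ℝ] ℝ) (xh, th) := by
    have hd := (hsqc.differentiable (by norm_num) (xh, th)).hasFDerivAt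
    have hmin : IsLocalMin (fun q : Euc N × ℝ => ‖q.1 - xh‖ ^ 2 + (q.2 - th) ^ 2) (xh, th) :=
      Eventually.of_forall fun q => by simp; positivity
    rw [hmin.fderiv_eq_zero] at hd; exact hd
  have hfd : HasFDerivAt ψ' (clm p a) (xh, th) := by have := hT.fd.add hsq0; rw [add_zero] at this; exact this
  have hcdn : ∀ᶠ q in 𝓝 (xh, th), ContDiffAt ℝ 1 ψ' q := hcd.eventually (by simp)
  obtain ⟨K0, S, hS, hK0⟩ := hcd.exists_lipschitzOnWith
  have hle := eventually_nhdsWithin_iff.1 hT.le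
  have hball : ∀ᶠ q : Euc N × ℝ in 𝓝 (xh, th), q.1 ∈ ball xh r0 ∧ 0 < q.2 := by
    have c1 : Tendsto (fun q : Euc N × ℝ => q.1) (𝓝 (xh, th)) (𝓝 xh) := continuous_fst.tendsto _
    have c2 : Tendsto (fun q : Euc N × ℝ => q.2) (𝓝 (xh, th)) (𝓝 th) := continuous_snd.tendsto _
    exact (c1.eventually (ball_mem_nhds _ hl.r_pos)).and (c2.eventually (Ioi_mem_nhds hth))
  obtain ⟨ε, hε, hεs⟩ := (Metric.nhds_basis_closedBall.eventually_iff).1 (hcdn.and (hle.and (hball.and hS)))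
  have hr0 := hl.r_pos
  set r := min ε r0 with hr
  have hrpos : 0 < r := lt_min hε hr0
  have hrs : ∀ ⦃q⦄, q ∈ closedBall (xh, th) r → _ := fun q hq => hεs (closedBall_subset_closedBall (min_le_left _ _) hq)
  set K := D.Cyl ∩ closedBall (xh, th) r with hK
  have hKc : IsCompact K := (isCompact_closedBall _ _).inter_left D.Cyl_closed
  have hX0 : (xh, th) ∈ K := ⟨D.mem_Cyl.2 ⟨hxh, hth.le⟩, mem_closedBall_self hrpos.le⟩
  have hecont : Continuous e := by
    have : LipschitzWith 2 e := LipschitzWith.of_dist_le_mul fun x y => by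
      rw [Real.dist_eq, dist_eq_norm]; exact hl.lipe x y
    exact this.continuous
  set pen : ℕ → Euc N × ℝ → Euc N × ℝ → ℝ := fun k X Y =>
    P k * br (ρ k) ‖X.1 - Y.1‖ + Q k * br (ρ k) (e X.1 - e Y.1) + R k * br (ρ k) (X.2 - Y.2) with hpen
  have hp0 : ∀ k X Y, 0 ≤ pen k X Y := fun k X Y => by
    have g1 := br_pos (hρ k) ‖X.1 - Y.1‖; have g2 := br_pos (hρ k) (e X.1 - e Y.1); have g3 := br_pos (hρ k) (X.2 - Y.2)
    have := hP k; have := hQ k; have := hR k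
    simp only [hpen]; positivity
  have hpP : ∀ k X Y, P k * ‖X.1 - Y.1‖ ≤ pen k X Y ∧ R k * |X.2 - Y.2| ≤ pen k X Y := fun k X Y => by
    have g1 := br_pos (hρ k) ‖X.1 - Y.1‖; have g2 := br_pos (hρ k) (e X.1 - e Y.1); have g3 := br_pos (hρ k) (X.2 - Y.2)
    have f1 := br_ge (ρ k) ‖X.1 - Y.1‖; have f3 := br_ge (ρ k) (X.2 - Y.2)
    rw [abs_of_nonneg (norm_nonneg _)] at f1
    have h1 := mul_le_mul_of_nonneg_left f1 (hP k).le
    have h3 := mul_le_mul_of_nonneg_left f3 (hR k).le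
    have h2 := mul_nonneg (hQ k) g2.le
    have h4 := mul_nonneg (hP k).le g1.le
    have h5 := mul_nonneg (hR k).le g3.le
    simp only [hpen]
    constructor <;> linarith
  have hstr : ∀ X ∈ K, u1 (xh, th) + u2 (xh, th) - ψ' (xh, th) ≤ u1 X + u2 X - ψ' X → X = (xh, th) := by
    intro X hX hh
    have hw := (hrs hX.2).2.1 hX.1
    have e0 : ψ' (xh, th) = ψ (xh, th) := by simp [hψ']
    have e1 : ψ' X = ψ X + (‖X.1 - xh‖ ^ 2 + (X.2 - th) ^ 2) := rfl
    rw [e0, e1] at hh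
    have h3 : ‖X.1 - xh‖ ^ 2 + (X.2 - th) ^ 2 ≤ 0 := by linarith
    have h4 : ‖X.1 - xh‖ = 0 := by nlinarith [sq_nonneg (X.2 - th), sq_nonneg ‖X.1 - xh‖]
    have h5 : X.2 - th = 0 := by nlinarith [sq_nonneg (X.2 - th), sq_nonneg ‖X.1 - xh‖]
    exact Prod.ext (sub_eq_zero.1 (norm_eq_zero.1 h4)) (sub_eq_zero.1 h5)
  obtain ⟨X, Y, hXY, hmax, hXt, hYt, hu1t, hu2t, hpt⟩ := pen_seq hKc hX0 (u1 := u1) (u2 := u2) (ψ := ψ')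
    (h1.mono inter_subset_left) (h2.mono inter_subset_left) (fun q hq => (hrs hq.2).1.continuousAt.continuousWithinAt)
    hstr (pen := pen) (fun k => by
      have := br_cont (ρ k)
      simp only [hpen]; fun_prop) hp0 (by
      refine hρt.congr fun k => ?_
      simp only [hpen, sub_self, norm_zero, br_zero (hρ k)]; ring)
    (c := fun k => (P k)⁻¹ + (R k)⁻¹) (fun k => by have := hP k; have := hR k; positivity)
    (by simpa using hPt.inv_tendsto_atTop.add hRt.inv_tendsto_atTop) (fun k X Y => by
      have f := hpP k X Y
      have hPk := hP k; have hRk := hR k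
      have f1 : ‖X.1 - Y.1‖ ≤ (P k)⁻¹ * pen k X Y := by rw [← div_eq_inv_mul, le_div_iff₀ hPk]; linarith [f.1]
      have f2 : |X.2 - Y.2| ≤ (R k)⁻¹ * pen k X Y := by rw [← div_eq_inv_mul, le_div_iff₀ hRk]; linarith [f.2]
      rw [Prod.dist_eq, dist_eq_norm, Real.dist_eq, add_mul]
      exact max_le (by linarith [abs_nonneg (X.2 - Y.2)]) (by linarith [norm_nonneg (X.1 - Y.1)]))
  have cfd : ContinuousAt (fderiv ℝ ψ') (xh, th) := (hcd.fderiv_right (m := 0) (by norm_num)).continuousAt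
  have tg : ∀ {Z : ℕ → Euc N × ℝ}, Tendsto Z atTop (𝓝 (xh, th)) →
      Tendsto (fun k => (1/2:ℝ) • cpp (fderiv ℝ ψ' (Z k))) atTop (𝓝 ((1/2:ℝ) • p)) ∧
      Tendsto (fun k => (1/2:ℝ) * cpa (fderiv ℝ ψ' (Z k))) atTop (𝓝 ((1/2:ℝ) * a)) := fun {Z} hZ => by
    have h3 := cfd.tendsto.comp hZ
    rw [hfd.fderiv] at h3
    have h4 := (cpp_cont.tendsto _).comp h3
    have h5 := (cpa_cont.tendsto _).comp h3
    rw [cpp_clm] at h4; rw [cpa_clm] at h5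
    exact ⟨h4.const_smul _, h5.const_mul _⟩
  have hin : ∀ x' ∈ closure D.Ω, x' ∈ ball xh r → ∀ Z ∈ K, (x', Z.2) ∈ K := fun x' hx' hxb Z hZ => by
    have h3 : dist Z.2 th ≤ r := (le_max_right _ _).trans (by have := hZ.2; rwa [mem_closedBall, Prod.dist_eq] at this)
    refine ⟨D.mem_Cyl.2 ⟨hx', (hrs hZ.2).2.2.1.2.le⟩, ?_⟩
    rw [mem_closedBall, Prod.dist_eq]
    exact max_le (le_of_lt hxb) h3
  have hlip : ∀ X ∈ K, ∀ x', (x', X.2) ∈ K → ψ' (x', X.2) - ψ' X ≤ K0 * ‖x' - X.1‖ := fun X hX x' hx' => by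
    have := hK0.dist_le_mul _ (hrs hx'.2).2.2.2 _ (hrs hX.2).2.2.2
    rw [Real.dist_eq, Prod.dist_eq, dist_self, dist_eq_norm, max_eq_left (norm_nonneg _)] at this
    exact (le_abs_self _).trans this
  have htouch : ∀ (v1 : Euc N × ℝ → ℝ) (Z W : Euc N × ℝ) (k : ℕ), Z ∈ K → Z ∈ ball (xh, th) r →
      (∀ Z' ∈ K, v1 Z' - ψ' Z' / 2 - pen k Z' W ≤ v1 Z - ψ' Z / 2 - pen k Z W) →
      ∃ φ, D.Touch v1 φ Z.1 Z.2 ((1/2:ℝ) • cpp (fderiv ℝ ψ' Z) + gr e ge (P k) (Q k) (ρ k) Z.1 W.1)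
        ((1/2:ℝ) * cpa (fderiv ℝ ψ' Z) + ta (R k) (ρ k) Z.2 W.2) := by
    intro v1 Z W k hZ hZb hm
    have hZ' := hrs hZ.2
    obtain ⟨c1, c2⟩ := pen_fd (P := P k) (Q := Q k) (R := R k) (hρ k) (y := W.1) (t := Z.2) (s := W.2)
      (hl.cd _ hZ'.2.2.1.1) (hl.grad _ hZ'.2.2.1.1)
    refine ⟨fun q => (1/2:ℝ) * ψ' q + pen k q W, ⟨?_, ?_, ?_⟩⟩
    · exact (contDiffAt_const.mul hZ'.1).add c1
    · have := ((hZ'.1.differentiableAt (by norm_num)).hasFDerivAt.const_mul (1/2:ℝ)).add c2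
      rw [← clm_cp (fderiv ℝ ψ' Z), clm_smul, clm_add] at this
      exact this
    · filter_upwards [self_mem_nhdsWithin, mem_nhdsWithin_of_mem_nhds (isOpen_ball.mem_nhds hZb)] with q hq hqb
      have := hm q ⟨hq, ball_subset_closedBall hqb⟩
      show v1 q - ((1/2:ℝ) * ψ' q + pen k q W) ≤ v1 Z - ((1/2:ℝ) * ψ' Z + pen k Z W)
      linarith
  have pensymm : ∀ k X Y, pen k X Y = pen k Y X := fun k X Y => by
    simp only [hpen]
    rw [norm_sub_rev, ← neg_sub (e Y.1), br_neg, ← neg_sub Y.2, br_neg]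
  refine ⟨r, K0, fun k => (X k).1, fun k => (Y k).1, fun k => (X k).2, fun k => (Y k).2,
    fun k => (1/2:ℝ) • cpp (fderiv ℝ ψ' (X k)), fun k => (1/2:ℝ) • cpp (fderiv ℝ ψ' (Y k)),
    fun k => (1/2:ℝ) * cpa (fderiv ℝ ψ' (X k)), fun k => (1/2:ℝ) * cpa (fderiv ℝ ψ' (Y k)), min_le_right _ _, ?_⟩
  refine ⟨hrpos, K0.2, fun k => (hXY k).1.1.1, fun k => (hXY k).2.1.1, fun k => (hrs (hXY k).1.2).2.2.1.2,
    fun k => (hrs (hXY k).2.2).2.2.1.2, (continuous_fst.tendsto _).comp hXt, (continuous_fst.tendsto _).comp hYt,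
    (continuous_snd.tendsto _).comp hXt, (continuous_snd.tendsto _).comp hYt, hu1t, hu2t,
    squeeze_zero (fun k => by have := hP k; positivity) (fun k => (hpP k _ _).1) hpt,
    squeeze_zero (fun k => by have := hR k; positivity) (fun k => (hpP k _ _).2) hpt,
    (tg hXt).1, (tg hYt).1, (tg hXt).2, (tg hYt).2, ?_, ?_, ?_, ?_⟩
  · filter_upwards [hXt (ball_mem_nhds _ hrpos)] with k hk
    refine htouch u1 (X k) (Y k) k (hXY k).1 hk fun Z' hZ' => ?_
    have := hmax k Z' hZ' (Y k) (hXY k).2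
    linarith
  · filter_upwards [hYt (ball_mem_nhds _ hrpos)] with k hk
    refine htouch u2 (Y k) (X k) k (hXY k).2 hk fun Z' hZ' => ?_
    have := hmax k (X k) (hXY k).1 Z' hZ'
    rw [pensymm k _ Z', pensymm k _ (Y k)] at this
    linarith
  · intro k x' hx' hxb y' hy' hyb
    have hX' := hin x' hx' hxb _ (hXY k).1
    have hY' := hin y' hy' hyb _ (hXY k).2
    have h3 := hmax k _ hX' _ hY'
    have h4 := hlip _ (hXY k).1 x' hX'
    have h5 := hlip _ (hXY k).2 y' hY'
    have h6 : pen k (x', (X k).2) (y', (Y k).2) - pen k (X k) (Y k) ≤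
        P k * |‖x' - y'‖ - ‖(X k).1 - (Y k).1‖| + Q k * |(e x' - e y') - (e (X k).1 - e (Y k).1)| := by
      simp only [hpen]
      have b1 := mul_le_mul_of_nonneg_left (br_sub (hρ k) ‖x' - y'‖ ‖(X k).1 - (Y k).1‖) (hP k).le
      have b2 := mul_le_mul_of_nonneg_left (br_sub (hρ k) (e x' - e y') (e (X k).1 - e (Y k).1)) (hQ k)
      linarith
    have h7 : 0 ≤ (K0:ℝ) * ‖x' - (X k).1‖ := by positivity
    have h8 : 0 ≤ (K0:ℝ) * ‖y' - (Y k).1‖ := by positivity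
    show u1 (x', (X k).2) - u1 (X k) + (u2 (y', (Y k).2) - u2 (Y k)) ≤ _
    linarith
  · intro y' hy' hyb
    have hY' : (y', th) ∈ K := hin y' hy' hyb _ hX0
    have h3 := (hrs hY'.2).2.1 hY'.1
    have h4 := hlip _ hX0 y' hY'
    have e0 : ψ' (xh, th) = ψ (xh, th) := by simp [hψ']
    have e1 : ψ' (y', th) = ψ (y', th) + (‖y' - xh‖ ^ 2 + (th - th) ^ 2) := rfl
    have e2 : 0 ≤ ‖y' - xh‖ ^ 2 + (th - th) ^ 2 := by positivity
    simp only at h4 h3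
    rw [e0, e1] at h4
    linarith

end Dat

namespace Dat
section DblSec
variable {D : Dat N} {u1 u2 : Euc N × ℝ → ℝ} {xh : Euc N} {th : ℝ} {p : Euc N} {a : ℝ} {e : Euc N → ℝ} {ge : Euc N → Euc N}
    {r C0 : ℝ} {P Q R ρ : ℕ → ℝ} {x y : ℕ → Euc N} {t s : ℕ → ℝ} {p1 p2 : ℕ → Euc N} {a1 a2 : ℕ → ℝ} {r0 L : ℝ}

lemma Dbl.xh_mem (h : D.Dbl u1 u2 xh th p a e ge r C0 P Q R ρ x y t s p1 p2 a1 a2) : xh ∈ closure D.Ω :=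
  isClosed_closure.mem_of_tendsto h.tx (Eventually.of_forall h.hx)

lemma Dbl.neumann (h : D.Dbl u1 u2 xh th p a e ge r C0 P Q R ρ x y t s p1 p2 a1 a2) (hl : D.Loc xh r0 L e ge)
    (hP : ∀ k, 0 < P k) (hQ : ∀ k, 0 ≤ Q k) (hρ : ∀ k, 0 < ρ k) (hN : xh ∈ D.Ω ∨ 0 < ⟪p, D.n xh⟫) :
    ∀ᶠ k in atTop, x k ∈ D.Ω ∨ 0 < ⟪p1 k + gr e ge (P k) (Q k) (ρ k) (x k) (y k), D.n (x k)⟫ := by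
  rcases D.mem_or h.xh_mem with hx | hx
  · filter_upwards [h.tx.eventually (D.open_Ω.mem_nhds hx)] with k hk using Or.inl hk
  · have hp : 0 < ⟪p, D.n xh⟫ := hN.resolve_left (D.not_mem_of_frontier hx)
    set c := ⟪p, D.n xh⟫ with hc
    have h1 : ContinuousWithinAt (fun q : Euc N × Euc N => ⟪q.1, D.n q.2⟫) (univ ×ˢ frontier D.Ω) ((1/2:ℝ) • p, xh) := by
      refine ContinuousWithinAt.inner (𝕜 := ℝ) continuous_fst.continuousWithinAt ?_
      exact ContinuousWithinAt.comp (g := D.n) (f := Prod.snd) (t := frontier D.Ω) (D.n_cont xh hx)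
        continuous_snd.continuousWithinAt (fun q hq => hq.2)
    have h2 := h1.eventually (Ioi_mem_nhds (b := ⟪(1/2:ℝ) • p, D.n xh⟫) (a := c / 4) (by
      rw [real_inner_smul_left, ← hc]; linarith))
    have h3 := (h.tp1.prodMk_nhds h.tx).eventually (eventually_nhdsWithin_iff.1 h2)
    have h4 : Tendsto (fun k => L * (P k * ‖x k - y k‖)) atTop (𝓝 (L * 0)) := h.Pq.const_mul L
    rw [mul_zero] at h4
    filter_upwards [h3, h4.eventually (Iio_mem_nhds (show (0:ℝ) < c / 8 by linarith)),
      h.tx.eventually (ball_mem_nhds _ hl.r_pos), h.ty.eventually (ball_mem_nhds _ hl.r_pos)] with k k3 k4 kx ky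
    rcases D.mem_or (h.hx k) with hk | hk
    · exact Or.inl hk
    right
    have k3 : c / 4 < ⟪p1 k, D.n (x k)⟫ := k3 ⟨trivial, hk⟩
    have k4 : L * (P k * ‖x k - y k‖) < c / 8 := k4
    have m1 := hl.tay _ kx _ ky hk (h.hy k)
    obtain ⟨m2, m3⟩ := hl.nrm _ kx _ (h.hy k) hk
    have b1 := br_pos (hρ k) ‖x k - y k‖
    have b2 := br_pos (hρ k) (e (x k) - e (y k))
    have b3 := br_ge (ρ k) ‖x k - y k‖
    rw [abs_of_nonneg (norm_nonneg _)] at b3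
    have hPk := hP k; have hQk := hQ k; have hL := hl.L_nonneg
    have s1 : -(L * (P k * ‖x k - y k‖)) ≤ P k * (br (ρ k) ‖x k - y k‖)⁻¹ * ⟪x k - y k, D.n (x k)⟫ := by
      have : P k * (br (ρ k) ‖x k - y k‖)⁻¹ * -(L * ‖x k - y k‖ * ‖x k - y k‖) ≤ P k * (br (ρ k) ‖x k - y k‖)⁻¹ * ⟪x k - y k, D.n (x k)⟫ :=
        mul_le_mul_of_nonneg_left m1 (by positivity)
      refine le_trans ?_ this
      have s2 : ‖x k - y k‖ * (br (ρ k) ‖x k - y k‖)⁻¹ ≤ 1 := by rw [← div_eq_mul_inv, div_le_one b1]; exact b3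
      have s3 : 0 ≤ L * (P k * ‖x k - y k‖) := by positivity
      nlinarith
    have s2 : 0 ≤ Q k * ((e (x k) - e (y k)) / br (ρ k) (e (x k) - e (y k))) * ⟪ge (x k), D.n (x k)⟫ := by
      rw [mul_assoc]; exact mul_nonneg hQk (mul_nonneg_of_nonpos_of_nonpos (div_nonpos_of_nonpos_of_nonneg m2 b2.le) m3)
    rw [inner_add_left, gr, inner_add_left, real_inner_smul_left, real_inner_smul_left]
    linarith

lemma Dbl.lsub (h : D.Dbl u1 u2 xh th p a e ge r C0 P Q R ρ x y t s p1 p2 a1 a2) (hl : D.Loc xh r0 L e ge)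
    (hP : ∀ k, 0 < P k) (hQ : ∀ k, 0 ≤ Q k) (hρ : ∀ k, 0 < ρ k) (hN : xh ∈ D.Ω ∨ 0 < ⟪p, D.n xh⟫)
    {G : Euc N → ℝ → ℝ → Euc N → ℝ} (hG : D.LSub G u1) :
    ∀ᶠ k in atTop, Integrable (D.inc (fun y => u1 (y, t k)) (x k)) ∧
      a1 k + ta (R k) (ρ k) (t k) (s k) + G (x k) (t k) (u1 (x k, t k)) (p1 k + gr e ge (P k) (Q k) (ρ k) (x k) (y k)) ≤
        ∫ z, D.inc (fun y => u1 (y, t k)) (x k) z := by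
  filter_upwards [h.neumann hl hP hQ hρ hN, h.touch1] with k k1 ⟨φ, k2⟩
  exact hG (x k) (h.hx k) (t k) (h.ht k) _ _ φ k2 k1

/-- one-variable increment estimate -/
lemma Dbl.var1 (h : D.Dbl u1 u2 xh th p a e ge r C0 P Q R ρ x y t s p1 p2 a1 a2) (hl : D.Loc xh r0 L e ge)
    (hP : ∀ k, 0 < P k) (hQ : ∀ k, 0 ≤ Q k) {k : ℕ} (hy : y k ∈ ball xh r) {x' : Euc N} (hx' : x' ∈ closure D.Ω)
    (hxb : x' ∈ ball xh r) : u1 (x', t k) - u1 (x k, t k) ≤ (C0 + P k + 2 * Q k) * ‖x' - x k‖ := by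
  have h1 := h.var k x' hx' hxb (y k) (h.hy k) hy
  have h2 : |‖x' - y k‖ - ‖x k - y k‖| ≤ ‖x' - x k‖ := by
    refine (abs_norm_sub_norm_le _ _).trans (le_of_eq ?_); congr 1; abel
  have h3 : |(e x' - e (y k)) - (e (x k) - e (y k))| ≤ 2 * ‖x' - x k‖ := by
    refine le_trans (le_of_eq ?_) (hl.lipe x' (x k)); congr 1; ring
  have h4 := mul_le_mul_of_nonneg_left h2 (hP k).le
  have h5 := mul_le_mul_of_nonneg_left h3 (hQ k)
  rw [sub_self (u2 _), sub_self (y k), norm_zero] at h1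
  linarith

lemma Dbl.crude (h : D.Dbl u1 u2 xh th p a e ge r C0 P Q R ρ x y t s p1 p2 a1 a2) (hl : D.Loc xh r0 L e ge)
    (hP : ∀ k, 0 < P k) (hQ : ∀ k, 0 ≤ Q k) {M T : ℝ} (hM0 : 0 ≤ M) (hT : th < T)
    (hM : ∀ x ∈ closure D.Ω, ∀ t, 0 ≤ t → t ≤ T → |u1 (x, t)| ≤ M) :
    ∀ᶠ k in atTop, Integrable (D.inc (fun y => u1 (y, t k)) (x k)) →
      ∫ z, D.inc (fun y => u1 (y, t k)) (x k) z ≤ D.KM (2 * M) * (C0 + P k + 2 * Q k + 4 * M / r) ^ D.σ := by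
  have hr := h.r_pos
  filter_upwards [h.tx.eventually (ball_mem_nhds _ (half_pos hr)), h.ty.eventually (ball_mem_nhds _ hr),
    h.tt.eventually (Iio_mem_nhds hT)] with k kx ky kt hi
  have kt : t k < T := kt
  have hPk := hP k; have hQk := hQ k; have hC := h.C0_nonneg
  have := D.lip_glob (w := fun y => u1 (y, t k)) (x := x k) (B := C0 + P k + 2 * Q k) (M := 2 * M) (by positivity) (by positivity) (half_pos hr)
    (fun y' hy' hd => h.var1 hl hP hQ ky hy' (by
      rw [mem_ball, dist_eq_norm] at *
      calc ‖y' - xh‖ = ‖(y' - x k) + (x k - xh)‖ := by congr 1; abel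
        _ ≤ _ := norm_add_le _ _
        _ < r := by linarith))
    (fun y' hy' => by
      have m1 := abs_le.1 (hM y' hy' (t k) (h.ht k).le kt.le)
      have m2 := abs_le.1 (hM (x k) (h.hx k) (t k) (h.ht k).le kt.le)
      linarith [m1.2, m2.1])
  have e1 : C0 + P k + 2 * Q k + 2 * M / (r / 2) = C0 + P k + 2 * Q k + 4 * M / r := by field_simp; ring
  rw [e1] at this
  exact D.inc_integral_le (h.hx k) (by positivity) (by positivity) hi this

end DblSec
end Dat

namespace Dat
section DblLim
variable {D : Dat N} {u1 u2 : Euc N × ℝ → ℝ} {xh : Euc N} {th : ℝ} {p : Euc N} {a : ℝ} {e : Euc N → ℝ} {ge : Euc N → Euc N}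
    {r C0 : ℝ} {P Q R ρ : ℕ → ℝ} {x y : ℕ → Euc N} {t s : ℕ → ℝ} {p1 p2 : ℕ → Euc N} {a1 a2 : ℕ → ℝ} {r0 L : ℝ}

lemma Dbl.pair_bound (h : D.Dbl u1 u2 xh th p a e ge r C0 P Q R ρ x y t s p1 p2 a1 a2) (hl : D.Loc xh r0 L e ge) (hr0 : r ≤ r0)
    (hP : ∀ k, 0 < P k) (hQ : ∀ k, 0 ≤ Q k) : ∃ C2 ≥ 0, ∀ k z, x k ∈ ball xh (r/2) → y k ∈ ball xh (r/2) → D.Cj * ‖z‖ < r / 2 →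
      D.inc (fun y => u1 (y, t k)) (x k) z + D.inc (fun y => u2 (y, s k)) (y k) z ≤
       D.Cμ * (2 * C0 * D.Cj * ‖z‖ * ker N D.σ z) + C2 * (1 + P k + Q k) * (‖x k - y k‖ * (‖z‖ * ker N D.σ z)
         + (D.mism (x k) (y k)).indicator (fun z => ‖z‖ * ker N D.σ z) z) := by
  have hr := h.r_pos
  have hC0 := h.C0_nonneg
  have hL := hl.L_nonneg
  have c1 := D.Cμ_pos; have c2 := D.Cj_pos; have c3 := D.Dj_pos; have c4 := D.Dμ_pos
  set C2 := (C0 + 2) * D.Cj * (D.Cμ + D.Dμ) + D.Cμ * (D.Dj + L * D.Cj + 2 * D.Dj) with hC2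
  have hC2p : 0 ≤ C2 := by positivity
  refine ⟨C2, hC2p, fun k z kx ky hz => ?_⟩
  have hPk := (hP k).le; have hQk := hQ k
  set q := ‖x k - y k‖ with hq
  have hq0 : 0 ≤ q := norm_nonneg _
  have hκ := ker_nonneg D.σ z
  have hz0 := norm_nonneg z
  set κ := ker N D.σ z with hκd
  have jx := D.j_le (h.hx k) z
  have jy := D.j_le (h.hy k) z
  have gx := D.g_le (h.hx k) z
  have gy := D.g_le (h.hy k) z
  have gx0 := D.g_nonneg (h.hx k) z
  have gy0 := D.g_nonneg (h.hy k) z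
  have gd := D.g_diff (h.hx k) (h.hy k) z
  have jd := D.j_diff (h.hx k) (h.hy k) z
  change _ ≤ _ * κ at gx gy gd
  have hbx : x k + D.j (x k) z ∈ ball xh r := by
    rw [mem_ball, dist_eq_norm] at *
    calc ‖x k + D.j (x k) z - xh‖ = ‖(x k - xh) + D.j (x k) z‖ := by congr 1; abel
      _ ≤ _ := norm_add_le _ _
      _ < r := by linarith
  have hby : y k + D.j (y k) z ∈ ball xh r := by
    rw [mem_ball, dist_eq_norm] at *
    calc ‖y k + D.j (y k) z - xh‖ = ‖(y k - xh) + D.j (y k) z‖ := by congr 1; abel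
      _ ≤ _ := norm_add_le _ _
      _ < r := by linarith
  have kx' : x k ∈ ball xh r := ball_subset_ball (by linarith) kx
  have ky' : y k ∈ ball xh r := ball_subset_ball (by linarith) ky
  set B := C0 + P k + 2 * Q k with hB
  have hB0 : 0 ≤ B := by positivity
  have hBC : B ≤ (C0 + 2) * (1 + P k + Q k) := by rw [hB]; nlinarith
  have vx : x k + D.j (x k) z ∈ closure D.Ω → u1 (x k + D.j (x k) z, t k) - u1 (x k, t k) ≤ B * (D.Cj * ‖z‖) := fun hm => by
    have := h.var1 hl hP hQ ky' hm hbx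
    rw [add_sub_cancel_left] at this
    exact this.trans (by gcongr)
  have vy : y k + D.j (y k) z ∈ closure D.Ω → u2 (y k + D.j (y k) z, s k) - u2 (y k, s k) ≤ B * (D.Cj * ‖z‖) := fun hm => by
    have := h.swap.var1 hl hP hQ kx' hm hby
    rw [add_sub_cancel_left] at this
    exact this.trans (by gcongr)
  have hzk : 0 ≤ ‖z‖ * κ := by positivity
  have hS : 0 ≤ 1 + P k + Q k := by positivity
  have one : ∀ A g' : ℝ, A ≤ B * (D.Cj * ‖z‖) → 0 ≤ g' → g' ≤ D.Cμ * κ → A * g' ≤ C2 * (1 + P k + Q k) * (‖z‖ * κ) := fun A g' hA h0 h1 => by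
    calc A * g' ≤ B * (D.Cj * ‖z‖) * g' := by gcongr
      _ ≤ B * (D.Cj * ‖z‖) * (D.Cμ * κ) := by gcongr
      _ ≤ ((C0 + 2) * (1 + P k + Q k)) * (D.Cj * ‖z‖) * (D.Cμ * κ) := by gcongr
      _ = ((C0 + 2) * D.Cj * D.Cμ) * (1 + P k + Q k) * (‖z‖ * κ) := by ring
      _ ≤ _ := by
        gcongr
        rw [hC2]
        have : 0 ≤ (C0 + 2) * D.Cj * D.Dμ := by positivity
        have : 0 ≤ D.Cμ * (D.Dj + L * D.Cj + 2 * D.Dj) := by positivity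
        nlinarith
  have pos1 : 0 ≤ D.Cμ * (2 * C0 * D.Cj * ‖z‖ * κ) := by positivity
  have pos2 : 0 ≤ C2 * (1 + P k + Q k) * (q * (‖z‖ * κ)) := by positivity
  by_cases hX : x k + D.j (x k) z ∈ closure D.Ω <;> by_cases hY : y k + D.j (y k) z ∈ closure D.Ω
  · have hnm : z ∉ D.mism (x k) (y k) := fun hm => hm ⟨fun _ => hY, fun _ => hX⟩
    rw [indicator_of_notMem hnm, add_zero, D.inc_of_mem hX, D.inc_of_mem hY]
    have hv := h.var k _ hX hbx _ hY hby
    have v1 := vx hX; have v2 := vy hY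
    set A1 := u1 (x k + D.j (x k) z, t k) - u1 (x k, t k)
    set A2 := u2 (y k + D.j (y k) z, s k) - u2 (y k, s k)
    have n1 : |‖x k + D.j (x k) z - (y k + D.j (y k) z)‖ - q| ≤ D.Dj * ‖z‖ * q := by
      refine ((abs_norm_sub_norm_le _ _).trans (le_of_eq ?_)).trans jd
      congr 1; abel
    have n2 : |(e (x k + D.j (x k) z) - e (y k + D.j (y k) z)) - (e (x k) - e (y k))| ≤ (L * D.Cj + 2 * D.Dj) * ‖z‖ * q := by
      have i1 := hl.second (x k) (ball_subset_ball hr0 kx') (y k) (ball_subset_ball hr0 ky') (D.j (x k) z) (by linarith)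
      have i2 := hl.lipe (y k + D.j (x k) z) (y k + D.j (y k) z)
      rw [add_sub_add_left_eq_sub] at i2
      have i3 : (e (x k + D.j (x k) z) - e (y k + D.j (y k) z)) - (e (x k) - e (y k)) =
        ((e (x k + D.j (x k) z) - e (x k)) - (e (y k + D.j (x k) z) - e (y k))) + (e (y k + D.j (x k) z) - e (y k + D.j (y k) z)) := by ring
      rw [i3]
      refine (abs_add_le _ _).trans ?_
      have i4 : L * ‖D.j (x k) z‖ * q ≤ L * (D.Cj * ‖z‖) * q := by gcongr
      linarith
    rw [add_sub_cancel_left, add_sub_cancel_left] at hv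
    have hV : A1 + A2 ≤ 2 * C0 * D.Cj * ‖z‖ + (D.Dj + L * D.Cj + 2 * D.Dj) * (1 + P k + Q k) * (‖z‖ * q) := by
      have n1' := mul_le_mul_of_nonneg_left n1 hPk
      have n2' := mul_le_mul_of_nonneg_left n2 hQk
      have n3 : C0 * (‖D.j (x k) z‖ + ‖D.j (y k) z‖) ≤ C0 * (D.Cj * ‖z‖ + D.Cj * ‖z‖) := by gcongr
      have n4 : 0 ≤ ‖z‖ * q := by positivity
      have n5 : 0 ≤ D.Dj * (1 + Q k) * (‖z‖ * q) := by positivity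
      have n6 : 0 ≤ (L * D.Cj + 2 * D.Dj) * (1 + P k) * (‖z‖ * q) := by positivity
      linarith
    set m := min (D.g (x k) z) (D.g (y k) z) with hm
    have hm0 : 0 ≤ m := le_min gx0 gy0
    have hm1 : m ≤ D.Cμ * κ := (min_le_left _ _).trans gx
    have hmd : (D.g (x k) z - m) + (D.g (y k) z - m) ≤ D.Dμ * q * κ := by
      refine le_trans (le_of_eq ?_) gd
      rcases le_total (D.g (x k) z) (D.g (y k) z) with hle | hle
      · rw [hm, min_eq_left hle, abs_of_nonpos (by linarith)]; ring
      · rw [hm, min_eq_right hle, abs_of_nonneg (by linarith)]; ring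
    have hmx : 0 ≤ D.g (x k) z - m := sub_nonneg.2 (min_le_left _ _)
    have hmy : 0 ≤ D.g (y k) z - m := sub_nonneg.2 (min_le_right _ _)
    set V := 2 * C0 * D.Cj * ‖z‖ + (D.Dj + L * D.Cj + 2 * D.Dj) * (1 + P k + Q k) * (‖z‖ * q) with hVd
    have hV0 : 0 ≤ V := by positivity
    calc A1 * D.g (x k) z + A2 * D.g (y k) z = (A1 + A2) * m + (A1 * (D.g (x k) z - m) + A2 * (D.g (y k) z - m)) := by ring
      _ ≤ V * m + (B * (D.Cj * ‖z‖) * (D.g (x k) z - m) + B * (D.Cj * ‖z‖) * (D.g (y k) z - m)) := by gcongr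
      _ = V * m + B * (D.Cj * ‖z‖) * ((D.g (x k) z - m) + (D.g (y k) z - m)) := by ring
      _ ≤ V * (D.Cμ * κ) + B * (D.Cj * ‖z‖) * (D.Dμ * q * κ) := by gcongr
      _ ≤ V * (D.Cμ * κ) + ((C0 + 2) * (1 + P k + Q k)) * (D.Cj * ‖z‖) * (D.Dμ * q * κ) := by gcongr
      _ ≤ _ := by
        have : 0 ≤ (C0 + 2) * D.Cj * D.Cμ * ((1 + P k + Q k) * (q * (‖z‖ * κ))) := by positivity
        rw [hVd, hC2]
        linarith
  · have hm : z ∈ D.mism (x k) (y k) := fun hm => hY (hm.1 hX)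
    rw [indicator_of_mem hm, D.inc_of_mem hX, D.inc_of_notMem hY]
    have := one _ _ (vx hX) gx0 gx
    linarith
  · have hm : z ∈ D.mism (x k) (y k) := fun hm => hX (hm.2 hY)
    rw [indicator_of_mem hm, D.inc_of_notMem hX, D.inc_of_mem hY]
    have := one _ _ (vy hY) gy0 gy
    linarith
  · have hnm : z ∉ D.mism (x k) (y k) := fun hm => hm ⟨fun h => (hX h).elim, fun h => (hY h).elim⟩
    rw [indicator_of_notMem hnm, add_zero, D.inc_of_notMem hX, D.inc_of_notMem hY]
    linarith

lemma mism_meas {x y : Euc N} (hx : x ∈ closure D.Ω) (hy : y ∈ closure D.Ω) : MeasurableSet (D.mism x y) := by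
  have h1 := D.J_meas hx; have h2 := D.J_meas hy
  have : D.mism x y = (D.J x \ D.J y) ∪ (D.J y \ D.J x) := by
    ext z; simp only [mism, J, mem_setOf_eq, mem_union, mem_diff]; tauto
  rw [this]
  exact (h1.diff h2).union (h2.diff h1)

lemma Dbl.limit (h : D.Dbl u1 u2 xh th p a e ge r C0 P Q R ρ x y t s p1 p2 a1 a2) (hl : D.Loc xh r0 L e ge) (hr0 : r ≤ r0)
    (hP : ∀ k, 0 < P k) (hQ : ∀ k, 0 ≤ Q k) (hth : 0 < th) {M T : ℝ} (hM0 : 0 ≤ M) (hT : th < T)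
    (hM1 : ∀ x ∈ closure D.Ω, ∀ t, 0 ≤ t → t ≤ T → |u1 (x, t)| ≤ M)
    (hM2 : ∀ x ∈ closure D.Ω, ∀ t, 0 ≤ t → t ≤ T → |u2 (x, t)| ≤ M)
    (h1 : UpperSemicontinuousOn u1 D.Cyl) (h2 : UpperSemicontinuousOn u2 D.Cyl)
    {η : ℕ → ℝ} (hη : ∀ k, 0 < η k) (hd : ∀ᶠ k in atTop, xh ∈ frontier D.Ω → |D.d (x k) - D.d (y k)| ≤ η k)
    (hlim : Tendsto (fun k => (1 + P k + Q k) * (‖x k - y k‖ + η k ^ D.θ)) atTop (𝓝 0))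
    {c : ℕ → ℝ} {c0 : ℝ} (hc : Tendsto c atTop (𝓝 c0))
    (hi : ∀ᶠ k in atTop, Integrable (D.inc (fun y => u1 (y, t k)) (x k)) ∧ Integrable (D.inc (fun y => u2 (y, s k)) (y k)) ∧
      c k ≤ (∫ z, D.inc (fun y => u1 (y, t k)) (x k) z) + ∫ z, D.inc (fun y => u2 (y, s k)) (y k) z) :
    Integrable (D.inc (fun y => u1 (y, th) + u2 (y, th)) xh) ∧ c0 ≤ ∫ z, D.inc (fun y => u1 (y, th) + u2 (y, th)) xh z := by
  have hr := h.r_pos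
  have hC0 := h.C0_nonneg
  have cμ := D.Cμ_pos; have cj := D.Cj_pos
  obtain ⟨ξ0, hξ0, rm, hrm, Cm, hCm, hmis⟩ := D.mism_est h.xh_mem
  obtain ⟨C2, hC2, hpb⟩ := h.pair_bound hl hr0 hP hQ
  set ξ := min ξ0 (r / (4 * D.Cj)) with hξ
  have hξp : 0 < ξ := lt_min hξ0 (by positivity)
  have hξr : D.Cj * ξ ≤ r / 4 := by
    have : ξ ≤ r / (4 * D.Cj) := min_le_right _ _
    rw [le_div_iff₀ (by positivity)] at this; linarith
  set Bd := 2 * C0 + 4 * M / (D.Cj * ξ) with hBd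
  have hBd0 : 0 ≤ Bd := by positivity
  set M' := 4 * M + Bd * D.Cj * ξ with hM'
  have hM'0 : 0 ≤ M' := by positivity
  have hBξ : 4 * M ≤ Bd * D.Cj * ξ := by
    have : 4 * M / (D.Cj * ξ) * (D.Cj * ξ) = 4 * M := by field_simp
    have : 0 ≤ 2 * C0 * (D.Cj * ξ) := by positivity
    rw [hBd]; nlinarith
  have domlow1 : ∀ z : Euc N, ‖z‖ < ξ → D.Cμ * (2 * C0 * D.Cj * ‖z‖ * ker N D.σ z) ≤ D.dom Bd M' z := fun z hz => by
    have := ker_nonneg D.σ z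
    unfold dom
    gcongr
    refine le_min ?_ ?_
    · gcongr; rw [hBd]; have : 0 ≤ 4 * M / (D.Cj * ξ) := by positivity
      linarith
    · have g1 : 2 * C0 * D.Cj * ‖z‖ ≤ 2 * C0 * D.Cj * ξ := by gcongr
      have g2 : 2 * C0 * D.Cj * ξ ≤ Bd * D.Cj * ξ := by
        gcongr; rw [hBd]; have : 0 ≤ 4 * M / (D.Cj * ξ) := by positivity
        linarith
      linarith
  have domlow2 : ∀ z : Euc N, ξ ≤ ‖z‖ → D.Cμ * (4 * M * ker N D.σ z) ≤ D.dom Bd M' z := fun z hz => by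
    have := ker_nonneg D.σ z
    unfold dom
    gcongr
    refine le_min (hBξ.trans (by gcongr)) ?_
    have : 0 ≤ Bd * D.Cj * ξ := by positivity
    linarith
  set S : ℕ → Set (Euc N) := fun k => {z | ‖z‖ < ξ ∧ z ∈ D.mism (x k) (y k)} with hS
  have hSm : ∀ k, MeasurableSet (S k) := fun k =>
    (measurableSet_lt measurable_norm measurable_const).inter (mism_meas (h.hx k) (h.hy k))
  set kk : Euc N → ℝ := fun z => min ‖z‖ ξ * ker N D.σ z with hkk
  have hkki : Integrable kk := by simpa [hkk] using ker_integrable D.hN D.σ_pos D.σ_lt 1 ξ zero_le_one hξp.le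
  have hkk0 : ∀ z, 0 ≤ kk z := fun z => mul_nonneg (le_min (norm_nonneg _) hξp.le) (ker_nonneg _ _)
  have hmeasf : Measurable (fun z : Euc N => ‖z‖ * ker N D.σ z) := measurable_norm.mul (ker_meas _)
  have hf0 : ∀ z : Euc N, 0 ≤ ‖z‖ * ker N D.σ z := fun z => mul_nonneg (norm_nonneg _) (ker_nonneg _ _)
  have hSi : ∀ k, Integrable ((S k).indicator (fun z => ‖z‖ * ker N D.σ z)) := fun k => by
    refine hkki.mono' (hmeasf.indicator (hSm k)).aestronglyMeasurable (Eventually.of_forall fun z => ?_)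
    rw [Real.norm_of_nonneg (indicator_nonneg (fun z _ => hf0 z) z)]
    by_cases hz : z ∈ S k
    · rw [indicator_of_mem hz, hkk]; simp only; rw [min_eq_left hz.1.le]
    · rw [indicator_of_notMem hz]; exact hkk0 z
  set E : ℕ → Euc N → ℝ := fun k z => C2 * (1 + P k + Q k) * (‖x k - y k‖ * kk z + (S k).indicator (fun z => ‖z‖ * ker N D.σ z) z) with hE
  have hE0 : ∀ k z, 0 ≤ E k z := fun k z => by
    have hPk := (hP k).le; have hQk := hQ k
    have := hkk0 z
    have : 0 ≤ (S k).indicator (fun z => ‖z‖ * ker N D.σ z) z := indicator_nonneg (fun z _ => hf0 z) z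
    simp only [hE]; positivity
  have hEi : ∀ k, Integrable (E k) := fun k => ((hkki.const_mul _).add (hSi k)).const_mul _
  have hEt : Tendsto (fun k => ∫ z, E k z) atTop (𝓝 0) := by
    have hb : ∀ᶠ k in atTop, ∫ z, E k z ≤ C2 * ((∫ z, kk z) + Cm) * ((1 + P k + Q k) * (‖x k - y k‖ + η k ^ D.θ)) := by
      filter_upwards [h.tx.eventually (ball_mem_nhds _ hrm), h.ty.eventually (ball_mem_nhds _ hrm), hd] with k kx ky kd
      have hm := hmis (x k) (h.hx k) (y k) (h.hy k) kx ky (η k) (hη k) kd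
      have hη' : 0 ≤ η k ^ D.θ := (Real.rpow_pos_of_pos (hη k) _).le
      have hPk := (hP k).le; have hQk := hQ k
      have i1 : ∫ z, (S k).indicator (fun z => ‖z‖ * ker N D.σ z) z ≤ Cm * (‖x k - y k‖ + η k ^ D.θ) := by
        rw [integral_eq_lintegral_of_nonneg_ae (Eventually.of_forall fun z => indicator_nonneg (fun z _ => hf0 z) z) (hSi k).aestronglyMeasurable]
        refine ENNReal.toReal_le_of_le_ofReal (by positivity) (le_trans ?_ hm)
        have : ∀ z, ENNReal.ofReal ((S k).indicator (fun z => ‖z‖ * ker N D.σ z) z) = (S k).indicator (fun z => ENNReal.ofReal (‖z‖ * ker N D.σ z)) z := fun z => by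
          by_cases hz : z ∈ S k
          · rw [indicator_of_mem hz, indicator_of_mem hz]
          · rw [indicator_of_notMem hz, indicator_of_notMem hz, ENNReal.ofReal_zero]
        simp_rw [this]
        rw [lintegral_indicator (hSm k)]
        exact lintegral_mono_set fun z hz => ⟨hz.1.trans_le (min_le_left _ _), hz.2⟩
      have i2 : ∫ z, E k z = C2 * (1 + P k + Q k) * (‖x k - y k‖ * (∫ z, kk z) + ∫ z, (S k).indicator (fun z => ‖z‖ * ker N D.σ z) z) := by
        simp only [hE]
        rw [integral_const_mul, integral_add (hkki.const_mul _) (hSi k), integral_const_mul]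
      have i3 : 0 ≤ ∫ z, kk z := integral_nonneg hkk0
      rw [i2]
      calc _ ≤ C2 * (1 + P k + Q k) * ((‖x k - y k‖ + η k ^ D.θ) * (∫ z, kk z) + Cm * (‖x k - y k‖ + η k ^ D.θ)) := by
            gcongr; linarith
        _ = _ := by ring
    have hz := hlim.const_mul (C2 * ((∫ z, kk z) + Cm))
    rw [mul_zero] at hz
    exact squeeze_zero' (Eventually.of_forall fun k => integral_nonneg (hE0 k)) hb hz
  have hxh := h.xh_mem
  have hth0 : th ≤ T := hT.le
  have bnd : ∀ᶠ k in atTop, t k < T ∧ s k < T := (h.tt.eventually (Iio_mem_nhds hT)).and (h.ts.eventually (Iio_mem_nhds hT))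
  have usclim : ∀ (u : Euc N × ℝ → ℝ) (τ : ℕ → ℝ), UpperSemicontinuousOn u D.Cyl → (∀ k, 0 < τ k) → Tendsto τ atTop (𝓝 th) →
      ∀ y ∈ D.Ω, ∀ y' : ℕ → Euc N, (∀ᶠ k in atTop, y' k ∈ closure D.Ω) → Tendsto y' atTop (𝓝 y) →
      ∀ ε > 0, ∀ᶠ k in atTop, u (y' k, τ k) ≤ u (y, th) + ε := fun u τ hu hτ hτt y hy y' hy' hyt ε hε => by
    have := hu (y, th) (D.mem_Cyl.2 ⟨subset_closure hy, hth.le⟩) (u (y, th) + ε) (by linarith)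
    have h3 := (hyt.prodMk_nhds hτt).eventually (eventually_nhdsWithin_iff.1 this)
    filter_upwards [h3, hy'] with k k1 k2
    exact (k1 (D.mem_Cyl.2 ⟨k2, (hτ k).le⟩)).le
  have key := fatou (f := fun k z => D.inc (fun y => u1 (y, t k)) (x k) z + D.inc (fun y => u2 (y, s k)) (y k) z) (E := E)
    (F := D.inc (fun y => u1 (y, th) + u2 (y, th)) xh) (G := D.dom Bd M') (c := c) (c0 := c0) (D.dom_integrable hBd0 hM'0) ?_ hc hEt ?_ ?_ ?_
  · exact key
  · filter_upwards [hi, bnd, h.tx.eventually (ball_mem_nhds _ (half_pos hr)), h.ty.eventually (ball_mem_nhds _ (half_pos hr))]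
      with k ⟨k1, k2, k3⟩ ⟨k4, k5⟩ kx ky
    refine ⟨k1.add k2, hEi k, hE0 k, Eventually.of_forall fun z => ?_, by rwa [integral_add k1 k2]⟩
    have hκ := ker_nonneg D.σ z
    by_cases hz : ‖z‖ < ξ
    · have hb := hpb k z kx ky (by
        have : D.Cj * ‖z‖ ≤ D.Cj * ξ := by gcongr
        linarith)
      have e1 : E k z = C2 * (1 + P k + Q k) * (‖x k - y k‖ * (‖z‖ * ker N D.σ z) + (D.mism (x k) (y k)).indicator (fun z => ‖z‖ * ker N D.σ z) z) := by
        simp only [hE, hkk]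
        rw [min_eq_left hz.le]
        congr 2
        by_cases hm : z ∈ D.mism (x k) (y k)
        · rw [indicator_of_mem hm, indicator_of_mem (show z ∈ S k from ⟨hz, hm⟩)]
        · rw [indicator_of_notMem hm, indicator_of_notMem (show z ∉ S k from fun hh => hm hh.2)]
      rw [e1]
      have := domlow1 z hz
      linarith
    · have g1 := domlow2 z (not_lt.1 hz)
      have b1 : D.inc (fun y => u1 (y, t k)) (x k) z ≤ D.Cμ * (2 * M * ker N D.σ z) := by
        by_cases hm : x k + D.j (x k) z ∈ closure D.Ω
        · rw [D.inc_of_mem hm]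
          have m1 := abs_le.1 (hM1 _ hm (t k) (h.ht k).le k4.le)
          have m2 := abs_le.1 (hM1 (x k) (h.hx k) (t k) (h.ht k).le k4.le)
          have m3 := D.g_nonneg (h.hx k) z
          have m4 : D.g (x k) z ≤ D.Cμ * ker N D.σ z := D.g_le (h.hx k) z
          calc _ ≤ (2 * M) * D.g (x k) z := by gcongr; linarith [m1.2, m2.1]
            _ ≤ (2 * M) * (D.Cμ * ker N D.σ z) := by gcongr
            _ = _ := by ring
        · rw [D.inc_of_notMem hm]; positivity
      have b2 : D.inc (fun y => u2 (y, s k)) (y k) z ≤ D.Cμ * (2 * M * ker N D.σ z) := by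
        by_cases hm : y k + D.j (y k) z ∈ closure D.Ω
        · rw [D.inc_of_mem hm]
          have m1 := abs_le.1 (hM2 _ hm (s k) (h.hs k).le k5.le)
          have m2 := abs_le.1 (hM2 (y k) (h.hy k) (s k) (h.hs k).le k5.le)
          have m3 := D.g_nonneg (h.hy k) z
          have m4 : D.g (y k) z ≤ D.Cμ * ker N D.σ z := D.g_le (h.hy k) z
          calc _ ≤ (2 * M) * D.g (y k) z := by gcongr; linarith [m1.2, m2.1]
            _ ≤ (2 * M) * (D.Cμ * ker N D.σ z) := by gcongr
            _ = _ := by ring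
        · rw [D.inc_of_notMem hm]; positivity
      have := hE0 k z
      linarith
  · refine (D.inc_meas hxh ?_).aestronglyMeasurable
    exact Adm.meas_slice (u := fun q => u1 q + u2 q) (h1.add h2) hth.le
  · have hl2 := D.lip_glob (w := fun y => u1 (y, th) + u2 (y, th)) (x := xh) (B := C0) (M := 4 * M) hC0 (by positivity) hr
      (fun y' hy' hyb => h.varw y' hy' (by rwa [mem_ball, dist_eq_norm]))
      (fun y' hy' => by
        have m1 := abs_le.1 (hM1 y' hy' th hth.le hth0)
        have m2 := abs_le.1 (hM1 xh hxh th hth.le hth0)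
        have m3 := abs_le.1 (hM2 y' hy' th hth.le hth0)
        have m4 := abs_le.1 (hM2 xh hxh th hth.le hth0)
        linarith [m1.2, m2.1, m3.2, m4.1])
    refine Eventually.of_forall fun z => (D.inc_le hxh (by positivity) (by positivity) hl2 z).trans ?_
    have hκ := ker_nonneg D.σ z
    unfold dom
    gcongr
    · have : 4 * M / r ≤ 4 * M / (D.Cj * ξ) := by gcongr; linarith
      rw [hBd]; linarith
    · have : 0 ≤ Bd * D.Cj * ξ := by positivity
      linarith
  · filter_upwards [D.ae_not_frontier hxh] with z hz ε hε
    have l1 := D.inc_limsup (w := fun k y => u1 (y, t k)) (w0 := fun y => u1 (y, th)) (x := x) (Eventually.of_forall h.hx) hxh h.tx hz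
      ⟨M, bnd.mono fun k hk y hy => hM1 y hy _ (h.ht k).le hk.1.le⟩ (usclim u1 t h1 h.ht h.tt) h.tu1 (ε / 2) (half_pos hε)
    have l2 := D.inc_limsup (w := fun k y => u2 (y, s k)) (w0 := fun y => u2 (y, th)) (x := y) (Eventually.of_forall h.hy) hxh h.ty hz
      ⟨M, bnd.mono fun k hk y hy => hM2 y hy _ (h.hs k).le hk.2.le⟩ (usclim u2 s h2 h.hs h.ts) h.tu2 (ε / 2) (half_pos hε)
    filter_upwards [l1, l2] with k k1 k2
    rw [D.inc_add]
    linarith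

end DblLim
end Dat

lemma modulus_tendsto {ω : ℝ → ℝ} (h : IsModulus ω) : Tendsto ω (𝓝 0) (𝓝 0) := by
  rw [Metric.tendsto_nhds]
  intro ε hε
  have h1 := h.2.2.eventually (Iio_mem_nhds hε)
  obtain ⟨d, hd, hd2⟩ := (h1.and self_mem_nhdsWithin).exists
  have hd' : ω d < ε := hd
  filter_upwards [Iio_mem_nhds (show (0:ℝ) < d from hd2)] with s hs
  rw [Real.dist_eq, sub_zero, abs_of_nonneg (h.1 s)]
  exact lt_of_le_of_lt (h.2.1 (le_of_lt hs)) hd'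

namespace Dat
def WSub (D : Dat N) (w : Euc N × ℝ → ℝ) (K e T : ℝ) (Γ : ℝ → ℝ) : Prop :=
  ∀ x ∈ closure D.Ω, ∀ t, 0 < t → t < T → 0 < w (x, t) → ∀ p a ψ, D.Touch w ψ x t p a →
    (x ∈ D.Ω ∨ 0 < ⟪p, D.n x⟫) → Integrable (D.inc (fun y => w (y, t)) x) ∧
      a - K * w (x, t) - Γ ‖p‖ - e ≤ ∫ z, D.inc (fun y => w (y, t)) x z

section DblSec
variable {D : Dat N} {u1 u2 : Euc N × ℝ → ℝ} {xh : Euc N} {th : ℝ} {p : Euc N} {a : ℝ} {e : Euc N → ℝ} {ge : Euc N → Euc N}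
    {r C0 : ℝ} {P Q R ρ : ℕ → ℝ} {x y : ℕ → Euc N} {t s : ℕ → ℝ} {p1 p2 : ℕ → Euc N} {a1 a2 : ℕ → ℝ} {r0 L : ℝ}

/-- directional lower bound of a Hamiltonian near a boundary point -/
def Force (D : Dat N) (G : Euc N → ℝ → ℝ → Euc N → ℝ) (ς : ℝ) (xh : Euc N) (th M β Mb C : ℝ) : Prop :=
  ∀ᶠ q in 𝓝[D.Cyl] (xh, th), ∀ r, |r| ≤ M → ∀ p, ∃ b' : Euc N, ‖b'‖ ≤ Mb ∧ β ≤ ς * ⟪b', D.gd q.1⟫ ∧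
    ⟪b', p⟫ - C ≤ G q.1 q.2 r p

lemma pow_lin {σ A B c : ℝ} (h0 : 0 < σ) (h1 : σ < 1) (hA : 0 ≤ A) (hB : 0 ≤ B) (hc : 0 < c) (C : ℝ) :
    ∀ᶠ k : ℕ in atTop, C + A * (B * ((k:ℝ) + 1)) ^ σ < c * ((k:ℝ) + 1) := by
  have hP : Tendsto (fun k : ℕ => (k:ℝ) + 1) atTop atTop :=
    tendsto_atTop_add_const_right _ _ tendsto_natCast_atTop_atTop
  have h2 : Tendsto (fun k : ℕ => C * ((k:ℝ) + 1)⁻¹ + A * B ^ σ * ((k:ℝ) + 1) ^ (-(1 - σ))) atTop (𝓝 (C * 0 + A * B ^ σ * 0)) :=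
    ((tendsto_inv_atTop_zero.comp hP).const_mul C).add (((tendsto_rpow_neg_atTop (by linarith)).comp hP).const_mul _)
  rw [mul_zero, mul_zero, add_zero] at h2
  filter_upwards [h2.eventually (Iio_mem_nhds hc)] with k hk
  have hk' : C * ((k:ℝ) + 1)⁻¹ + A * B ^ σ * ((k:ℝ) + 1) ^ (-(1 - σ)) < c := hk
  have hp : (0:ℝ) < (k:ℝ) + 1 := by positivity
  have h3 := mul_lt_mul_of_pos_right hk' hp
  rw [Real.mul_rpow hB hp.le]
  have h4 : ((k:ℝ) + 1) ^ (-(1 - σ)) * ((k:ℝ) + 1) = ((k:ℝ) + 1) ^ σ := by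
    nth_rewrite 2 [← Real.rpow_one ((k:ℝ) + 1)]
    rw [← Real.rpow_add hp]; congr 1; ring
  calc C + A * (B ^ σ * ((k:ℝ) + 1) ^ σ) = (C * ((k:ℝ) + 1)⁻¹ + A * B ^ σ * ((k:ℝ) + 1) ^ (-(1 - σ))) * ((k:ℝ) + 1) := by
        rw [← h4]; field_simp
    _ < _ := h3

lemma Dbl.forcing {κ : ℝ} (h : D.Dbl u1 u2 xh th p a D.d D.gd r C0 (fun k => (k:ℝ) + 1) (fun k => κ * ((k:ℝ) + 1)) (fun k => (k:ℝ) + 1) ρ x y t s p1 p2 a1 a2)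
    (hl : D.Loc xh r0 L D.d D.gd) (hκ : 0 ≤ κ) (hρ : ∀ k, 0 < ρ k) {M T : ℝ} (hM0 : 0 ≤ M) (hth : 0 < th) (hT : th < T)
    (hM : ∀ x ∈ closure D.Ω, ∀ t, 0 ≤ t → t ≤ T → |u1 (x, t)| ≤ M)
    (hN : xh ∈ D.Ω ∨ 0 < ⟪p, D.n xh⟫) {G : Euc N → ℝ → ℝ → Euc N → ℝ} (hG : D.LSub G u1)
    {ς β Mb C : ℝ} (hς : |ς| = 1) (hF : D.Force G ς xh th M β Mb C) (hβ : 0 < β) (hMb : 0 ≤ Mb) (hκ2 : Mb + 2 ≤ κ * β / 2) :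
    ∀ᶠ k in atTop, ς * (D.d (x k) - D.d (y k)) ≤ ρ k := by
  have hP : ∀ k : ℕ, (0:ℝ) < (k:ℝ) + 1 := fun k => by positivity
  have hQ : ∀ k : ℕ, (0:ℝ) ≤ κ * ((k:ℝ) + 1) := fun k => by positivity
  have e1 := h.lsub hl hP hQ hρ hN hG
  have e2 := h.crude hl hP hQ hM0 hT hM
  have e3 : ∀ᶠ k in atTop, ∀ r, |r| ≤ M → ∀ p, ∃ b' : Euc N, ‖b'‖ ≤ Mb ∧ β ≤ ς * ⟪b', D.gd (x k)⟫ ∧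
    ⟪b', p⟫ - C ≤ G (x k) (t k) r p := by
    have h5 := (h.tx.prodMk_nhds h.tt).eventually (eventually_nhdsWithin_iff.1 hF)
    filter_upwards [h5] with k hk
    exact hk ⟨h.hx k, (h.ht k).le⟩
  have e4 : ∀ᶠ k in atTop, ‖p1 k‖ < ‖(1/2:ℝ) • p‖ + 1 := h.tp1.norm.eventually (Iio_mem_nhds (lt_add_one _))
  have e5 : ∀ᶠ k in atTop, 1/2 * a - 1 < a1 k := h.ta1.eventually (Ioi_mem_nhds (sub_one_lt _))
  have e6 := pow_lin (σ := D.σ) (A := D.KM (2 * M)) (B := C0 + 4 * M / r + 1 + 2 * κ) (c := 1) D.σ_pos D.σ_lt (D.KM_nonneg (by positivity))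
    (by have := h.C0_nonneg; have := h.r_pos; positivity) one_pos (C + Mb * (‖(1/2:ℝ) • p‖ + 1) - (1/2 * a - 1))
  have e7 : ∀ᶠ k in atTop, t k < T := h.tt.eventually (Iio_mem_nhds hT)
  filter_upwards [e1, e2, e3, e4, e5, e6, e7] with k k1 k2 k3 k4 k5 k6 k7
  by_contra! hcon
  have hr := h.r_pos
  have hC0 := h.C0_nonneg
  set Pk : ℝ := (k:ℝ) + 1 with hPk
  have hPp : 0 < Pk := hP k
  have hP1 : 1 ≤ Pk := by rw [hPk]; linarith [Nat.cast_nonneg (α := ℝ) k]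
  obtain ⟨b', hb1, hb2, hb3⟩ := k3 (u1 (x k, t k)) (hM _ (h.hx k) _ (h.ht k).le k7.le) (p1 k + gr D.d D.gd Pk (κ * Pk) (ρ k) (x k) (y k))
  have k8 := k2 k1.1
  have k9 := k1.2
  have hta := ta_abs (R := Pk) hPp.le (hρ k) (t k) (s k)
  have hta' := (abs_le.1 hta).1
  have hin : ⟪b', p1 k⟫ ≥ -(Mb * (‖(1/2:ℝ) • p‖ + 1)) := by
    have := (abs_le.1 (abs_real_inner_le_norm b' (p1 k))).1
    have h9 : ‖b'‖ * ‖p1 k‖ ≤ Mb * (‖(1/2:ℝ) • p‖ + 1) := by gcongr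
    linarith
  have hin2 : ⟪b', (Pk * (br (ρ k) ‖x k - y k‖)⁻¹) • (x k - y k)⟫ ≥ -(Mb * Pk) := by
    have := (abs_le.1 (abs_real_inner_le_norm b' ((Pk * (br (ρ k) ‖x k - y k‖)⁻¹) • (x k - y k)))).1
    have h9 : ‖b'‖ * ‖(Pk * (br (ρ k) ‖x k - y k‖)⁻¹) • (x k - y k)‖ ≤ Mb * Pk := by
      gcongr
      exact brn_coef (hρ k) hPp.le _
    linarith
  have hin3 : ⟪b', (κ * Pk * ((D.d (x k) - D.d (y k)) / br (ρ k) (D.d (x k) - D.d (y k)))) • D.gd (x k)⟫ ≥ κ * Pk * (β / 2) := by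
    rw [real_inner_smul_right, mul_assoc]
    apply mul_le_mul_of_nonneg_left _ (hQ k)
    set dd := D.d (x k) - D.d (y k) with hdd
    have hς2 : ς * ς = 1 := by rw [← abs_mul_abs_self, hς, one_mul]
    have habs : |dd| = ς * dd := by
      have h10 : |ς * dd| = |dd| := by rw [abs_mul, hς, one_mul]
      rw [← h10, abs_of_pos (lt_trans (hρ k) hcon)]
    have hc := br_coef_ge (hρ k) (s := dd) (by rw [habs]; exact hcon.le)
    have : dd / br (ρ k) dd * ⟪b', D.gd (x k)⟫ = |dd| / br (ρ k) dd * (ς * ⟪b', D.gd (x k)⟫) := by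
      rw [habs]
      calc _ = (ς * ς) * (dd / br (ρ k) dd * ⟪b', D.gd (x k)⟫) := by rw [hς2, one_mul]
        _ = _ := by ring
    rw [this]
    calc β / 2 = 1 / 2 * β := by ring
      _ ≤ _ := by gcongr
  have hsum : ⟪b', p1 k + gr D.d D.gd Pk (κ * Pk) (ρ k) (x k) (y k)⟫ ≥
      -(Mb * (‖(1/2:ℝ) • p‖ + 1)) - Mb * Pk + κ * Pk * (β / 2) := by
    unfold gr
    rw [inner_add_right, inner_add_right]
    linarith
  have hpw : D.KM (2 * M) * (C0 + Pk + 2 * (κ * Pk) + 4 * M / r) ^ D.σ ≤ D.KM (2 * M) * ((C0 + 4 * M / r + 1 + 2 * κ) * Pk) ^ D.σ := by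
    apply mul_le_mul_of_nonneg_left _ (D.KM_nonneg (by positivity))
    apply Real.rpow_le_rpow (by positivity) _ D.σ_pos.le
    have : (C0 + 4 * M / r) * 1 ≤ (C0 + 4 * M / r) * Pk := by gcongr
    linarith
  have hlast : (Mb + 2) * Pk ≤ κ * β / 2 * Pk := by gcongr
  linarith
end DblSec
end Dat

section BellSec
variable {A : Type} [MetricSpace A] [CompactSpace A] [Nonempty A]
  {lam : Euc N → ℝ → A → ℝ} {b : Euc N → ℝ → A → Euc N} {l : Euc N → ℝ → A → ℝ} {H : Euc N → ℝ → ℝ → Euc N → ℝ}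

lemma bell_ctsα (hd : ParBellmanData lam b l) (x : Euc N) (t r : ℝ) (p : Euc N) :
    Continuous (fun α => lam x t α * r - ⟪b x t α, p⟫ - l x t α) := by
  obtain ⟨h1, -, h2, -, h3, -⟩ := hd
  have e : Continuous (fun α : A => ((x, t, α) : Euc N × ℝ × A)) := by fun_prop
  exact (((h1.comp e).mul_const r).sub ((h2.comp e).inner continuous_const)).sub (h3.comp e)

lemma bell_max (hd : ParBellmanData lam b l) (hH : IsParBellman lam b l H) (x : Euc N) (t r : ℝ) (p : Euc N) :
    ∃ α, H x t r p = lam x t α * r - ⟪b x t α, p⟫ - l x t α ∧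
      ∀ α', lam x t α' * r - ⟪b x t α', p⟫ - l x t α' ≤ lam x t α * r - ⟪b x t α, p⟫ - l x t α := by
  obtain ⟨α, -, hα⟩ := isCompact_univ.exists_isMaxOn univ_nonempty (bell_ctsα hd x t r p).continuousOn
  have hm : ∀ α', lam x t α' * r - ⟪b x t α', p⟫ - l x t α' ≤ lam x t α * r - ⟪b x t α, p⟫ - l x t α := fun α' => hα (mem_univ α')
  refine ⟨α, ?_, hm⟩
  rw [hH]
  apply le_antisymm (ciSup_le hm)
  exact le_ciSup (f := fun α => lam x t α * r - ⟪b x t α, p⟫ - l x t α) ⟨_, by rintro _ ⟨α', rfl⟩; exact hm α'⟩ α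

lemma bell_ge (hd : ParBellmanData lam b l) (hH : IsParBellman lam b l H) (x : Euc N) (t r : ℝ) (p : Euc N) (α : A) :
    lam x t α * r - ⟪b x t α, p⟫ - l x t α ≤ H x t r p := by
  obtain ⟨α', h1, h2⟩ := bell_max hd hH x t r p
  rw [h1]; exact h2 α

namespace Dat
variable (D : Dat N)

lemma gd_contAt {xh : Euc N} (hxh : xh ∈ frontier D.Ω) : ContinuousAt D.gd xh := by
  obtain ⟨r, L, e, ge, hl, he⟩ := D.exists_loc (frontier_subset_closure hxh)
  obtain ⟨rfl, rfl⟩ := he hxh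
  rw [ContinuousAt, tendsto_iff_norm_sub_tendsto_zero]
  have h1 : Tendsto (fun x => L * ‖x - xh‖) (𝓝 xh) (𝓝 0) := by
    have : Continuous (fun x : Euc N => L * ‖x - xh‖) := by fun_prop
    simpa using this.tendsto xh
  refine squeeze_zero' (Eventually.of_forall fun x => norm_nonneg _) ?_ h1
  filter_upwards [ball_mem_nhds xh hl.r_pos] with x hx
  exact hl.glip x hx xh (mem_ball_self hl.r_pos)

lemma Force.mono {D : Dat N} {G : Euc N → ℝ → ℝ → Euc N → ℝ} {ς : ℝ} {xh : Euc N} {th M β β' Mb C : ℝ}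
    (h : D.Force G ς xh th M β Mb C) (hb : β' ≤ β) : D.Force G ς xh th M β' Mb C := by
  filter_upwards [h] with q hq r hr p
  obtain ⟨b', h1, h2, h3⟩ := hq r hr p
  exact ⟨b', h1, hb.trans h2, h3⟩

lemma bell_force (hd : ParBellmanData lam b l) (hH : IsParBellman lam b l H) (hB : AssumptionB' D.Ω D.n b)
    {Ml Mb Mc : ℝ} (hMl : ∀ x t α, |lam x t α| ≤ Ml) (hMb : ∀ x t α, ‖b x t α‖ ≤ Mb) (hMc : ∀ x t α, |l x t α| ≤ Mc)
    {xh : Euc N} (hxh : xh ∈ frontier D.Ω) {th M : ℝ} (hth : 0 ≤ th) (hM : 0 ≤ M) {ς : ℝ} (hς : ς = 1 ∨ ς = -1) :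
    ∃ β > 0, D.Force H ς xh th M β Mb (Ml * M + Mc) ∨ D.Force (Hneg H) (-ς) xh th M β Mb (Ml * M + Mc) := by
  have hbc := hd.2.2.1
  have hMl0 : 0 ≤ Ml := (abs_nonneg _).trans (hMl 0 0 (Classical.arbitrary A))
  have hcont : ∀ α : A, ContinuousAt (fun q : (Euc N × ℝ) × A => ς * ⟪b q.1.1 q.1.2 q.2, D.gd q.1.1⟫) ((xh, th), α) := by
    intro α
    have h1 : ContinuousAt (fun q : (Euc N × ℝ) × A => b q.1.1 q.1.2 q.2) ((xh, th), α) :=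
      (hbc.comp (by fun_prop : Continuous (fun q : (Euc N × ℝ) × A => ((q.1.1, q.1.2, q.2) : Euc N × ℝ × A)))).continuousAt
    have h2 : ContinuousAt (fun q : (Euc N × ℝ) × A => D.gd q.1.1) ((xh, th), α) :=
      ContinuousAt.comp (g := D.gd) (f := fun q : (Euc N × ℝ) × A => q.1.1) (D.gd_contAt hxh) (by fun_prop)
    exact continuousAt_const.mul (ContinuousAt.inner (𝕜 := ℝ) h1 h2)
  have hgn : D.gd xh = -D.n xh := Near.gd_frontier hxh
  have hdich : (∃ α, ς * ⟪b xh th α, D.gd xh⟫ < 0) ∨ ∀ α, 0 < ς * ⟪b xh th α, D.gd xh⟫ := by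
    have hx := hxh
    rw [← hB.1] at hx
    rw [hgn]
    simp only [inner_neg_right]
    have h0 : th ∈ Ici (0:ℝ) := hth
    obtain ⟨α0⟩ := (inferInstance : Nonempty A)
    rcases hx with (hx | hx) | hx <;> rcases hς with rfl | rfl
    · right; intro α; linarith [hx.2 th h0 α]
    · left; exact ⟨α0, by linarith [hx.2 th h0 α0]⟩
    · left; exact ⟨α0, by linarith [hx.2 th h0 α0]⟩
    · right; intro α; linarith [hx.2 th h0 α]
    · obtain ⟨a1, a2, h1, h2⟩ := hx.2 th h0
      left; exact ⟨a2, by linarith⟩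
    · obtain ⟨a1, a2, h1, h2⟩ := hx.2 th h0
      left; exact ⟨a1, by linarith⟩
  rcases hdich with ⟨α, hα⟩ | hα
  · set β := -(ς * ⟪b xh th α, D.gd xh⟫) / 2 with hβ
    refine ⟨β, by linarith, Or.inl ?_⟩
    have h1 : ContinuousAt (fun q : Euc N × ℝ => ς * ⟪b q.1 q.2 α, D.gd q.1⟫) (xh, th) :=
      ContinuousAt.comp (f := fun q : Euc N × ℝ => (q, α)) (g := fun q : (Euc N × ℝ) × A => ς * ⟪b q.1.1 q.1.2 q.2, D.gd q.1.1⟫)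
        (hcont α) (by fun_prop)
    have h2 := h1.eventually (Iio_mem_nhds (show ς * ⟪b xh th α, D.gd xh⟫ < -β by rw [hβ]; linarith))
    filter_upwards [h2.filter_mono nhdsWithin_le_nhds] with q hq r hr p
    have hq : ς * ⟪b q.1 q.2 α, D.gd q.1⟫ < -β := hq
    refine ⟨-b q.1 q.2 α, by rw [norm_neg]; exact hMb _ _ _, by rw [inner_neg_left]; linarith, ?_⟩
    refine le_trans ?_ (bell_ge hd hH q.1 q.2 r p α)
    rw [inner_neg_left]
    have h3 := (abs_le.1 (hMc q.1 q.2 α)).2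
    have h4 : |lam q.1 q.2 α * r| ≤ Ml * M := by
      rw [abs_mul]; exact mul_le_mul (hMl _ _ _) hr (abs_nonneg _) hMl0
    linarith [(abs_le.1 h4).1]
  · have hcα : Continuous (fun α => ς * ⟪b xh th α, D.gd xh⟫) :=
      continuous_const.mul ((hbc.comp (by fun_prop : Continuous (fun α : A => ((xh, th, α) : Euc N × ℝ × A)))).inner continuous_const)
    obtain ⟨α1, -, hα1⟩ := isCompact_univ.exists_isMinOn univ_nonempty hcα.continuousOn
    set β := ς * ⟪b xh th α1, D.gd xh⟫ / 2 with hβ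
    have hβ0 : 0 < β := by have := hα α1; linarith
    refine ⟨β, hβ0, Or.inr ?_⟩
    have h2 := (isCompact_univ (X := A)).eventually_forall_of_forall_eventually (x₀ := (xh, th))
      (P := fun (q : Euc N × ℝ) α => β < ς * ⟪b q.1 q.2 α, D.gd q.1⟫) (by
        intro α _
        have h3 : ς * ⟪b xh th α1, D.gd xh⟫ ≤ ς * ⟪b xh th α, D.gd xh⟫ := hα1 (mem_univ α)
        exact (hcont α).eventually (Ioi_mem_nhds (a := β) (show β < ς * ⟪b xh th α, D.gd xh⟫ by linarith)))
    filter_upwards [h2.filter_mono nhdsWithin_le_nhds] with q hq r hr p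
    obtain ⟨α, h3, -⟩ := bell_max hd hH q.1 q.2 (-r) (-p)
    refine ⟨-b q.1 q.2 α, by rw [norm_neg]; exact hMb _ _ _, by rw [inner_neg_left]; linarith [hq α (mem_univ α)], ?_⟩
    unfold Hneg
    rw [h3, inner_neg_left, inner_neg_right]
    have h3 := (abs_le.1 (hMc q.1 q.2 α)).1
    have h4 : |lam q.1 q.2 α * r| ≤ Ml * M := by
      rw [abs_mul]; exact mul_le_mul (hMl _ _ _) hr (abs_nonneg _) hMl0
    linarith [(abs_le.1 h4).1]

lemma bell_diff (hd : ParBellmanData lam b l) (hH : IsParBellman lam b l H)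
    {Mb : ℝ} (hMb : ∀ x t α, ‖b x t α‖ ≤ Mb) {ω1 ω2 : ℝ → ℝ} {CL : ℝ}
    (h1 : ∀ (α : A), ∀ x ∈ closure D.Ω, ∀ y ∈ closure D.Ω,
      ∀ t ∈ Ici (0:ℝ), ∀ s ∈ Ici (0:ℝ), |l x t α - l y s α| ≤ ω1 (‖x - y‖ + |t - s|))
    (h2 : ∀ (α : A), ∀ x ∈ closure D.Ω, ∀ y ∈ closure D.Ω,
      ∀ t ∈ Ici (0:ℝ), ∀ s ∈ Ici (0:ℝ), |lam x t α - lam y s α| ≤ ω2 (‖x - y‖ + |t - s|))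
    (h3 : ∀ (α : A), ∀ x ∈ closure D.Ω, ∀ y ∈ closure D.Ω, ∀ s ∈ Ici (0:ℝ), ∀ t ∈ Ici (0:ℝ),
      ‖b x s α - b y t α‖ ≤ CL * (‖x - y‖ + |s - t|))
    {x y : Euc N} (hx : x ∈ closure D.Ω) (hy : y ∈ closure D.Ω) {t s : ℝ} (ht : 0 ≤ t) (hs : 0 ≤ s) {v M : ℝ} (hv : |v| ≤ M)
    (X1 X2 : Euc N) : H y s v (-X2) ≤ H x t v X1 + ω1 (‖x - y‖ + |t - s|) + ω2 (‖x - y‖ + |t - s|) * M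
      + CL * (‖x - y‖ + |t - s|) * ‖X2‖ + Mb * ‖X1 + X2‖ := by
  obtain ⟨α, e1, -⟩ := bell_max hd hH y s v (-X2)
  have e2 := bell_ge hd hH x t v X1 α
  rw [e1, inner_neg_right]
  have e3 := (abs_le.1 (h1 α x hx y hy t ht s hs)).2
  have e4 : |(lam x t α - lam y s α) * v| ≤ ω2 (‖x - y‖ + |t - s|) * M := by
    rw [abs_mul]
    exact mul_le_mul (h2 α x hx y hy t ht s hs) hv (abs_nonneg _) ((abs_nonneg _).trans (h2 α x hx y hy t ht s hs))
  have e5 := (abs_le.1 e4).1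
  have e6 : |⟪b x t α - b y s α, X2⟫| ≤ CL * (‖x - y‖ + |t - s|) * ‖X2‖ :=
    (abs_real_inner_le_norm _ _).trans (by gcongr; exact h3 α x hx y hy t ht s hs)
  have e7 : |⟪b x t α, X1 + X2⟫| ≤ Mb * ‖X1 + X2‖ :=
    (abs_real_inner_le_norm _ _).trans (by gcongr; exact hMb _ _ _)
  have e8 := (abs_le.1 e6).1
  have e9 := (abs_le.1 e7).2
  rw [inner_sub_left] at e8
  rw [inner_add_right] at e9
  linarith

def MonoH (D : Dat N) (H : Euc N → ℝ → ℝ → Euc N → ℝ) (K : ℝ) : Prop :=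
  0 ≤ K ∧ ∀ x ∈ closure D.Ω, ∀ t, 0 ≤ t → ∀ r s : ℝ, s ≤ r → ∀ p : Euc N, -(K * (r - s)) ≤ H x t r p - H x t s p

lemma exists_monoH (h : AssumptionH' D.Ω H) : ∃ K, D.MonoH H K := by
  obtain ⟨K, hK⟩ := h
  refine ⟨max K 0, le_max_right _ _, fun x hx t ht r s hrs p => ?_⟩
  obtain ⟨γ, hγ, hm⟩ := hK (|r| + |s| + t + 1) (by positivity)
  have h1 := hm x hx t ⟨ht, by linarith [abs_nonneg r, abs_nonneg s]⟩ r s (by linarith [abs_nonneg r, abs_nonneg s])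
    (by linarith [abs_nonneg r, abs_nonneg s]) hrs p
  have h2 : -max K 0 ≤ γ := le_trans (neg_le_neg (le_max_left _ _)) hγ
  have h3 : -max K 0 * (r - s) ≤ γ * (r - s) := mul_le_mul_of_nonneg_right h2 (by linarith)
  linarith

lemma exists_rho {θ : ℝ} (hθ : 0 < θ) {ω : ℝ → ℝ} (hω : Tendsto ω (𝓝[>] 0) (𝓝 0)) (B : ℕ → ℝ) :
    ∃ ρ : ℕ → ℝ, (∀ k, 0 < ρ k) ∧ Tendsto (fun k => B k * ρ k) atTop (𝓝 0) ∧ Tendsto (fun k => B k * (2 * ρ k) ^ θ) atTop (𝓝 0) ∧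
      Tendsto (fun k => B k * ω (ρ k)) atTop (𝓝 0) := by
  have h1 : ∀ k : ℕ, ∃ s : ℝ, 0 < s ∧ |B k * s| < 1 / ((k:ℝ) + 1) ∧ |B k * (2 * s) ^ θ| < 1 / ((k:ℝ) + 1) ∧ |B k * ω s| < 1 / ((k:ℝ) + 1) := by
    intro k
    have hk : (0:ℝ) < 1 / ((k:ℝ) + 1) := by positivity
    have e0 : Tendsto (fun s : ℝ => s) (𝓝[>] 0) (𝓝 0) := tendsto_id.mono_left nhdsWithin_le_nhds
    have e1 : Tendsto (fun s => |B k * s|) (𝓝[>] 0) (𝓝 0) := by simpa using (e0.const_mul (B k)).abs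
    have e2 : Tendsto (fun s => |B k * ω s|) (𝓝[>] 0) (𝓝 0) := by simpa using (hω.const_mul (B k)).abs
    have e3 : Tendsto (fun s => |B k * (2 * s) ^ θ|) (𝓝[>] 0) (𝓝 0) := by
      have := (((e0.const_mul 2).rpow_const (p := θ) (Or.inr hθ.le)).const_mul (B k)).abs
      simpa [Real.zero_rpow hθ.ne'] using this
    obtain ⟨s, hs⟩ := ((((e1.eventually (Iio_mem_nhds hk)).and (e3.eventually (Iio_mem_nhds hk))).and (e2.eventually (Iio_mem_nhds hk))).and
      self_mem_nhdsWithin).exists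
    exact ⟨s, hs.2, hs.1.1.1, hs.1.1.2, hs.1.2⟩
  choose ρ hρ using h1
  have h2 : Tendsto (fun k : ℕ => 1 / ((k:ℝ) + 1)) atTop (𝓝 0) := tendsto_one_div_add_atTop_nhds_zero_nat
  refine ⟨ρ, fun k => (hρ k).1, ?_, ?_, ?_⟩
  · exact squeeze_zero_norm (fun k => (hρ k).2.1.le) h2
  · exact squeeze_zero_norm (fun k => (hρ k).2.2.1.le) h2
  · exact squeeze_zero_norm (fun k => (hρ k).2.2.2.le) h2

lemma bell_wsub (hOK : ParBellmanOK D.Ω D.n lam b l H) {K : ℝ} (hK : D.MonoH H K) {u1 u2 : Euc N × ℝ → ℝ}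
    (hu1 : D.Adm u1) (hu2 : D.Adm u2) (h1 : D.LSub H u1) (h2 : D.LSub (Hneg H) u2) (T : ℝ) :
    ∃ Mb, 0 ≤ Mb ∧ D.WSub (fun q => u1 q + u2 q) K 0 T (fun s => Mb * s) := by
  obtain ⟨hd, hH, ⟨⟨ω1, hω1, hc1⟩, ⟨ω2, hω2, hc2⟩⟩, ⟨CL, hCL, hL⟩, hB⟩ := hOK
  obtain ⟨-, ⟨Ml, hMl⟩, -, ⟨Mb, hMb⟩, -, ⟨Mc, hMc⟩⟩ := id hd
  have hMb0 : 0 ≤ Mb := (norm_nonneg _).trans (hMb 0 0 (Classical.arbitrary A))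
  refine ⟨Mb, hMb0, ?_⟩
  intro xh hxh th hth hthT hw p a ψ hT hN
  obtain ⟨M1, hM10, hM1⟩ := hu1.bdd T
  obtain ⟨M2, hM20, hM2⟩ := hu2.bdd T
  set M := max M1 M2 with hMdef
  have hM0 : 0 ≤ M := hM10.trans (le_max_left _ _)
  have hM1' : ∀ x ∈ closure D.Ω, ∀ t, 0 ≤ t → t ≤ T → |u1 (x, t)| ≤ M := fun x hx t h0 h1 => (hM1 x hx t h0 h1).trans (le_max_left _ _)
  have hM2' : ∀ x ∈ closure D.Ω, ∀ t, 0 ≤ t → t ≤ T → |u2 (x, t)| ≤ M := fun x hx t h0 h1 => (hM2 x hx t h0 h1).trans (le_max_right _ _)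
  obtain ⟨r0, L, e, ge, hl, hle⟩ := D.exists_loc hxh
  -- choice of the boundary penalization constant
  have hβ : ∃ β > 0, xh ∈ frontier D.Ω → ∀ ς : ℝ, ς = 1 ∨ ς = -1 → D.Force H ς xh th M β Mb (Ml * M + Mc) ∨
      D.Force (Hneg H) (-ς) xh th M β Mb (Ml * M + Mc) := by
    by_cases hf : xh ∈ frontier D.Ω
    · obtain ⟨β1, hb1, hf1⟩ := D.bell_force hd hH hB hMl hMb hMc hf hth.le hM0 (ς := 1) (Or.inl rfl)
      obtain ⟨β2, hb2, hf2⟩ := D.bell_force hd hH hB hMl hMb hMc hf hth.le hM0 (ς := -1) (Or.inr rfl)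
      refine ⟨min β1 β2, lt_min hb1 hb2, fun _ ς hς => ?_⟩
      rcases hς with rfl | rfl
      · exact hf1.imp (fun h => h.mono (min_le_left _ _)) (fun h => h.mono (min_le_left _ _))
      · exact hf2.imp (fun h => h.mono (min_le_right _ _)) (fun h => h.mono (min_le_right _ _))
    · exact ⟨1, one_pos, fun h => absurd h hf⟩
  obtain ⟨β, hβ0, hF⟩ := hβ
  set κ := (Mb + 2) * 2 / β with hκ
  have hκ0 : 0 ≤ κ := by positivity
  have hκ2 : Mb + 2 ≤ κ * β / 2 := by rw [hκ]; apply le_of_eq; field_simp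
  obtain ⟨ρ, hρ, hρ1, hρ2, -⟩ := exists_rho D.θ_pos (ω := fun _ => 0) tendsto_const_nhds (fun k => (2 + κ) * ((k:ℝ) + 1) + 1)
  have hP : ∀ k : ℕ, (0:ℝ) < (k:ℝ) + 1 := fun k => by positivity
  have hQ : ∀ k : ℕ, (0:ℝ) ≤ κ * ((k:ℝ) + 1) := fun k => by positivity
  have hPt : Tendsto (fun k : ℕ => (k:ℝ) + 1) atTop atTop :=
    tendsto_atTop_add_const_right _ _ tendsto_natCast_atTop_atTop
  have hρt : Tendsto (fun k : ℕ => ((k:ℝ) + 1 + κ * ((k:ℝ) + 1) + ((k:ℝ) + 1)) * ρ k) atTop (𝓝 0) := by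
    refine squeeze_zero (fun k => ?_) (fun k => ?_) hρ1
    · have := hρ k; positivity
    · have := hρ k
      apply mul_le_mul_of_nonneg_right _ (hρ k).le
      linarith
  obtain ⟨r, C0, x, y, t, s, p1, p2, a1, a2, hr0, h⟩ := D.exists_dbl hu1.usc hu2.usc hxh hth hT hl hP hQ hP hρ hPt hPt hρt
  have e1 := h.lsub hl hP hQ hρ hN h1
  have e2 := h.swap.lsub hl hP hQ hρ hN h2
  have hd' : ∀ᶠ k in atTop, xh ∈ frontier D.Ω → |D.d (x k) - D.d (y k)| ≤ ρ k := by
    by_cases hf : xh ∈ frontier D.Ω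
    · obtain ⟨rfl, rfl⟩ := hle hf
      have key : ∀ ς : ℝ, ς = 1 ∨ ς = -1 → ∀ᶠ k in atTop, ς * (D.d (x k) - D.d (y k)) ≤ ρ k := by
        intro ς hς
        have hς1 : |ς| = 1 := by rcases hς with rfl | rfl <;> simp
        rcases hF hf ς hς with hf1 | hf1
        · exact h.forcing hl hκ0 hρ hM0 hth hthT hM1' hN h1 hς1 hf1 hβ0 hMb0 hκ2
        · have := h.swap.forcing hl hκ0 hρ hM0 hth hthT hM2' hN h2 (ς := -ς) (by rw [abs_neg]; exact hς1) hf1 hβ0 hMb0 hκ2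
          filter_upwards [this] with k hk
          linarith
      filter_upwards [key 1 (Or.inl rfl), key (-1) (Or.inr rfl)] with k k1 k2 _
      rw [abs_le]; constructor <;> linarith
    · exact Eventually.of_forall fun k hk => absurd hk hf
  have hPq := h.Pq
  have hq0 : Tendsto (fun k => ‖x k - y k‖ + |t k - s k|) atTop (𝓝 0) := by
    have h3 := (h.tx.sub h.ty).norm.add (h.tt.sub h.ts).abs
    simpa using h3
  have hlim : Tendsto (fun k : ℕ => (1 + ((k:ℝ) + 1) + κ * ((k:ℝ) + 1)) * (‖x k - y k‖ + ρ k ^ D.θ)) atTop (𝓝 0) := by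
    have h3 := (hPq.const_mul (2 + κ)).add hρ2
    rw [mul_zero, add_zero] at h3
    refine squeeze_zero (fun k => ?_) (fun k => ?_) h3
    · have := hρ k; positivity
    · have := hρ k
      have hk1 : (1:ℝ) ≤ (k:ℝ) + 1 := by linarith [Nat.cast_nonneg (α := ℝ) k]
      rw [mul_add]
      apply add_le_add
      · rw [← mul_assoc]
        apply mul_le_mul_of_nonneg_right _ (norm_nonneg _)
        nlinarith
      · apply mul_le_mul
        · linarith
        · apply Real.rpow_le_rpow this.le (by linarith) D.θ_pos.le
        · positivity
        · positivity
  have hm1 := (modulus_tendsto hω1).comp hq0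
  have hm2 := (modulus_tendsto hω2).comp hq0
  have hp12 : Tendsto (fun k => p1 k + p2 k) atTop (𝓝 p) := by
    have h3 := h.tp1.add h.tp2
    rwa [← add_smul, show (1/2:ℝ) + 1/2 = 1 by norm_num, one_smul] at h3
  have hq2 : Tendsto (fun k : ℕ => CL * ((‖x k - y k‖ + |t k - s k|) * ‖p2 k‖ + (1 + 2 * κ) * (((k:ℝ) + 1) * ‖x k - y k‖ + ((k:ℝ) + 1) * |t k - s k|)))
      atTop (𝓝 0) := by
    have h3 := ((hq0.mul h.tp2.norm).add ((hPq.add h.Rq).const_mul (1 + 2 * κ))).const_mul CL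
    simpa using h3
  have hSS : Tendsto (fun k : ℕ => ‖p1 k + p2 k‖ + L * (κ * (((k:ℝ) + 1) * ‖x k - y k‖))) atTop (𝓝 ‖p‖) := by
    have h3 := hp12.norm.add ((hPq.const_mul κ).const_mul L)
    simpa using h3
  have hc : Tendsto (fun k : ℕ => a1 k + a2 k - K * (u1 (x k, t k) + u2 (y k, s k)) - (ω1 (‖x k - y k‖ + |t k - s k|) + ω2 (‖x k - y k‖ + |t k - s k|) * M
      + CL * ((‖x k - y k‖ + |t k - s k|) * ‖p2 k‖ + (1 + 2 * κ) * (((k:ℝ) + 1) * ‖x k - y k‖ + ((k:ℝ) + 1) * |t k - s k|))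
      + Mb * (‖p1 k + p2 k‖ + L * (κ * (((k:ℝ) + 1) * ‖x k - y k‖))))) atTop
      (𝓝 (1/2 * a + 1/2 * a - K * (u1 (xh, th) + u2 (xh, th)) - (0 + 0 * M + 0 + Mb * ‖p‖))) :=
    ((h.ta1.add h.ta2).sub ((h.tu1.add h.tu2).const_mul K)).sub (((hm1.add (hm2.mul_const M)).add hq2).add (hSS.const_mul Mb))
  have hfin := h.limit hl hr0 hP hQ hth hM0 hthT hM1' hM2' hu1.usc hu2.usc hρ hd' hlim hc ?_
  · refine ⟨hfin.1, le_trans (le_of_eq ?_) hfin.2⟩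
    ring
  have hball : ∀ᶠ k in atTop, x k ∈ ball xh r0 := h.tx.eventually (ball_mem_nhds _ hl.r_pos)
  have hbally : ∀ᶠ k in atTop, y k ∈ ball xh r0 := h.ty.eventually (ball_mem_nhds _ hl.r_pos)
  have hwk : ∀ᶠ k in atTop, 0 < u1 (x k, t k) + u2 (y k, s k) := (h.tu1.add h.tu2).eventually (Ioi_mem_nhds hw)
  have hsT : ∀ᶠ k in atTop, s k < T := h.ts.eventually (Iio_mem_nhds hthT)
  filter_upwards [e1, e2, hball, hbally, hwk, hsT] with k k1 k2 k3 k4 k5 k6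
  refine ⟨k1.1, k2.1, ?_⟩
  have i1 := k1.2
  have i2 := k2.2
  rw [ta_swap] at i2
  unfold Hneg at i2
  set X1 := p1 k + gr e ge ((k:ℝ) + 1) (κ * ((k:ℝ) + 1)) (ρ k) (x k) (y k) with hX1
  set X2 := p2 k + gr e ge ((k:ℝ) + 1) (κ * ((k:ℝ) + 1)) (ρ k) (y k) (x k) with hX2
  have i3 := D.bell_diff hd hH hMb hc1 hc2 hL (h.hx k) (h.hy k) (h.ht k).le (h.hs k).le (v := -u2 (y k, s k)) (M := M)
    (by rw [abs_neg]; exact hM2' _ (h.hy k) _ (h.hs k).le k6.le) X1 X2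
  have i4 := hK.2 (x k) (h.hx k) (t k) (h.ht k).le (u1 (x k, t k)) (-u2 (y k, s k)) (by linarith) X1
  have i5 : ‖X1 + X2‖ ≤ ‖p1 k + p2 k‖ + L * (κ * (((k:ℝ) + 1) * ‖x k - y k‖)) := by
    have : X1 + X2 = (p1 k + p2 k) + (gr e ge ((k:ℝ) + 1) (κ * ((k:ℝ) + 1)) (ρ k) (x k) (y k) + gr e ge ((k:ℝ) + 1) (κ * ((k:ℝ) + 1)) (ρ k) (y k) (x k)) := by
      rw [hX1, hX2]; abel
    rw [this]
    refine (norm_add_le _ _).trans (add_le_add le_rfl ((gr_add_norm (hQ k) (hρ k) (hl.glip _ k3 _ k4)).trans (le_of_eq ?_)))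
    ring
  have i6 : ‖X2‖ ≤ ‖p2 k‖ + (1 + 2 * κ) * ((k:ℝ) + 1) := by
    refine (norm_add_le _ _).trans (add_le_add le_rfl ((gr_norm (hP k).le (hQ k) (hρ k) (hl.gle _ k4)).trans (le_of_eq ?_)))
    ring
  have i7 : CL * (‖x k - y k‖ + |t k - s k|) * ‖X2‖ ≤ CL * ((‖x k - y k‖ + |t k - s k|) * ‖p2 k‖ + (1 + 2 * κ) * (((k:ℝ) + 1) * ‖x k - y k‖ + ((k:ℝ) + 1) * |t k - s k|)) := by
    calc _ ≤ CL * (‖x k - y k‖ + |t k - s k|) * (‖p2 k‖ + (1 + 2 * κ) * ((k:ℝ) + 1)) := by gcongr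
      _ = _ := by ring
  have i8 : Mb * ‖X1 + X2‖ ≤ Mb * (‖p1 k + p2 k‖ + L * (κ * (((k:ℝ) + 1) * ‖x k - y k‖))) := by gcongr
  linarith
end Dat
end BellSec

lemma pow_lin2 {σ m A B c : ℝ} (hm : 0 < m) (h1 : σ < m) (hB : 0 ≤ B) (hc : 0 < c) (C : ℝ) :
    ∀ᶠ k : ℕ in atTop, C + ((k:ℝ) + 1) ^ (m / 2) + A * (B * ((k:ℝ) + 1)) ^ σ < c * (((k:ℝ) + 1) / 4) ^ m := by
  have hP : Tendsto (fun k : ℕ => (k:ℝ) + 1) atTop atTop :=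
    tendsto_atTop_add_const_right _ _ tendsto_natCast_atTop_atTop
  have h2 : Tendsto (fun k : ℕ => C * ((k:ℝ) + 1) ^ (-m) + ((k:ℝ) + 1) ^ (-(m / 2)) + A * B ^ σ * ((k:ℝ) + 1) ^ (-(m - σ))) atTop
      (𝓝 (C * 0 + 0 + A * B ^ σ * 0)) :=
    ((((tendsto_rpow_neg_atTop hm).comp hP).const_mul C).add ((tendsto_rpow_neg_atTop (by linarith)).comp hP)).add
      (((tendsto_rpow_neg_atTop (by linarith)).comp hP).const_mul _)
  rw [mul_zero, mul_zero, add_zero, add_zero] at h2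
  have hc' : 0 < c * (1 / 4 : ℝ) ^ m := by positivity
  filter_upwards [h2.eventually (Iio_mem_nhds hc')] with k hk
  have hk' : C * ((k:ℝ) + 1) ^ (-m) + ((k:ℝ) + 1) ^ (-(m / 2)) + A * B ^ σ * ((k:ℝ) + 1) ^ (-(m - σ)) < c * (1 / 4 : ℝ) ^ m := hk
  have hp : (0:ℝ) < (k:ℝ) + 1 := by positivity
  have hpm : 0 < ((k:ℝ) + 1) ^ m := by positivity
  have h3 := mul_lt_mul_of_pos_right hk' hpm
  rw [Real.mul_rpow hB hp.le, show ((k:ℝ) + 1) / 4 = 1 / 4 * ((k:ℝ) + 1) by ring, Real.mul_rpow (by norm_num) hp.le]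
  have h4 : ((k:ℝ) + 1) ^ (-(m - σ)) * ((k:ℝ) + 1) ^ m = ((k:ℝ) + 1) ^ σ := by
    rw [← Real.rpow_add hp]; congr 1; ring
  have h5 : ((k:ℝ) + 1) ^ (-(m / 2)) * ((k:ℝ) + 1) ^ m = ((k:ℝ) + 1) ^ (m / 2) := by
    rw [← Real.rpow_add hp]; congr 1; ring
  have h6 : ((k:ℝ) + 1) ^ (-m) * ((k:ℝ) + 1) ^ m = 1 := by
    rw [← Real.rpow_add hp]; simp
  calc C + ((k:ℝ) + 1) ^ (m / 2) + A * (B ^ σ * ((k:ℝ) + 1) ^ σ)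
      = C * (((k:ℝ) + 1) ^ (-m) * ((k:ℝ) + 1) ^ m) + ((k:ℝ) + 1) ^ (-(m / 2)) * ((k:ℝ) + 1) ^ m + A * B ^ σ * (((k:ℝ) + 1) ^ (-(m - σ)) * ((k:ℝ) + 1) ^ m) := by
        rw [h4, h5, h6]; ring
    _ = (C * ((k:ℝ) + 1) ^ (-m) + ((k:ℝ) + 1) ^ (-(m / 2)) + A * B ^ σ * ((k:ℝ) + 1) ^ (-(m - σ))) * ((k:ℝ) + 1) ^ m := by ring
    _ < _ := by linarith

namespace Dat
section DblSec
variable {D : Dat N} {u1 u2 : Euc N × ℝ → ℝ} {xh : Euc N} {th : ℝ} {p : Euc N} {a : ℝ} {e : Euc N → ℝ} {ge : Euc N → Euc N}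
    {r C0 : ℝ} {P Q R ρ : ℕ → ℝ} {x y : ℕ → Euc N} {t s : ℕ → ℝ} {p1 p2 : ℕ → Euc N} {a1 a2 : ℕ → ℝ} {r0 L : ℝ}

lemma gr_zero_norm {P ρ : ℝ} (hP : 0 ≤ P) (hρ : 0 < ρ) {x y : Euc N} (h : ρ ≤ ‖x - y‖) : P / 2 ≤ ‖gr e ge P 0 ρ x y‖ := by
  unfold gr
  rw [zero_mul, zero_smul, add_zero, norm_smul, Real.norm_eq_abs, abs_of_nonneg (mul_nonneg hP (inv_nonneg.2 (br_pos hρ _).le))]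
  have h1 := br_coef_ge hρ (s := ‖x - y‖) (by rwa [abs_of_nonneg (norm_nonneg _)])
  rw [abs_of_nonneg (norm_nonneg _), div_eq_inv_mul ‖x - y‖] at h1
  rw [mul_assoc]
  have := mul_le_mul_of_nonneg_left h1 hP
  linarith

lemma Dbl.forcing_c {m : ℝ} (h : D.Dbl u1 u2 xh th p a e ge r C0 (fun k => (k:ℝ) + 1) (fun _ => 0) (fun k => ((k:ℝ) + 1) ^ (m / 2)) ρ x y t s p1 p2 a1 a2)
    (hl : D.Loc xh r0 L e ge) (hρ : ∀ k, 0 < ρ k) {M T : ℝ} (hM0 : 0 ≤ M) (hth : 0 < th) (hT : th < T)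
    (hM : ∀ x ∈ closure D.Ω, ∀ t, 0 ≤ t → t ≤ T → |u1 (x, t)| ≤ M)
    (hN : xh ∈ D.Ω ∨ 0 < ⟪p, D.n xh⟫) {G : Euc N → ℝ → ℝ → Euc N → ℝ} (hG : D.LSub G u1)
    (hm : D.σ < m) {c0 Dc : ℝ} (hc0 : 0 < c0) (hco : ∀ x ∈ closure D.Ω, ∀ t, 0 ≤ t → t ≤ T → ∀ r, |r| ≤ M → ∀ p, c0 * ‖p‖ ^ m - Dc ≤ G x t r p) :
    ∀ᶠ k in atTop, ‖x k - y k‖ < ρ k := by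
  have hσ := D.σ_pos
  have hP : ∀ k : ℕ, (0:ℝ) < (k:ℝ) + 1 := fun k => by positivity
  have hQ : ∀ k : ℕ, (0:ℝ) ≤ (fun _ : ℕ => (0:ℝ)) k := fun k => le_rfl
  have hPt : Tendsto (fun k : ℕ => (k:ℝ) + 1) atTop atTop :=
    tendsto_atTop_add_const_right _ _ tendsto_natCast_atTop_atTop
  have e1 := h.lsub hl hP hQ hρ hN hG
  have e2 := h.crude hl hP hQ hM0 hT hM
  have e4 : ∀ᶠ k in atTop, ‖p1 k‖ < ‖(1/2:ℝ) • p‖ + 1 := h.tp1.norm.eventually (Iio_mem_nhds (lt_add_one _))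
  have e5 : ∀ᶠ k in atTop, 1/2 * a - 1 < a1 k := h.ta1.eventually (Ioi_mem_nhds (sub_one_lt _))
  have e6 := pow_lin2 (σ := D.σ) (A := D.KM (2 * M)) (B := C0 + 4 * M / r + 1) (c := c0) (by linarith) hm
    (by have := h.C0_nonneg; have := h.r_pos; positivity) hc0 (Dc - (1/2 * a - 1))
  have e7 : ∀ᶠ k in atTop, t k < T := h.tt.eventually (Iio_mem_nhds hT)
  have e8 := hPt.eventually (eventually_ge_atTop (4 * (‖(1/2:ℝ) • p‖ + 1)))
  filter_upwards [e1, e2, e4, e5, e6, e7, e8] with k k1 k2 k4 k5 k6 k7 k8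
  by_contra! hcon
  have hr := h.r_pos
  have hC0 := h.C0_nonneg
  set Pk : ℝ := (k:ℝ) + 1 with hPk
  have hPp : 0 < Pk := hP k
  have hP1 : 1 ≤ Pk := by rw [hPk]; linarith [Nat.cast_nonneg (α := ℝ) k]
  have k3 := hco (x k) (h.hx k) (t k) (h.ht k).le k7.le (u1 (x k, t k)) (hM _ (h.hx k) _ (h.ht k).le k7.le) (p1 k + gr e ge Pk 0 (ρ k) (x k) (y k))
  have k9 := k2 k1.1
  have k10 := k1.2
  have hta := (abs_le.1 (ta_abs (R := Pk ^ (m / 2)) (by positivity) (hρ k) (t k) (s k))).1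
  have hn : Pk / 4 ≤ ‖p1 k + gr e ge Pk 0 (ρ k) (x k) (y k)‖ := by
    have h1 := gr_zero_norm (e := e) (ge := ge) hPp.le (hρ k) hcon
    have h2 := norm_sub_le_norm_add (gr e ge Pk 0 (ρ k) (x k) (y k)) (p1 k)
    rw [add_comm (gr e ge Pk 0 (ρ k) (x k) (y k))] at h2
    linarith
  have hn2 : c0 * (Pk / 4) ^ m ≤ c0 * ‖p1 k + gr e ge Pk 0 (ρ k) (x k) (y k)‖ ^ m := by
    apply mul_le_mul_of_nonneg_left _ hc0.le
    exact Real.rpow_le_rpow (by positivity) hn (by linarith)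
  have hpw : D.KM (2 * M) * (C0 + Pk + 2 * 0 + 4 * M / r) ^ D.σ ≤ D.KM (2 * M) * ((C0 + 4 * M / r + 1) * Pk) ^ D.σ := by
    apply mul_le_mul_of_nonneg_left _ (D.KM_nonneg (by positivity))
    apply Real.rpow_le_rpow (by positivity) _ D.σ_pos.le
    have : (C0 + 4 * M / r) * 1 ≤ (C0 + 4 * M / r) * Pk := by gcongr
    linarith
  linarith

lemma coer_wsub (h1u : UpperSemicontinuousOn u1 D.Cyl) (h2u : UpperSemicontinuousOn u2 D.Cyl) {M T : ℝ} (hM0 : 0 ≤ M)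
    (hM1 : ∀ x ∈ closure D.Ω, ∀ t, 0 ≤ t → t ≤ T → |u1 (x, t)| ≤ M)
    (hM2 : ∀ x ∈ closure D.Ω, ∀ t, 0 ≤ t → t ≤ T → |u2 (x, t)| ≤ M)
    {G1 G2 : Euc N → ℝ → ℝ → Euc N → ℝ} (hG1 : D.LSub G1 u1) (hG2 : D.LSub G2 u2)
    {m : ℝ} (hm : D.σ < m) {c0 Dc : ℝ} (hc0 : 0 < c0)
    (hco : ∀ x ∈ closure D.Ω, ∀ t, 0 ≤ t → t ≤ T → ∀ r, |r| ≤ M → ∀ p, c0 * ‖p‖ ^ m - Dc ≤ G1 x t r p)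
    {ω ω2 Γ : ℝ → ℝ} {δ K e' : ℝ} (hω : IsModulus ω) (hω2 : IsModulus ω2) (hδ : 0 < δ) (hΓ : Continuous Γ)
    (hdiff : ∀ x ∈ closure D.Ω, ∀ y ∈ closure D.Ω, ∀ t, 0 ≤ t → t ≤ T → ∀ s, 0 ≤ s → s ≤ T → ∀ r1, |r1| ≤ M → ∀ r2, |r2| ≤ M →
      0 < r1 + r2 → ∀ X1 X2, ‖x - y‖ < δ → -(K * (r1 + r2)) - Γ ‖X1 + X2‖ - e' - ω ‖x - y‖ * (1 + ‖X1‖) - ω2 |t - s|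
        ≤ G1 x t r1 X1 + G2 y s r2 X2) :
    D.WSub (fun q => u1 q + u2 q) K e' T Γ := by
  have hσ := D.σ_pos
  intro xh hxh th hth hthT hw p a ψ hT hN
  obtain ⟨r0, L, e, ge, hl, hle⟩ := D.exists_loc hxh
  have hP : ∀ k : ℕ, (0:ℝ) < (k:ℝ) + 1 := fun k => by positivity
  have hR : ∀ k : ℕ, (0:ℝ) < ((k:ℝ) + 1) ^ (m / 2) := fun k => by positivity
  have hQ : ∀ k : ℕ, (0:ℝ) ≤ (fun _ : ℕ => (0:ℝ)) k := fun k => le_rfl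
  have hPt : Tendsto (fun k : ℕ => (k:ℝ) + 1) atTop atTop :=
    tendsto_atTop_add_const_right _ _ tendsto_natCast_atTop_atTop
  have hRt : Tendsto (fun k : ℕ => ((k:ℝ) + 1) ^ (m / 2)) atTop atTop := (tendsto_rpow_atTop (by linarith)).comp hPt
  obtain ⟨ρ, hρ, hρ1, hρ2, hρ3⟩ := exists_rho D.θ_pos hω.2.2 (fun k => 1 + ((k:ℝ) + 1) + ((k:ℝ) + 1) ^ (m / 2))
  have hρt : Tendsto (fun k : ℕ => ((k:ℝ) + 1 + (fun _ : ℕ => (0:ℝ)) k + ((k:ℝ) + 1) ^ (m / 2)) * ρ k) atTop (𝓝 0) := by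
    refine squeeze_zero (fun k => ?_) (fun k => ?_) hρ1
    · have := hρ k; have := hR k; positivity
    · apply mul_le_mul_of_nonneg_right _ (hρ k).le
      simp only; linarith
  obtain ⟨r, C0, x, y, t, s, p1, p2, a1, a2, hr0, h⟩ := D.exists_dbl h1u h2u hxh hth hT hl hP hQ hR hρ hPt hRt hρt
  have e1 := h.lsub hl hP hQ hρ hN hG1
  have e2 := h.swap.lsub hl hP hQ hρ hN hG2
  have e3 := h.forcing_c hl hρ hM0 hth hthT hM1 hN hG1 hm hc0 hco
  have hd' : ∀ᶠ k in atTop, xh ∈ frontier D.Ω → |D.d (x k) - D.d (y k)| ≤ 2 * ρ k := by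
    filter_upwards [e3] with k hk _
    exact (D.d_lip _ _).trans (by linarith)
  have hlim : Tendsto (fun k : ℕ => (1 + ((k:ℝ) + 1) + (fun _ : ℕ => (0:ℝ)) k) * (‖x k - y k‖ + (2 * ρ k) ^ D.θ)) atTop (𝓝 0) := by
    have h3 := (h.Pq.const_mul 2).add hρ2
    rw [mul_zero, add_zero] at h3
    refine squeeze_zero (fun k => ?_) (fun k => ?_) h3
    · have := hρ k; positivity
    · have := hρ k
      have hR' := hR k
      have hk1 : (1:ℝ) ≤ (k:ℝ) + 1 := by linarith [Nat.cast_nonneg (α := ℝ) k]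
      rw [mul_add]
      apply add_le_add
      · rw [← mul_assoc]
        apply mul_le_mul_of_nonneg_right _ (norm_nonneg _)
        simp only; linarith
      · apply mul_le_mul_of_nonneg_right
        · simp only; linarith
        · positivity
  have hp12 : Tendsto (fun k => p1 k + p2 k) atTop (𝓝 p) := by
    have h3 := h.tp1.add h.tp2
    rwa [← add_smul, show (1/2:ℝ) + 1/2 = 1 by norm_num, one_smul] at h3
  have hτ : Tendsto (fun k => |t k - s k|) atTop (𝓝 0) := by
    simpa using (h.tt.sub h.ts).abs
  have hm2 := (modulus_tendsto hω2).comp hτ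
  have hΓt := (hΓ.tendsto _).comp hp12.norm
  have hωt : Tendsto (fun k : ℕ => ω (ρ k) * ‖p1 k‖ + (1 + ((k:ℝ) + 1) + ((k:ℝ) + 1) ^ (m / 2)) * ω (ρ k)) atTop (𝓝 0) := by
    have h4 : Tendsto (fun k => ω (ρ k)) atTop (𝓝 0) := by
      refine squeeze_zero (fun k => hω.1 _) (fun k => ?_) hρ3
      have := hω.1 (ρ k)
      have := hR k
      nlinarith [hP k]
    simpa using (h4.mul h.tp1.norm).add hρ3
  have hc : Tendsto (fun k : ℕ => a1 k + a2 k - K * (u1 (x k, t k) + u2 (y k, s k)) - Γ ‖p1 k + p2 k‖ - e'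
      - (ω (ρ k) * ‖p1 k‖ + (1 + ((k:ℝ) + 1) + ((k:ℝ) + 1) ^ (m / 2)) * ω (ρ k)) - ω2 |t k - s k|) atTop
      (𝓝 (1/2 * a + 1/2 * a - K * (u1 (xh, th) + u2 (xh, th)) - Γ ‖p‖ - e' - 0 - 0)) :=
    (((((h.ta1.add h.ta2).sub ((h.tu1.add h.tu2).const_mul K)).sub hΓt).sub_const e').sub hωt).sub hm2
  have hfin := h.limit hl hr0 hP hQ hth hM0 hthT hM1 hM2 h1u h2u (η := fun k => 2 * ρ k) (fun k => by have := hρ k; positivity) hd' hlim hc ?_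
  · refine ⟨hfin.1, le_trans (le_of_eq ?_) hfin.2⟩
    ring
  have hwk : ∀ᶠ k in atTop, 0 < u1 (x k, t k) + u2 (y k, s k) := (h.tu1.add h.tu2).eventually (Ioi_mem_nhds hw)
  have htT : ∀ᶠ k in atTop, t k < T := h.tt.eventually (Iio_mem_nhds hthT)
  have hsT : ∀ᶠ k in atTop, s k < T := h.ts.eventually (Iio_mem_nhds hthT)
  have hqδ : ∀ᶠ k in atTop, ‖x k - y k‖ < δ := by
    have h3 := (h.tx.sub h.ty).norm
    rw [sub_self, norm_zero] at h3
    exact h3.eventually (Iio_mem_nhds hδ)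
  have hball : ∀ᶠ k in atTop, x k ∈ ball xh r0 := h.tx.eventually (ball_mem_nhds _ hl.r_pos)
  filter_upwards [e1, e2, e3, hwk, hsT, htT, hqδ, hball] with k k1 k2 k3 k4 k5 k6 k7 k8
  refine ⟨k1.1, k2.1, ?_⟩
  have i1 := k1.2
  have i2 := k2.2
  rw [ta_swap] at i2
  set X1 := p1 k + gr e ge ((k:ℝ) + 1) 0 (ρ k) (x k) (y k) with hX1
  set X2 := p2 k + gr e ge ((k:ℝ) + 1) 0 (ρ k) (y k) (x k) with hX2
  have i3 := hdiff (x k) (h.hx k) (y k) (h.hy k) (t k) (h.ht k).le k6.le (s k) (h.hs k).le k5.le _ (hM1 _ (h.hx k) _ (h.ht k).le k6.le)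
    _ (hM2 _ (h.hy k) _ (h.hs k).le k5.le) k4 X1 X2 k7
  have i4 : X1 + X2 = p1 k + p2 k := by
    have := gr_add e ge ((k:ℝ) + 1) 0 (ρ k) (x k) (y k)
    rw [zero_mul, zero_smul] at this
    calc X1 + X2 = (p1 k + p2 k) + (gr e ge ((k:ℝ) + 1) 0 (ρ k) (x k) (y k) + gr e ge ((k:ℝ) + 1) 0 (ρ k) (y k) (x k)) := by
          rw [hX1, hX2]; abel
      _ = _ := by rw [this, add_zero]
  rw [i4] at i3
  have i5 : ω ‖x k - y k‖ * (1 + ‖X1‖) ≤ ω (ρ k) * ‖p1 k‖ + (1 + ((k:ℝ) + 1) + ((k:ℝ) + 1) ^ (m / 2)) * ω (ρ k) := by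
    have j1 : ω ‖x k - y k‖ ≤ ω (ρ k) := hω.2.1 k3.le
    have j2 : ‖X1‖ ≤ ‖p1 k‖ + ((k:ℝ) + 1) := by
      refine (norm_add_le _ _).trans (add_le_add le_rfl ((gr_norm (hP k).le le_rfl (hρ k) (hl.gle _ k8)).trans (le_of_eq ?_)))
      ring
    have j3 := hω.1 (ρ k)
    have j4 := hR k
    calc _ ≤ ω (ρ k) * (1 + (‖p1 k‖ + ((k:ℝ) + 1))) := mul_le_mul j1 (by linarith) (by positivity) j3
      _ ≤ _ := by nlinarith
  linarith
end DblSec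
end Dat

lemma hasFD_x {θ : Euc N → ℝ} {g x : Euc N} (h : HasGradientAt θ g x) (t : ℝ) :
    HasFDerivAt (fun q : Euc N × ℝ => θ q.1) (clm g 0) (x, t) := by
  have h1 := HasFDerivAt.comp (g := θ) (f := Prod.fst) ((x, t) : Euc N × ℝ) h.hasFDerivAt (hasFDerivAt_fst)
  refine h1.congr_fderiv ?_
  ext q
  · simp [clm_apply]
  · simp [clm_apply]

lemma hasFD_t {f : ℝ → ℝ} {a t : ℝ} (h : HasDerivAt f a t) (x : Euc N) :
    HasFDerivAt (fun q : Euc N × ℝ => f q.2) (clm 0 a) (x, t) := by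
  have h1 := HasFDerivAt.comp (g := f) (f := Prod.snd) ((x, t) : Euc N × ℝ) h.hasFDerivAt (hasFDerivAt_snd)
  refine h1.congr_fderiv ?_
  ext q
  · simp [clm_apply]
  · simp [clm_apply]

lemma usc_mul {X : Type} [TopologicalSpace X] {S : Set X} {w c : X → ℝ} (hw : UpperSemicontinuousOn w S) (hc : ContinuousOn c S) (h0 : ∀ q ∈ S, 0 < c q) :
    UpperSemicontinuousOn (fun q => w q * c q) S := by
  intro q hq b hb
  have hb : w q * c q < b := hb
  have hcq := h0 q hq
  obtain ⟨b', h1, h2⟩ := exists_between ((lt_div_iff₀ hcq).2 hb)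
  have h3 := hw q hq b' h1
  have h4 : Tendsto (fun q' => b' * c q') (𝓝[S] q) (𝓝 (b' * c q)) := (hc q hq).const_mul b'
  have h5 : b' * c q < b := (lt_div_iff₀ hcq).1 h2
  filter_upwards [h3, h4.eventually (Iio_mem_nhds h5), self_mem_nhdsWithin] with q' k1 k2 k3
  have k2 : b' * c q' < b := k2
  exact lt_of_le_of_lt (mul_le_mul_of_nonneg_right k1.le (h0 q' k3).le) k2

lemma HasGradientAt_norm_le {θ : Euc N → ℝ} {g x : Euc N} {C : ℝ} (h : HasGradientAt θ g x) (hC : 0 ≤ C) (hl : ∀ x y, |θ x - θ y| ≤ C * ‖x - y‖) :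
    ‖g‖ ≤ C := by
  have h1 := h.hasFDerivAt.le_of_lip' hC (Eventually.of_forall fun y => by rw [Real.norm_eq_abs]; exact hl y x)
  simpa using h1

namespace Dat
variable (D : Dat N)

lemma compare_w {w : Euc N × ℝ → ℝ} (hw : UpperSemicontinuousOn w D.Cyl) {M K e T : ℝ} {Γ : ℝ → ℝ} (hM0 : 0 ≤ M)
    (hM : ∀ x ∈ closure D.Ω, ∀ t, 0 ≤ t → t ≤ T → |w (x, t)| ≤ M) (hK : 0 ≤ K) (he : 0 ≤ e)
    (hΓ : Tendsto Γ (𝓝 0) (𝓝 0)) (hW : D.WSub w K e T Γ) (h0 : ∀ x ∈ closure D.Ω, w (x, 0) ≤ 0) :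
    ∀ x ∈ closure D.Ω, ∀ t, 0 ≤ t → t < T → w (x, t) ≤ e * Real.exp ((K + 1) * t) := by
  intro x1 hx1 t1 ht1 ht1T
  by_contra! hcon
  have hTp : 0 < T := lt_of_le_of_lt ht1 ht1T
  set lm := K + 1 with hlm
  have hlm0 : 0 ≤ lm := by linarith
  have hexp : ∀ t, 0 ≤ t → Real.exp (-(lm * t)) ≤ 1 := fun t ht => Real.exp_le_one_iff.2 (by nlinarith)
  have hee : ∀ t, Real.exp (lm * t) * Real.exp (-(lm * t)) = 1 := fun t => by rw [← Real.exp_add]; simp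
  -- value at the bad point
  have hv1 : e < w (x1, t1) * Real.exp (-(lm * t1)) := by
    have := mul_lt_mul_of_pos_right hcon (Real.exp_pos (-(lm * t1)))
    rwa [mul_assoc, hee, mul_one] at this
  set κ := (w (x1, t1) * Real.exp (-(lm * t1)) - e) / 2 * (T - t1) with hκdef
  have hκ : 0 < κ := by apply mul_pos <;> linarith
  set F0 : Euc N × ℝ → ℝ := fun q => w q * Real.exp (-(lm * q.2)) - κ / (T - q.2) with hF0
  have hF0le : ∀ x ∈ closure D.Ω, ∀ t, 0 ≤ t → t < T → F0 (x, t) ≤ M - κ / (T - t) := by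
    intro x hx t h1 h2
    have h3 := (abs_le.1 (hM x hx t h1 h2.le)).2
    have h4 : w (x, t) * Real.exp (-(lm * t)) ≤ M * 1 :=
      (mul_le_mul_of_nonneg_right h3 (Real.exp_pos _).le).trans (mul_le_mul_of_nonneg_left (hexp t h1) hM0)
    simp only [hF0]; linarith
  set S : Set ℝ := F0 '' (closure D.Ω ×ˢ Ico 0 T) with hS
  have hSb : BddAbove S := ⟨M, by
    rintro _ ⟨⟨x, t⟩, ⟨hx, ht⟩, rfl⟩
    have := hF0le x hx t ht.1 ht.2
    have h5 : 0 < T - t := by have := ht.2; simp only at this; linarith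
    have : 0 < κ / (T - t) := by positivity
    linarith⟩
  set A := sSup S with hA
  have hAe : e < A := by
    have h5 : F0 (x1, t1) ≤ A := le_csSup hSb ⟨_, ⟨hx1, ht1, ht1T⟩, rfl⟩
    have h6 : F0 (x1, t1) = (w (x1, t1) * Real.exp (-(lm * t1)) + e) / 2 := by
      simp only [hF0, hκdef]
      have : T - t1 ≠ 0 := by linarith
      field_simp
      ring
    linarith
  obtain ⟨C, hC0, hC⟩ := D.exists_theta (r := 1) one_pos
  set EC := Real.exp (lm * T) * (C + 1) with hEC
  have hEC0 : 0 < EC := by positivity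
  -- choose eta
  have hex : ∃ η : ℝ, 0 < η ∧ η < 1 ∧ η < (A - e) / 4 ∧ (∀ s, 0 ≤ s → s ≤ EC * η → Γ s < (A - e) / 4) ∧
      D.KM (2 * M) * (EC * η) ^ D.σ < (A - e) / 4 := by
    have hq : 0 < (A - e) / 4 := by linarith
    have hlimη : Tendsto (fun η : ℝ => EC * η) (𝓝[>] 0) (𝓝 0) := by
      have : Continuous fun η : ℝ => EC * η := by fun_prop
      simpa using (this.tendsto 0).mono_left nhdsWithin_le_nhds
    have g1 : ∀ᶠ η in 𝓝[>] (0:ℝ), η < (A - e) / 4 := (Iio_mem_nhds hq |> mem_nhdsWithin_of_mem_nhds)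
    have g0 : ∀ᶠ η in 𝓝[>] (0:ℝ), η < 1 := (Iio_mem_nhds one_pos |> mem_nhdsWithin_of_mem_nhds)
    obtain ⟨ε, hε, hΓε⟩ := Metric.eventually_nhds_iff.1 (hΓ.eventually (Iio_mem_nhds hq))
    have g2 : ∀ᶠ η in 𝓝[>] (0:ℝ), EC * η < ε := hlimη.eventually (Iio_mem_nhds hε)
    have g3 : ∀ᶠ η in 𝓝[>] (0:ℝ), D.KM (2 * M) * (EC * η) ^ D.σ < (A - e) / 4 := by
      have := ((hlimη.rpow_const (p := D.σ) (Or.inr D.σ_pos.le))).const_mul (D.KM (2 * M))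
      rw [Real.zero_rpow D.σ_pos.ne', mul_zero] at this
      exact this.eventually (Iio_mem_nhds hq)
    obtain ⟨η, hη⟩ := ((((g1.and g2).and g3).and self_mem_nhdsWithin).and g0).exists
    refine ⟨η, hη.1.2, hη.2, hη.1.1.1.1, fun s hs hs2 => hΓε ?_, hη.1.1.2⟩
    rw [Real.dist_eq, sub_zero, abs_of_nonneg hs]
    exact lt_of_le_of_lt hs2 hη.1.1.1.2
  obtain ⟨η, hη, hη1, hηA, hηΓ, hηK⟩ := hex
  obtain ⟨_, ⟨⟨x0, t0⟩, ⟨hx0, ht0⟩, rfl⟩, hA0⟩ := exists_lt_of_lt_csSup (s := S) ⟨_, ⟨(x1, t1), ⟨hx1, ht1, ht1T⟩, rfl⟩⟩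
    (show A - η / 4 < sSup S by linarith)
  obtain ⟨θ, hθ⟩ := hC x0 (1/8) (by norm_num)
  set T' := T - κ / (2 * M + 2) with hT'
  have hT'T : T' < T := by have : 0 < κ / (2 * M + 2) := by positivity
                           linarith
  have hbig : ∀ t, t < T → T' < t → 2 * M + 2 ≤ κ / (T - t) := by
    intro t h1 h2
    rw [le_div_iff₀ (by linarith), ← le_div_iff₀' (by positivity)]
    linarith
  set F : Euc N × ℝ → ℝ := fun q => F0 q - η * θ q.1 with hF
  have hF00 : A - η / 2 < F (x0, t0) := by
    have := mul_le_mul_of_nonneg_left hθ.ctr hη.le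
    simp only [hF]; linarith
  have ht0T' : t0 ≤ T' := by
    by_contra! h5
    have h6 := hbig t0 ht0.2 h5
    have h7 := hF0le x0 hx0 t0 ht0.1 ht0.2
    linarith
  set Kc : Set (Euc N × ℝ) := (closedBall x0 1 ∩ closure D.Ω) ×ˢ Icc 0 T' with hKc
  have hKcc : IsCompact Kc := ((isCompact_closedBall x0 1).inter_right isClosed_closure).prod isCompact_Icc
  have hKsub : Kc ⊆ D.Cyl := fun q hq => ⟨hq.1.2, hq.2.1⟩
  have hθc : Continuous θ := by
    refine (LipschitzWith.of_dist_le_mul (K := ⟨C, hC0⟩) fun x y => ?_).continuous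
    rw [Real.dist_eq, dist_eq_norm]; exact hθ.lip x y
  have hFusc : UpperSemicontinuousOn F Kc := by
    have h1 : UpperSemicontinuousOn (fun q => w q * Real.exp (-(lm * q.2))) Kc :=
      usc_mul (fun q hq b hb => (hw q (hKsub hq) b hb).filter_mono (nhdsWithin_mono _ hKsub)) (by fun_prop) (fun q _ => Real.exp_pos _)
    have h2 : ContinuousOn (fun q : Euc N × ℝ => -(κ / (T - q.2)) + -(η * θ q.1)) Kc := by
      refine ContinuousOn.add (ContinuousOn.neg (ContinuousOn.div continuousOn_const (by fun_prop) fun q hq => ?_)) (by fun_prop)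
      have := hq.2.2; linarith
    have h3 := h1.add h2.upperSemicontinuousOn
    have heq : F = fun q => w q * Real.exp (-(lm * q.2)) + (-(κ / (T - q.2)) + -(η * θ q.1)) := by
      funext q
      change w q * Real.exp (-(lm * q.2)) - κ / (T - q.2) - η * θ q.1 = _
      ring
    rw [heq]
    exact h3
  obtain ⟨⟨xh, th⟩, hmem, hmax⟩ := hFusc.exists_isMaxOn (show Kc.Nonempty from ⟨(x0, t0), ⟨⟨mem_closedBall_self zero_le_one, hx0⟩, ht0.1, ht0T'⟩⟩) hKcc
  have hmax0 : F (x0, t0) ≤ F (xh, th) := hmax ⟨⟨mem_closedBall_self zero_le_one, hx0⟩, ht0.1, ht0T'⟩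
  have hxh : xh ∈ closure D.Ω := hmem.1.2
  have hthT' : th ≤ T' := hmem.2.2
  have hth0 : 0 ≤ th := hmem.2.1
  have hglob : ∀ x ∈ closure D.Ω, ∀ t, 0 ≤ t → t < T → F (x, t) ≤ F (xh, th) := by
    intro x hx t h1 h2
    have hlow := hθ.lower x
    have hlow' := mul_le_mul_of_nonneg_left hlow hη.le
    by_cases h3 : T' < t
    · have h4 := hbig t h2 h3
      have h5 := hF0le x hx t h1 h2
      simp only [hF] at hmax0 hF00 ⊢
      linarith
    · by_cases h4 : x ∈ closedBall x0 1
      · exact hmax ⟨⟨h4, hx⟩, h1, not_lt.1 h3⟩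
      · have h5 : F0 (x, t) ≤ A := le_csSup hSb ⟨_, ⟨hx, h1, h2⟩, rfl⟩
        have h6 := hθ.off x (by rw [mem_closedBall, dist_eq_norm] at h4; linarith)
        have h7 := mul_le_mul_of_nonneg_left h6 hη.le
        simp only [hF] at hmax0 hF00 ⊢
        linarith
  set Φ := F (xh, th) with hΦ
  have hΦA : A - η / 2 < Φ := lt_of_lt_of_le hF00 hmax0
  have hwexp : A - η ≤ w (xh, th) * Real.exp (-(lm * th)) := by
    have h5 : 0 < T - th := by linarith
    have h6 : 0 < κ / (T - th) := by positivity
    have h7 := mul_le_mul_of_nonneg_left (hθ.lower xh) hη.le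
    simp only [hF, hF0] at hΦ
    linarith
  have hwpos : A - η ≤ w (xh, th) := by
    have h5 : 0 ≤ w (xh, th) := by
      by_contra! h6
      have := mul_nonpos_of_nonpos_of_nonneg h6.le (Real.exp_pos (-(lm * th))).le
      linarith
    have := mul_le_mul_of_nonneg_left (hexp th hth0) h5
    linarith
  have hth : 0 < th := by
    rcases hth0.lt_or_eq with h5 | h5
    · exact h5
    · rw [← h5] at hwpos
      have := h0 xh hxh
      linarith
  have hthT : th < T := by linarith
  -- test function
  set ψ : Euc N × ℝ → ℝ := fun q => Real.exp (lm * q.2) * (κ / (T - q.2) + η * θ q.1 + Φ) with hψ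
  have hwψ : ∀ x ∈ closure D.Ω, ∀ t, 0 ≤ t → t < T → w (x, t) ≤ ψ (x, t) := by
    intro x hx t h1 h2
    have h3 := hglob x hx t h1 h2
    have h4 : w (x, t) * Real.exp (-(lm * t)) ≤ κ / (T - t) + η * θ x + Φ := by
      simp only [hF, hF0] at h3; linarith
    have h5 := mul_le_mul_of_nonneg_left h4 (Real.exp_pos (lm * t)).le
    calc w (x, t) = Real.exp (lm * t) * (w (x, t) * Real.exp (-(lm * t))) := by
          rw [mul_left_comm, hee, mul_one]
      _ ≤ _ := h5
  have hweq : κ / (T - th) + η * θ xh + Φ = w (xh, th) * Real.exp (-(lm * th)) := by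
    rw [hΦ]; simp only [hF, hF0]; ring
  have hψeq : ψ (xh, th) = w (xh, th) := by
    simp only [hψ]
    rw [hweq, mul_left_comm, hee, mul_one]
  have hgrad : HasGradientAt θ (gradient θ xh) xh := ((hθ.cd xh hxh).differentiableAt (by norm_num)).hasGradientAt
  have hfd : HasFDerivAt ψ (clm (Real.exp (lm * th) • (η • gradient θ xh)) (Real.exp (lm * th) * (κ / (T - th) ^ 2) + lm * w (xh, th))) (xh, th) := by
    have d1 : HasDerivAt (fun t => Real.exp (lm * t)) (Real.exp (lm * th) * lm) th := by
      simpa using ((hasDerivAt_id th).const_mul lm).exp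
    have d2 : HasDerivAt (fun t => κ / (T - t)) (κ / (T - th) ^ 2) th := by
      have h5 := ((hasDerivAt_id th).const_sub T).inv (by simp only [id]; linarith)
      have h6 := h5.const_mul κ
      refine (h6.congr_deriv ?_).congr_of_eventuallyEq (Eventually.of_forall fun t => ?_)
      · simp only [id]; ring
      · simp [div_eq_mul_inv]
    have f1 := hasFD_t d1 xh
    have f2 := ((hasFD_t d2 xh).add ((hasFD_x hgrad th).const_mul η)).add_const Φ
    have f3 := f1.mul f2
    refine f3.congr_fderiv ?_
    rw [clm_smul, clm_add, clm_smul, clm_smul, clm_add]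
    congr 1
    · simp
    · simp only [mul_zero, add_zero]
      have this := hee th
      have hv : (((fun q : Euc N × ℝ => κ / (T - q.2)) + fun y : Euc N × ℝ => η * θ y.1) (xh, th) + Φ) = w (xh, th) * Real.exp (-(lm * th)) := hweq
      rw [hv]
      linear_combination (lm * w (xh, th)) * this
  have hcd : ContDiffAt ℝ 1 ψ (xh, th) := by
    have h5 : ContDiffAt ℝ 1 (fun q : Euc N × ℝ => θ q.1) (xh, th) := ContDiffAt.comp (g := θ) (f := Prod.fst) ((xh, th) : Euc N × ℝ) (hθ.cd xh hxh) contDiffAt_fst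
    have h6 : ContDiffAt ℝ 1 (fun q : Euc N × ℝ => κ / (T - q.2)) (xh, th) :=
      contDiffAt_const.div (contDiffAt_const.sub contDiffAt_snd) (by simp only; linarith)
    exact ((contDiffAt_const.mul contDiffAt_snd).exp).mul ((h6.add (contDiffAt_const.mul h5)).add contDiffAt_const)
  have htouch : D.Touch w ψ xh th (Real.exp (lm * th) • (η • gradient θ xh)) (Real.exp (lm * th) * (κ / (T - th) ^ 2) + lm * w (xh, th)) := by
    refine ⟨hcd, hfd, ?_⟩
    have h5 : ∀ᶠ q : Euc N × ℝ in 𝓝 (xh, th), q.2 < T := (continuous_snd.tendsto (xh, th)).eventually (Iio_mem_nhds hthT)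
    filter_upwards [h5.filter_mono nhdsWithin_le_nhds, self_mem_nhdsWithin] with q h6 h7
    have := hwψ q.1 h7.1 q.2 h7.2 h6
    rw [hψeq, sub_self]
    linarith
  have hneu : xh ∈ D.Ω ∨ 0 < ⟪Real.exp (lm * th) • (η • gradient θ xh), D.n xh⟫ := by
    rcases D.mem_or hxh with h5 | h5
    · exact Or.inl h5
    · right
      have h6 := hθ.neus xh h5 (by
        have := hmem.1.1; rw [mem_closedBall, dist_eq_norm] at this; linarith)
      rw [real_inner_smul_left, real_inner_smul_left]
      positivity
  obtain ⟨hi, hineq⟩ := hW xh hxh th hth hthT (by linarith) _ _ ψ htouch hneu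
  have hexpT : Real.exp (lm * th) ≤ Real.exp (lm * T) := Real.exp_le_exp.2 (by gcongr)
  have hintg := D.inc_integral_le (B := EC * η) (M := 2 * M) hxh (by positivity) (by positivity) hi (by
    intro y hy
    apply le_min
    · have h5 := hwψ y hy th hth.le hthT
      have h6 := (abs_le.1 (hθ.lip y xh)).2
      have h7 : ψ (y, th) - ψ (xh, th) = Real.exp (lm * th) * (η * (θ y - θ xh)) := by simp only [hψ]; ring
      have h8 : Real.exp (lm * th) * (η * (θ y - θ xh)) ≤ Real.exp (lm * T) * (η * ((C + 1) * ‖y - xh‖)) := by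
        calc _ ≤ Real.exp (lm * th) * (η * ((C + 1) * ‖y - xh‖)) := by
              gcongr
              have := norm_nonneg (y - xh)
              linarith
          _ ≤ _ := by gcongr
      rw [hψeq] at h7
      calc w (y, th) - w (xh, th) ≤ ψ (y, th) - w (xh, th) := by linarith
        _ ≤ Real.exp (lm * T) * (η * ((C + 1) * ‖y - xh‖)) := by rw [h7]; exact h8
        _ = _ := by rw [hEC]; ring
    · have h5 := (abs_le.1 (hM y hy th hth.le hthT.le)).2
      have h6 := (abs_le.1 (hM xh hxh th hth.le hthT.le)).1
      linarith)
  have hpn : ‖Real.exp (lm * th) • (η • gradient θ xh)‖ ≤ EC * η := by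
    have h5 := HasGradientAt_norm_le hgrad hC0 hθ.lip
    rw [norm_smul, norm_smul, Real.norm_eq_abs, Real.norm_eq_abs, abs_of_pos (Real.exp_pos _), abs_of_pos hη]
    have h6 : ‖gradient θ xh‖ ≤ C + 1 := by linarith
    have h7 : Real.exp (lm * th) * (η * ‖gradient θ xh‖) ≤ Real.exp (lm * T) * (η * (C + 1)) := by gcongr
    calc _ ≤ Real.exp (lm * T) * (η * (C + 1)) := h7
      _ = _ := by rw [hEC]; ring
  have hΓp := hηΓ _ (norm_nonneg _) hpn
  have hpos2 : 0 ≤ Real.exp (lm * th) * (κ / (T - th) ^ 2) := by positivity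
  have hlmw : lm * w (xh, th) = K * w (xh, th) + w (xh, th) := by rw [hlm]; ring
  linarith
end Dat

lemma f_modulus {f : Euc N → ℝ → ℝ} (hf : UniformContinuous (fun q : Euc N × ℝ => f q.1 q.2)) {M : ℝ} (hM : ∀ x t, |f x t| ≤ M) :
    ∃ ω, IsModulus ω ∧ ∀ y t s, |f y t - f y s| ≤ ω |t - s| := by
  set S : ℝ → Set ℝ := fun τ => {v | ∃ y t s, |t - s| ≤ τ ∧ v = |f y t - f y s|} with hS
  have hM0 : 0 ≤ M := (abs_nonneg _).trans (hM 0 0)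
  have hb : ∀ τ, BddAbove (S τ) := fun τ => ⟨2 * M, by
    rintro v ⟨y, t, s, -, rfl⟩
    have := abs_sub (f y t) (f y s)
    have h1 := hM y t
    have h2 := hM y s
    linarith⟩
  have h0 : ∀ τ, 0 ≤ sSup (S τ) := fun τ => Real.sSup_nonneg (by rintro v ⟨y, t, s, -, rfl⟩; exact abs_nonneg _)
  refine ⟨fun τ => sSup (S τ), ⟨h0, ?_, ?_⟩, ?_⟩
  · intro a b hab
    by_cases hne : (S a).Nonempty
    · exact csSup_le_csSup (hb b) hne (by rintro v ⟨y, t, s, h1, rfl⟩; exact ⟨y, t, s, h1.trans hab, rfl⟩)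
    · rw [not_nonempty_iff_eq_empty] at hne
      simp only [hne, Real.sSup_empty]
      exact h0 b
  · rw [Metric.tendsto_nhdsWithin_nhds]
    intro ε hε
    obtain ⟨δ, hδ, h⟩ := Metric.uniformContinuous_iff.1 hf (ε / 2) (by linarith)
    refine ⟨δ, hδ, fun {τ} h1 h2 => ?_⟩
    rw [Real.dist_eq, sub_zero, abs_of_nonneg (h0 τ)]
    have h3 : sSup (S τ) ≤ ε / 2 := by
      apply Real.sSup_le _ (by linarith)
      rintro v ⟨y, t, s, h4, rfl⟩
      have h5 := @h (y, t) (y, s) (by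
        rw [Prod.dist_eq]
        simp only [dist_self]
        rw [Real.dist_eq, sub_zero] at h2
        rw [Real.dist_eq]
        exact max_lt hδ (lt_of_le_of_lt (h4.trans (le_abs_self _)) h2))
      rw [Real.dist_eq] at h5
      exact h5.le
    linarith
  · intro y t s
    exact le_csSup (hb _) ⟨y, t, s, le_rfl, rfl⟩

lemma key_ineq {m C κ : ℝ} (hm : 1 < m) (hC : 0 ≤ C) (hκ : 0 < κ) :
    ∃ ε C', 0 < ε ∧ 0 ≤ C' ∧ ∀ X s : ℝ, 0 ≤ X → 0 ≤ s → ε * (X + s) ^ m + C * s * (X + s) ^ (m - 1) ≤ κ * X ^ m + C' * s ^ m := by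
  set lm := 1 + 2 * C * 2 ^ (m - 1) / κ with hlm
  have hA : (0:ℝ) < 2 ^ (m - 1) := by positivity
  have hB : (0:ℝ) < 2 ^ m := by positivity
  have hlm1 : 1 ≤ lm := by
    have : 0 ≤ 2 * C * 2 ^ (m - 1) / κ := by positivity
    linarith
  set ε := κ / (2 * 2 ^ m) with hε
  have hε0 : 0 < ε := by positivity
  refine ⟨ε, ε * (lm + 1) ^ m + C * (lm + 1) ^ (m - 1), hε0, by positivity, fun X s hX hs => ?_⟩
  have hpow : ∀ v : ℝ, 0 ≤ v → v ^ m = v * v ^ (m - 1) := by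
    intro v hv
    rcases hv.eq_or_lt with h | h
    · rw [← h, zero_mul, Real.zero_rpow (by linarith)]
    · rw [← Real.rpow_one_add' hv (by linarith)]; congr 1; ring
  by_cases h : X ≤ lm * s
  · have h1 : X + s ≤ (lm + 1) * s := by linarith
    have h2 : (X + s) ^ m ≤ (lm + 1) ^ m * s ^ m := by
      rw [← Real.mul_rpow (by linarith) hs]
      exact Real.rpow_le_rpow (by linarith) h1 (by linarith)
    have h3 : (X + s) ^ (m - 1) ≤ (lm + 1) ^ (m - 1) * s ^ (m - 1) := by
      rw [← Real.mul_rpow (by linarith) hs]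
      exact Real.rpow_le_rpow (by linarith) h1 (by linarith)
    have h4 := mul_le_mul_of_nonneg_left h2 hε0.le
    have h5 := mul_le_mul_of_nonneg_left h3 (mul_nonneg hC hs)
    have h6 : 0 ≤ κ * X ^ m := by positivity
    have h7 := hpow s hs
    calc _ ≤ ε * ((lm + 1) ^ m * s ^ m) + C * s * ((lm + 1) ^ (m - 1) * s ^ (m - 1)) := by linarith
      _ = (ε * (lm + 1) ^ m + C * (lm + 1) ^ (m - 1)) * s ^ m := by rw [h7]; ring
      _ ≤ _ := by linarith
  · have h : lm * s < X := not_le.1 h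
    have hlm0 : 0 < lm := by linarith
    have hsX : s ≤ X / lm := by rw [le_div_iff₀ hlm0]; linarith
    have h1 : X + s ≤ 2 * X := by nlinarith
    have h2 : (X + s) ^ m ≤ 2 ^ m * X ^ m := by
      rw [← Real.mul_rpow (by norm_num) hX]
      exact Real.rpow_le_rpow (by linarith) h1 (by linarith)
    have h3 : (X + s) ^ (m - 1) ≤ 2 ^ (m - 1) * X ^ (m - 1) := by
      rw [← Real.mul_rpow (by norm_num) hX]
      exact Real.rpow_le_rpow (by linarith) h1 (by linarith)
    have h4 := mul_le_mul_of_nonneg_left h2 hε0.le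
    have h5 : C * s * (X + s) ^ (m - 1) ≤ C * (X / lm) * (2 ^ (m - 1) * X ^ (m - 1)) := by gcongr
    have h6 : 0 ≤ (ε * (lm + 1) ^ m + C * (lm + 1) ^ (m - 1)) * s ^ m := by positivity
    have h7 := hpow X hX
    have h8 : C * 2 ^ (m - 1) / lm ≤ κ / 2 := by
      rw [div_le_iff₀ hlm0, hlm]
      have : κ / 2 * (1 + 2 * C * 2 ^ (m - 1) / κ) = κ / 2 + C * 2 ^ (m - 1) := by field_simp
      linarith
    have h9 : ε * 2 ^ m = κ / 2 := by rw [hε]; field_simp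
    have h10 := mul_le_mul_of_nonneg_right h8 (Real.rpow_nonneg hX m)
    calc _ ≤ ε * (2 ^ m * X ^ m) + C * (X / lm) * (2 ^ (m - 1) * X ^ (m - 1)) := by linarith
      _ = (ε * 2 ^ m) * X ^ m + C * 2 ^ (m - 1) / lm * X ^ m := by rw [h7]; ring
      _ ≤ κ * X ^ m := by rw [h9]; linarith
      _ ≤ _ := by linarith

namespace Dat
variable (D : Dat N)

lemma LSub.scale {H : Euc N → ℝ → ℝ → Euc N → ℝ} {u : Euc N × ℝ → ℝ} (h : D.LSub H u) {μ : ℝ} (hμ : 0 < μ) (M : ℝ) :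
    D.LSub (fun x t r p => μ * H x t ((r + M) / μ - M) (μ⁻¹ • p)) (fun q => μ * (u q + M) - M) := by
  intro x hx t ht p a φ hT hn
  have hT' : D.Touch u (fun q => μ⁻¹ * φ q) x t (μ⁻¹ • p) (μ⁻¹ * a) := by
    refine ⟨contDiffAt_const.mul hT.cd, ?_, ?_⟩
    · have := hT.fd.const_mul μ⁻¹
      rwa [clm_smul] at this
    · filter_upwards [hT.le] with q hq
      have := mul_le_mul_of_nonneg_left hq (inv_pos.2 hμ).le
      have h1 : ∀ v w : ℝ, μ⁻¹ * (μ * (v + M) - M - w) = v - μ⁻¹ * w + (M - μ⁻¹ * M) := by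
        intro v w; field_simp; ring
      rw [h1, h1] at this
      linarith
  obtain ⟨h1, h2⟩ := h x hx t ht _ _ _ hT' (hn.imp_right fun hn => by
    rw [real_inner_smul_left]; exact mul_pos (inv_pos.2 hμ) hn)
  have h3 : ∀ z, D.inc (fun y => μ * (u (y, t) + M) - M) x z = μ * D.inc (fun y => u (y, t)) x z := by
    intro z
    by_cases hz : x + D.j x z ∈ closure D.Ω
    · rw [D.inc_of_mem hz, D.inc_of_mem hz]; ring
    · rw [D.inc_of_notMem hz, D.inc_of_notMem hz, mul_zero]
  refine ⟨?_, ?_⟩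
  · rw [show D.inc (fun y => μ * (u (y, t) + M) - M) x = fun z => μ * D.inc (fun y => u (y, t)) x z from funext h3]
    exact h1.const_mul μ
  · rw [show D.inc (fun y => μ * (u (y, t) + M) - M) x = fun z => μ * D.inc (fun y => u (y, t)) x z from funext h3]
    rw [integral_const_mul]
    have h4 := mul_le_mul_of_nonneg_left h2 hμ.le
    have h5 : (μ * (u (x, t) + M) - M + M) / μ - M = u (x, t) := by field_simp; ring
    simp only [h5]
    have h6 : μ * (μ⁻¹ * a) = a := by field_simp
    rw [mul_add, h6] at h4
    exact h4

/-- comparison principle -/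
def Comp (H : Euc N → ℝ → ℝ → Euc N → ℝ) : Prop :=
  ∀ u1 u2 : Euc N × ℝ → ℝ, D.Adm u1 → D.Adm u2 → D.LSub H u1 → D.LSub (Hneg H) u2 →
    (∀ x ∈ closure D.Ω, u1 (x, 0) + u2 (x, 0) ≤ 0) → ∀ x ∈ closure D.Ω, ∀ t, 0 ≤ t → u1 (x, t) + u2 (x, t) ≤ 0

lemma comp_of_wsub {H : Euc N → ℝ → ℝ → Euc N → ℝ} {K : ℝ} (hK : 0 ≤ K)
    (h : ∀ u1 u2 : Euc N × ℝ → ℝ, D.Adm u1 → D.Adm u2 → D.LSub H u1 → D.LSub (Hneg H) u2 → ∀ T, 0 < T →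
      ∃ Γ : ℝ → ℝ, Tendsto Γ (𝓝 0) (𝓝 0) ∧ D.WSub (fun q => u1 q + u2 q) K 0 T Γ) : D.Comp H := by
  intro u1 u2 h1 h2 g1 g2 h0 x hx t ht
  obtain ⟨M1, hM1, hb1⟩ := h1.bdd (t + 1)
  obtain ⟨M2, hM2, hb2⟩ := h2.bdd (t + 1)
  obtain ⟨Γ, hΓ, hW⟩ := h u1 u2 h1 h2 g1 g2 (t + 1) (by linarith)
  have := D.compare_w (h1.usc.add h2.usc) (M := M1 + M2) (by linarith) (fun x hx s h3 h4 => by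
    have e1 := hb1 x hx s h3 h4
    have e2 := hb2 x hx s h3 h4
    exact (abs_add_le _ _).trans (add_le_add e1 e2)) hK le_rfl hΓ hW h0 x hx t ht (by linarith)
  simpa using this

lemma comp_bell {A : Type} [MetricSpace A] [CompactSpace A] [Nonempty A]
    {lam : Euc N → ℝ → A → ℝ} {b : Euc N → ℝ → A → Euc N} {l : Euc N → ℝ → A → ℝ}
    {H : Euc N → ℝ → ℝ → Euc N → ℝ} (hOK : ParBellmanOK D.Ω D.n lam b l H) (hH : AssumptionH' D.Ω H) : D.Comp H := by
  obtain ⟨K, hK⟩ := D.exists_monoH hH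
  refine D.comp_of_wsub hK.1 fun u1 u2 h1 h2 g1 g2 T hT => ?_
  obtain ⟨Mb, -, hW⟩ := D.bell_wsub hOK hK h1 h2 g1 g2 T
  refine ⟨_, ?_, hW⟩
  have : Continuous fun s : ℝ => Mb * s := by fun_prop
  simpa using this.tendsto 0

lemma modulus_small {ω : ℝ → ℝ} (h : IsModulus ω) {ε : ℝ} (hε : 0 < ε) : ∃ δ, 0 < δ ∧ ∀ s, 0 ≤ s → s < δ → ω s < ε := by
  obtain ⟨δ, hδ, h1⟩ := Metric.eventually_nhds_iff.1 ((modulus_tendsto h).eventually (Iio_mem_nhds hε))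
  refine ⟨δ, hδ, fun s h0 hs => h1 ?_⟩
  rw [Real.dist_eq, sub_zero, abs_of_nonneg h0]; exact hs

lemma comp_sub {H : Euc N → ℝ → ℝ → Euc N → ℝ} (hH0 : AssumptionH0' H) (he : AssumptionHe' D.Ω H D.σ) (hH : AssumptionH' D.Ω H) : D.Comp H := by
  obtain ⟨K, hK⟩ := D.exists_monoH hH
  refine D.comp_of_wsub hK.1 fun u1 u2 h1 h2 g1 g2 T hT => ?_
  obtain ⟨H₀, f, -, hfu, ⟨Mf, hMf⟩, hHeq⟩ := hH0
  obtain ⟨ω2, hω2, hf2⟩ := f_modulus hfu hMf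
  obtain ⟨M1, hM1, hb1⟩ := h1.bdd T
  obtain ⟨M2, hM2, hb2⟩ := h2.bdd T
  obtain ⟨m, hm, -, hR⟩ := he
  set M := max M1 M2 with hM
  have hM0 : 0 ≤ M := le_max_of_le_left hM1
  obtain ⟨⟨c0, hc0, Dc, -, hco⟩, ⟨C, hC, ω, hω, hHa⟩⟩ := hR (M + 1) (by linarith)
  obtain ⟨δ, hδ, hδω⟩ := modulus_small hω one_pos
  have hΓc : Continuous fun s : ℝ => (C + 1) * s := by fun_prop
  refine ⟨fun s => (C + 1) * s, by simpa using hΓc.tendsto 0, ?_⟩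
  refine D.coer_wsub h1.usc h2.usc hM0 (fun x hx t h3 h4 => (hb1 x hx t h3 h4).trans (le_max_left _ _))
    (fun x hx t h3 h4 => (hb2 x hx t h3 h4).trans (le_max_right _ _)) g1 g2 hm hc0
    (fun x hx t h3 _ r hr p => hco x hx t h3 r (by linarith) p) hω hω2 hδ hΓc ?_
  intro x hx y hy t ht _ s hs _ r1 hr1 r2 hr2 hpos X1 X2 hxy
  have a1 := hK.2 x hx t ht r1 (-r2) (by linarith) X1
  have a2 := hHa x y t ht (-r2) (by rw [abs_neg]; linarith) (-X2) X1
  have a3 : H y s (-r2) (-X2) ≤ H y t (-r2) (-X2) + ω2 |t - s| := by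
    rw [hHeq, hHeq]
    have := (abs_le.1 (hf2 y t s)).2
    linarith
  have a4 : ‖-X2‖ ≤ ‖X1‖ + ‖X1 + X2‖ := by
    have : -X2 = X1 - (X1 + X2) := by abel
    rw [this]; exact norm_sub_le _ _
  have a5 : ‖-X2 - X1‖ = ‖X1 + X2‖ := by rw [← norm_neg]; congr 1; abel
  have a6 := hω.1 ‖x - y‖
  have a7 := hδω ‖x - y‖ (norm_nonneg _) hxy
  have a8 : ω ‖x - y‖ * (1 + ‖-X2‖) ≤ ω ‖x - y‖ * (1 + ‖X1‖) + ‖X1 + X2‖ := by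
    nlinarith [norm_nonneg (X1 + X2)]
  rw [a5] at a2
  simp only [Hneg]
  have a9 : r1 - -r2 = r1 + r2 := by ring
  rw [a9] at a1
  linarith

set_option maxHeartbeats 800000 in
lemma comp_super {H : Euc N → ℝ → ℝ → Euc N → ℝ} (hH0 : AssumptionH0' H) {m : ℝ} (he : AssumptionHe'' D.Ω H D.σ m) (hH : AssumptionH' D.Ω H) : D.Comp H := by
  obtain ⟨K, hK⟩ := D.exists_monoH hH
  intro u1 u2 h1 h2 g1 g2 h0 x0 hx0 t0 ht0
  obtain ⟨H₀, f, -, hfu, ⟨Mf, hMf⟩, hHeq⟩ := hH0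
  obtain ⟨ω2, hω2, hf2⟩ := f_modulus hfu hMf
  set T := t0 + 1 with hT
  obtain ⟨M1, hM1, hb1⟩ := h1.bdd T
  obtain ⟨M2, hM2, hb2⟩ := h2.bdd T
  obtain ⟨hm1, hm, hR⟩ := he
  set M := max M1 M2 with hM
  have hM0 : 0 ≤ M := le_max_of_le_left hM1
  have hb1 : ∀ x ∈ closure D.Ω, ∀ t, 0 ≤ t → t ≤ T → |u1 (x, t)| ≤ M := fun x hx t h3 h4 => (hb1 x hx t h3 h4).trans (le_max_left _ _)
  have hb2 : ∀ x ∈ closure D.Ω, ∀ t, 0 ≤ t → t ≤ T → |u2 (x, t)| ≤ M := fun x hx t h3 h4 => (hb2 x hx t h3 h4).trans (le_max_right _ _)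
  obtain ⟨⟨c0, hc0, Dc, -, hco⟩, ⟨A, hA, Cb, hCb, hHb⟩, ⟨C, hC, ω, hω, hHc⟩⟩ := hR (3 * M + 1) (by linarith)
  have main : ∀ μ : ℝ, 1 / 2 ≤ μ → μ < 1 → μ * (u1 (x0, t0) + M) - M + u2 (x0, t0) ≤
      ((1 - μ) * (A + 4 * K * M)) * Real.exp ((K + 1) * t0) := by
    intro μ hμ2 hμ1
    have hμ : 0 < μ := by linarith
    have hK0 := hK.1
    obtain ⟨ε, C', hε, hC', hkey⟩ := key_ineq (m := m) (C := C) (κ := (1 - μ) * (Cb * (m - 1))) hm1 hC.le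
      (mul_pos (by linarith) (mul_pos hCb (by linarith)))
    obtain ⟨δ, hδ, hδω⟩ := modulus_small hω hε
    have hΓc : Continuous fun s : ℝ => C' * s ^ m := continuous_const.mul (Real.continuous_rpow_const (by linarith))
    have husc : UpperSemicontinuousOn (fun q => μ * (u1 q + M) - M) D.Cyl := by
      have e1 := usc_mul (w := u1) (c := fun _ => μ) h1.usc continuousOn_const (fun _ _ => hμ)
      have e2 := e1.add (g := fun _ => μ * M - M) (continuousOn_const.upperSemicontinuousOn)
      have e3 : (fun q => μ * (u1 q + M) - M) = fun q => u1 q * μ + (μ * M - M) := by funext q; ring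
      rw [e3]; exact e2
    have hbt : ∀ x ∈ closure D.Ω, ∀ t, 0 ≤ t → t ≤ T → |μ * (u1 (x, t) + M) - M| ≤ M := by
      intro x hx t h3 h4
      have := abs_le.1 (hb1 x hx t h3 h4)
      rw [abs_le]
      constructor <;> nlinarith
    have hρ : ∀ r1 : ℝ, |r1| ≤ M → r1 ≤ (r1 + M) / μ - M ∧ (r1 + M) / μ - M ≤ r1 + 4 * M * (1 - μ) ∧ |(r1 + M) / μ - M| ≤ 3 * M := by
      intro r1 hr1
      have h3 := abs_le.1 hr1
      have e1 : r1 + M ≤ (r1 + M) / μ := by rw [le_div_iff₀ hμ]; nlinarith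
      have e2 : (r1 + M) / μ ≤ r1 + M + 4 * M * (1 - μ) := by
        rw [div_le_iff₀ hμ]
        have : 0 ≤ (1 - μ) * (M * (2 * μ - 1)) := mul_nonneg (by linarith) (mul_nonneg hM0 (by linarith))
        nlinarith
      have e3 : (r1 + M) / μ ≤ 4 * M := by rw [div_le_iff₀ hμ]; nlinarith
      refine ⟨by linarith, by linarith, abs_le.2 ⟨by linarith, by linarith⟩⟩
    have hW : D.WSub (fun q => (μ * (u1 q + M) - M) + u2 q) K ((1 - μ) * (A + 4 * K * M)) T (fun s => C' * s ^ m) := by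
      refine D.coer_wsub husc h2.usc hM0 hbt hb2 (g1.scale D hμ M) g2 hm (c0 := μ * (c0 * (μ⁻¹) ^ m)) (Dc := μ * Dc) (by positivity) ?_ hω hω2 hδ hΓc ?_
      · intro x hx t h3 _ r hr p
        have := mul_le_mul_of_nonneg_left (hco x hx t h3 ((r + M) / μ - M) (by have := (hρ r hr).2.2; linarith) (μ⁻¹ • p)) hμ.le
        rw [norm_smul, Real.norm_eq_abs, abs_of_pos (inv_pos.2 hμ), Real.mul_rpow (inv_pos.2 hμ).le (norm_nonneg _)] at this
        refine le_trans (le_of_eq ?_) this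
        ring
      · intro x hx y hy t ht _ s hs _ r1 hr1 r2 hr2 hpos X1 X2 hxy
        obtain ⟨b1, b2, b3⟩ := hρ r1 hr1
        set ρ := (r1 + M) / μ - M with hρdef
        have a0 := hHb μ ⟨hμ, hμ1⟩ x hx t ht ρ (by linarith) X1
        have a1 := hK.2 x hx t ht ρ (-r2) (by linarith) X1
        have a2 := hHc x y t ht (-r2) (by rw [abs_neg]; linarith) (-X2) X1
        have a3 : H y s (-r2) (-X2) ≤ H y t (-r2) (-X2) + ω2 |t - s| := by
          rw [hHeq, hHeq]
          have := (abs_le.1 (hf2 y t s)).2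
          linarith
        have a4 : ‖-X2‖ ≤ ‖X1‖ + ‖X1 + X2‖ := by
          have : -X2 = X1 - (X1 + X2) := by abel
          rw [this]; exact norm_sub_le _ _
        have a5 : ‖-X2 - X1‖ = ‖X1 + X2‖ := by rw [← norm_neg]; congr 1; abel
        have a6 := hω.1 ‖x - y‖
        have a7 := hδω ‖x - y‖ (norm_nonneg _) hxy
        have hX := norm_nonneg X1
        have hs0 := norm_nonneg (X1 + X2)
        have a8 : max ‖-X2‖ ‖X1‖ ≤ ‖X1‖ + ‖X1 + X2‖ := max_le a4 (by linarith)
        have a8' : 0 ≤ max ‖-X2‖ ‖X1‖ := le_max_of_le_right hX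
        have a9 : (max ‖-X2‖ ‖X1‖) ^ m ≤ (‖X1‖ + ‖X1 + X2‖) ^ m := Real.rpow_le_rpow a8' a8 (by linarith)
        have a10 : (max ‖-X2‖ ‖X1‖) ^ (m - 1) ≤ (‖X1‖ + ‖X1 + X2‖) ^ (m - 1) := Real.rpow_le_rpow a8' a8 (by linarith)
        have a11 := hkey ‖X1‖ ‖X1 + X2‖ hX hs0
        rw [a5] at a2
        have a12 : C * ‖X1 + X2‖ * (max ‖-X2‖ ‖X1‖) ^ (m - 1) ≤ C * ‖X1 + X2‖ * (‖X1‖ + ‖X1 + X2‖) ^ (m - 1) := by gcongr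
        have a13 : ω ‖x - y‖ * (max ‖-X2‖ ‖X1‖) ^ m ≤ ε * (‖X1‖ + ‖X1 + X2‖) ^ m := by gcongr
        have a14 : 0 ≤ ω ‖x - y‖ * ‖X1‖ := by positivity
        have a15 : K * (ρ - -r2) ≤ K * (r1 + r2) + (1 - μ) * (4 * K * M) := by nlinarith
        simp only [Hneg]
        linarith
    have := D.compare_w (husc.add h2.usc) (M := M + M) (by linarith) (fun x hx s h3 h4 =>
      (abs_add_le _ _).trans (add_le_add (hbt x hx s h3 h4) (hb2 x hx s h3 h4))) hK0
      (mul_nonneg (by linarith) (by positivity)) (by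
        have := hΓc.tendsto 0
        rwa [Real.zero_rpow (by linarith), mul_zero] at this) hW (by
      intro x hx
      have e1 := h0 x hx
      have e2 := (abs_le.1 (hb1 x hx 0 le_rfl (by linarith))).1
      nlinarith) x0 hx0 t0 ht0 (by linarith)
    simpa using this
  have l1 : Tendsto (fun μ : ℝ => μ * (u1 (x0, t0) + M) - M + u2 (x0, t0)) (𝓝[<] 1) (𝓝 (u1 (x0, t0) + u2 (x0, t0))) := by
    have : Continuous (fun μ : ℝ => μ * (u1 (x0, t0) + M) - M + u2 (x0, t0)) := by fun_prop
    have := (this.tendsto 1).mono_left (nhdsWithin_le_nhds (s := Iio 1))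
    convert this using 2; ring
  have l2 : Tendsto (fun μ : ℝ => ((1 - μ) * (A + 4 * K * M)) * Real.exp ((K + 1) * t0)) (𝓝[<] 1) (𝓝 0) := by
    have : Continuous (fun μ : ℝ => ((1 - μ) * (A + 4 * K * M)) * Real.exp ((K + 1) * t0)) := by fun_prop
    have := (this.tendsto 1).mono_left (nhdsWithin_le_nhds (s := Iio 1))
    simpa using this
  refine le_of_tendsto_of_tendsto l1 l2 ?_
  filter_upwards [self_mem_nhdsWithin, mem_nhdsWithin_of_mem_nhds (Ioi_mem_nhds (show (1:ℝ) / 2 < 1 by norm_num))] with μ h3 h4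
  exact main μ (le_of_lt h4) h3

lemma comp_coer {H : Euc N → ℝ → ℝ → Euc N → ℝ} (h : ParCoerciveOK D.Ω H D.σ) (hH : AssumptionH' D.Ω H) : D.Comp H := by
  rcases h with ⟨h0, h1 | ⟨m, h1⟩⟩
  · exact D.comp_sub h0 h1 hH
  · exact D.comp_super h0 h1 hH

end Dat

namespace Dat
variable (D : Dat N)

/-- what the Perron construction uses about the Hamiltonian -/
structure Ok (H : Euc N → ℝ → ℝ → Euc N → ℝ) (K : ℝ) : Prop where
  cont : Continuous (fun q : Euc N × ℝ × ℝ × Euc N => H q.1 q.2.1 q.2.2.1 q.2.2.2)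
  comp : D.Comp H
  mono : D.MonoH H K
  bnd : ∀ R > (0:ℝ), ∃ B, ∀ x ∈ D.Ω, ∀ t, 0 ≤ t → ∀ r p, |r| ≤ R → ‖p‖ ≤ R → |H x t r p| ≤ B

variable {D}

lemma Ok.neg {H : Euc N → ℝ → ℝ → Euc N → ℝ} {K : ℝ} (h : D.Ok H K) : D.Ok (Hneg H) K := by
  refine ⟨?_, ?_, ⟨h.mono.1, ?_⟩, ?_⟩
  · have := (h.cont.comp (f := fun q : Euc N × ℝ × ℝ × Euc N => (q.1, q.2.1, -q.2.2.1, -q.2.2.2)) (by fun_prop)).neg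
    exact this
  · intro u1 u2 h1 h2 g1 g2 h0 x hx t ht
    rw [Hneg_Hneg] at g2
    have := h.comp u2 u1 h2 h1 g2 g1 (fun x hx => by linarith [h0 x hx]) x hx t ht
    linarith
  · intro x hx t ht r s hrs p
    have := h.mono.2 x hx t ht (-s) (-r) (by linarith) (-p)
    simp only [Hneg]
    have e : -s - -r = r - s := by ring
    rw [e] at this
    linarith
  · intro R hR
    obtain ⟨B, hB⟩ := h.bnd R hR
    exact ⟨B, fun x hx t ht r p hr hp => by
      simp only [Hneg, abs_neg]
      exact hB x hx t ht (-r) (-p) (by rwa [abs_neg]) (by rwa [norm_neg])⟩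

lemma Theta.cont {x0 : Euc N} {r τ C : ℝ} {θ : Euc N → ℝ} (hC0 : 0 ≤ C) (hθ : D.Theta x0 r τ C θ) : Continuous θ := by
  refine (LipschitzWith.of_dist_le_mul (K := ⟨C, hC0⟩) fun x y => ?_).continuous
  rw [Real.dist_eq, dist_eq_norm]; exact hθ.lip x y

lemma Adm.of_cont {f : Euc N × ℝ → ℝ} (h : ContinuousOn f D.Cyl) (hb : D.LocBdd f) : D.Adm f := ⟨h.upperSemicontinuousOn, hb⟩

lemma Ok.barrier {H : Euc N → ℝ → ℝ → Euc N → ℝ} {K : ℝ} (h : D.Ok H K) {u0 : Euc N → ℝ} (hu0 : ContinuousOn u0 (closure D.Ω))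
    {M : ℝ} (hM0 : 0 ≤ M) (hM : ∀ x ∈ closure D.Ω, |u0 x| ≤ M) {x0 : Euc N} (hx0 : x0 ∈ closure D.Ω) {ε : ℝ} (hε : 0 < ε) :
    ∃ f : Euc N × ℝ → ℝ, Continuous f ∧ D.Adm f ∧ D.LSub H f ∧ (∀ x ∈ closure D.Ω, f (x, 0) ≤ u0 x) ∧ u0 x0 - ε ≤ f (x0, 0) := by
  have hK0 := h.mono.1
  obtain ⟨r, hr, hru⟩ : ∃ r > 0, ∀ x ∈ closure D.Ω, ‖x - x0‖ < r → u0 x0 - ε / 4 ≤ u0 x := by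
    obtain ⟨r, hr, h1⟩ := Metric.continuousWithinAt_iff.1 (hu0 x0 hx0) (ε / 4) (by linarith)
    refine ⟨r, hr, fun x hx hxr => ?_⟩
    have := h1 hx (by rwa [dist_eq_norm])
    rw [Real.dist_eq] at this
    linarith [(abs_lt.1 this).1]
  obtain ⟨C, hC0, hC⟩ := D.exists_theta hr
  set Q := 4 * M with hQ
  have hQ0 : 0 ≤ Q := by positivity
  set τ := min (1 / 2) (ε / (4 * (Q + 1))) with hτ
  have hτ0 : 0 < τ := lt_min (by norm_num) (by positivity)
  have hτ2 : τ ≤ 1 / 2 := min_le_left _ _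
  have hQτ : Q * τ ≤ ε / 4 := by
    have h1 : τ ≤ ε / (4 * (Q + 1)) := min_le_right _ _
    rw [le_div_iff₀ (by positivity)] at h1
    nlinarith
  obtain ⟨θ, hθ⟩ := hC x0 τ hτ0
  have hθc := hθ.cont hC0
  obtain ⟨B, hB⟩ := h.bnd (M + ε + 2 * Q + Q * C + 1) (by positivity)
  set I := D.KM (3 * Q) * (Q * C + 1) ^ D.σ with hI
  set E := |B| + |I| with hE
  have hE0 : 0 ≤ E := by positivity
  set lm := K + 1 with hlm
  set f : Euc N × ℝ → ℝ := fun q => u0 x0 - ε / 2 - Q * θ q.1 - E * (Real.exp (lm * q.2) - 1) with hf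
  have hfc : Continuous f := by simp only [hf]; fun_prop
  have hθQ : ∀ x, |Q * θ x| ≤ 2 * Q := fun x => by
    have h1 := hθ.lower x
    have h2 := hθ.upper x
    rw [abs_le]; constructor <;> nlinarith
  refine ⟨f, hfc, Adm.of_cont hfc.continuousOn fun T => ?_, ?_, ?_, ?_⟩
  · refine ⟨M + ε + 2 * Q + E * (Real.exp (lm * |T|) + 1), by positivity, fun x hx t ht htT => ?_⟩
    have h1 := abs_le.1 (hM x0 hx0)
    have h2 := abs_le.1 (hθQ x)
    have h3 : Real.exp (lm * t) ≤ Real.exp (lm * |T|) := Real.exp_le_exp.2 (by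
      have : t ≤ |T| := htT.trans (le_abs_self _)
      exact mul_le_mul_of_nonneg_left this (by linarith))
    have h4 := Real.exp_pos (lm * t)
    have h5 : E * (Real.exp (lm * t) - 1) ≤ E * (Real.exp (lm * |T|) + 1) := mul_le_mul_of_nonneg_left (by linarith) hE0
    have h6 : -(E * (Real.exp (lm * |T|) + 1)) ≤ E * (Real.exp (lm * t) - 1) := by
      rw [← mul_neg]
      exact mul_le_mul_of_nonneg_left (by linarith [Real.exp_pos (lm * |T|)]) hE0
    simp only [hf]
    rw [abs_le]; constructor <;> linarith
  · refine D.classical_sub fun x hx t ht => ⟨-(Q • gradient θ x), -(E * (Real.exp (lm * t) * lm)), ?_, ?_, ?_⟩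
    · have hgrad : HasGradientAt θ (gradient θ x) x := ((hθ.cd x hx).differentiableAt (by norm_num)).hasGradientAt
      have d1 : HasDerivAt (fun t => Real.exp (lm * t)) (Real.exp (lm * t) * lm) t := by
        simpa using ((hasDerivAt_id t).const_mul lm).exp
      have f1 := (hasFD_t ((d1.sub_const 1).const_mul E) x)
      have f2 := (((hasFD_x hgrad t).const_mul Q).const_sub (u0 x0 - ε / 2)).sub f1
      refine f2.congr_fderiv ?_
      rw [clm_smul, clm_neg, sub_eq_add_neg, clm_neg, clm_add]
      congr 1
      · simp
      · simp
    · intro hxf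
      rw [inner_neg_left, real_inner_smul_left]
      have := hθ.neu x hxf
      have := mul_nonneg hQ0 this
      linarith
    · intro hxΩ
      have hgrad : HasGradientAt θ (gradient θ x) x := ((hθ.cd x hx).differentiableAt (by norm_num)).hasGradientAt
      have hgn := HasGradientAt_norm_le hgrad hC0 hθ.lip
      have hlip : ∀ y, |Q * θ y - Q * θ x| ≤ min ((Q * C + 1) * ‖y - x‖) (3 * Q) := by
        intro y
        rw [← mul_sub, abs_mul, abs_of_nonneg hQ0]
        refine le_min ?_ ?_
        · have h1 := mul_le_mul_of_nonneg_left (hθ.lip y x) hQ0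
          have h2 := norm_nonneg (y - x)
          linarith
        · have h1 : |θ y - θ x| ≤ 3 := by
            have h1 := hθ.lower x
            have h2 := hθ.upper x
            have h3 := hθ.lower y
            have h4 := hθ.upper y
            rw [abs_le]; constructor <;> linarith
          nlinarith
      have hintg : Integrable (D.inc (fun y => Q * θ y) x) :=
        D.inc_integrable (B := Q * C + 1) (M := 3 * Q) hx (by positivity) (by positivity)
          ((by fun_prop : Measurable fun y => Q * θ y).indicator isClosed_closure.measurableSet) (fun y hy => hlip y)
      have hle := D.inc_integral_le (B := Q * C + 1) (M := 3 * Q) hx (by positivity) (by positivity) hintg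
        (fun y _ => (le_abs_self _).trans (hlip y))
      have hinc : D.inc (fun y => f (y, t)) x = fun z => -D.inc (fun y => Q * θ y) x z := by
        funext z
        by_cases hz : x + D.j x z ∈ closure D.Ω
        · rw [D.inc_of_mem hz, D.inc_of_mem hz]; simp only [hf]; ring
        · rw [D.inc_of_notMem hz, D.inc_of_notMem hz, neg_zero]
      rw [hinc]
      refine ⟨hintg.neg, ?_⟩
      rw [integral_neg]
      set f0 := u0 x0 - ε / 2 - Q * θ x with hf0
      have h1 := abs_le.1 (hM x0 hx0)
      have h2 := abs_le.1 (hθQ x)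
      have hQC : 0 ≤ Q * C := by positivity
      have e1 := hB x hxΩ t ht.le f0 (-(Q • gradient θ x)) (by rw [abs_le]; constructor <;> linarith) (by
        rw [norm_neg, norm_smul, Real.norm_eq_abs, abs_of_nonneg hQ0]
        have := mul_le_mul_of_nonneg_left hgn hQ0
        linarith)
      have hexp1 : 1 ≤ Real.exp (lm * t) := Real.one_le_exp (mul_nonneg (by linarith) ht.le)
      have hff : f (x, t) = f0 - E * (Real.exp (lm * t) - 1) := rfl
      have hEe : 0 ≤ E * (Real.exp (lm * t) - 1) := mul_nonneg hE0 (by linarith)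
      have e2 := h.mono.2 x hx t ht.le f0 (f (x, t)) (by rw [hff]; linarith) (-(Q • gradient θ x))
      rw [hff] at e2 ⊢
      have e3 := (abs_le.1 e1).2
      have e4 := le_abs_self B
      have e5 := le_abs_self I
      have e6 : E ≤ E * Real.exp (lm * t) := by nlinarith
      have e7 : 0 ≤ K * E := by positivity
      rw [hlm] at *
      nlinarith
  · intro x hx
    have h1 := abs_le.1 (hM x0 hx0)
    have h2 := abs_le.1 (hM x hx)
    simp only [hf, mul_zero, Real.exp_zero, sub_self]
    by_cases hxr : ‖x - x0‖ < r
    · have h3 := hru x hx hxr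
      have h4 := mul_le_mul_of_nonneg_left (hθ.lower x) hQ0
      linarith
    · have h3 := hθ.off x (not_lt.1 hxr)
      have h4 : Q * (1 / 2) ≤ Q * θ x := mul_le_mul_of_nonneg_left (by linarith) hQ0
      linarith
  · have := mul_le_mul_of_nonneg_left hθ.ctr hQ0
    simp only [hf, mul_zero, Real.exp_zero, sub_self]
    linarith

end Dat

namespace Dat
variable (D : Dat N)

/-- upper semicontinuous envelope relative to the cylinder -/
def env (u : Euc N × ℝ → ℝ) (q : Euc N × ℝ) : ℝ :=
  sInf {b | ∀ᶠ q' in 𝓝[D.Cyl] q, u q' ≤ b}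

variable {D}

lemma env_ne {u : Euc N × ℝ → ℝ} (hb : D.LocBdd u) {q : Euc N × ℝ} :
    ∃ M, ∀ᶠ q' in 𝓝[D.Cyl] q, u q' ≤ M := by
  obtain ⟨M, hM, h⟩ := hb (q.2 + 1)
  refine ⟨M, ?_⟩
  have h2 : ∀ᶠ q' in 𝓝 q, q'.2 < q.2 + 1 :=
    (continuous_snd.tendsto q).eventually (Iio_mem_nhds (by linarith))
  filter_upwards [self_mem_nhdsWithin, mem_nhdsWithin_of_mem_nhds h2] with q' hq' h3
  have h3 : q'.2 < q.2 + 1 := h3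
  exact (abs_le.1 (h q'.1 hq'.1 q'.2 hq'.2 h3.le)).2

lemma env_below {u : Euc N × ℝ → ℝ} {q : Euc N × ℝ} (hq : q ∈ D.Cyl) {b : ℝ}
    (h : ∀ᶠ q' in 𝓝[D.Cyl] q, u q' ≤ b) : u q ≤ b := h.self_of_nhdsWithin hq

lemma le_env {u : Euc N × ℝ → ℝ} (hb : D.LocBdd u) {q : Euc N × ℝ} (hq : q ∈ D.Cyl) :
    u q ≤ D.env u q := by
  obtain ⟨M, hM⟩ := env_ne hb (q := q)
  exact le_csInf ⟨M, hM⟩ fun b h => env_below hq h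

lemma env_le {u : Euc N × ℝ → ℝ} {q : Euc N × ℝ} (hq : q ∈ D.Cyl) {b : ℝ}
    (h : ∀ᶠ q' in 𝓝[D.Cyl] q, u q' ≤ b) : D.env u q ≤ b :=
  csInf_le ⟨u q, fun _ h => env_below hq h⟩ h

lemma env_lt {u : Euc N × ℝ → ℝ} (hb : D.LocBdd u) {q : Euc N × ℝ} {b : ℝ} (h : D.env u q < b) :
    ∃ b' < b, ∀ᶠ q' in 𝓝[D.Cyl] q, u q' ≤ b' := by
  obtain ⟨M, hM⟩ := env_ne hb (q := q)
  obtain ⟨b', h1, h2⟩ := exists_lt_of_csInf_lt (s := {b | ∀ᶠ q' in 𝓝[D.Cyl] q, u q' ≤ b}) ⟨M, hM⟩ h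
  exact ⟨b', h2, h1⟩

lemma env_usc {u : Euc N × ℝ → ℝ} (hb : D.LocBdd u) : UpperSemicontinuousOn (D.env u) D.Cyl := by
  intro q hq b h
  obtain ⟨b', h1, h2⟩ := env_lt hb h
  have h3 := eventually_eventually_nhdsWithin.2 h2
  filter_upwards [self_mem_nhdsWithin, h3] with q' hq' h4
  exact (env_le hq' h4).trans_lt h1

lemma env_le_of_usc {u g : Euc N × ℝ → ℝ} (hg : UpperSemicontinuousOn g D.Cyl)
    (h : ∀ q ∈ D.Cyl, u q ≤ g q) {q : Euc N × ℝ} (hq : q ∈ D.Cyl) : D.env u q ≤ g q := by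
  refine le_of_forall_gt fun b hb => ?_
  obtain ⟨c, hc1, hc2⟩ := exists_between hb
  refine lt_of_le_of_lt (env_le hq ?_) hc2
  filter_upwards [self_mem_nhdsWithin, hg q hq c hc1] with q' hq' h4
  exact (h q' hq').trans h4.le

lemma env_bdd {u : Euc N × ℝ → ℝ} (hb : D.LocBdd u) : D.LocBdd (D.env u) := fun T => by
  obtain ⟨M, hM, h⟩ := hb (T + 1)
  refine ⟨M, hM, fun x hx t ht htT => abs_le.2 ⟨?_, ?_⟩⟩
  · exact (abs_le.1 (h x hx t ht (by linarith))).1.trans (le_env hb (D.mem_Cyl.2 ⟨hx, ht⟩))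
  · refine env_le (D.mem_Cyl.2 ⟨hx, ht⟩) ?_
    have h2 : ∀ᶠ q' : Euc N × ℝ in 𝓝 (x, t), q'.2 < T + 1 :=
      (continuous_snd.tendsto (x, t)).eventually (Iio_mem_nhds (by show t < T + 1; linarith))
    filter_upwards [self_mem_nhdsWithin, mem_nhdsWithin_of_mem_nhds h2] with q' hq' h3
    have h3 : q'.2 < T + 1 := h3
    exact (abs_le.1 (h q'.1 hq'.1 q'.2 hq'.2 h3.le)).2

lemma env_adm {u : Euc N × ℝ → ℝ} (hb : D.LocBdd u) : D.Adm (D.env u) := ⟨env_usc hb, env_bdd hb⟩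

lemma env_seq {u : Euc N × ℝ → ℝ} (hb : D.LocBdd u) {q : Euc N × ℝ} (hq : q ∈ D.Cyl) :
    ∃ X : ℕ → Euc N × ℝ, (∀ k, X k ∈ D.Cyl) ∧ Tendsto X atTop (𝓝 q) ∧
      Tendsto (fun k => u (X k)) atTop (𝓝 (D.env u q)) := by
  have key : ∀ k : ℕ, ∃ y ∈ D.Cyl, dist y q < 1 / ((k:ℝ) + 1) ∧ D.env u q - 1 / ((k:ℝ) + 1) ≤ u y ∧
      u y ≤ D.env u q + 1 / ((k:ℝ) + 1) := by
    intro k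
    have hk : (0:ℝ) < 1 / ((k:ℝ) + 1) := by positivity
    have f1 : ∃ᶠ y in 𝓝[D.Cyl] q, D.env u q - 1 / ((k:ℝ) + 1) < u y := fun hc => by
      have := env_le hq (b := D.env u q - 1 / ((k:ℝ) + 1)) (hc.mono fun y hy => not_lt.1 hy)
      linarith
    obtain ⟨b', h1, h2⟩ := env_lt hb (q := q) (b := D.env u q + 1 / ((k:ℝ) + 1)) (by linarith)
    have h3 : ∀ᶠ y in 𝓝[D.Cyl] q, dist y q < 1 / ((k:ℝ) + 1) :=
      mem_nhdsWithin_of_mem_nhds (ball_mem_nhds q hk)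
    obtain ⟨y, hy1, hy2, hy3, hy4⟩ := (f1.and_eventually ((show ∀ᶠ y in 𝓝[D.Cyl] q, y ∈ D.Cyl from self_mem_nhdsWithin).and (h2.and h3))).exists
    exact ⟨y, hy2, hy4, hy1.le, hy3.trans h1.le⟩
  choose X h1 h2 h3 h4 using key
  have h0 : Tendsto (fun k : ℕ => 1 / ((k:ℝ) + 1)) atTop (𝓝 0) := tendsto_one_div_add_atTop_nhds_zero_nat
  refine ⟨X, h1, ?_, ?_⟩
  · exact tendsto_iff_dist_tendsto_zero.2 (squeeze_zero (fun _ => dist_nonneg) (fun k => (h2 k).le) h0)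
  · refine tendsto_of_tendsto_of_tendsto_of_le_of_le ?_ ?_ h3 h4
    · simpa using h0.const_sub (D.env u q)
    · simpa using h0.const_add (D.env u q)

lemma grad_conv {ζ : Euc N × ℝ → ℝ} {q : Euc N × ℝ} {p : Euc N} {a : ℝ}
    (hc : ContDiffAt ℝ 1 ζ q) (hf : HasFDerivAt ζ (clm p a) q) :
    ∃ (P : Euc N × ℝ → Euc N) (A : Euc N × ℝ → ℝ),
      (∀ᶠ y in 𝓝 q, ContDiffAt ℝ 1 ζ y ∧ HasFDerivAt ζ (clm (P y) (A y)) y) ∧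
      Tendsto P (𝓝 q) (𝓝 p) ∧ Tendsto A (𝓝 q) (𝓝 a) := by
  have cfd : ContinuousAt (fderiv ℝ ζ) q := (hc.fderiv_right (m := 0) (by norm_num)).continuousAt
  have h3 := cfd.tendsto
  rw [hf.fderiv] at h3
  have h4 := (cpp_cont.tendsto _).comp h3
  have h5 := (cpa_cont.tendsto _).comp h3
  rw [cpp_clm] at h4; rw [cpa_clm] at h5
  refine ⟨fun y => cpp (fderiv ℝ ζ y), fun y => cpa (fderiv ℝ ζ y), ?_, h4, h5⟩
  filter_upwards [hc.eventually (by simp)] with y hy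
  refine ⟨hy, ?_⟩
  rw [clm_cp]
  exact (hy.differentiableAt (by norm_num)).hasFDerivAt

/-- squared distance on space-time -/
def sqd (q0 q : Euc N × ℝ) : ℝ := ‖q.1 - q0.1‖ ^ 2 + (q.2 - q0.2) ^ 2

lemma sqd_self (q0 : Euc N × ℝ) : sqd q0 q0 = 0 := by simp [sqd]

lemma sqd_nonneg (q0 q : Euc N × ℝ) : 0 ≤ sqd q0 q := by unfold sqd; positivity

lemma sqd_cd (q0 : Euc N × ℝ) : ContDiff ℝ 1 (sqd q0) := by
  unfold sqd
  exact (ContDiff.norm_sq ℝ (contDiff_fst.sub contDiff_const)).add ((contDiff_snd.sub contDiff_const).pow 2)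

lemma sqd_fd (q0 : Euc N × ℝ) : HasFDerivAt (sqd q0) (clm 0 0) q0 := by
  have h := ((sqd_cd q0).differentiable (by norm_num) q0).hasFDerivAt
  have h2 : IsLocalMin (sqd q0) q0 := Filter.Eventually.of_forall fun q => by
    rw [sqd_self]; exact sqd_nonneg q0 q
  rw [h2.fderiv_eq_zero] at h
  have : (clm 0 0 : (Euc N × ℝ) →L[ℝ] ℝ) = 0 := by
    ext q <;> simp [clm_apply]
  rwa [this]

lemma sqd_dist (q0 q : Euc N × ℝ) : dist q q0 ^ 2 ≤ sqd q0 q := by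
  unfold sqd
  rw [Prod.dist_eq, dist_eq_norm, Real.dist_eq]
  rcases max_choice ‖q.1 - q0.1‖ |q.2 - q0.2| with h | h <;> rw [h]
  · nlinarith [sq_nonneg (q.2 - q0.2)]
  · rw [sq_abs]; nlinarith [sq_nonneg ‖q.1 - q0.1‖]

lemma stab_touch {V φ ζ : Euc N × ℝ → ℝ} {xh : Euc N} {th : ℝ} {p : Euc N} {a r M c0 : ℝ}
    {w : ℕ → Euc N × ℝ → ℝ} {X : ℕ → Euc N × ℝ} {c : ℕ → ℝ}
    (hV : D.Adm V) (hT : D.Touch V φ xh th p a) (hxh : xh ∈ closure D.Ω) (hth : 0 < th)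
    (hX : ∀ k, X k ∈ D.Cyl) (hXt : Tendsto X atTop (𝓝 (xh, th)))
    (hζ : ContDiffAt ℝ 1 ζ (xh, th)) (hr : 0 < r)
    (hle : ∀ k, ∀ q ∈ D.Cyl, q ∈ ball (xh, th) r → w k q - w k (X k) ≤ ζ q - ζ (X k))
    (hM : ∀ k, ∀ x ∈ closure D.Ω, ∀ t, 0 ≤ t → t ≤ th + 1 → |w k (x, t)| ≤ M)
    (hwV : ∀ k, ∀ q ∈ D.Cyl, w k q ≤ V q)
    (hwt : Tendsto (fun k => w k (X k)) atTop (𝓝 (V (xh, th))))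
    (hi : ∀ᶠ k in atTop, Integrable (D.inc (fun y => w k (y, (X k).2)) (X k).1) ∧
      c k ≤ ∫ z, D.inc (fun y => w k (y, (X k).2)) (X k).1 z)
    (hc : Tendsto c atTop (𝓝 c0)) :
    Integrable (D.inc (fun y => V (y, th)) xh) ∧ c0 ≤ ∫ z, D.inc (fun y => V (y, th)) xh z := by
  have hqh : (xh, th) ∈ D.Cyl := D.mem_Cyl.2 ⟨hxh, hth.le⟩
  obtain ⟨MV, hMV0, hMV⟩ := hV.bdd th
  have hM0 : 0 ≤ M := (abs_nonneg _).trans (hM 0 xh hxh th hth.le (by linarith))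
  obtain ⟨B1, hB1, hb1⟩ := hT.bound hth (M := 2 * MV) (by positivity) (fun y hy => by
    have h1 := abs_le.1 (hMV y hy th hth.le le_rfl)
    have h2 := abs_le.1 (hMV xh hxh th hth.le le_rfl)
    linarith [h1.2, h2.1])
  obtain ⟨K, s, hs, hK⟩ := hζ.exists_lipschitzOnWith
  obtain ⟨ρ, hρ, hρs⟩ := Metric.mem_nhds_iff.1 (Filter.inter_mem hs (ball_mem_nhds _ hr))
  set M' := max (2 * M) (2 * MV) with hM'
  have hM'0 : 0 ≤ M' := (by positivity : 0 ≤ 2 * M).trans (le_max_left _ _)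
  set B2 := (K:ℝ) + 2 * M / (ρ / 2) with hB2
  have hB20 : 0 ≤ B2 := by positivity
  set B' := max B1 B2 with hB'
  have hB'0 : 0 ≤ B' := hB1.trans (le_max_left _ _)
  have hX1 : Tendsto (fun k => (X k).1) atTop (𝓝 xh) := (continuous_fst.tendsto (xh, th)).comp hXt
  have hX2 : Tendsto (fun k => (X k).2) atTop (𝓝 th) := (continuous_snd.tendsto (xh, th)).comp hXt
  have hX2' : ∀ᶠ k in atTop, (X k).2 ≤ th + 1 :=
    (hX2.eventually (Iio_mem_nhds (by linarith : th < th + 1))).mono fun k hk => le_of_lt hk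
  refine D.stab hB'0 hM'0 (Eventually.of_forall fun k => (hX k).1) hxh hX1 ⟨M, ?_⟩ ?_ hwt ?_ ?_
    (Adm.meas_slice hV.usc hth.le) hi hc
  · filter_upwards [hX2'] with k hk y hy
    exact hM k y hy _ (hX k).2 hk
  · intro y hy y' hy' hyt ε hε
    have h1 : Tendsto (fun k => (y' k, (X k).2)) atTop (𝓝[D.Cyl] (y, th)) := by
      refine tendsto_nhdsWithin_iff.2 ⟨hyt.prodMk_nhds hX2, ?_⟩
      filter_upwards [hy'] with k hk
      exact D.mem_Cyl.2 ⟨hk, (hX k).2⟩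
    have h2 := h1.eventually (hV.usc (y, th) (D.mem_Cyl.2 ⟨subset_closure hy, hth.le⟩) (V (y, th) + ε) (by linarith))
    filter_upwards [h2, hy'] with k hk hk2
    exact (hwV k _ (D.mem_Cyl.2 ⟨hk2, (hX k).2⟩)).trans hk.le
  · filter_upwards [hX2', hXt.eventually (ball_mem_nhds _ (half_pos hρ))] with k hk hkb
    have hkb : dist (X k) (xh, th) < ρ / 2 := hkb
    refine D.inc_le (hX k).1 hB'0 hM'0 fun y hy => ?_
    have hg := lip_glob (D := D) (w := fun y => w k (y, (X k).2)) (x := (X k).1) (B := K) (M := 2 * M) (r := ρ / 2)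
      K.2 (by positivity) (half_pos hρ) (fun y hy hyr => by
        have hyb : (y, (X k).2) ∈ ball (xh, th) ρ := by
          have : dist (y, (X k).2) (X k) < ρ / 2 := by
            rw [Prod.dist_eq]
            simpa [dist_eq_norm, hρ] using hyr
          rw [mem_ball]
          linarith [dist_triangle (y, (X k).2) (X k) (xh, th)]
        have hXb : X k ∈ ball (xh, th) ρ := by rw [mem_ball]; linarith
        have h1 := hle k (y, (X k).2) (D.mem_Cyl.2 ⟨hy, (hX k).2⟩) (hρs hyb).2
        have h2 := hK.dist_le_mul _ (hρs hyb).1 _ (hρs hXb).1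
        have h3 : dist (y, (X k).2) (X k) = ‖y - (X k).1‖ := by
          rw [Prod.dist_eq]
          simp [dist_eq_norm]
        rw [h3, Real.dist_eq] at h2
        exact h1.trans ((le_abs_self _).trans h2)) (fun y hy => by
        have h1 := abs_le.1 (hM k y hy _ (hX k).2 hk)
        have h2 := abs_le.1 (hM k _ (hX k).1 _ (hX k).2 hk)
        show w k (y, (X k).2) - w k ((X k).1, (X k).2) ≤ 2 * M
        linarith [h1.2, h2.1]) y hy
    refine hg.trans (min_le_min ?_ (le_max_left _ _))
    exact mul_le_mul_of_nonneg_right (le_max_right _ _) (norm_nonneg _)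
  · refine D.inc_le hxh hB'0 hM'0 fun y hy => (hb1 y hy).trans (min_le_min ?_ (le_max_right _ _))
    exact mul_le_mul_of_nonneg_right (le_max_left _ _) (norm_nonneg _)

/-- inheritance of the subsolution inequality -/
lemma inherit {H : Euc N → ℝ → ℝ → Euc N → ℝ} {u W φ : Euc N × ℝ → ℝ} {x : Euc N} {t : ℝ} {p : Euc N} {a : ℝ}
    (hu : D.LSub H u) (hW : D.Adm W) (hle : ∀ q ∈ D.Cyl, u q ≤ W q) (hx : x ∈ closure D.Ω) (ht : 0 < t)
    (heq : u (x, t) = W (x, t)) (hT : D.Touch W φ x t p a) (hb : x ∈ D.Ω ∨ 0 < ⟪p, D.n x⟫) :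
    Integrable (D.inc (fun y => W (y, t)) x) ∧
      a + H x t (W (x, t)) p ≤ ∫ z, D.inc (fun y => W (y, t)) x z := by
  have hTu : D.Touch u φ x t p a := ⟨hT.cd, hT.fd, by
    filter_upwards [hT.le, self_mem_nhdsWithin] with q h1 h2
    linarith [hle q h2]⟩
  obtain ⟨h1, h2⟩ := hu x hx t ht p a φ hTu hb
  obtain ⟨M, hM0, hM⟩ := hW.bdd t
  obtain ⟨B, hB, hBb⟩ := hT.bound ht (M := 2 * M) (by positivity) (fun y hy => by
    have h1 := abs_le.1 (hM y hy t ht.le le_rfl)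
    have h2 := abs_le.1 (hM x hx t ht.le le_rfl)
    linarith [h1.2, h2.1])
  have h3 : ∀ z, D.inc (fun y => u (y, t)) x z ≤ D.inc (fun y => W (y, t)) x z := fun z =>
    D.inc_mono hx fun hz => by
      have := hle _ (D.mem_Cyl.2 ⟨hz, ht.le⟩)
      show u _ - u _ ≤ W _ - W _
      linarith
  have h4 := D.inc_le hx hB (by positivity) hBb
  have hm : Measurable (D.inc (fun y => W (y, t)) x) := D.inc_meas hx (Adm.meas_slice hW.usc ht.le)
  have hintg : Integrable (D.inc (fun y => W (y, t)) x) := by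
    refine (h1.abs.add (D.dom_integrable hB (by positivity : 0 ≤ 2 * M))).mono' hm.aestronglyMeasurable
      (Eventually.of_forall fun z => ?_)
    rw [Real.norm_eq_abs, abs_le]
    have h5 := D.dom_nonneg hB (by positivity : 0 ≤ 2 * M) z
    have h6 := neg_abs_le (D.inc (fun y => u (y, t)) x z)
    have h7 := abs_nonneg (D.inc (fun y => u (y, t)) x z)
    simp only [Pi.add_apply]
    constructor <;> linarith [h3 z, h4 z]
  refine ⟨hintg, ?_⟩
  rw [← heq]
  exact h2.trans (integral_mono h1 hintg h3)

lemma usc_max {f g : Euc N × ℝ → ℝ} {s : Set (Euc N × ℝ)} (hf : UpperSemicontinuousOn f s)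
    (hg : UpperSemicontinuousOn g s) : UpperSemicontinuousOn (fun q => max (f q) (g q)) s := by
  intro q hq b hb
  have hb : max (f q) (g q) < b := hb
  rw [max_lt_iff] at hb
  filter_upwards [hf q hq b hb.1, hg q hq b hb.2] with y h1 h2
  exact max_lt h1 h2

lemma Adm.max {f g : Euc N × ℝ → ℝ} (hf : D.Adm f) (hg : D.Adm g) : D.Adm (fun q => max (f q) (g q)) := by
  refine ⟨usc_max hf.usc hg.usc, fun T => ?_⟩
  obtain ⟨M1, h1, h2⟩ := hf.bdd T
  obtain ⟨M2, h3, h4⟩ := hg.bdd T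
  refine ⟨M1 + M2, by positivity, fun x hx t ht htT => ?_⟩
  have f1 := abs_le.1 (h2 x hx t ht htT)
  have f2 := abs_le.1 (h4 x hx t ht htT)
  exact abs_le.2 ⟨le_max_of_le_left (by linarith), max_le (by linarith) (by linarith)⟩

lemma LSub.max {H : Euc N → ℝ → ℝ → Euc N → ℝ} {f g : Euc N × ℝ → ℝ} (hf : D.Adm f) (hg : D.Adm g)
    (hf' : D.LSub H f) (hg' : D.LSub H g) : D.LSub H (fun q => max (f q) (g q)) := by
  intro x hx t ht p a φ hT hb
  rcases max_choice (f (x, t)) (g (x, t)) with h | h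
  · exact inherit hf' (Adm.max hf hg) (fun q _ => le_max_left _ _) hx ht h.symm hT hb
  · exact inherit hg' (Adm.max hf hg) (fun q _ => le_max_right _ _) hx ht h.symm hT hb

lemma LSub.congr {H : Euc N → ℝ → ℝ → Euc N → ℝ} {f g : Euc N × ℝ → ℝ} (hg : D.Adm g)
    (hf : D.LSub H f) (h : ∀ q ∈ D.Cyl, f q = g q) : D.LSub H g := by
  intro x hx t ht p a φ hT hb
  exact inherit hf hg (fun q hq => (h q hq).le) hx ht (h _ (D.mem_Cyl.2 ⟨hx, ht.le⟩)) hT hb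

end Dat

namespace Dat
variable {D : Dat N}

lemma bdry_ev {x p : Euc N} {t : ℝ} {Y : ℕ → Euc N × ℝ} {P : ℕ → Euc N} (hx : x ∈ closure D.Ω)
    (hY : ∀ k, Y k ∈ D.Cyl) (hYt : Tendsto Y atTop (𝓝 (x, t))) (hP : Tendsto P atTop (𝓝 p))
    (hb : x ∈ D.Ω ∨ 0 < ⟪p, D.n x⟫) :
    ∀ᶠ k in atTop, (Y k).1 ∈ D.Ω ∨ 0 < ⟪P k, D.n (Y k).1⟫ := by
  have hY1 : Tendsto (fun k => (Y k).1) atTop (𝓝 x) := (continuous_fst.tendsto (x, t)).comp hYt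
  by_cases hxΩ : x ∈ D.Ω
  · filter_upwards [hY1.eventually (D.open_Ω.mem_nhds hxΩ)] with k hk
    exact Or.inl hk
  · have hf : x ∈ frontier D.Ω := (D.mem_or hx).resolve_left hxΩ
    have hb := hb.resolve_left hxΩ
    have h1 := D.n_cont x hf
    have h2 : Tendsto (fun z : Euc N × Euc N => ⟪z.1, D.n z.2⟫) (𝓝 p ×ˢ 𝓝[frontier D.Ω] x) (𝓝 ⟪p, D.n x⟫) :=
      tendsto_fst.inner (h1.tendsto.comp tendsto_snd)
    have h3 := h2.eventually (Ioi_mem_nhds hb)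
    obtain ⟨pa, hpa, pb, hpb, h4⟩ := eventually_prod_iff.1 h3
    filter_upwards [hP.eventually hpa, hY1.eventually (eventually_nhdsWithin_iff.1 hpb)] with k h5 h6
    rcases D.mem_or (hY k).1 with h | h
    · exact Or.inl h
    · exact Or.inr (h4 h5 (h6 h))

lemma tendsto_H {H : Euc N → ℝ → ℝ → Euc N → ℝ}
    (hH : Continuous (fun q : Euc N × ℝ × ℝ × Euc N => H q.1 q.2.1 q.2.2.1 q.2.2.2))
    {Y : ℕ → Euc N × ℝ} {s : ℕ → ℝ} {P : ℕ → Euc N} {x p : Euc N} {t s0 : ℝ}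
    (hYt : Tendsto Y atTop (𝓝 (x, t))) (hs : Tendsto s atTop (𝓝 s0)) (hP : Tendsto P atTop (𝓝 p)) :
    Tendsto (fun k => H (Y k).1 (Y k).2 (s k) (P k)) atTop (𝓝 (H x t s0 p)) := by
  have hY1 : Tendsto (fun k => (Y k).1) atTop (𝓝 x) := (continuous_fst.tendsto (x, t)).comp hYt
  have hY2 : Tendsto (fun k => (Y k).2) atTop (𝓝 t) := (continuous_snd.tendsto (x, t)).comp hYt
  exact (hH.tendsto (x, t, s0, p)).comp (hY1.prodMk_nhds (hY2.prodMk_nhds (hs.prodMk_nhds hP)))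

lemma tendsto_of_sqd {q0 : Euc N × ℝ} {Y : ℕ → Euc N × ℝ} {e : ℕ → ℝ} (he : Tendsto e atTop (𝓝 0))
    (h : ∀ᶠ k in atTop, sqd q0 (Y k) ≤ e k) : Tendsto Y atTop (𝓝 q0) := by
  rw [tendsto_iff_dist_tendsto_zero]
  have h1 : Tendsto (fun k => √(e k)) atTop (𝓝 0) := by
    have := (Real.continuous_sqrt.tendsto 0).comp he
    rw [Real.sqrt_zero] at this
    exact this
  refine squeeze_zero' (Eventually.of_forall fun _ => dist_nonneg) ?_ h1
  filter_upwards [h] with k hk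
  exact Real.le_sqrt_of_sq_le ((sqd_dist _ _).trans hk)

lemma sup_stab {H : Euc N → ℝ → ℝ → Euc N → ℝ}
    (hH : Continuous (fun q : Euc N × ℝ × ℝ × Euc N => H q.1 q.2.1 q.2.2.1 q.2.2.2))
    {F : Set (Euc N × ℝ → ℝ)} {U L : Euc N × ℝ → ℝ} (hF : ∀ u ∈ F, D.Adm u ∧ D.LSub H u)
    (hU : D.LocBdd U) (hLb : D.LocBdd L)
    (hle : ∀ u ∈ F, ∀ q ∈ D.Cyl, u q ≤ U q) (hlow : ∀ u ∈ F, ∀ q ∈ D.Cyl, L q ≤ u q)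
    (happ : ∀ q ∈ D.Cyl, ∀ ε > (0:ℝ), ∃ u ∈ F, U q - ε < u q) : D.LSub H (D.env U) := by
  intro x hx t ht p a φ hT hb
  have hqh : (x, t) ∈ D.Cyl := D.mem_Cyl.2 ⟨hx, ht.le⟩
  set q0 : Euc N × ℝ := (x, t) with hq0
  set V := D.env U with hVdef
  have hV : D.Adm V := env_adm hU
  set ζ : Euc N × ℝ → ℝ := fun q => φ q + sqd q0 q with hζ
  have hζc : ContDiffAt ℝ 1 ζ q0 := hT.cd.add (sqd_cd q0).contDiffAt
  have hζf : HasFDerivAt ζ (clm p a) q0 := by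
    have := hT.fd.add (sqd_fd q0)
    rw [clm_add, add_zero, add_zero] at this
    exact this
  obtain ⟨P, A, hPA, hP, hA⟩ := grad_conv hζc hζf
  have hev : ∀ᶠ q in 𝓝 q0, (q ∈ D.Cyl → V q - φ q ≤ V q0 - φ q0) ∧
      (ContDiffAt ℝ 1 ζ q ∧ HasFDerivAt ζ (clm (P q) (A q)) q) ∧ 0 < q.2 :=
    (eventually_nhdsWithin_iff.1 hT.le).and (hPA.and ((continuous_snd.tendsto q0).eventually (Ioi_mem_nhds ht)))
  obtain ⟨r, hr, hrs⟩ := (Metric.nhds_basis_closedBall.eventually_iff).1 hev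
  set K := D.Cyl ∩ closedBall q0 r with hK
  have hKc : IsCompact K := (isCompact_closedBall q0 r).inter_left D.Cyl_closed
  have hK0 : q0 ∈ K := ⟨hqh, mem_closedBall_self hr.le⟩
  obtain ⟨X, hX, hXt, hUX⟩ := env_seq hU hqh
  have hch : ∀ k : ℕ, ∃ u ∈ F, U (X k) - 1 / ((k:ℝ) + 1) < u (X k) := fun k =>
    happ _ (hX k) _ (by positivity)
  choose u huF hu using hch
  have hmx : ∀ k, ∃ y ∈ K, ∀ q ∈ K, u k q - ζ q ≤ u k y - ζ y := fun k => by
    have h1 : UpperSemicontinuousOn (fun q => u k q + -ζ q) K :=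
      UpperSemicontinuousOn.add (f := u k) (g := fun q => -ζ q) ((hF _ (huF k)).1.usc.mono inter_subset_left)
        (ContinuousOn.upperSemicontinuousOn fun q hq =>
          ((hrs hq.2).2.1.1.continuousAt.neg).continuousWithinAt)
    obtain ⟨y, hy, hy2⟩ := h1.exists_isMaxOn (show K.Nonempty from ⟨q0, hK0⟩) hKc
    refine ⟨y, hy, fun q hq => ?_⟩
    have : u k q + -ζ q ≤ u k y + -ζ y := hy2 hq
    linarith
  choose Y hYK hYm using hmx
  have hY : ∀ k, Y k ∈ D.Cyl := fun k => (hYK k).1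
  have huV : ∀ k, ∀ q ∈ D.Cyl, u k q ≤ V q := fun k q hq => (hle _ (huF k) q hq).trans (le_env hU hq)
  have hXK : ∀ᶠ k in atTop, X k ∈ K := by
    filter_upwards [hXt.eventually (closedBall_mem_nhds _ hr)] with k hk
    exact ⟨hX k, hk⟩
  have h0 : Tendsto (fun k : ℕ => 1 / ((k:ℝ) + 1)) atTop (𝓝 0) := tendsto_one_div_add_atTop_nhds_zero_nat
  have hζX : Tendsto (fun k => ζ (X k)) atTop (𝓝 (φ q0)) := by
    have := hζc.continuousAt.tendsto.comp hXt
    simpa [hζ, sqd_self, Function.comp_def] using this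
  set lo : ℕ → ℝ := fun k => U (X k) - 1 / ((k:ℝ) + 1) - ζ (X k) with hlo
  have hlot : Tendsto lo atTop (𝓝 (V q0 - φ q0)) := by
    have := (hUX.sub h0).sub hζX
    rw [sub_zero] at this
    exact this
  have hloY : ∀ᶠ k in atTop, lo k ≤ u k (Y k) - ζ (Y k) := by
    filter_upwards [hXK] with k hk
    have := hYm k _ hk
    have h2 := hu k
    simp only [hlo]; linarith
  have hup : ∀ k, u k (Y k) - φ (Y k) ≤ V q0 - φ q0 := fun k => by
    have h1 := (hrs (hYK k).2).1 (hY k)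
    have h2 := huV k _ (hY k)
    linarith
  have hYt : Tendsto Y atTop (𝓝 q0) := by
    refine tendsto_of_sqd (e := fun k => V q0 - φ q0 - lo k) (by simpa using hlot.const_sub (V q0 - φ q0)) ?_
    filter_upwards [hloY] with k hk
    have h1 := hup k
    simp only [hζ] at hk
    linarith
  have hζY : Tendsto (fun k => ζ (Y k)) atTop (𝓝 (φ q0)) := by
    have := hζc.continuousAt.tendsto.comp hYt
    simpa [hζ, sqd_self, Function.comp_def] using this
  have hφY : Tendsto (fun k => φ (Y k)) atTop (𝓝 (φ q0)) := hT.cd.continuousAt.tendsto.comp hYt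
  have huY : Tendsto (fun k => u k (Y k)) atTop (𝓝 (V q0)) := by
    refine tendsto_of_tendsto_of_tendsto_of_le_of_le' (g := fun k => lo k + ζ (Y k))
      (h := fun k => V q0 - φ q0 + φ (Y k)) (by simpa using hlot.add hζY)
      (by simpa using hφY.const_add (V q0 - φ q0)) ?_ (Eventually.of_forall fun k => by linarith [hup k])
    filter_upwards [hloY] with k hk
    linarith
  obtain ⟨M1, hM1, hM1b⟩ := hU (t + 1)
  obtain ⟨M2, hM2, hM2b⟩ := hLb (t + 1)
  refine stab_touch (w := u) (X := Y) (ζ := ζ) (r := r) (M := M1 + M2) hV hT hx ht hY hYt hζc hr ?_ ?_ huV huY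
    (c := fun k => A (Y k) + H (Y k).1 (Y k).2 (u k (Y k)) (P (Y k))) ?_ ?_
  · intro k q hq hqb
    have := hYm k q ⟨hq, ball_subset_closedBall hqb⟩
    linarith
  · intro k y hy s hs hst
    have hm := D.mem_Cyl.2 ⟨hy, hs⟩
    have h1 := (abs_le.1 (hM1b y hy s hs hst)).2
    have h2 := (abs_le.1 (hM2b y hy s hs hst)).1
    have h3 := hle _ (huF k) _ hm
    have h4 := hlow _ (huF k) _ hm
    exact abs_le.2 ⟨by linarith, by linarith⟩
  · filter_upwards [hYt.eventually (ball_mem_nhds _ hr), bdry_ev hx hY hYt (hP.comp hYt) hb] with k hk hkb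
    have hr' := hrs (hYK k).2
    refine (hF _ (huF k)).2 (Y k).1 (hY k).1 (Y k).2 hr'.2.2 (P (Y k)) (A (Y k)) ζ ⟨hr'.2.1.1, hr'.2.1.2, ?_⟩ hkb
    filter_upwards [self_mem_nhdsWithin, mem_nhdsWithin_of_mem_nhds (isOpen_ball.mem_nhds hk)] with q hq hqb
    exact hYm k q ⟨hq, ball_subset_closedBall hqb⟩
  · exact (hA.comp hYt).add (tendsto_H hH hYt huY (hP.comp hYt))

lemma bump {H : Euc N → ℝ → ℝ → Euc N → ℝ}
    (hH : Continuous (fun q : Euc N × ℝ × ℝ × Euc N => H q.1 q.2.1 q.2.2.1 q.2.2.2))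
    {u : Euc N × ℝ → ℝ} (hu : D.Adm u) (hL : D.LSub H u)
    (hmax : ∀ W, D.Adm W → D.LSub H W → (∀ q ∈ D.Cyl, u q ≤ W q) →
      (∀ x ∈ closure D.Ω, W (x, 0) = u (x, 0)) → ∀ q ∈ D.Cyl, W q ≤ u q) :
    D.LSub (Hneg H) (D.env (fun q => -u q)) := by
  intro x hx t ht p a φ hT hb
  have hqh : (x, t) ∈ D.Cyl := D.mem_Cyl.2 ⟨hx, ht.le⟩
  set q0 : Euc N × ℝ := (x, t) with hq0
  set V := D.env (fun q => -u q) with hVdef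
  have hnb := hu.bdd.neg
  have hV : D.Adm V := env_adm hnb
  have huV : ∀ q ∈ D.Cyl, -u q ≤ V q := fun q hq => le_env hnb hq
  set ψ : Euc N × ℝ → ℝ := fun q => φ q0 - φ q - V q0 - sqd q0 q with hψ
  have hψ0 : ψ q0 = -V q0 := by simp [hψ, sqd_self]
  have hψc : ContDiffAt ℝ 1 ψ q0 :=
    ((contDiffAt_const.sub hT.cd).sub contDiffAt_const).sub (sqd_cd q0).contDiffAt
  have hψf : HasFDerivAt ψ (clm (-p) (-a)) q0 := by
    have := ((hT.fd.const_sub (φ q0)).sub_const (V q0)).sub (sqd_fd q0)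
    have e : -clm p a - clm 0 0 = clm (-p) (-a) := by
      rw [sub_eq_add_neg, clm_neg, clm_neg, clm_add, neg_zero, neg_zero, add_zero, add_zero]
    rw [e] at this
    exact this
  obtain ⟨P, A, hPA, hP, hA⟩ := grad_conv hψc hψf
  have hev : ∀ᶠ q in 𝓝 q0, (q ∈ D.Cyl → V q - φ q ≤ V q0 - φ q0) ∧
      (ContDiffAt ℝ 1 ψ q ∧ HasFDerivAt ψ (clm (P q) (A q)) q) ∧ 0 < q.2 ∧ ψ q < -V q0 + 1 :=
    (eventually_nhdsWithin_iff.1 hT.le).and (hPA.and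
      (((continuous_snd.tendsto q0).eventually (Ioi_mem_nhds ht)).and
        (hψc.continuousAt.tendsto.eventually (Iio_mem_nhds (by rw [hψ0]; linarith)))))
  obtain ⟨r, hr, hrs⟩ := (Metric.nhds_basis_closedBall.eventually_iff).1 hev
  have hrb : ∀ {q}, q ∈ ball q0 r → q ∈ closedBall q0 r := fun h => ball_subset_closedBall h
  have huψ : ∀ q ∈ D.Cyl, q ∈ closedBall q0 r → ψ q + sqd q0 q ≤ u q := fun q hq hqb => by
    have h1 := (hrs hqb).1 hq
    have h2 := huV q hq
    simp only [hψ]; linarith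
  set m := min 1 ((r / 2) ^ 2) with hm
  have hm0 : 0 < m := lt_min one_pos (by positivity)
  set κ : ℕ → ℝ := fun k => m * (1 / ((k:ℝ) + 1)) with hκ
  have hκ0 : ∀ k, 0 < κ k := fun k => by simp only [hκ]; positivity
  have hκm : ∀ k, κ k ≤ m := fun k => by
    simp only [hκ]
    refine mul_le_of_le_one_right hm0.le ?_
    rw [div_le_one (by positivity)]
    linarith [(Nat.cast_nonneg k : (0:ℝ) ≤ k)]
  have hκt : Tendsto κ atTop (𝓝 0) := by
    have := (tendsto_one_div_add_atTop_nhds_zero_nat (𝕜 := ℝ)).const_mul m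
    rw [mul_zero] at this
    exact this
  classical
  set W : ℕ → Euc N × ℝ → ℝ := fun k q => if q ∈ ball q0 r then max (u q) (ψ q + κ k) else u q with hW
  have hWin : ∀ k q, q ∈ ball q0 r → W k q = max (u q) (ψ q + κ k) := fun k q h => if_pos h
  have hWout : ∀ k q, q ∉ ball q0 r → W k q = u q := fun k q h => if_neg h
  have hWfar : ∀ k, ∀ q ∈ D.Cyl, r / 2 ≤ dist q q0 → W k q = u q := fun k q hq hd => by
    by_cases h : q ∈ ball q0 r
    · rw [hWin k q h]
      refine max_eq_left ?_
      have h1 := huψ q hq (hrb h)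
      have h2 := sqd_dist q0 q
      have h3 : (r / 2) ^ 2 ≤ dist q q0 ^ 2 := pow_le_pow_left₀ (by positivity) hd 2
      have h4 := hκm k
      have h5 : m ≤ (r / 2) ^ 2 := min_le_right _ _
      linarith
    · exact hWout k q h
  have huW : ∀ k q, u q ≤ W k q := fun k q => by
    by_cases h : q ∈ ball q0 r
    · rw [hWin k q h]; exact le_max_left _ _
    · rw [hWout k q h]
  have hWup : ∀ k q, W k q ≤ max (u q) (-V q0 + 2) := fun k q => by
    by_cases h : q ∈ ball q0 r
    · rw [hWin k q h]
      refine max_le_max le_rfl ?_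
      have h1 := (hrs (hrb h)).2.2.2
      have h2 := hκm k
      have h3 : m ≤ 1 := min_le_left _ _
      linarith
    · rw [hWout k q h]; exact le_max_left _ _
  have hWadm : ∀ k, D.Adm (W k) := fun k => by
    refine ⟨?_, ?_⟩
    · intro q hq b hbq
      by_cases h : q ∈ ball q0 r
      · have hbq : W k q < b := hbq
        rw [hWin k q h, max_lt_iff] at hbq
        have hc : ContinuousAt (fun q => ψ q + κ k) q :=
          (hrs (hrb h)).2.1.1.continuousAt.add continuousAt_const
        have h1 : ∀ᶠ q' in 𝓝 q, ψ q' + κ k < b := hc.tendsto.eventually (Iio_mem_nhds hbq.2)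
        filter_upwards [hu.usc q hq b hbq.1, mem_nhdsWithin_of_mem_nhds h1,
          mem_nhdsWithin_of_mem_nhds (isOpen_ball.mem_nhds h)] with q' h2 h3 h4
        rw [hWin k q' h4]
        exact max_lt h2 h3
      · have hbq : W k q < b := hbq
        rw [hWout k q h] at hbq
        have hd : r ≤ dist q q0 := not_lt.1 h
        have h1 : ∀ᶠ q' in 𝓝 q, r / 2 < dist q' q0 :=
          ((continuous_id.dist continuous_const).tendsto q).eventually
            (Ioi_mem_nhds (by show r / 2 < dist q q0; linarith))
        filter_upwards [hu.usc q hq b hbq, self_mem_nhdsWithin, mem_nhdsWithin_of_mem_nhds h1] with q' h2 h3 h4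
        have h4 : r / 2 < dist q' q0 := h4
        rw [hWfar k q' h3 h4.le]
        exact h2
    · intro T
      obtain ⟨M, hM, hMb⟩ := hu.bdd T
      refine ⟨M + |-V q0 + 2|, by positivity, fun y hy s hs hsT => ?_⟩
      have h1 := abs_le.1 (hMb y hy s hs hsT)
      have h2 := huW k (y, s)
      have h3 := hWup k (y, s)
      have h4 := le_abs_self (-V q0 + 2)
      have h5 := abs_nonneg (-V q0 + 2)
      refine abs_le.2 ⟨by linarith [h1.1], h3.trans (max_le (by linarith [h1.2]) (by linarith))⟩
  have hnot : ∀ k, ¬ D.LSub H (W k) := fun k hLk => by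
    have h1 := hmax (W k) (hWadm k) hLk (fun q _ => huW k q) (fun y hy => hWout k _ fun hb => by
      have := (hrs (hrb hb)).2.2.1
      exact lt_irrefl _ this)
    have h2 : V q0 ≤ V q0 - κ k / 2 := by
      refine env_le hqh ?_
      have h3 : ∀ᶠ q in 𝓝 q0, -V q0 - κ k / 2 < ψ q :=
        hψc.continuousAt.tendsto.eventually (Ioi_mem_nhds (by rw [hψ0]; linarith [hκ0 k]))
      filter_upwards [self_mem_nhdsWithin, mem_nhdsWithin_of_mem_nhds h3,
        mem_nhdsWithin_of_mem_nhds (ball_mem_nhds q0 hr)] with q hq h4 h5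
      have h4 : -V q0 - κ k / 2 < ψ q := h4
      have h6 := h1 q hq
      rw [hWin k q h5] at h6
      have := (le_max_right _ _).trans h6
      linarith
    linarith [hκ0 k]
  have hex : ∀ k, ∃ X : Euc N × ℝ, X ∈ D.Cyl ∧ 0 < X.2 ∧ ∃ p' a' φ', D.Touch (W k) φ' X.1 X.2 p' a' ∧
      (X.1 ∈ D.Ω ∨ 0 < ⟪p', D.n X.1⟫) ∧ ¬ (Integrable (D.inc (fun y => W k (y, X.2)) X.1) ∧
        a' + H X.1 X.2 (W k X) p' ≤ ∫ z, D.inc (fun y => W k (y, X.2)) X.1 z) := fun k => by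
    by_contra hcon
    push Not at hcon
    refine hnot k fun y hy s hs p' a' φ' hT' hb' => ?_
    have := hcon (y, s) (D.mem_Cyl.2 ⟨hy, hs.le⟩) hs p' a' φ' hT' hb'
    exact this
  choose X hXC hX0 p' a' φ' hT' hb' hfail using hex
  have hne : ∀ k, X k ∈ ball q0 r ∧ W k (X k) = ψ (X k) + κ k ∧ u (X k) < ψ (X k) + κ k := fun k => by
    have h1 : u (X k) ≠ W k (X k) := fun h =>
      hfail k (inherit hL (hWadm k) (fun q _ => huW k q) (hXC k).1 (hX0 k) h (hT' k) (hb' k))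
    by_cases h : X k ∈ ball q0 r
    · rw [hWin k _ h] at h1 ⊢
      have h2 : u (X k) < ψ (X k) + κ k := by
        by_contra h3
        exact h1 (max_eq_left (not_lt.1 h3)).symm
      exact ⟨h, max_eq_right h2.le, h2⟩
    · exact absurd (hWout k _ h).symm h1
  have hXt : Tendsto X atTop (𝓝 q0) := by
    refine tendsto_of_sqd hκt (Eventually.of_forall fun k => ?_)
    have h1 := huψ _ (hXC k) (hrb (hne k).1)
    linarith [(hne k).2.2]
  have hPX := hP.comp hXt
  have hAX := hA.comp hXt
  have hψX : Tendsto (fun k => ψ (X k)) atTop (𝓝 (-V q0)) := by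
    have := hψc.continuousAt.tendsto.comp hXt
    rwa [hψ0] at this
  have hWX : Tendsto (fun k => W k (X k)) atTop (𝓝 (-V q0)) := by
    have := hψX.add hκt
    rw [add_zero] at this
    exact this.congr fun k => (hne k).2.1.symm
  have hWψ : ∀ k q, q ∈ ball q0 r → ψ q - ψ (X k) ≤ W k q - W k (X k) := fun k q hq => by
    rw [(hne k).2.1, hWin k q hq]
    linarith [le_max_right (u q) (ψ q + κ k)]
  have hgr : ∀ k, ((X k).1 ∈ D.Ω → p' k = P (X k) ∧ a' k = A (X k)) ∧
      ((X k).1 ∈ frontier D.Ω → ⟪p' k, D.n (X k).1⟫ ≤ ⟪P (X k), D.n (X k).1⟫) := fun k =>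
    (hT' k).grad (hX0 k) (f := ψ) (hrs (hrb (hne k).1)).2.1.2 (by
      filter_upwards [mem_nhdsWithin_of_mem_nhds (isOpen_ball.mem_nhds (hne k).1)] with q hq
      exact hWψ k q hq)
  have hintg : ∀ k, Integrable (D.inc (fun y => W k (y, (X k).2)) (X k).1) := fun k => by
    obtain ⟨M, hM0, hM⟩ := (hWadm k).bdd (X k).2
    have hM1 : ∀ y ∈ closure D.Ω, |W k (y, (X k).2)| ≤ M := fun y hy => hM y hy _ (hX0 k).le le_rfl
    have hM2 := hM1 (X k).1 (hXC k).1
    have hT2 : D.Touch (fun q => -W k q) (fun q => -ψ q) (X k).1 (X k).2 (-P (X k)) (-A (X k)) := by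
      have h1 := (hrs (hrb (hne k).1)).2.1
      refine ⟨h1.1.neg, ?_, ?_⟩
      · rw [← clm_neg]; exact h1.2.neg
      · filter_upwards [mem_nhdsWithin_of_mem_nhds (isOpen_ball.mem_nhds (hne k).1)] with q hq
        have := hWψ k q hq
        show -W k q - -ψ q ≤ -W k (X k) - -ψ (X k)
        linarith
    obtain ⟨B1, hB1, hb1⟩ := (hT' k).bound (hX0 k) (M := 2 * M) (by positivity) (fun y hy => by
      linarith [(abs_le.1 (hM1 y hy)).2, (abs_le.1 hM2).1])
    obtain ⟨B2, hB2, hb2⟩ := hT2.bound (hX0 k) (M := 2 * M) (by positivity) (fun y hy => by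
      linarith [(abs_le.1 (hM1 y hy)).1, (abs_le.1 hM2).2])
    refine D.inc_integrable (hXC k).1 (B := max B1 B2) (M := 2 * M) (hB1.trans (le_max_left _ _)) (by positivity)
      (Adm.meas_slice (hWadm k).usc (hX0 k).le) fun y hy => ?_
    have e1 := (hb1 y hy).trans (min_le_min_right (2 * M)
      (mul_le_mul_of_nonneg_right (le_max_left B1 B2) (norm_nonneg (y - (X k).1))))
    have e2 := (hb2 y hy).trans (min_le_min_right (2 * M)
      (mul_le_mul_of_nonneg_right (le_max_right B1 B2) (norm_nonneg (y - (X k).1))))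
    exact abs_le.2 ⟨by linarith, e1⟩
  obtain ⟨MU, hMU0, hMU⟩ := hu.bdd (t + 1)
  refine stab_touch (w := fun k q => -W k q) (X := X) (ζ := fun q => -ψ q) (r := r)
    (M := MU + |-V q0 + 2|) hV hT hx ht hXC hXt hψc.neg hr ?_ ?_ ?_ ?_
    (c := fun k => -A (X k) - H (X k).1 (X k).2 (W k (X k)) (P (X k))) ?_ ?_
  · intro k q hq hqb
    have := hWψ k q hqb
    linarith
  · intro k y hy s hs hst
    have h1 := abs_le.1 (hMU y hy s hs hst)
    have h2 := huW k (y, s)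
    have h3 := hWup k (y, s)
    have h4 := le_abs_self (-V q0 + 2)
    have h5 := abs_nonneg (-V q0 + 2)
    rw [abs_neg]
    exact abs_le.2 ⟨by linarith [h1.1], h3.trans (max_le (by linarith [h1.2]) (by linarith))⟩
  · intro k q hq
    linarith [huW k q, huV q hq]
  · simpa using hWX.neg
  · filter_upwards [bdry_ev hx hXC hXt (p := p) (P := fun k => -P (X k)) (by simpa using hPX.neg) hb] with k hk
    have hΩ : (X k).1 ∈ D.Ω := by
      by_contra hno
      have hf := (D.mem_or (hXC k).1).resolve_left hno
      have h1 := hk.resolve_left hno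
      have h2 := (hb' k).resolve_left hno
      have h3 := (hgr k).2 hf
      rw [inner_neg_left] at h1
      linarith
    obtain ⟨e1, e2⟩ := (hgr k).1 hΩ
    have h1 := hfail k
    rw [e1, e2] at h1
    have h2 : ∫ z, D.inc (fun y => W k (y, (X k).2)) (X k).1 z <
        A (X k) + H (X k).1 (X k).2 (W k (X k)) (P (X k)) := by
      by_contra h3
      exact h1 ⟨hintg k, not_lt.1 h3⟩
    have h3 : D.inc (fun y => -W k (y, (X k).2)) (X k).1 = fun z => -D.inc (fun y => W k (y, (X k).2)) (X k).1 z :=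
      funext fun z => D.inc_neg _ _ _
    rw [h3]
    refine ⟨(hintg k).neg, ?_⟩
    rw [integral_neg]
    linarith
  · have h1 := (hAX.neg).sub (tendsto_H hH hXt hWX hPX)
    have h2 : a + Hneg H x t (V q0) p = - -a - H x t (-V q0) (-p) := by
      simp only [Hneg]; ring
    rw [h2]
    exact h1

end Dat

namespace Dat
variable {D : Dat N}

lemma Ok.solve {H : Euc N → ℝ → ℝ → Euc N → ℝ} {K M : ℝ} {u0 : Euc N → ℝ} (h : D.Ok H K)
    (hu0 : ContinuousOn u0 (closure D.Ω)) (hM0 : 0 ≤ M) (hM : ∀ x ∈ closure D.Ω, |u0 x| ≤ M) :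
    ∃ u : Euc N × ℝ → ℝ, ContinuousOn u D.Cyl ∧ D.LocBdd u ∧ D.LSub H u ∧ D.LSub (Hneg H) (fun q => -u q) ∧
      ∀ x ∈ closure D.Ω, u (x, 0) = u0 x := by
  rcases (closure D.Ω).eq_empty_or_nonempty with hem | ⟨xs, hxs⟩
  · refine ⟨fun _ => 0, continuousOn_const, fun T => ⟨0, le_rfl, fun x hx => ?_⟩, fun x hx => ?_, fun x hx => ?_,
      fun x hx => ?_⟩ <;> · rw [hem] at hx; exact absurd hx (notMem_empty x)
  have hneg : ContinuousOn (fun x => -u0 x) (closure D.Ω) := hu0.neg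
  have hMn : ∀ x ∈ closure D.Ω, |(-u0 x)| ≤ M := fun x hx => by rw [abs_neg]; exact hM x hx
  have low : ∀ x0 ∈ closure D.Ω, ∀ ε > (0:ℝ), ∃ f, Continuous f ∧ D.Adm f ∧ D.LSub H f ∧
      (∀ x ∈ closure D.Ω, f (x, 0) ≤ u0 x) ∧ u0 x0 - ε ≤ f (x0, 0) := fun x0 hx0 ε hε =>
    h.barrier hu0 hM0 hM hx0 hε
  have upp : ∀ x0 ∈ closure D.Ω, ∀ ε > (0:ℝ), ∃ f, Continuous f ∧ D.Adm f ∧ D.LSub (Hneg H) f ∧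
      (∀ x ∈ closure D.Ω, f (x, 0) ≤ -u0 x) ∧ -u0 x0 - ε ≤ f (x0, 0) := fun x0 hx0 ε hε =>
    h.neg.barrier hneg hM0 hMn hx0 hε
  obtain ⟨fs, fsc, fsA, fsL, fs0, -⟩ := low xs hxs 1 one_pos
  obtain ⟨gs, gsc, gsA, gsL, gs0, -⟩ := upp xs hxs 1 one_pos
  set S : Set (Euc N × ℝ → ℝ) := {u | D.Adm u ∧ D.LSub H u ∧ (∀ x ∈ closure D.Ω, u (x, 0) ≤ u0 x) ∧
    ∀ q ∈ D.Cyl, fs q ≤ u q} with hS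
  have hfsS : fs ∈ S := ⟨fsA, fsL, fs0, fun _ _ => le_rfl⟩
  have hcmp : ∀ u ∈ S, ∀ g, D.Adm g → D.LSub (Hneg H) g → (∀ x ∈ closure D.Ω, g (x, 0) ≤ -u0 x) →
      ∀ q ∈ D.Cyl, u q ≤ -g q := fun u hu g hg1 hg2 hg3 q hq => by
    have := h.comp u g hu.1 hg1 hu.2.1 hg2 (fun x hx => by linarith [hu.2.2.1 x hx, hg3 x hx]) q.1 hq.1 q.2 hq.2
    have : u q + g q ≤ 0 := this
    linarith
  set U : Euc N × ℝ → ℝ := fun q => sSup ((fun u : Euc N × ℝ → ℝ => u q) '' S) with hU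
  have hne : ∀ q, ((fun u : Euc N × ℝ → ℝ => u q) '' S).Nonempty := fun q => ⟨_, fs, hfsS, rfl⟩
  have hUg : ∀ g, D.Adm g → D.LSub (Hneg H) g → (∀ x ∈ closure D.Ω, g (x, 0) ≤ -u0 x) →
      ∀ q ∈ D.Cyl, U q ≤ -g q := fun g hg1 hg2 hg3 q hq => by
    refine csSup_le (hne q) ?_
    rintro _ ⟨u, hu, rfl⟩
    exact hcmp u hu g hg1 hg2 hg3 q hq
  have hle : ∀ u ∈ S, ∀ q ∈ D.Cyl, u q ≤ U q := fun u hu q hq => by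
    refine le_csSup ⟨-gs q, ?_⟩ ⟨u, hu, rfl⟩
    rintro _ ⟨v, hv, rfl⟩
    exact hcmp v hv gs gsA gsL gs0 q hq
  have hUb : D.LocBdd U := fun T => by
    obtain ⟨M1, h1, h2⟩ := fsA.bdd T
    obtain ⟨M2, h3, h4⟩ := gsA.bdd T
    refine ⟨M1 + M2, by positivity, fun x hx t ht htT => ?_⟩
    have hq := D.mem_Cyl.2 ⟨hx, ht⟩
    have e1 := (abs_le.1 (h2 x hx t ht htT)).1
    have e2 := (abs_le.1 (h4 x hx t ht htT)).1
    have e3 := hle fs hfsS _ hq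
    have e4 := hUg gs gsA gsL gs0 _ hq
    exact abs_le.2 ⟨by linarith, by linarith⟩
  have hLU : D.LSub H (D.env U) := sup_stab h.cont (F := S) (U := U) (L := fs) (fun u hu => ⟨hu.1, hu.2.1⟩) hUb fsA.bdd
    hle (fun u hu q hq => hu.2.2.2 q hq) (fun q hq ε hε => by
      obtain ⟨_, ⟨u, hu, rfl⟩, h2⟩ := exists_lt_of_lt_csSup (hne q) (show U q - ε < U q by linarith)
      exact ⟨u, hu, h2⟩)
  set u := D.env U with hu
  have huA : D.Adm u := env_adm hUb
  have hu0' : ∀ x ∈ closure D.Ω, u (x, 0) ≤ u0 x := fun x hx => by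
    refine le_of_forall_pos_le_add fun ε hε => ?_
    obtain ⟨g, g1, g2, g3, g4, g5⟩ := upp x hx ε hε
    have := env_le_of_usc (D := D) (u := U) (g := fun q => -g q) g1.neg.continuousOn.upperSemicontinuousOn
      (hUg g g2 g3 g4) (D.mem_Cyl.2 ⟨hx, le_rfl⟩)
    have : u (x, 0) ≤ -g (x, 0) := this
    linarith
  have huS : u ∈ S := ⟨huA, hLU, hu0', fun q hq => (hle fs hfsS q hq).trans (le_env hUb hq)⟩
  have hdom : ∀ v ∈ S, ∀ q ∈ D.Cyl, v q ≤ u q := fun v hv q hq => (hle v hv q hq).trans (le_env hUb hq)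
  have hVL := bump h.cont huA hLU (fun W hW1 hW2 hW3 hW4 => hdom W ⟨hW1, hW2, fun x hx => by
    rw [hW4 x hx]; exact hu0' x hx, fun q hq => (huS.2.2.2 q hq).trans (hW3 q hq)⟩)
  have hnb := huA.bdd.neg
  set V := D.env (fun q => -u q) with hV
  have hV0 : ∀ x ∈ closure D.Ω, V (x, 0) ≤ -u0 x := fun x hx => by
    refine le_of_forall_pos_le_add fun ε hε => ?_
    obtain ⟨f, g1, g2, g3, g4, g5⟩ := low x hx ε hε
    have hm : (fun q => max (f q) (fs q)) ∈ S := ⟨Adm.max g2 fsA, LSub.max g2 fsA g3 fsL,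
      fun x hx => max_le (g4 x hx) (fs0 x hx), fun q _ => le_max_right _ _⟩
    have := env_le_of_usc (D := D) (u := fun q => -u q) (g := fun q => -f q)
      g1.neg.continuousOn.upperSemicontinuousOn
      (fun q hq => neg_le_neg ((le_max_left _ _).trans (hdom _ hm q hq))) (D.mem_Cyl.2 ⟨hx, le_rfl⟩)
    have : V (x, 0) ≤ -f (x, 0) := this
    linarith
  have hVA : D.Adm V := env_adm hnb
  have hcm := h.comp u V huA hVA hLU hVL (fun x hx => by linarith [hu0' x hx, hV0 x hx])
  have hVu : ∀ q ∈ D.Cyl, V q = -u q := fun q hq => by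
    have h1 : u q + V q ≤ 0 := hcm q.1 hq.1 q.2 hq.2
    have h2 : -u q ≤ V q := le_env hnb hq
    linarith
  have huc : ContinuousOn u D.Cyl := fun q hq => by
    refine tendsto_order.2 ⟨fun b hb => ?_, fun b hb => huA.usc q hq b hb⟩
    filter_upwards [hVA.usc q hq (-b) (by show V q < -b; rw [hVu q hq]; linarith), self_mem_nhdsWithin] with q' h1 h2
    rw [hVu q' h2] at h1
    linarith
  refine ⟨u, huc, huA.bdd, hLU, LSub.congr (Adm.of_cont huc.neg hnb) hVL hVu, fun x hx => ?_⟩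
  have h1 := hVu (x, 0) (D.mem_Cyl.2 ⟨hx, le_rfl⟩)
  linarith [hV0 x hx, hu0' x hx]

end Dat

namespace Dat
variable {D : Dat N}

lemma ok_bell {A : Type} [MetricSpace A] [CompactSpace A] [Nonempty A]
    {lam : Euc N → ℝ → A → ℝ} {b : Euc N → ℝ → A → Euc N} {l : Euc N → ℝ → A → ℝ}
    {H : Euc N → ℝ → ℝ → Euc N → ℝ} (hOK : ParBellmanOK D.Ω D.n lam b l H) (hH : AssumptionH' D.Ω H) :
    ∃ K, D.Ok H K := by
  obtain ⟨K, hK⟩ := D.exists_monoH hH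
  refine ⟨K, ?_, D.comp_bell hOK hH, hK, ?_⟩
  · obtain ⟨⟨h1, -, h2, -, h3, -⟩, hB, -⟩ := hOK
    have hc : Continuous ↿(fun (q : Euc N × ℝ × ℝ × Euc N) (α : A) =>
        lam q.1 q.2.1 α * q.2.2.1 - ⟪b q.1 q.2.1 α, q.2.2.2⟫ - l q.1 q.2.1 α) := by
      have e : Continuous (fun z : (Euc N × ℝ × ℝ × Euc N) × A => ((z.1.1, z.1.2.1, z.2) : Euc N × ℝ × A)) := by
        fun_prop
      have c1 : Continuous (fun z : (Euc N × ℝ × ℝ × Euc N) × A => z.1.2.2.1) := by fun_prop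
      have c2 : Continuous (fun z : (Euc N × ℝ × ℝ × Euc N) × A => z.1.2.2.2) := by fun_prop
      exact (((h1.comp e).mul c1).sub ((h2.comp e).inner c2)).sub (h3.comp e)
    have := (isCompact_univ (X := A)).continuous_sSup hc
    refine this.congr fun q => ?_
    rw [hB q.1 q.2.1 q.2.2.1 q.2.2.2, image_univ]
    rfl
  · obtain ⟨hd, hB, -⟩ := hOK
    obtain ⟨-, ⟨Ml, hMl⟩, -, ⟨Mb, hMb⟩, -, ⟨Mc, hMc⟩⟩ := id hd
    intro R hR
    refine ⟨Ml * R + Mb * R + Mc, fun x _ t _ r p hr hp => ?_⟩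
    obtain ⟨α, h1, -⟩ := bell_max hd hB x t r p
    rw [h1]
    have e1 : |lam x t α * r| ≤ Ml * R := by
      rw [abs_mul]
      exact mul_le_mul (hMl x t α) hr (abs_nonneg _) ((abs_nonneg _).trans (hMl x t α))
    have e2 : |⟪b x t α, p⟫| ≤ Mb * R := (abs_real_inner_le_norm _ _).trans
      (mul_le_mul (hMb x t α) hp (norm_nonneg _) ((norm_nonneg _).trans (hMb x t α)))
    have e3 := hMc x t α
    rw [abs_le] at e1 e2 e3 ⊢
    constructor <;> linarith [e1.1, e1.2, e2.1, e2.2, e3.1, e3.2]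

lemma ok_coer {H : Euc N → ℝ → ℝ → Euc N → ℝ} (hOK : ParCoerciveOK D.Ω H D.σ) (hH : AssumptionH' D.Ω H)
    (hE : AssumptionE' D.Ω H) : ∃ K, D.Ok H K := by
  obtain ⟨K, hK⟩ := D.exists_monoH hH
  refine ⟨K, ?_, D.comp_coer hOK hH, hK, ?_⟩
  · obtain ⟨⟨H0, f, h1, h2, -, h4⟩, -⟩ := hOK
    have e1 : Continuous (fun q : Euc N × ℝ × ℝ × Euc N => ((q.1, q.2.2.1, q.2.2.2) : Euc N × ℝ × Euc N)) := by
      fun_prop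
    have e2 : Continuous (fun q : Euc N × ℝ × ℝ × Euc N => ((q.1, q.2.1) : Euc N × ℝ)) := by fun_prop
    exact ((h1.comp e1).sub (h2.continuous.comp e2)).congr fun q => (h4 _ _ _ _).symm
  · obtain ⟨⟨H0, f, -, -, ⟨Mf, hMf⟩, h4⟩, -⟩ := hOK
    intro R hR
    obtain ⟨B, hB⟩ := hE 1 one_pos R hR
    refine ⟨B + Mf + Mf, fun x hx t _ r p hr hp => ?_⟩
    have e1 := abs_le.1 (hB x hx 0 (by simp) r p hr hp)
    rw [h4] at e1 ⊢
    have e2 := abs_le.1 (hMf x 0)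
    have e3 := abs_le.1 (hMf x t)
    rw [abs_le]
    constructor <;> linarith [e1.1, e1.2, e2.1, e2.2, e3.1, e3.2]

lemma const_sub {H : Euc N → ℝ → ℝ → Euc N → ℝ} {c : ℝ} (h : ∀ x ∈ D.Ω, ∀ t, 0 < t → H x t c 0 ≤ 0) :
    D.LSub H (fun _ => c) := by
  refine D.classical_sub fun x hx t ht => ⟨0, 0, ?_, fun _ => by simp, fun hxΩ => ?_⟩
  · have h1 : (clm 0 0 : (Euc N × ℝ) →L[ℝ] ℝ) = 0 := by ext q <;> simp [clm_apply]
    rw [h1]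
    exact hasFDerivAt_const c _
  · have h2 : D.inc (fun _ => c) x = fun _ => 0 := by
      funext z
      by_cases hz : x + D.j x z ∈ closure D.Ω
      · rw [D.inc_of_mem hz]; simp
      · exact D.inc_of_notMem hz
    rw [h2]
    refine ⟨integrable_zero _ _ _, ?_⟩
    simpa using h x hxΩ t ht

lemma main {H : Euc N → ℝ → ℝ → Euc N → ℝ} {K : ℝ} (h : D.Ok H K)
    (u₀ : Euc N → ℝ) (hu₀c : ContinuousOn u₀ (closure D.Ω)) (hu₀b : BddOn u₀ (closure D.Ω)) :
    ∃ u : Euc N → ℝ → ℝ,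
      (ContinuousOn (fun q : Euc N × ℝ => u q.1 q.2) (closure D.Ω ×ˢ Ici 0) ∧
        (∀ T > (0:ℝ), BddOnT u (closure D.Ω) (Icc 0 T)) ∧
        IsParSubSol D.Ω D.j D.g D.n D.Cj (parF H) u ∧ IsParSuperSol D.Ω D.j D.g D.n D.Cj (parF H) u ∧
        (∀ x ∈ closure D.Ω, u x 0 = u₀ x)) ∧
      (∀ u' : Euc N → ℝ → ℝ,
        ContinuousOn (fun q : Euc N × ℝ => u' q.1 q.2) (closure D.Ω ×ˢ Ici 0) →
        (∀ T > (0:ℝ), BddOnT u' (closure D.Ω) (Icc 0 T)) →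
        IsParSubSol D.Ω D.j D.g D.n D.Cj (parF H) u' → IsParSuperSol D.Ω D.j D.g D.n D.Cj (parF H) u' →
        (∀ x ∈ closure D.Ω, u' x 0 = u₀ x) →
        ∀ x ∈ closure D.Ω, ∀ t ∈ Ici (0:ℝ), u' x t = u x t) ∧
      (AssumptionH'' D.Ω H → BddOnT u (closure D.Ω) (Ici 0)) := by
  obtain ⟨M', hM'⟩ := hu₀b
  set M := max M' 0 with hMdef
  have hM0 : 0 ≤ M := le_max_right _ _
  have hM : ∀ x ∈ closure D.Ω, |u₀ x| ≤ M := fun x hx => (hM' x hx).trans (le_max_left _ _)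
  obtain ⟨u, huc, hub, hL, hL', hu0⟩ := h.solve hu₀c hM0 hM
  have huA : D.Adm u := Adm.of_cont huc hub
  have hnA : D.Adm (fun q => -u q) := Adm.of_cont huc.neg hub.neg
  refine ⟨fun x t => u (x, t), ⟨huc, ?_, ?_, ?_, hu0⟩, ?_, ?_⟩
  · intro T _
    obtain ⟨C, -, hC⟩ := hub T
    exact ⟨C, fun x hx t ht => hC x hx t ht.1 ht.2⟩
  · exact D.par_of_lsub (u := fun x t => u (x, t)) hub huA.usc hL
  · exact D.super_iff.2 (D.par_of_lsub (u := fun x t => -u (x, t)) hub.neg hnA.usc hL')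
  · intro v hvc hvb hv1 hv2 hv0 x hx t ht
    have hvb' : D.LocBdd (fun q => v q.1 q.2) := fun T => by
      obtain ⟨C, hC⟩ := hvb (max T 1) (lt_max_of_lt_right one_pos)
      exact ⟨max C 0, le_max_right _ _, fun x hx t h0 h1 =>
        (hC x hx t ⟨h0, h1.trans (le_max_left _ _)⟩).trans (le_max_left _ _)⟩
    have hvA : D.Adm (fun q => v q.1 q.2) := Adm.of_cont hvc hvb'
    have hvn : D.Adm (fun q => -v q.1 q.2) := Adm.of_cont (ContinuousOn.neg hvc) hvb'.neg
    have hvL := D.lsub_of_par hvb' hvA.usc hv1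
    have hvL' := D.lsub_of_par (u := fun x t => -v x t) hvb'.neg hvn.usc (D.super_iff.1 hv2)
    have c1 := h.comp _ _ hvA hnA hvL hL' (fun x hx => by
      have e1 := hv0 x hx
      have e2 := hu0 x hx
      show v x 0 + -u (x, 0) ≤ 0
      rw [e1, e2]; linarith) x hx t ht
    have c2 := h.comp _ _ huA hvn hL hvL' (fun x hx => by
      have e1 := hv0 x hx
      have e2 := hu0 x hx
      show u (x, 0) + -v x 0 ≤ 0
      rw [e1, e2]; linarith) x hx t ht
    have c1 : v x t + -u (x, t) ≤ 0 := c1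
    have c2 : u (x, t) + -v x t ≤ 0 := c2
    show v x t = u (x, t)
    linarith
  · rintro ⟨γ₀, hγ, hmono⟩
    obtain ⟨B0', hB0'⟩ := h.bnd 1 one_pos
    set B0 := max B0' 0
    have hB0 : ∀ x ∈ D.Ω, ∀ t, 0 ≤ t → |H x t 0 0| ≤ B0 := fun x hx t ht =>
      (hB0' x hx t ht 0 0 (by simp) (by simp)).trans (le_max_left _ _)
    have hB00 : 0 ≤ B0 := le_max_right _ _
    set C := M + B0 / γ₀ with hC
    have hC0 : 0 ≤ C := by positivity
    have hCγ : B0 ≤ γ₀ * C := by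
      rw [hC, mul_add, mul_div_cancel₀ _ hγ.ne']
      nlinarith
    have hMC : M ≤ C := le_add_of_nonneg_right (by positivity)
    have mono : ∀ x ∈ D.Ω, ∀ t, 0 < t → ∀ r s, |r| ≤ C → |s| ≤ C → s ≤ r →
        γ₀ * (r - s) ≤ H x t r 0 - H x t s 0 := fun x hx t ht r s hr hs hsr => by
      obtain ⟨γ, h1, h2⟩ := hmono (C + t) (by positivity)
      have := h2 x (subset_closure hx) t ⟨ht.le, by linarith⟩ r s (by linarith) (by linarith) hsr 0
      exact (mul_le_mul_of_nonneg_right h1 (by linarith)).trans this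
    have s1 : D.LSub H (fun _ => -C) := const_sub fun x hx t ht => by
      have e1 := mono x hx t ht 0 (-C) (by simpa using hC0) (by rw [abs_neg, abs_of_nonneg hC0]) (by linarith)
      have e2 := abs_le.1 (hB0 x hx t ht.le)
      linarith [e2.2]
    have s2 : D.LSub (Hneg H) (fun _ => -C) := const_sub fun x hx t ht => by
      have e1 := mono x hx t ht C 0 (by rw [abs_of_nonneg hC0]) (by simpa using hC0) hC0
      have e2 := abs_le.1 (hB0 x hx t ht.le)
      simp only [Hneg, neg_neg, neg_zero]
      linarith [e2.1]
    have hcA : D.Adm (fun _ => -C) := Adm.of_cont continuousOn_const fun T =>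
      ⟨C, hC0, fun _ _ _ _ _ => by rw [abs_neg, abs_of_nonneg hC0]⟩
    refine ⟨C, fun x hx t ht => ?_⟩
    have c1 := h.comp _ _ huA hcA hL s2 (fun x hx => by
      have e1 := abs_le.1 (hM x hx)
      have e2 := hu0 x hx
      show u (x, 0) + -C ≤ 0
      rw [e2]; linarith [e1.2]) x hx t ht
    have c2 := h.comp _ _ hcA hnA s1 hL' (fun x hx => by
      have e1 := abs_le.1 (hM x hx)
      have e2 := hu0 x hx
      show -C + -u (x, 0) ≤ 0
      rw [e2]; linarith [e1.1]) x hx t ht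
    have c1 : u (x, t) + -C ≤ 0 := c1
    have c2 : -C + -u (x, t) ≤ 0 := c2
    show |u (x, t)| ≤ C
    exact abs_le.2 ⟨by linarith, by linarith⟩

end Dat

/-- **Parabolic existence and uniqueness.**  Under (O), (M), (J0), (J1), for
`u₀ ∈ C_b(closure Ω)` and `H` either of Bellman type with (C'), (L'), (B') or coercive
with (H0') and (He') or (He''), and assuming (H') and (E'), there exists a unique
viscosity solution of the Cauchy problem `∂_t u - I[u(·,t)] + H(x,t,u,Du) = 0` in
`Ω × (0,∞)`, `∂u/∂n = 0` on `∂Ω × (0,∞)`, `u(·,0) = u₀`, which is continuous on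
`closure Ω × [0,∞)` and bounded on `closure Ω × [0,T]` for every `T > 0`.  If moreover
(H'') holds, this solution is uniformly bounded on `closure Ω × [0,∞)`. -/
theorem parabolic_existence_uniqueness
    (hN : 0 < N) (Ω : Set (Euc N)) (hΩ : IsW2Domain hN Ω)
    (n : Euc N → Euc N) (hn : IsExteriorNormal Ω n)
    (g : Euc N → Euc N → ℝ) (Cμ Dμ σ : ℝ) (hM : AssumptionM Ω g Cμ Dμ σ)
    (j : Euc N → Euc N → Euc N) (Aj : ℝ) (hJ0 : AssumptionJ0 Ω j Aj)
    (Cj' Cj Dj : ℝ) (hJ1 : AssumptionJ1 Ω j Cj' Cj Dj)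
    {A : Type} [MetricSpace A] [CompactSpace A] [Nonempty A]
    (lam : Euc N → ℝ → A → ℝ) (b : Euc N → ℝ → A → Euc N) (l : Euc N → ℝ → A → ℝ)
    (H : Euc N → ℝ → ℝ → Euc N → ℝ)
    (hHam : ParBellmanOK Ω n lam b l H ∨ ParCoerciveOK Ω H σ)
    (hH' : AssumptionH' Ω H) (hE' : AssumptionE' Ω H)
    (u₀ : Euc N → ℝ) (hu₀c : ContinuousOn u₀ (closure Ω)) (hu₀b : BddOn u₀ (closure Ω)) :
    ∃ u : Euc N → ℝ → ℝ,
      (ContinuousOn (fun q : Euc N × ℝ => u q.1 q.2) (closure Ω ×ˢ Ici 0) ∧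
        (∀ T > (0:ℝ), BddOnT u (closure Ω) (Icc 0 T)) ∧
        IsParSubSol Ω j g n Cj (parF H) u ∧ IsParSuperSol Ω j g n Cj (parF H) u ∧
        (∀ x ∈ closure Ω, u x 0 = u₀ x)) ∧
      (∀ u' : Euc N → ℝ → ℝ,
        ContinuousOn (fun q : Euc N × ℝ => u' q.1 q.2) (closure Ω ×ˢ Ici 0) →
        (∀ T > (0:ℝ), BddOnT u' (closure Ω) (Icc 0 T)) →
        IsParSubSol Ω j g n Cj (parF H) u' → IsParSuperSol Ω j g n Cj (parF H) u' →
        (∀ x ∈ closure Ω, u' x 0 = u₀ x) →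
        ∀ x ∈ closure Ω, ∀ t ∈ Ici (0:ℝ), u' x t = u x t) ∧
      (AssumptionH'' Ω H → BddOnT u (closure Ω) (Ici 0)) := by
  let D : Dat N := ⟨hN, Ω, hΩ, n, hn, g, Cμ, Dμ, σ, hM, j, Aj, hJ0, Cj', Cj, Dj, hJ1⟩
  obtain ⟨K, hK⟩ : ∃ K, D.Ok H K := by
    rcases hHam with h | h
    · exact Dat.ok_bell (D := D) h hH'
    · exact Dat.ok_coer (D := D) h hH' hE'
  exact Dat.main (D := D) hK u₀ hu₀c hu₀b

end Censored

end
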